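/- Let U be an open interval in ℝ and x₀ ∈ ℝ a point in the closure of U. Let x ↦ ζ(x) and x ↦ ξ(x) be continuous maps from U ∪ {x₀} to L¹(P; ℝ) and L¹(P; ℝ^d) respectively, whose restrictions to U are analytic, and such that ζ(x) > 0 P-a.s. for every x ∈ U ∪ {x₀}. For each x ∈ U ∪ {x₀}, define the probability measure Q(x) by dQ(x)/dP = ζ(x)/E_P[ζ(x)], and let S(x) be a right-continuous adapted version of the Q(x)-martingale S_t(x) = E_{Q(x)}[ξ(x)/ζ(x) | F_t]. If S(x₀) has the MRP, then the exception set I = {x ∈ U : S(x) does not have the MRP} is at most countable. -/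

import Mathlib

open MeasureTheory Filter Set
open scoped ENNReal NNReal

noncomputable section

/-- A stopping time with values in `[0, ∞]` relative to the filtration `F`. -/
def IsStoppingTimeENN {Ω : Type*} {m : MeasurableSpace Ω}
    (F : Filtration ℝ≥0 m) (τ : Ω → ℝ≥0∞) : Prop :=
  ∀ t : ℝ≥0, MeasurableSet[F t] {ω | τ ω ≤ (t : ℝ≥0∞)}

/-- The process `M` stopped at the `[0, ∞]`-valued random time `τ`,
i.e. `t ↦ M_{t ∧ τ}`. -/
def stoppedAtENN {Ω E : Type*} (M : ℝ≥0 → Ω → E) (τ : Ω → ℝ≥0∞) : ℝ≥0 → Ω → E :=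
  fun t ω => if τ ω ≤ (t : ℝ≥0∞) then M (τ ω).toNNReal ω else M t ω

/-- A process `S` is a local martingale under `R` if there is a nondecreasing sequence of
`[0, ∞]`-valued stopping times `τ n ↑ ∞` pointwise such that every stopped process
`S^{τ n}` is an `R`-martingale. -/
def IsLocalMartingale {Ω : Type*} {m : MeasurableSpace Ω} {E : Type*}
    [NormedAddCommGroup E] [NormedSpace ℝ E] [CompleteSpace E]
    (F : Filtration ℝ≥0 m) (S : ℝ≥0 → Ω → E) (R : Measure Ω) : Prop :=
  ∃ τ : ℕ → Ω → ℝ≥0∞,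
    (∀ n, IsStoppingTimeENN F (τ n)) ∧
    (∀ ω, Monotone fun n => τ n ω) ∧
    (∀ ω, (⨆ n, τ n ω) = ∞) ∧
    (∀ n, Martingale (stoppedAtENN S (τ n)) F R)

/-- `S` has the Martingale Representation Property relative to the reference measure `P` and
the measure `Q`: by Jacod's theorem this is taken to mean that `Q` is the unique probability
measure equivalent to `P` under which `S` is a local martingale. -/
def HasMRP {Ω : Type*} {m : MeasurableSpace Ω} {E : Type*}
    [NormedAddCommGroup E] [NormedSpace ℝ E] [CompleteSpace E]
    (F : Filtration ℝ≥0 m) (S : ℝ≥0 → Ω → E) (P Q : Measure Ω) : Prop :=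
  IsLocalMartingale F S Q ∧
    ∀ R : Measure Ω, IsProbabilityMeasure R → (R ≪ P ∧ P ≪ R) →
      IsLocalMartingale F S R → R = Q

namespace AF
set_option linter.all false
open scoped Topology

section PartOne

variable {Ω : Type*} {m : MeasurableSpace Ω} {P : Measure Ω} [IsProbabilityMeasure P]

/-- multiplication operator on `L²` by an essentially bounded function -/
def mulL (P : Measure Ω) (q : Ω → ℝ) : Lp ℝ 2 P →L[ℝ] Lp ℝ 2 P :=
  open Classical in
  if h : MemLp q ∞ P then
    (ContinuousLinearMap.mul ℝ ℝ).holderL P ∞ 2 2 (h.toLp q)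
  else 0

lemma mulL_ae {q : Ω → ℝ} (h : MemLp q ∞ P) (f : Lp ℝ 2 P) :
    (mulL P q f : Ω → ℝ) =ᵐ[P] fun o => q o * f o := by
  have : mulL P q = (ContinuousLinearMap.mul ℝ ℝ).holderL P ∞ 2 2 (h.toLp q) := by
    simp [mulL, h]
  rw [this]
  have h1 := (ContinuousLinearMap.mul ℝ ℝ).coeFn_holder (r := 2) (h.toLp q) f
  filter_upwards [h1, h.coeFn_toLp] with o h1 h2
  change ((ContinuousLinearMap.mul ℝ ℝ).holder 2 (h.toLp q) f : Ω → ℝ) o = _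
  rw [h1, h2]; rfl

/-- conditional expectation on `L²` -/
def ceL {m' m : MeasurableSpace Ω} (P : Measure[m] Ω) (h : m' ≤ m) : Lp ℝ 2 P →L[ℝ] Lp ℝ 2 P :=
  (lpMeas ℝ ℝ m' 2 P).subtypeL.comp (condExpL2 ℝ ℝ h)

lemma ceL_ae {m' : MeasurableSpace Ω} (h : m' ≤ m) (f : Lp ℝ 2 P) :
    (ceL P h f : Ω → ℝ) =ᵐ[P] P[f|m'] := by
  have := MemLp.condExpL2_ae_eq_condExp (𝕜 := ℝ) h (Lp.memLp f)
  rwa [Lp.toLp_coeFn] at this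

lemma int_of_L2 (f : Lp ℝ 2 P) : Integrable f P := (Lp.memLp f).integrable (by norm_num)

lemma inner_eq (f g : Lp ℝ 2 P) : inner ℝ f g = ∫ o, f o * g o ∂P := by
  rw [L2.inner_def]; congr 1; ext o; simp [mul_comm]

lemma int_mul (f g : Lp ℝ 2 P) : Integrable (fun o => f o * g o) P :=
  (Lp.memLp f).integrable_mul (Lp.memLp g)

lemma ceL_sa {m' : MeasurableSpace Ω} (h : m' ≤ m) (f g : Lp ℝ 2 P) :
    inner ℝ (ceL P h f) g = inner ℝ f (ceL P h g) := inner_condExpL2_left_eq_right h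

lemma ceL_ceL {m₁ m₂ : MeasurableSpace Ω} (h₁ : m₁ ≤ m) (h₂ : m₂ ≤ m) (h : m₁ ≤ m₂) (f : Lp ℝ 2 P) :
    ceL P h₁ (ceL P h₂ f) = ceL P h₁ f := by
  apply Lp.ext
  filter_upwards [ceL_ae h₁ (ceL P h₂ f), ceL_ae h₁ f, condExp_congr_ae (m := m₁) (ceL_ae h₂ f),
    condExp_condExp_of_le (μ := P) (f := f) h h₂] with o a b c d
  rw [a, b, c, d]

lemma ceL_fix {m' : MeasurableSpace Ω} (h : m' ≤ m) (f : Lp ℝ 2 P) (hf : AEStronglyMeasurable[m'] f P) :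
    ceL P h f = f := by
  apply Lp.ext
  filter_upwards [ceL_ae h f, condExp_of_aestronglyMeasurable' h hf (int_of_L2 f)] with o a b
  rw [a, b]

lemma ceL_ceL' {m₁ m₂ : MeasurableSpace Ω} (h₁ : m₁ ≤ m) (h₂ : m₂ ≤ m) (h : m₁ ≤ m₂) (f : Lp ℝ 2 P) :
    ceL P h₂ (ceL P h₁ f) = ceL P h₁ f := by
  apply ceL_fix
  exact (stronglyMeasurable_condExp.mono h).aestronglyMeasurable.congr (ceL_ae h₁ f).symm

lemma mulL_sa {q : Ω → ℝ} (h : MemLp q ∞ P) (f g : Lp ℝ 2 P) :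
    inner ℝ (mulL P q f) g = inner ℝ f (mulL P q g) := by
  rw [inner_eq, inner_eq]
  apply integral_congr_ae
  filter_upwards [mulL_ae h f, mulL_ae h g] with o a b
  rw [a, b]; ring

lemma mulL_mulL {q q' : Ω → ℝ} (h : MemLp q ∞ P) (h' : MemLp q' ∞ P)
    (f : Lp ℝ 2 P) : mulL P q (mulL P q' f) = mulL P (fun o => q o * q' o) f := by
  have h2 : MemLp (fun o => q o * q' o) ∞ P := h'.mul h
  apply Lp.ext
  filter_upwards [mulL_ae h (mulL P q' f), mulL_ae h' f, mulL_ae h2 f] with o a b c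
  rw [a, b, c]; ring

lemma mulL_add {q q' : Ω → ℝ} (h : MemLp q ∞ P) (h' : MemLp q' ∞ P)
    (f : Lp ℝ 2 P) : mulL P (fun o => q o + q' o) f = mulL P q f + mulL P q' f := by
  apply Lp.ext
  filter_upwards [mulL_ae h f, mulL_ae h' f, mulL_ae (h.add h') f,
    Lp.coeFn_add (mulL P q f) (mulL P q' f)] with o a b c d
  rw [d, Pi.add_apply, a, b]; erw [c]; simp; ring

lemma mulL_smul {q : Ω → ℝ} (h : MemLp q ∞ P) (c : ℝ)
    (f : Lp ℝ 2 P) : mulL P (fun o => c * q o) f = c • mulL P q f := by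
  have h2 : MemLp (fun o => c * q o) ∞ P := h.const_mul c
  apply Lp.ext
  filter_upwards [mulL_ae h f, mulL_ae h2 f, Lp.coeFn_smul c (mulL P q f)] with o a b d
  rw [d, Pi.smul_apply, a, b]; simp; ring

lemma mulL_congr {q q' : Ω → ℝ} (h : MemLp q ∞ P) (hq : q =ᵐ[P] q') : mulL P q = mulL P q' := by
  have h' : MemLp q' ∞ P := (memLp_congr_ae hq).1 h
  ext1 f
  apply Lp.ext
  filter_upwards [mulL_ae h f, mulL_ae h' f, hq] with o a b c
  rw [a, b, c]

lemma ceL_mulL {m' : MeasurableSpace Ω} (h : m' ≤ m) {q : Ω → ℝ} (hq : MemLp q ∞ P)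
    (hm : StronglyMeasurable[m'] q) (f : Lp ℝ 2 P) :
    ceL P h (mulL P q f) = mulL P q (ceL P h f) := by
  have hi : Integrable (q * (f : Ω → ℝ)) P :=
    ((Lp.memLp f).mul hq (r := 2)).integrable (by norm_num)
  apply Lp.ext
  filter_upwards [ceL_ae h (mulL P q f), mulL_ae hq (ceL P h f), ceL_ae h f,
    condExp_congr_ae (m := m') (mulL_ae hq f),
    condExp_mul_of_stronglyMeasurable_left (μ := P) hm hi (int_of_L2 f)] with o a b c d e
  rw [a, b, c, d]; exact e

/-- dyadic grid points -/
def gp (n i : ℕ) : ℝ := (i : ℝ) / 2 ^ n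

lemma gp_mono (n : ℕ) {i j : ℕ} (h : i ≤ j) : gp n i ≤ gp n j := by
  unfold gp; gcongr

lemma gp_succ (n i : ℕ) : gp (n+1) (2*i) = gp n i := by
  unfold gp; push_cast; rw [pow_succ]; field_simp

lemma gp_zero (n : ℕ) : gp n 0 = 0 := by simp [gp]
lemma gp_last (n : ℕ) : gp n (2^n) = 1 := by simp [gp]

lemma gp_add (n k i : ℕ) : gp (n+k) (2^k*i) = gp n i := by
  unfold gp; push_cast; rw [pow_add]; field_simp

variable (P) in
/-- conditional expectation given `Γ u` -/
def ceF (Γ : Filtration ℝ m) (u : ℝ) : Lp ℝ 2 P →L[ℝ] Lp ℝ 2 P := ceL P (Γ.le u)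

variable (P) in
/-- martingale difference operators -/
def dl (Γ : Filtration ℝ m) (n i : ℕ) : Lp ℝ 2 P →L[ℝ] Lp ℝ 2 P :=
  ceF P Γ (gp n (i+1)) - ceF P Γ (gp n i)

variable (P) in
/-- discrete stochastic integral operator -/
def T (Γ : Filtration ℝ m) (n : ℕ) (q : ℝ → Ω → ℝ) : Lp ℝ 2 P →L[ℝ] Lp ℝ 2 P :=
  ∑ i ∈ Finset.range (2^n), (mulL P (q (gp n i))).comp (dl P Γ n i)

lemma T_apply (Γ : Filtration ℝ m) (n : ℕ) (q : ℝ → Ω → ℝ) (f : Lp ℝ 2 P) :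
    T P Γ n q f = ∑ i ∈ Finset.range (2^n), mulL P (q (gp n i)) (dl P Γ n i f) := by
  simp [T, ContinuousLinearMap.sum_apply]

variable (P) in
/-- adapted essentially bounded processes -/
structure Ad (Γ : Filtration ℝ m) (q : ℝ → Ω → ℝ) : Prop where
  sm : ∀ u, StronglyMeasurable[Γ u] (q u)
  bd : ∀ u, MemLp (q u) ∞ P

variable {Γ : Filtration ℝ m}

lemma dl_sa (n i : ℕ) (f g : Lp ℝ 2 P) : inner ℝ (dl P Γ n i f) g = inner ℝ f (dl P Γ n i g) := by
  simp [dl, ceF, inner_sub_left, inner_sub_right, ceL_sa]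

lemma dl_mulL {q : ℝ → Ω → ℝ} (hq : Ad P Γ q) (n i : ℕ) (f : Lp ℝ 2 P) :
    dl P Γ n i (mulL P (q (gp n i)) f) = mulL P (q (gp n i)) (dl P Γ n i f) := by
  simp only [dl, ceF, ContinuousLinearMap.sub_apply, map_sub]
  rw [ceL_mulL _ (hq.bd _) (hq.sm _), ceL_mulL _ (hq.bd _) ((hq.sm _).mono (Γ.mono (gp_mono n i.le_succ)))]

lemma dl_dl_self (n i : ℕ) (f : Lp ℝ 2 P) : dl P Γ n i (dl P Γ n i f) = dl P Γ n i f := by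
  have h := Γ.mono (gp_mono n i.le_succ)
  simp only [dl, ceF, ContinuousLinearMap.sub_apply, map_sub]
  rw [ceL_ceL _ _ le_rfl, ceL_ceL _ _ le_rfl, ceL_ceL _ _ h, ceL_ceL' _ _ h]; simp

lemma dl_dl_ne (n : ℕ) {i j : ℕ} (hij : i ≠ j) (f : Lp ℝ 2 P) : dl P Γ n i (dl P Γ n j f) = 0 := by
  simp only [dl, ceF, ContinuousLinearMap.sub_apply, map_sub]
  rcases lt_or_gt_of_ne hij with h | h
  · have h1 := Γ.mono (gp_mono n h)
    have h2 := Γ.mono (gp_mono n h.le)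
    have h3 := Γ.mono (gp_mono n (i.le_succ))
    have h4 := Γ.mono (gp_mono n (j.le_succ))
    rw [ceL_ceL _ _ (h1.trans h4), ceL_ceL _ _ h1, ceL_ceL _ _ (h2.trans h4), ceL_ceL _ _ h2]; simp
  · have h1 := Γ.mono (gp_mono n h)
    have h2 := Γ.mono (gp_mono n h.le)
    have h3 := Γ.mono (gp_mono n (i.le_succ))
    have h4 := Γ.mono (gp_mono n (j.le_succ))
    rw [ceL_ceL' _ _ (h1.trans h3), ceL_ceL' _ _ (h2.trans h3), ceL_ceL' _ _ h1, ceL_ceL' _ _ h2]; simp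

lemma dl_T {q : ℝ → Ω → ℝ} (hq : Ad P Γ q) (n : ℕ) {i : ℕ} (hi : i < 2^n) (f : Lp ℝ 2 P) :
    dl P Γ n i (T P Γ n q f) = mulL P (q (gp n i)) (dl P Γ n i f) := by
  have h0 : ∀ j ∈ Finset.range (2^n), j ≠ i → dl P Γ n i (mulL P (q (gp n j)) (dl P Γ n j f)) = 0 := by
    intro j _ hj
    rw [← dl_mulL hq, dl_dl_ne _ hj.symm]
  rw [T_apply, map_sum, Finset.sum_eq_single_of_mem i (Finset.mem_range.2 hi) h0, dl_mulL hq, dl_dl_self]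

lemma T_mul {q q' : ℝ → Ω → ℝ} (hq : Ad P Γ q) (hq' : Ad P Γ q') (n : ℕ) (f : Lp ℝ 2 P) :
    T P Γ n q (T P Γ n q' f) = T P Γ n (fun u o => q u o * q' u o) f := by
  rw [T_apply Γ n q, T_apply Γ n (fun u o => q u o * q' u o)]
  refine Finset.sum_congr rfl fun i hi => ?_
  rw [dl_T hq' n (Finset.mem_range.1 hi), mulL_mulL (hq.bd _) (hq'.bd _)]

lemma T_sa {q : ℝ → Ω → ℝ} (hq : Ad P Γ q) (n : ℕ) (f g : Lp ℝ 2 P) :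
    inner ℝ (T P Γ n q f) g = inner ℝ f (T P Γ n q g) := by
  rw [T_apply, T_apply, sum_inner, inner_sum]
  refine Finset.sum_congr rfl fun i hi => ?_
  rw [mulL_sa (hq.bd _), dl_sa, dl_mulL hq]

lemma T_add {q q' : ℝ → Ω → ℝ} (hq : Ad P Γ q) (hq' : Ad P Γ q') (n : ℕ) (f : Lp ℝ 2 P) :
    T P Γ n (fun u o => q u o + q' u o) f = T P Γ n q f + T P Γ n q' f := by
  simp only [T_apply, ← Finset.sum_add_distrib]
  refine Finset.sum_congr rfl fun i hi => ?_
  rw [mulL_add (hq.bd _) (hq'.bd _)]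

lemma T_smul {q : ℝ → Ω → ℝ} (hq : Ad P Γ q) (c : ℝ) (n : ℕ) (f : Lp ℝ 2 P) :
    T P Γ n (fun u o => c * q u o) f = c • T P Γ n q f := by
  simp only [T_apply, Finset.smul_sum]
  refine Finset.sum_congr rfl fun i hi => ?_
  rw [mulL_smul (hq.bd _)]

/-- the quadratic form of `T` -/
lemma T_inner {q : ℝ → Ω → ℝ} (hq : Ad P Γ q) (n : ℕ) (f g : Lp ℝ 2 P) :
    inner ℝ (T P Γ n q f) g =
      ∑ i ∈ Finset.range (2^n), ∫ o, q (gp n i) o * (dl P Γ n i f o * dl P Γ n i g o) ∂P := by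
  rw [T_apply, sum_inner]
  refine Finset.sum_congr rfl fun i hi => ?_
  rw [← dl_dl_self n i f, ← dl_mulL hq, dl_sa, inner_eq]
  apply integral_congr_ae
  filter_upwards [mulL_ae (hq.bd (gp n i)) (dl P Γ n i f)] with o a
  rw [dl_dl_self, a]; ring

lemma int_qff {q : Ω → ℝ} (hq : MemLp q ∞ P) (f g : Lp ℝ 2 P) :
    Integrable (fun o => q o * (f o * g o)) P := by
  have := int_mul (mulL P q f) g
  refine this.congr ?_
  filter_upwards [mulL_ae hq f] with o a
  rw [a]; ring

lemma T_mono {q q' : ℝ → Ω → ℝ} (hq : Ad P Γ q) (hq' : Ad P Γ q') (n : ℕ)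
    (h : ∀ i < 2^n, ∀ᵐ o ∂P, q (gp n i) o ≤ q' (gp n i) o) (f : Lp ℝ 2 P) :
    inner ℝ (T P Γ n q f) f ≤ inner ℝ (T P Γ n q' f) f := by
  rw [T_inner hq, T_inner hq']
  refine Finset.sum_le_sum fun i hi => ?_
  refine integral_mono_ae (int_qff (hq.bd _) _ _) (int_qff (hq'.bd _) _ _) ?_
  filter_upwards [h i (Finset.mem_range.1 hi)] with o a
  exact mul_le_mul_of_nonneg_right a (mul_self_nonneg _)

lemma Ad.const (c : ℝ) : Ad P Γ (fun _ _ => c) :=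
  ⟨fun _ => stronglyMeasurable_const, fun _ => memLp_const c⟩

lemma Ad.mul {q q' : ℝ → Ω → ℝ} (hq : Ad P Γ q) (hq' : Ad P Γ q') :
    Ad P Γ (fun u o => q u o * q' u o) :=
  ⟨fun u => (hq.sm u).mul (hq'.sm u), fun u => (hq'.bd u).mul (hq.bd u)⟩

lemma Ad.add {q q' : ℝ → Ω → ℝ} (hq : Ad P Γ q) (hq' : Ad P Γ q') :
    Ad P Γ (fun u o => q u o + q' u o) :=
  ⟨fun u => (hq.sm u).add (hq'.sm u), fun u => (hq.bd u).add (hq'.bd u)⟩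

lemma Ad.cmul {q : ℝ → Ω → ℝ} (hq : Ad P Γ q) (c : ℝ) :
    Ad P Γ (fun u o => c * q u o) := (Ad.const c).mul hq

lemma Ad.sub {q q' : ℝ → Ω → ℝ} (hq : Ad P Γ q) (hq' : Ad P Γ q') :
    Ad P Γ (fun u o => q u o - q' u o) :=
  ⟨fun u => (hq.sm u).sub (hq'.sm u), fun u => (hq.bd u).sub (hq'.bd u)⟩

lemma T_sub {q q' : ℝ → Ω → ℝ} (hq : Ad P Γ q) (hq' : Ad P Γ q') (n : ℕ) (f : Lp ℝ 2 P) :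
    T P Γ n (fun u o => q u o - q' u o) f = T P Γ n q f - T P Γ n q' f := by
  rw [eq_sub_iff_add_eq, ← T_add (hq.sub hq') hq']; simp

lemma mulL_const (c : ℝ) (f : Lp ℝ 2 P) : mulL P (fun _ => c) f = c • f := by
  apply Lp.ext
  filter_upwards [mulL_ae (memLp_const c) f, Lp.coeFn_smul c f] with o a b
  rw [a, b]; simp

/-- `T 1 f = f_1 - f_0`. -/
lemma T_one (n : ℕ) (f : Lp ℝ 2 P) :
    T P Γ n (fun _ _ => 1) f = ceF P Γ 1 f - ceF P Γ 0 f := by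
  rw [T_apply]
  have : ∀ i ∈ Finset.range (2^n), mulL P ((fun _ _ => 1 : ℝ → Ω → ℝ) (gp n i)) (dl P Γ n i f) =
      (fun i => ceF P Γ (gp n i) f) (i+1) - (fun i => ceF P Γ (gp n i) f) i := by
    intro i _
    show mulL P (fun _ => 1) _ = _
    rw [mulL_const]; simp [dl]
  rw [Finset.sum_congr rfl this, Finset.sum_range_sub (fun i => ceF P Γ (gp n i) f)]
  simp only [gp_zero, gp_last]

lemma T_one_normsq (n : ℕ) (f : Lp ℝ 2 P) :
    inner ℝ (T P Γ n (fun _ _ => 1) f) f ≤ ‖f‖^2 := by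
  have h1 : T P Γ n (fun _ _ => 1) (T P Γ n (fun _ _ => 1) f) = T P Γ n (fun _ _ => 1) f := by
    rw [T_mul (Ad.const 1) (Ad.const 1)]; simp
  have h2 : inner ℝ (T P Γ n (fun _ _ => 1) f) f = ‖T P Γ n (fun _ _ => 1) f‖^2 := by
    rw [← real_inner_self_eq_norm_sq, ← T_sa (Ad.const 1), h1]
  have h3 := real_inner_le_norm (T P Γ n (fun _ _ => 1) f) f
  rw [h2] at *
  have : ‖T P Γ n (fun _ _ => 1) f‖ ≤ ‖f‖ := by
    by_contra! hh
    nlinarith [norm_nonneg f]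
  gcongr

lemma T_normsq {q : ℝ → Ω → ℝ} (hq : Ad P Γ q) (n : ℕ) (f : Lp ℝ 2 P) :
    ‖T P Γ n q f‖^2 = inner ℝ (T P Γ n (fun u o => q u o * q u o) f) f := by
  rw [← T_mul hq hq, T_sa hq, real_inner_self_eq_norm_sq]

lemma T_norm_le {q : ℝ → Ω → ℝ} (hq : Ad P Γ q) (n : ℕ) {c : ℝ} (hc : 0 ≤ c)
    (h : ∀ i < 2^n, ∀ᵐ o ∂P, |q (gp n i) o| ≤ c) (f : Lp ℝ 2 P) :
    ‖T P Γ n q f‖ ≤ c * ‖f‖ := by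
  have h1 := T_mono (hq.mul hq) (Ad.const (c^2)) n (f := f) (fun i hi => by
    filter_upwards [h i hi] with o a
    rw [← sq, ← sq_abs]; gcongr)
  rw [← T_normsq hq] at h1
  have h2 := T_smul (P := P) (Γ := Γ) (Ad.const 1) (c^2) n f
  simp only [mul_one] at h2
  rw [h2, real_inner_smul_left] at h1
  have h3 := T_one_normsq (Γ := Γ) n f
  have : ‖T P Γ n q f‖^2 ≤ (c * ‖f‖)^2 := by nlinarith [sq_nonneg c]
  exact (abs_le_of_sq_le_sq' this (by positivity)).2

/-- refinement -/
lemma dl_succ (n i : ℕ) (f : Lp ℝ 2 P) :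
    dl P Γ n i f = dl P Γ (n+1) (2*i) f + dl P Γ (n+1) (2*i+1) f := by
  have h1 : gp (n+1) (2*i+1+1) = gp n (i+1) := by rw [← gp_succ n (i+1)]; rfl
  simp only [dl, h1, gp_succ, ContinuousLinearMap.sub_apply]
  abel

lemma sum_two_mul {M : Type*} [AddCommMonoid M] (f : ℕ → M) (N : ℕ) :
    ∑ i ∈ Finset.range (2*N), f i = ∑ i ∈ Finset.range N, (f (2*i) + f (2*i+1)) := by
  induction N with
  | zero => simp
  | succ k ih => rw [Finset.sum_range_succ, ← ih, mul_add, mul_one, Finset.sum_range_succ, Finset.sum_range_succ, add_assoc]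

lemma T_succ {q : ℝ → Ω → ℝ} (n : ℕ)
    (h : ∀ i < 2^n, q (gp (n+1) (2*i+1)) = q (gp n i)) :
    T P Γ (n+1) q = T P Γ n q := by
  ext1 f
  rw [T_apply, T_apply, pow_succ, mul_comm, sum_two_mul]
  refine Finset.sum_congr rfl fun i hi => ?_
  rw [dl_succ n i, h i (Finset.mem_range.1 hi), gp_succ, map_add]

lemma T_congr {q q' : ℝ → Ω → ℝ} (n : ℕ)
    (h : ∀ i < 2^n, q (gp n i) = q' (gp n i)) : T P Γ n q = T P Γ n q' := by
  ext1 f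
  rw [T_apply, T_apply]
  exact Finset.sum_congr rfl fun i hi => by rw [h i (Finset.mem_range.1 hi)]

lemma T_congr_ae {q q' : ℝ → Ω → ℝ} (hq : Ad P Γ q) (n : ℕ)
    (h : ∀ i < 2^n, q (gp n i) =ᵐ[P] q' (gp n i)) : T P Γ n q = T P Γ n q' := by
  ext1 f
  rw [T_apply, T_apply]
  exact Finset.sum_congr rfl fun i hi => by
    rw [mulL_congr (hq.bd _) (h i (Finset.mem_range.1 hi))]

/-- dyadic floor -/
def fl (n : ℕ) (u : ℝ) : ℝ := (⌊u * 2^n⌋ : ℝ) / 2^n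

lemma fl_gp (n i : ℕ) : fl n (gp n i) = gp n i := by
  unfold fl gp
  rw [div_mul_cancel₀ _ (by positivity)]; simp

lemma fl_le (n : ℕ) (u : ℝ) : fl n u ≤ u := by
  unfold fl; rw [div_le_iff₀ (by positivity)]; exact Int.floor_le _

lemma fl_succ_fl (n : ℕ) (u : ℝ) : fl (n+1) (fl n u) = fl n u := by
  unfold fl
  have : (⌊u * 2 ^ n⌋ : ℝ) / 2 ^ n * 2 ^ (n + 1) = ((⌊u * 2 ^ n⌋ * 2 : ℤ) : ℝ) := by
    push_cast; rw [pow_succ]; field_simp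
  rw [this, Int.floor_intCast]; push_cast; rw [pow_succ]; field_simp

lemma fl_fl_succ (n : ℕ) (u : ℝ) : fl n (fl (n+1) u) = fl n u := by
  unfold fl
  have h : ⌊(⌊u * 2 ^ (n + 1)⌋ : ℝ) / 2 ^ (n + 1) * 2 ^ n⌋ = ⌊u * 2 ^ n⌋ := by
    have h1 : (⌊u * 2 ^ (n + 1)⌋ : ℝ) / 2 ^ (n + 1) * 2 ^ n = (⌊u * 2 ^ (n + 1)⌋ : ℝ) / 2 := by
      rw [pow_succ]; field_simp
    rw [h1]
    have h2 : u * 2^n = u * 2^(n+1) / 2 := by rw [pow_succ]; ring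
    rw [h2]
    have := Int.floor_div_natCast (u * 2^(n+1)) 2
    have h3 := Int.floor_div_natCast ((⌊u * 2 ^ (n + 1)⌋ : ℝ)) 2
    push_cast at *
    rw [this, h3, Int.floor_intCast]
  rw [h]

lemma fl_fl {n k : ℕ} (h : n ≤ k) (u : ℝ) : fl k (fl n u) = fl n u := by
  induction h with
  | refl => unfold fl; rw [div_mul_cancel₀ _ (by positivity), Int.floor_intCast]
  | step h ih => rw [← ih, fl_succ_fl]

lemma fl_fl' {n k : ℕ} (h : n ≤ k) (u : ℝ) : fl n (fl k u) = fl n u := by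
  induction h generalizing u with
  | refl => exact fl_fl le_rfl u
  | @step k h ih => rw [← ih u, ← fl_fl_succ k u, ih]

lemma fl_mid (n i : ℕ) : fl n (gp (n+1) (2*i+1)) = gp n i := by
  unfold fl gp
  have : (((2*i+1 : ℕ) : ℝ)) / 2 ^ (n+1) * 2^n = ((2*i+1 : ℕ) : ℝ) / (2 : ℕ) := by
    rw [pow_succ]; push_cast; field_simp
  rw [this]
  have h2 : ⌊((2*i+1 : ℕ) : ℝ) / (2:ℕ)⌋ = (i : ℤ) := by
    rw [Int.floor_eq_iff]; push_cast; constructor <;> linarith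
  rw [h2]; simp

/-- process which is constant on dyadic intervals of level `n` -/
def Lev (n : ℕ) (q : ℝ → Ω → ℝ) : Prop := ∀ u, q u = q (fl n u)

lemma Lev.mono {n k : ℕ} {q : ℝ → Ω → ℝ} (h : Lev n q) (hk : n ≤ k) : Lev k q := by
  intro u; rw [h u, h (fl k u), fl_fl' hk]

lemma Lev.T_eq {n k : ℕ} {q : ℝ → Ω → ℝ} (h : Lev n q) (hk : n ≤ k) : T P Γ k q = T P Γ n q := by
  induction hk with
  | refl => rfl
  | @step k hk ih =>
    rw [← ih, T_succ]
    intro i _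
    rw [h.mono hk, fl_mid]

/-- discretized process -/
def disc (n : ℕ) (q : ℝ → Ω → ℝ) : ℝ → Ω → ℝ := fun u => q (fl n u)

lemma lev_disc (n : ℕ) (q : ℝ → Ω → ℝ) : Lev n (disc n q) := by
  intro u; simp [disc, fl_fl le_rfl]

lemma Ad.disc {q : ℝ → Ω → ℝ} (hq : Ad P Γ q) (n : ℕ) : Ad P Γ (disc n q) :=
  ⟨fun u => (hq.sm _).mono (Γ.mono (fl_le n u)), fun u => hq.bd _⟩

lemma T_disc (n : ℕ) (q : ℝ → Ω → ℝ) : T P Γ n (disc n q) = T P Γ n q :=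
  T_congr n fun i _ => by simp [AF.disc, fl_gp]

/-- tail lemma -/
lemma tail_lemma {c : ℝ → Ω → ℝ} (hc : Ad P Γ c) (n : ℕ) (E : Set Ω) (hE : MeasurableSet E)
    (h01 : ∀ i < 2^n, ∀ o, c (gp n i) o = 0 ∨ c (gp n i) o = 1)
    (hcE : ∀ i < 2^n, ∀ o, c (gp n i) o = 1 → o ∈ E) (f : Lp ℝ 2 P) :
    ‖T P Γ n c f‖ ≤ ‖mulL P (E.indicator fun _ => (1:ℝ)) f‖ := by
  have hI : MemLp (E.indicator fun _ => (1:ℝ)) ∞ P := (memLp_const (1:ℝ)).indicator hE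
  have : T P Γ n c f = T P Γ n c (mulL P (E.indicator fun _ => (1:ℝ)) f) := by
    rw [T_apply, T_apply]
    refine Finset.sum_congr rfl fun i hi => ?_
    rw [← dl_mulL hc, ← dl_mulL hc, mulL_mulL (hc.bd _) hI]
    congr 3
    ext o
    rcases h01 i (Finset.mem_range.1 hi) o with h | h
    · simp [h]
    · simp [h, hcE i (Finset.mem_range.1 hi) o h]
  rw [this]
  have := T_norm_le hc n zero_le_one (f := mulL P (E.indicator fun _ => (1:ℝ)) f) (fun i hi => by
    filter_upwards with o
    rcases h01 i hi o with h | h <;> simp [h])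
  simpa using this

end PartOne

section LL
variable {Ω : Type*} {m : MeasurableSpace Ω} {P : Measure Ω} [IsProbabilityMeasure P] {Γ : Filtration ℝ m}

/-- `k` disjoint pairs of level `n` grid indices up to `i` with oscillation `> ε`. -/
def Chain (q : ℝ → Ω → ℝ) (ε : ℝ) (n : ℕ) : ℕ → ℕ → Ω → Prop
  | 0, _, _ => True
  | k+1, i, o => ∃ j' ≤ i, ∃ j < j', ε < |q (gp n j) o - q (gp n j') o| ∧ Chain q ε n k j o

lemma Chain.mono {q : ℝ → Ω → ℝ} {ε : ℝ} {n k i i' : ℕ} {o : Ω} (h : Chain q ε n k i o) (hi : i ≤ i') :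
    Chain q ε n k i' o := by
  cases k with
  | zero => trivial
  | succ k =>
    obtain ⟨j', hj', j, hj, h1, h2⟩ := h
    exact ⟨j', hj'.trans hi, j, hj, h1, h2⟩

lemma Chain.refine {q : ℝ → Ω → ℝ} {ε : ℝ} {n k i : ℕ} {o : Ω} (h : Chain q ε n k i o) (l : ℕ) :
    Chain q ε (n+l) k (2^l*i) o := by
  induction k generalizing i with
  | zero => trivial
  | succ k ih =>
    obtain ⟨j', hj', j, hj, h1, h2⟩ := h
    refine ⟨2^l*j', Nat.mul_le_mul_left _ hj', 2^l*j, Nat.mul_lt_mul_of_pos_left hj (by positivity), ?_, ih h2⟩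
    rwa [gp_add, gp_add]

lemma Chain.meas {q : ℝ → Ω → ℝ} (hq : Ad P Γ q) (ε : ℝ) (n k i : ℕ) :
    MeasurableSet[Γ (gp n i)] {o | Chain q ε n k i o} := by
  induction k generalizing i with
  | zero => simp [Chain]
  | succ k ih =>
    have : {o | Chain q ε n (k+1) i o} = ⋃ j' ∈ Finset.range (i+1), ⋃ j ∈ Finset.range j',
        ({o | ε < |q (gp n j) o - q (gp n j') o|} ∩ {o | Chain q ε n k j o}) := by
      ext o; simp only [Chain, mem_setOf_eq, mem_iUnion, Finset.mem_range, Nat.lt_succ_iff, exists_prop, mem_inter_iff]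
    rw [this]
    refine Finset.measurableSet_biUnion _ fun j' hj' => Finset.measurableSet_biUnion _ fun j hj => ?_
    simp only [Finset.mem_range] at hj hj'
    have h1 : Γ (gp n j) ≤ Γ (gp n i) := Γ.mono (gp_mono n (by omega))
    have h2 : Γ (gp n j') ≤ Γ (gp n i) := Γ.mono (gp_mono n (by omega))
    refine MeasurableSet.inter ?_ (h1 _ (ih j))
    exact ((((hq.sm _).mono h1).sub ((hq.sm _).mono h2)).norm).measurable measurableSet_Ioi

open Classical in
/-- indicator process of a chain -/
def chI (q : ℝ → Ω → ℝ) (ε : ℝ) (n k : ℕ) : ℝ → Ω → ℝ :=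
  fun u o => if Chain q ε n k ⌊u * 2^n⌋₊ o then 1 else 0

lemma nfl_gp (n i : ℕ) : ⌊gp n i * 2^n⌋₊ = i := by
  unfold gp; rw [div_mul_cancel₀ _ (by positivity)]; simp

lemma chI_ad {q : ℝ → Ω → ℝ} (hq : Ad P Γ q) (ε : ℝ) (n k : ℕ) : Ad P Γ (chI q ε n k) := by
  have key : ∀ u, StronglyMeasurable[Γ u] (chI q ε n k u) := by
    intro u
    by_cases hu : 0 ≤ u
    · refine StronglyMeasurable.ite ?_ stronglyMeasurable_const stronglyMeasurable_const
      refine Γ.mono ?_ _ (Chain.meas hq ε n k _)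
      unfold gp
      rw [div_le_iff₀ (by positivity)]
      exact Nat.floor_le (by positivity)
    · push Not at hu
      have h0 : ⌊u * 2^n⌋₊ = 0 := Nat.floor_of_nonpos (by nlinarith [pow_pos (two_pos (α := ℝ)) n])
      refine StronglyMeasurable.ite ?_ stronglyMeasurable_const stronglyMeasurable_const
      rw [h0]
      cases k <;> simp [Chain]
  refine ⟨key, fun u => ?_⟩
  refine memLp_top_of_bound ((key u).mono (Γ.le u)).aestronglyMeasurable 1 ?_
  filter_upwards with o
  unfold chI; split_ifs <;> simp

lemma nfl_fl (n : ℕ) (u : ℝ) : ⌊fl n u * 2^n⌋₊ = ⌊u * 2^n⌋₊ := by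
  unfold fl; rw [div_mul_cancel₀ _ (by positivity)]
  rw [← Int.floor_toNat, ← Int.floor_toNat, Int.floor_intCast]

lemma chI_lev (q : ℝ → Ω → ℝ) (ε : ℝ) (n k : ℕ) : Lev n (chI q ε n k) := by
  intro u; funext o; unfold chI; rw [nfl_fl]

/-- truncated chain count -/
def psi (q : ℝ → Ω → ℝ) (ε : ℝ) (n k0 : ℕ) : ℝ → Ω → ℝ :=
  fun u o => ∑ k ∈ Finset.range k0, chI q ε n (k+1) u o

lemma psi_lev (q : ℝ → Ω → ℝ) (ε : ℝ) (n k : ℕ) : Lev n (psi q ε n k) := by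
  intro u; ext o; unfold psi; exact Finset.sum_congr rfl fun k _ => by rw [chI_lev]

lemma Ad.sum {ι : Type*} (s : Finset ι) (q : ι → ℝ → Ω → ℝ) (hq : ∀ i ∈ s, Ad P Γ (q i)) :
    Ad P Γ (fun u o => ∑ i ∈ s, q i u o) := by
  classical
  induction s using Finset.induction with
  | empty => simpa using Ad.const 0
  | insert a s ha ih =>
    simp only [Finset.sum_insert ha]
    exact (hq a (by simp)).add (ih fun i hi => hq i (by simp [hi]))

lemma psi_ad {q : ℝ → Ω → ℝ} (hq : Ad P Γ q) (ε : ℝ) (n k : ℕ) : Ad P Γ (psi q ε n k) :=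
  Ad.sum _ _ fun i _ => chI_ad hq ε n (i+1)

lemma gp_floor_le (n l i : ℕ) : 2^l * ⌊gp (n+l) i * 2^n⌋₊ ≤ i := by
  have h1 : gp (n+l) i * 2^n = (i:ℝ) / ((2^l : ℕ) : ℝ) := by
    unfold gp; rw [pow_add]; push_cast; field_simp
  rw [h1, Nat.floor_div_natCast, Nat.floor_natCast]
  exact Nat.mul_div_le i (2^l)

lemma chI_le {q : ℝ → Ω → ℝ} {ε : ℝ} (n l k i : ℕ) (o : Ω) :
    chI q ε n k (gp (n+l) i) o ≤ chI q ε (n+l) k (gp (n+l) i) o := by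
  unfold chI
  rw [nfl_gp]
  split_ifs with h1 h2 h2
  · rfl
  · exact absurd ((h1.refine l).mono (gp_floor_le n l i)) h2
  · norm_num
  · rfl

lemma chI_nonneg {q : ℝ → Ω → ℝ} {ε : ℝ} (n k : ℕ) (u : ℝ) (o : Ω) : 0 ≤ chI q ε n k u o := by
  unfold chI; split_ifs <;> norm_num

lemma chI_le_one {q : ℝ → Ω → ℝ} {ε : ℝ} (n k : ℕ) (u : ℝ) (o : Ω) : chI q ε n k u o ≤ 1 := by
  unfold chI; split_ifs <;> norm_num

lemma psi_le {q : ℝ → Ω → ℝ} {ε : ℝ} (n l k i : ℕ) (o : Ω) :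
    psi q ε n k (gp (n+l) i) o ≤ psi q ε (n+l) k (gp (n+l) i) o :=
  Finset.sum_le_sum fun _ _ => chI_le n l _ i o

/-- key combinatorial inequality -/
lemma chain_key {q : ℝ → Ω → ℝ} {ε : ℝ} (n l k0 i : ℕ) (o : Ω)
    (h : ε < |q (gp (n+l) i) o - q (fl n (gp (n+l) i)) o|) (hε : 0 ≤ ε) :
    1 ≤ psi q ε (n+l) k0 (gp (n+l) i) o - psi q ε n k0 (gp (n+l) i) o +
      chI q ε n k0 (gp (n+l) i) o := by
  classical
  set u := gp (n+l) i with hu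
  set j := ⌊u * 2^n⌋₊ with hj
  have hflu : fl n u = gp n j := by
    unfold fl gp
    have : 0 ≤ u * 2^n := by rw [hu]; unfold gp; positivity
    rw [hj, ← natCast_floor_eq_intCast_floor this]
  have hle : 2^l * j ≤ i := gp_floor_le n l i
  have hlt : 2^l * j < i := by
    refine lt_of_le_of_ne hle fun he => ?_
    have : fl n u = u := by rw [hflu, hu, ← he, gp_add]
    rw [this] at h; simp at h; linarith
  -- appending a pair
  have happ : ∀ k, Chain q ε n k j o → Chain q ε (n+l) (k+1) i o := by
    intro k hk
    refine ⟨i, le_rfl, 2^l*j, hlt, ?_, hk.refine l⟩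
    rw [gp_add, ← hflu, abs_sub_comm]; exact h
  by_cases hk0 : Chain q ε n k0 j o
  · have : chI q ε n k0 u o = 1 := by unfold chI; simp only [← hj, hk0, if_true]
    have := psi_le (q := q) (ε := ε) n l k0 i o
    rw [← hu] at this
    linarith
  · have hex : ∃ k, ¬ Chain q ε n k j o := ⟨k0, hk0⟩
    have hK := Nat.find_spec hex
    have hKmin := fun k hk => Nat.find_min hex (m := k) hk
    set K := Nat.find hex with hKdef
    have hK0 : K ≠ 0 := by intro h0; rw [h0] at hK; exact hK trivial
    obtain ⟨k, hk⟩ := Nat.exists_eq_succ_of_ne_zero hK0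
    have hKk0 : K ≤ k0 := Nat.find_min' hex hk0
    have hCk : Chain q ε n k j o := not_not.1 (hKmin k (by omega))
    have hCK : Chain q ε (n+l) (k+1) i o := happ k hCk
    have hterm : psi q ε n k0 u o + 1 ≤ psi q ε (n+l) k0 u o := by
      unfold psi
      have hmem : k ∈ Finset.range k0 := Finset.mem_range.2 (by omega)
      rw [← Finset.add_sum_erase _ _ hmem, ← Finset.add_sum_erase _ _ hmem]
      have h1 : chI q ε n (k+1) u o = 0 := by
        unfold chI; rw [if_neg]; rw [← hj]; rw [hk] at hK; exact hK
      have h2 : chI q ε (n+l) (k+1) u o = 1 := by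
        unfold chI; rw [if_pos]; rw [hu, nfl_gp]; exact hCK
      have h3 : ∑ x ∈ (Finset.range k0).erase k, chI q ε n (x+1) u o ≤
          ∑ x ∈ (Finset.range k0).erase k, chI q ε (n+l) (x+1) u o :=
        Finset.sum_le_sum fun x _ => by rw [hu]; exact chI_le n l _ i o
      rw [h1, h2]; linarith
    have := chI_nonneg (q := q) (ε := ε) n k0 u o
    linarith

/-- greedy reference value -/
def refv (q : ℕ → ℝ) (ε : ℝ) : ℕ → ℝ
  | 0 => q 0
  | i+1 => if ε / 2 < |q (i+1) - refv q ε i| then q (i+1) else refv q ε i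

def cnt (q : ℕ → ℝ) (ε : ℝ) : ℕ → ℕ
  | 0 => 0
  | i+1 => if ε / 2 < |q (i+1) - refv q ε i| then cnt q ε i + 1 else cnt q ε i

lemma refv_close (q : ℕ → ℝ) {ε : ℝ} (hε : 0 ≤ ε) (i : ℕ) : |q i - refv q ε i| ≤ ε / 2 := by
  cases i with
  | zero => simp [refv]; linarith
  | succ i =>
    unfold refv
    split_ifs with h
    · simp; linarith
    · exact not_lt.1 h

lemma cnt_mono (q : ℕ → ℝ) (ε : ℝ) : Monotone (cnt q ε) := by
  refine monotone_nat_of_le_succ fun i => ?_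
  conv_rhs => unfold cnt
  split_ifs <;> omega

lemma refv_const (q : ℕ → ℝ) (ε : ℝ) {i j : ℕ} (h : i ≤ j) (hc : cnt q ε i = cnt q ε j) :
    refv q ε j = refv q ε i := by
  induction h with
  | refl => rfl
  | @step j hj ih =>
    have h1 := cnt_mono q ε hj
    have h2 := cnt_mono q ε j.le_succ
    have h3 : cnt q ε (j+1) = cnt q ε j := by
      simp only [Nat.succ_eq_add_one] at hc h2; omega
    rw [← ih (by simp only [Nat.succ_eq_add_one] at hc h2; omega)]
    simp only [Nat.succ_eq_add_one]
    rw [show cnt q ε (j+1) = if ε / 2 < |q (j+1) - refv q ε j| then cnt q ε j + 1 else cnt q ε j from rfl] at h3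
    rw [show refv q ε (j+1) = if ε / 2 < |q (j+1) - refv q ε j| then q (j+1) else refv q ε j from rfl]
    split_ifs at h3 ⊢ with hh
    · omega
    · rfl

lemma cnt_jump (q : ℕ → ℝ) {ε : ℝ} (hε : 0 ≤ ε) {i j : ℕ} (h : i < j) (hc : ε < |q i - q j|) :
    cnt q ε i + 1 ≤ cnt q ε j := by
  by_contra! hh
  have h1 := cnt_mono q ε h.le
  have h2 := refv_const q ε h.le (by omega)
  have h3 := refv_close q hε i
  have h4 := refv_close q hε j
  rw [h2] at h4
  rw [abs_le] at h3 h4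
  rcases lt_abs.1 hc with h | h <;> linarith

lemma chain_cnt {q : ℝ → Ω → ℝ} {ε : ℝ} (hε : 0 ≤ ε) {n k i : ℕ} {o : Ω} (h : Chain q ε n k i o) :
    k ≤ cnt (fun i => q (gp n i) o) ε i := by
  induction k generalizing i with
  | zero => omega
  | succ k ih =>
    obtain ⟨j', hj', j, hj, h1, h2⟩ := h
    have := cnt_jump (fun i => q (gp n i) o) hε hj h1
    have h3 := cnt_mono (fun i => q (gp n i) o) ε hj'
    have := ih h2
    omega

lemma cnt_energy (q : ℕ → ℝ) {ε : ℝ} (hε : 0 ≤ ε) (i : ℕ) :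
    (ε/2)^2 * cnt q ε i + (q i - refv q ε i)^2 ≤
      q i ^ 2 - q 0 ^ 2 - 2 * ∑ j ∈ Finset.range i, refv q ε j * (q (j+1) - q j) := by
  induction i with
  | zero => simp [cnt, refv]
  | succ i ih =>
    rw [Finset.sum_range_succ]
    unfold cnt
    rw [show refv q ε (i+1) = if ε / 2 < |q (i+1) - refv q ε i| then q (i+1) else refv q ε i from rfl]
    split_ifs with h
    · have : (ε/2)^2 ≤ (q (i+1) - refv q ε i)^2 := by
        rw [← sq_abs (q (i+1) - _)]; gcongr
      push_cast
      nlinarith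
    · nlinarith

variable (P Γ) in
/-- martingale process closed by `M` -/
def mp (M : Ω → ℝ) : ℝ → Ω → ℝ := fun u => P[M|Γ u]

lemma bdd_of_top {M : Ω → ℝ} (hM : MemLp M ∞ P) : ∀ᵐ o ∂P, |M o| ≤ (eLpNorm M ∞ P).toReal := by
  have h1 := ae_le_eLpNormEssSup (f := M) (μ := P)
  have h2 := hM.2
  rw [eLpNorm_exponent_top] at *
  filter_upwards [h1] with o h
  have := ENNReal.toReal_mono h2.ne h
  simpa using this

lemma mp_bdd {M : Ω → ℝ} {c : ℝ} (hM : ∀ᵐ o ∂P, |M o| ≤ c) (u : ℝ) :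
    ∀ᵐ o ∂P, |mp P Γ M u o| ≤ c := ae_bdd_abs_condExp_of_ae_bdd_abs hM

lemma mp_ad {M : Ω → ℝ} (hM : MemLp M ∞ P) : Ad P Γ (mp P Γ M) := by
  refine ⟨fun u => stronglyMeasurable_condExp, fun u => ?_⟩
  exact memLp_top_of_bound (stronglyMeasurable_condExp.mono (Γ.le u)).aestronglyMeasurable _
    (mp_bdd (bdd_of_top hM) u)

lemma integral_mul_condExp' {m' : MeasurableSpace Ω} (h : m' ≤ m) {q M : Ω → ℝ}
    (hq : StronglyMeasurable[m'] q) (hi : Integrable (q * M) P) (hM : Integrable M P) :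
    ∫ o, q o * (P[M|m']) o ∂P = ∫ o, q o * M o ∂P := by
  have h1 := condExp_mul_of_stronglyMeasurable_left (μ := P) hq hi hM
  have h2 := integral_condExp (μ := P) (f := q * M) h
  rw [integral_congr_ae h1] at h2
  exact h2

lemma top_int {M : Ω → ℝ} (hM : MemLp M ∞ P) : Integrable M P := hM.integrable le_top

lemma refv_meas {q : ℝ → Ω → ℝ} (hq : Ad P Γ q) (ε : ℝ) (n i : ℕ) :
    StronglyMeasurable[Γ (gp n i)] (fun o => refv (fun i => q (gp n i) o) ε i) := by
  induction i with
  | zero => exact hq.sm _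
  | succ i ih =>
    have h1 : StronglyMeasurable[Γ (gp n (i+1))] (fun o => refv (fun i => q (gp n i) o) ε i) :=
      ih.mono (Γ.mono (gp_mono n i.le_succ))
    refine StronglyMeasurable.ite ?_ (hq.sm _) h1
    exact (((hq.sm _).sub h1).norm).measurable measurableSet_Ioi

lemma refv_bdd {q : ℕ → ℝ} {c : ℝ} (ε : ℝ) (h : ∀ i, |q i| ≤ c) (i : ℕ) : |refv q ε i| ≤ c := by
  induction i with
  | zero => exact h 0
  | succ i ih => unfold refv; split_ifs; exacts [h _, ih]

lemma chain_prob {M : Ω → ℝ} (hM : MemLp M ∞ P) {c : ℝ} (hc : ∀ᵐ o ∂P, |M o| ≤ c)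
    {ε : ℝ} (hε : 0 < ε) (n k : ℕ) :
    (ε/2)^2 * k * P.real {o | Chain (mp P Γ M) ε n k (2^n) o} ≤ c^2 := by
  set q := mp P Γ M with hqdef
  have hq : Ad P Γ q := mp_ad hM
  set E := {o | Chain q ε n k (2^n) o} with hE
  have hEm : MeasurableSet E := Γ.le _ _ (Chain.meas hq ε n k (2^n))
  have hall : ∀ᵐ o ∂P, ∀ i, |q (gp n i) o| ≤ c := ae_all_iff.2 fun i => mp_bdd hc _
  set r : ℕ → Ω → ℝ := fun j o => refv (fun i => q (gp n i) o) ε j with hr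
  have hrb : ∀ j, MemLp (r j) ∞ P := fun j =>
    memLp_top_of_bound ((refv_meas hq ε n j).mono (Γ.le _)).aestronglyMeasurable c (by
      filter_upwards [hall] with o h using refv_bdd ε h j)
  have hitg : ∀ j j', Integrable (fun o => r j o * q (gp n j') o) P := fun j j' =>
    top_int ((hq.bd _).mul (hrb j))
  have hzero : ∀ j, ∫ o, r j o * (q (gp n (j+1)) o - q (gp n j) o) ∂P = 0 := by
    intro j
    simp only [mul_sub]
    rw [integral_sub (hitg _ _) (hitg _ _)]
    have hi : Integrable (r j * M) P := top_int (hM.mul (hrb j))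
    have h1 := integral_mul_condExp' (Γ.le (gp n j)) (refv_meas hq ε n j) hi (top_int hM)
    have h2 := integral_mul_condExp' (Γ.le (gp n (j+1)))
      ((refv_meas hq ε n j).mono (Γ.mono (gp_mono n j.le_succ))) hi (top_int hM)
    rw [hqdef]; unfold mp
    rw [h1, h2, sub_self]
  have hmain : ∀ᵐ o ∂P, (ε/2)^2 * k * E.indicator (fun _ => (1:ℝ)) o ≤
      c^2 - 2 * ∑ j ∈ Finset.range (2^n), r j o * (q (gp n (j+1)) o - q (gp n j) o) := by
    filter_upwards [hall] with o h
    have h1 := cnt_energy (fun i => q (gp n i) o) hε.le (2^n)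
    have h2 : q (gp n (2^n)) o ^ 2 ≤ c^2 := by
      rw [← sq_abs]; have := h (2^n); gcongr
    by_cases hω : o ∈ E
    · have h3 := chain_cnt hε.le hω
      have h4 : ((k:ℕ):ℝ) ≤ cnt (fun i => q (gp n i) o) ε (2^n) := by exact_mod_cast h3
      have h5 : (ε/2)^2 * k ≤ (ε/2)^2 * cnt (fun i => q (gp n i) o) ε (2^n) := by gcongr
      simp only [indicator_of_mem hω, mul_one]
      nlinarith [sq_nonneg (q (gp n (2^n)) o - refv (fun i => q (gp n i) o) ε (2^n)), sq_nonneg (q (gp n 0) o)]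
    · simp only [indicator_of_notMem hω, mul_zero]
      have : 0 ≤ (ε/2)^2 * (cnt (fun i => q (gp n i) o) ε (2^n) : ℝ) := by positivity
      nlinarith [sq_nonneg (q (gp n (2^n)) o - refv (fun i => q (gp n i) o) ε (2^n)), sq_nonneg (q (gp n 0) o)]
  have hint2 : ∀ j, Integrable (fun o => r j o * (q (gp n (j+1)) o - q (gp n j) o)) P := fun j => by
    simp only [mul_sub]; exact (hitg _ _).sub (hitg _ _)
  have hI1 : Integrable (fun o => (ε/2)^2 * k * E.indicator (fun _ => (1:ℝ)) o) P :=
    ((integrable_const (1:ℝ)).indicator hEm).const_mul _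
  have hI2 : Integrable (fun o => ∑ j ∈ Finset.range (2^n), r j o * (q (gp n (j+1)) o - q (gp n j) o)) P :=
    integrable_finset_sum _ fun j _ => hint2 j
  have hI3 : Integrable (fun o => c^2 - 2 * ∑ j ∈ Finset.range (2^n), r j o * (q (gp n (j+1)) o - q (gp n j) o)) P :=
    (integrable_const _).sub (hI2.const_mul 2)
  have := integral_mono_ae hI1 hI3 hmain
  rw [integral_const_mul, integral_indicator_const _ hEm, integral_sub (integrable_const _) (hI2.const_mul 2),
    integral_const_mul, integral_finset_sum _ (fun j _ => hint2 j)] at this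
  simpa [hzero] using this

lemma normsq_mulL_ind (E : Set Ω) (hE : MeasurableSet E) (f : Lp ℝ 2 P) :
    ‖mulL P (E.indicator fun _ => (1:ℝ)) f‖ = (eLpNorm (E.indicator f) 2 P).toReal := by
  rw [Lp.norm_def]
  congr 1
  apply eLpNorm_congr_ae
  filter_upwards [mulL_ae ((memLp_const (1:ℝ)).indicator hE) f] with o h
  rw [h]; by_cases hω : o ∈ E <;> simp [hω]

lemma ui_lemma (f : Lp ℝ 2 P) {η : ℝ} (hη : 0 < η) : ∃ δ > 0, ∀ E : Set Ω, MeasurableSet E →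
    P.real E ≤ δ → ‖mulL P (E.indicator fun _ => (1:ℝ)) f‖ ≤ η := by
  obtain ⟨δ, hδ, h⟩ := (Lp.memLp f).eLpNorm_indicator_le (by norm_num) (by norm_num) hη
  refine ⟨δ, hδ, fun E hE hPE => ?_⟩
  rw [normsq_mulL_ind E hE]
  refine ENNReal.toReal_le_of_le_ofReal hη.le (h E hE ?_)
  rw [← ENNReal.ofReal_toReal (measure_ne_top P E)]
  exact ENNReal.ofReal_le_ofReal hPE

/-- the main convergence statement (existence of left limits in `L²`) -/
lemma T_cauchy {M : Ω → ℝ} (hM : MemLp M ∞ P) (f : Lp ℝ 2 P) :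
    CauchySeq (fun n => T P Γ n (mp P Γ M) f) := by
  obtain ⟨c, hc⟩ : ∃ c, ∀ᵐ o ∂P, |M o| ≤ c := ⟨_, bdd_of_top hM⟩
  have hc0 : 0 ≤ c := by
    obtain ⟨o, h⟩ := hc.exists
    exact (abs_nonneg _).trans h
  set q := mp P Γ M with hqdef
  have hq : Ad P Γ q := mp_ad hM
  -- quantitative estimate
  have est : ∀ ε > 0, ∀ k0 n l : ℕ, ‖T P Γ (n+l) q f - T P Γ n q f‖^2 ≤
      ε^2 * ‖f‖^2 + 4 * c^2 * (inner ℝ (T P Γ (n+l) (psi q ε (n+l) k0) f) f -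
        inner ℝ (T P Γ n (psi q ε n k0) f) f) +
      4 * c^2 * ‖mulL P ({o | Chain q ε n k0 (2^n) o}.indicator fun _ => (1:ℝ)) f‖^2 := by
    intro ε hε k0 n l
    have hr : Ad P Γ (fun u o => q u o - AF.disc n q u o) := hq.sub (hq.disc n)
    have h1 : T P Γ (n+l) q f - T P Γ n q f = T P Γ (n+l) (fun u o => q u o - AF.disc n q u o) f := by
      rw [T_sub hq (hq.disc n), (lev_disc n q).T_eq (Nat.le_add_right n l), T_disc]
    rw [h1, T_normsq hr]
    have hA1 := (Ad.const (P := P) (Γ := Γ) (1:ℝ))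
    have hA := ((hA1.cmul (ε^2)).add (((psi_ad hq ε (n+l) k0).sub (psi_ad hq ε n k0)).cmul (4*c^2))).add
      ((chI_ad hq ε n k0).cmul (4*c^2))
    have h2 := T_mono (hr.mul hr) hA (n+l) (f := f) (by
      intro i hi
      have hb1 := mp_bdd (Γ := Γ) hc (gp (n+l) i)
      have hb2 := mp_bdd (Γ := Γ) hc (fl n (gp (n+l) i))
      filter_upwards [hb1, hb2] with o hb1 hb2
      have hps := psi_le (q := q) (ε := ε) n l k0 i o
      have hch := chI_nonneg (q := q) (ε := ε) n k0 (gp (n+l) i) o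
      have e1 : AF.disc n q (gp (n+l) i) o = q (fl n (gp (n+l) i)) o := rfl
      rw [e1]
      set x := q (gp (n+l) i) o - q (fl n (gp (n+l) i)) o with hx
      have hx2 : |x| ≤ 2*c := by
        rw [hx]; refine (abs_sub _ _).trans ?_
        rw [← hqdef] at hb1 hb2; linarith
      have hxx : x * x = |x|^2 := by rw [sq_abs]; ring
      rw [hxx]
      by_cases hbig : ε < |x|
      · have hk := chain_key (q := q) (ε := ε) n l k0 i o hbig hε.le
        have : |x|^2 ≤ 4*c^2 := by nlinarith [abs_nonneg x]
        nlinarith [sq_nonneg c, sq_nonneg ε]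
      · push Not at hbig
        have : |x|^2 ≤ ε^2 := by gcongr
        have h4 : 0 ≤ 4*c^2 := by positivity
        nlinarith [mul_nonneg h4 (sub_nonneg.2 hps), mul_nonneg h4 hch])
    refine h2.trans ?_
    rw [T_add ((hA1.cmul (ε^2)).add (((psi_ad hq ε (n+l) k0).sub (psi_ad hq ε n k0)).cmul (4*c^2)))
      ((chI_ad hq ε n k0).cmul (4*c^2)),
      T_add (hA1.cmul (ε^2)) (((psi_ad hq ε (n+l) k0).sub (psi_ad hq ε n k0)).cmul (4*c^2)),
      T_smul hA1, T_smul ((psi_ad hq ε (n+l) k0).sub (psi_ad hq ε n k0)),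
      T_sub (psi_ad hq ε (n+l) k0) (psi_ad hq ε n k0), T_smul (chI_ad hq ε n k0),
      (psi_lev q ε n k0).T_eq (Nat.le_add_right n l), (chI_lev q ε n k0).T_eq (Nat.le_add_right n l),
      inner_add_left, inner_add_left, real_inner_smul_left, real_inner_smul_left, real_inner_smul_left,
      inner_sub_left]
    have h3 := T_one_normsq (Γ := Γ) (n+l) f
    have hcc : (fun u o => chI q ε n k0 u o * chI q ε n k0 u o) = chI q ε n k0 := by
      ext u o; unfold chI; split_ifs <;> simp
    have h4 : inner ℝ (T P Γ n (chI q ε n k0) f) f = ‖T P Γ n (chI q ε n k0) f‖^2 := by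
      rw [T_normsq (chI_ad hq ε n k0), hcc]
    have h5 := tail_lemma (chI_ad hq ε n k0) n {o | Chain q ε n k0 (2^n) o}
      (Γ.le _ _ (Chain.meas hq ε n k0 (2^n)))
      (fun i _ o => by unfold chI; split_ifs <;> simp)
      (fun i hi o h => by
        unfold chI at h; rw [nfl_gp] at h
        split_ifs at h with h'
        · exact h'.mono hi.le
        · norm_num at h) f
    rw [h4]
    gcongr
  rw [Metric.cauchySeq_iff']
  intro η hη
  -- choose ε
  obtain ⟨ε, hε, hε2⟩ : ∃ ε > 0, ε^2 * ‖f‖^2 ≤ η^2/4 := by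
    refine ⟨η / (2 * (‖f‖ + 1)), by positivity, ?_⟩
    rw [div_pow, div_mul_eq_mul_div, div_le_iff₀ (by positivity)]
    have : ‖f‖^2 ≤ (‖f‖+1)^2 := by gcongr; linarith
    nlinarith [mul_le_mul_of_nonneg_left this (sq_nonneg η)]
  obtain ⟨δ, hδ, hui⟩ := ui_lemma f (η := η / (4 * (c+1))) (by positivity)
  obtain ⟨k0, hk0⟩ := exists_nat_gt (c^2 / ((ε/2)^2 * δ))
  have hk0' : c^2 ≤ (ε/2)^2 * k0 * δ := by
    rw [div_lt_iff₀ (by positivity)] at hk0; nlinarith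
  have htail : ∀ n, 4 * c^2 * ‖mulL P ({o | Chain q ε n k0 (2^n) o}.indicator fun _ => (1:ℝ)) f‖^2 ≤ η^2/4 := by
    intro n
    have hk0pos : (0:ℝ) < k0 := lt_of_le_of_lt (by positivity) hk0
    have h1 := hui {o | Chain q ε n k0 (2^n) o} (Γ.le _ _ (Chain.meas hq ε n k0 (2^n))) (by
      have := chain_prob (Γ := Γ) hM hc hε n k0
      have h2 := this.trans hk0'
      have : 0 < (ε/2)^2 * k0 := by positivity
      exact le_of_mul_le_mul_left h2 this)
    calc _ ≤ 4 * c^2 * (η / (4 * (c+1)))^2 := by gcongr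
      _ ≤ η^2/4 := by
        rw [div_pow, ← mul_div_assoc, div_le_iff₀ (by positivity)]
        nlinarith [mul_nonneg (sq_nonneg η) hc0, sq_nonneg η]
  -- monotone forms
  have hmono : Monotone (fun n => inner ℝ (T P Γ n (psi q ε n k0) f) f) := by
    refine monotone_nat_of_le_succ fun n => ?_
    rw [← (psi_lev q ε n k0).T_eq (Nat.le_add_right n 1)]
    exact T_mono (psi_ad hq ε n k0) (psi_ad hq ε (n+1) k0) (n+1) (fun i _ => by
      filter_upwards with o using psi_le n 1 k0 i o) f
  have hbdd : BddAbove (range (fun n => inner ℝ (T P Γ n (psi q ε n k0) f) f)) := by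
    refine ⟨k0 * ‖f‖^2, ?_⟩
    rintro _ ⟨n, rfl⟩
    have h1 := T_mono (psi_ad hq ε n k0) ((Ad.const (P := P) (Γ := Γ) 1).cmul k0) n (f := f) (fun i _ => by
      filter_upwards with o
      unfold psi
      calc _ ≤ ∑ k ∈ Finset.range k0, (1:ℝ) := Finset.sum_le_sum fun k _ => chI_le_one _ _ _ _
        _ = _ := by simp)
    rw [T_smul (Ad.const 1), real_inner_smul_left] at h1
    have h3 := T_one_normsq (Γ := Γ) n f
    refine h1.trans ?_
    gcongr
  have hconv := tendsto_atTop_ciSup hmono hbdd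
  have hcs := hconv.cauchySeq
  rw [Metric.cauchySeq_iff'] at hcs
  obtain ⟨N, hN⟩ := hcs (η^2 / (16 * (c^2+1))) (by positivity)
  refine ⟨N, fun n hn => ?_⟩
  obtain ⟨l, rfl⟩ := Nat.exists_eq_add_of_le hn
  have h1 := est ε hε k0 N l
  have h2 := hN (N+l) hn
  rw [Real.dist_eq] at h2
  have h3 := (abs_lt.1 h2).2
  have h4 : 4 * c^2 * (inner ℝ (T P Γ (N+l) (psi q ε (N+l) k0) f) f -
        inner ℝ (T P Γ N (psi q ε N k0) f) f) ≤ η^2/4 := by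
    calc _ ≤ 4 * c^2 * (η^2 / (16 * (c^2+1))) := by gcongr
      _ ≤ _ := by
        rw [← mul_div_assoc, div_le_iff₀ (by positivity)]
        nlinarith [sq_nonneg η, sq_nonneg c, mul_nonneg (sq_nonneg η) (sq_nonneg c)]
  have h5 : ‖T P Γ (N+l) q f - T P Γ N q f‖^2 ≤ 3 * η^2/4 := by linarith [htail N]
  rw [dist_eq_norm]
  by_contra! hcon
  nlinarith

end LL

section MM

/-- element of `L²` given by a function -/
def toL {Y : Type*} [MeasurableSpace Y] (ν : Measure Y) (φ : Y → ℝ) : Lp ℝ 2 ν :=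
  open Classical in if h : MemLp φ 2 ν then h.toLp φ else 0

lemma toL_ae {Y : Type*} [MeasurableSpace Y] (ν : Measure Y) {φ : Y → ℝ} (h : MemLp φ 2 ν) : toL ν φ =ᵐ[ν] φ := by
  unfold toL; rw [dif_pos h]; exact h.coeFn_toLp

lemma inner_eq' {Y : Type*} [MeasurableSpace Y] (ν : Measure Y) (f g : Lp ℝ 2 ν) : inner ℝ f g = ∫ o, f o * g o ∂ν := by
  rw [L2.inner_def]; congr 1; ext o; simp [mul_comm]

lemma Lp_sum_ae {Y ι : Type*} [MeasurableSpace Y] (ν : Measure Y) (s : Finset ι) (f : ι → Lp ℝ 2 ν) :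
    ((∑ i ∈ s, f i : Lp ℝ 2 ν) : Y → ℝ) =ᵐ[ν] fun κ => ∑ i ∈ s, f i κ := by
  classical
  induction s using Finset.induction with
  | empty =>
    filter_upwards [Lp.coeFn_zero ℝ 2 ν] with κ h
    simpa using h
  | insert a s ha ih =>
    simp only [Finset.sum_insert ha]
    filter_upwards [ih, Lp.coeFn_add (f a) (∑ i ∈ s, f i)] with κ h1 h2
    rw [h2, Pi.add_apply, h1]

/-- abstract projection-valued content on an algebra of clopen sets -/
structure PM (Y H : Type*) [TopologicalSpace Y] [MeasurableSpace Y]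
    [NormedAddCommGroup H] [InnerProductSpace ℝ H] where
  A : Set (Set Y)
  alg : IsSetAlgebra A
  clopen : ∀ s ∈ A, IsClopen s
  gen : ‹MeasurableSpace Y› = MeasurableSpace.generateFrom A
  p : Set Y → H →L[ℝ] H
  inter : ∀ s ∈ A, ∀ t ∈ A, ∀ f, p s (p t f) = p (s ∩ t) f
  union : ∀ s ∈ A, ∀ t ∈ A, Disjoint s t → p (s ∪ t) = p s + p t
  sa : ∀ s ∈ A, ∀ f g, inner ℝ (p s f) g = inner ℝ f (p s g)

variable {Y H : Type*} [TopologicalSpace Y] [CompactSpace Y] [MeasurableSpace Y]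
    [NormedAddCommGroup H] [InnerProductSpace ℝ H] [CompleteSpace H] (W : PM Y H)

namespace PM

lemma empty : W.p ∅ = 0 := by
  have := W.union ∅ W.alg.empty_mem ∅ W.alg.empty_mem (by simp)
  simpa using this

lemma meas {s : Set Y} (hs : s ∈ W.A) : MeasurableSet s := by
  have := MeasurableSpace.measurableSet_generateFrom hs
  rwa [← W.gen] at this

lemma pp {s t : Set Y} (hs : s ∈ W.A) (ht : t ∈ W.A) (f g : H) :
    inner ℝ (W.p s f) (W.p t g) = inner ℝ (W.p (s ∩ t) f) g := by
  rw [← W.sa t ht, W.inter t ht s hs, inter_comm]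

lemma pnorm {s : Set Y} (hs : s ∈ W.A) (f : H) : ‖W.p s f‖^2 = inner ℝ (W.p s f) f := by
  rw [← real_inner_self_eq_norm_sq, W.pp hs hs, inter_self]

lemma pnorm_le {s : Set Y} (hs : s ∈ W.A) (f : H) : ‖W.p s f‖ ≤ ‖f‖ := by
  have h1 := W.pnorm hs f
  have h2 := real_inner_le_norm (W.p s f) f
  by_contra! h
  nlinarith [norm_nonneg f]

/-- content of a vector -/
def cont (f : H) : AddContent ℝ≥0∞ W.A :=
  W.alg.isSetRing.addContent_of_union (fun s => ENNReal.ofReal (‖W.p s f‖^2)) (by simp [W.empty]) (by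
    intro s t hs ht hd
    rw [← ENNReal.ofReal_add (by positivity) (by positivity)]
    congr 1
    rw [W.pnorm hs, W.pnorm ht, W.pnorm (W.alg.union_mem hs ht), W.union s hs t ht hd]
    simp [inner_add_left])

lemma cont_sub (f : H) : (W.cont f).IsSigmaSubadditive := by
  intro s hs hu
  have hc : IsCompact (⋃ i, s i) := (W.clopen _ hu).isClosed.isCompact
  obtain ⟨t, ht⟩ := hc.elim_finite_subcover s (fun i => (W.clopen _ (hs i)).isOpen) le_rfl
  have h1 := addContent_mono (m := W.cont f) W.alg.isSetRing.isSetSemiring hu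
    (W.alg.isSetRing.biUnion_mem t (fun i _ => hs i)) ht
  refine h1.trans ((addContent_biUnion_le W.alg.isSetRing fun i _ => hs i).trans ?_)
  exact ENNReal.sum_le_tsum t

/-- spectral measure of a vector -/
def mu (f : H) : Measure Y := (W.cont f).measure W.alg.isSetRing.isSetSemiring W.gen.le (W.cont_sub f)

lemma mu_apply (f : H) {s : Set Y} (hs : s ∈ W.A) : W.mu f s = ENNReal.ofReal (‖W.p s f‖^2) :=
  AddContent.measure_eq _ _ W.gen _ hs

instance (f : H) : IsFiniteMeasure (W.mu f) := ⟨by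
  rw [W.mu_apply f W.alg.univ_mem]; exact ENNReal.ofReal_lt_top⟩

lemma mu_real (f : H) {s : Set Y} (hs : s ∈ W.A) : (W.mu f).real s = inner ℝ (W.p s f) f := by
  rw [Measure.real, W.mu_apply f hs, ENNReal.toReal_ofReal (by positivity), W.pnorm hs]

variable (ν : Measure Y) [IsFiniteMeasure ν]

/-- indicator in L² -/
def ind (s : Set Y) : Lp ℝ 2 ν := toL ν (s.indicator fun _ => 1)

lemma memLp_ind {s : Set Y} (hs : MeasurableSet s) : MemLp (s.indicator fun _ => (1:ℝ)) 2 ν :=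
  (memLp_const 1).indicator hs

lemma ind_ae {s : Set Y} (hs : MeasurableSet s) : ind ν s =ᵐ[ν] s.indicator fun _ => 1 :=
  toL_ae ν (memLp_ind ν hs)

/-- the simple-function map into `L²` -/
def eM : (W.A →₀ ℝ) →ₗ[ℝ] Lp ℝ 2 ν := Finsupp.linearCombination ℝ (fun s : W.A => ind ν s.1)

/-- the simple-function map into `H` -/
def gM (f : H) : (W.A →₀ ℝ) →ₗ[ℝ] H := Finsupp.linearCombination ℝ (fun s : W.A => W.p s.1 f)

lemma eM_ae (x : W.A →₀ ℝ) : eM W ν x =ᵐ[ν] fun κ => ∑ s ∈ x.support, x s * s.1.indicator (fun _ => (1:ℝ)) κ := by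
  unfold eM
  rw [Finsupp.linearCombination_apply, Finsupp.sum]
  have h1 : ∀ᵐ κ ∂ν, ∀ s ∈ x.support, (ind ν s.1 : Y → ℝ) κ = s.1.indicator (fun _ => 1) κ := by
    rw [Filter.eventually_all_finset]
    exact fun s _ => ind_ae ν (W.meas s.2)
  have h2 : ∀ᵐ κ ∂ν, ∀ s ∈ x.support, ((x s • ind ν s.1 : Lp ℝ 2 ν) : Y → ℝ) κ = x s * (ind ν s.1 : Y → ℝ) κ := by
    rw [Filter.eventually_all_finset]
    intro s _
    filter_upwards [Lp.coeFn_smul (x s) (ind ν s.1)] with κ h using h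
  filter_upwards [h1, h2, Lp_sum_ae ν x.support (fun s => x s • ind ν s.1)] with κ h1 h2 h3
  rw [h3]
  exact Finset.sum_congr rfl fun s hs => by rw [h2 s hs, h1 s hs]

lemma gM_norm (f : H) (hf : W.mu f ≤ ν) (x : W.A →₀ ℝ) : ‖gM W f x‖ ≤ 1 * ‖eM W ν x‖ := by
  rw [one_mul]
  refine le_of_sq_le_sq ?_ (norm_nonneg _)
  have h1 : ‖eM W ν x‖^2 = ∫ κ, (∑ s ∈ x.support, x s * s.1.indicator (fun _ => (1:ℝ)) κ)^2 ∂ν := by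
    rw [← real_inner_self_eq_norm_sq, inner_eq']
    refine integral_congr_ae ?_
    filter_upwards [eM_ae W ν x] with κ h
    rw [h]; ring
  have hitg : ∀ s t : W.A, Integrable (fun κ => (x s * x t) * (s.1 ∩ t.1).indicator (fun _ => (1:ℝ)) κ) ν :=
    fun s t => ((integrable_const _).indicator ((W.meas s.2).inter (W.meas t.2))).const_mul _
  have hsq : ∀ κ, (∑ s ∈ x.support, x s * s.1.indicator (fun _ => (1:ℝ)) κ)^2 =
      ∑ s ∈ x.support, ∑ t ∈ x.support, (x s * x t) * (s.1 ∩ t.1).indicator (fun _ => (1:ℝ)) κ := by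
    intro κ
    rw [sq, Finset.sum_mul_sum]
    refine Finset.sum_congr rfl fun s _ => Finset.sum_congr rfl fun t _ => ?_
    by_cases h1 : κ ∈ s.1 <;> by_cases h2 : κ ∈ t.1 <;> simp [h1, h2]
  have h2 : ‖gM W f x‖^2 = ∫ κ, (∑ s ∈ x.support, x s * s.1.indicator (fun _ => (1:ℝ)) κ)^2 ∂(W.mu f) := by
    simp only [hsq]
    rw [integral_finset_sum]
    · rw [← real_inner_self_eq_norm_sq]
      unfold gM
      rw [Finsupp.linearCombination_apply, Finsupp.sum, sum_inner]
      refine Finset.sum_congr rfl fun s _ => ?_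
      rw [integral_finset_sum, inner_sum]
      · refine Finset.sum_congr rfl fun t _ => ?_
        rw [integral_const_mul, integral_indicator_const _ ((W.meas s.2).inter (W.meas t.2)),
          W.mu_real f (W.alg.inter_mem s.2 t.2), real_inner_smul_left, real_inner_smul_right, W.pp s.2 t.2]
        simp; ring
      · intro t _
        exact (hitg s t).mono_measure hf
    · intro s _
      exact integrable_finset_sum _ fun t _ => (hitg s t).mono_measure hf
  rw [h1, h2]
  refine integral_mono_measure hf (ae_of_all _ fun κ => sq_nonneg _) ?_
  simp only [hsq]
  exact integrable_finset_sum _ fun s _ => integrable_finset_sum _ fun t _ => hitg s t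

lemma dense : ν.MeasureDense W.A := Measure.MeasureDense.of_generateFrom_isSetAlgebra_finite (μ := ν) W.alg W.gen

lemma eM_dense : DenseRange (eM W ν) := by
  -- orthogonal complement is trivial
  have key : ((LinearMap.range (eM W ν)).topologicalClosure) = ⊤ := by
    rw [← Submodule.orthogonal_orthogonal_eq_closure, Submodule.orthogonal_eq_top_iff]
    rw [Submodule.eq_bot_iff]
    intro g hg
    have h0 : ∀ s ∈ W.A, ∫ κ in s, g κ ∂ν = 0 := by
      intro s hs
      have h1 := (Submodule.mem_orthogonal _ _).1 hg (ind ν s) ⟨Finsupp.single ⟨s, hs⟩ 1, by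
        simp [eM]⟩
      rw [inner_eq' ν] at h1
      rw [← h1, ← integral_indicator (W.meas hs)]
      refine integral_congr_ae ?_
      filter_upwards [ind_ae ν (W.meas hs)] with κ h
      rw [h]; by_cases hk : κ ∈ s <;> simp [hk]
    have hgi : Integrable g ν := (Lp.memLp g).integrable (by norm_num)
    have h1 : ∀ s, MeasurableSet s → ∫ κ in s, g κ ∂ν = 0 := by
      intro s hs
      induction s, hs using MeasurableSpace.induction_on_inter W.gen
        (fun a ha b hb _ => W.alg.inter_mem ha hb) with
      | empty => simp
      | basic t ht => exact h0 t ht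
      | compl t ht ih =>
        have := integral_add_compl ht hgi
        have h2 := h0 univ W.alg.univ_mem
        rw [setIntegral_univ] at h2
        linarith
      | iUnion f hd hf ih =>
        rw [integral_iUnion hf hd hgi.integrableOn]
        simp [ih]
    have h2 := hgi.ae_eq_zero_of_forall_setIntegral_eq_zero (fun s hs _ => h1 s hs)
    exact Lp.eq_zero_iff_ae_eq_zero.2 h2
  rw [DenseRange, dense_iff_closure_eq]
  have := congrArg (fun s : Submodule ℝ _ => (s : Set (Lp ℝ 2 ν))) key
  simpa [LinearMap.coe_range] using this

lemma ae_eq_of_A {φ ψ : Y → ℝ} (hφ : Integrable φ ν) (hψ : Integrable ψ ν)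
    (h0 : ∀ s ∈ W.A, ∫ κ in s, φ κ ∂ν = ∫ κ in s, ψ κ ∂ν) : φ =ᵐ[ν] ψ := by
  have h1 : ∀ s, MeasurableSet s → ∫ κ in s, φ κ ∂ν = ∫ κ in s, ψ κ ∂ν := by
    intro s hs
    induction s, hs using MeasurableSpace.induction_on_inter W.gen
      (fun a ha b hb _ => W.alg.inter_mem ha hb) with
    | empty => simp
    | basic t ht => exact h0 t ht
    | compl t ht ih =>
      have e1 := integral_add_compl ht hφ
      have e2 := integral_add_compl ht hψ
      have h2 := h0 univ W.alg.univ_mem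
      rw [setIntegral_univ, setIntegral_univ] at h2
      linarith
    | iUnion f hd hf ih =>
      rw [integral_iUnion hf hd hφ.integrableOn, integral_iUnion hf hd hψ.integrableOn]
      simp [ih]
  exact hφ.ae_eq_of_forall_setIntegral_eq _ _ hψ (fun s hs _ => h1 s hs)

/-- integration of scalar functions against the vector measure of `f` -/
def J (f : H) : Lp ℝ 2 ν →L[ℝ] H := (gM W f).extendOfNorm (eM W ν)

lemma J_ind {f : H} (hf : W.mu f ≤ ν) {s : Set Y} (hs : s ∈ W.A) : W.J ν f (ind ν s) = W.p s f := by
  have := LinearMap.extendOfNorm_eq (f := gM W f) (e := eM W ν) (eM_dense W ν) ⟨1, gM_norm W ν f hf⟩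
    (Finsupp.single ⟨s, hs⟩ 1)
  have e1 : eM W ν (Finsupp.single ⟨s, hs⟩ 1) = ind ν s := by simp [eM]
  have e2 : gM W f (Finsupp.single ⟨s, hs⟩ 1) = W.p s f := by simp [gM]
  rw [e1, e2] at this; exact this

lemma J_norm {f : H} (hf : W.mu f ≤ ν) (φ : Lp ℝ 2 ν) : ‖W.J ν f φ‖ ≤ ‖φ‖ := by
  have := LinearMap.norm_extendOfNorm_apply_le (f := gM W f) (e := eM W ν) (eM_dense W ν) 1 (gM_norm W ν f hf) φ
  rwa [one_mul] at this

/-- the density of `⟨p(A) f, v⟩` -/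
def D (f : H) : H →L[ℝ] Lp ℝ 2 ν := ContinuousLinearMap.adjoint (W.J ν f)

lemma J_inner (f v : H) (φ : Lp ℝ 2 ν) : inner ℝ (W.J ν f φ) v = ∫ κ, φ κ * W.D ν f v κ ∂ν := by
  rw [← inner_eq', D, ContinuousLinearMap.adjoint_inner_right]

lemma L2int (φ : Lp ℝ 2 ν) : Integrable φ ν := (Lp.memLp φ).integrable (by norm_num)

lemma L2mul (φ ψ : Lp ℝ 2 ν) : Integrable (fun κ => φ κ * ψ κ) ν := (Lp.memLp φ).integrable_mul (Lp.memLp ψ)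

lemma D_set {f : H} (hf : W.mu f ≤ ν) (v : H) {s : Set Y} (hs : s ∈ W.A) :
    ∫ κ in s, W.D ν f v κ ∂ν = inner ℝ (W.p s f) v := by
  rw [← W.J_ind ν hf hs, J_inner, ← integral_indicator (W.meas hs)]
  refine integral_congr_ae ?_
  filter_upwards [ind_ae ν (W.meas hs)] with κ h
  rw [h]; by_cases hk : κ ∈ s <;> simp [hk]

lemma D_p {f : H} (hf : W.mu f ≤ ν) (v : H) {s : Set Y} (hs : s ∈ W.A) :
    W.D ν f (W.p s v) =ᵐ[ν] s.indicator (W.D ν f v) := by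
  refine W.ae_eq_of_A ν (L2int ν _) ((L2int ν _).indicator (W.meas hs)) fun t ht => ?_
  rw [W.D_set ν hf _ ht, setIntegral_indicator (W.meas hs), W.D_set ν hf _ (W.alg.inter_mem ht hs), W.pp ht hs]

lemma D_symm {f g : H} (hf : W.mu f ≤ ν) (hg : W.mu g ≤ ν) : W.D ν f g =ᵐ[ν] W.D ν g f := by
  refine W.ae_eq_of_A ν (L2int ν _) (L2int ν _) fun t ht => ?_
  rw [W.D_set ν hf _ ht, W.D_set ν hg _ ht, W.sa t ht, real_inner_comm]

lemma D_J {f g : H} (hf : W.mu f ≤ ν) (hg : W.mu g ≤ ν) (K : Lp ℝ 2 ν) :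
    W.D ν f (W.J ν g K) =ᵐ[ν] fun κ => K κ * W.D ν f g κ := by
  refine W.ae_eq_of_A ν (L2int ν _) (L2mul ν _ _) fun t ht => ?_
  rw [W.D_set ν hf _ ht, real_inner_comm, J_inner, ← integral_indicator (W.meas ht)]
  refine integral_congr_ae ?_
  filter_upwards [W.D_p ν hg f ht, W.D_symm ν hf hg] with κ h1 h2
  rw [h1]; by_cases hk : κ ∈ t <;> simp [hk, h2]

lemma J_p {f : H} (hf : W.mu f ≤ ν) (K : Lp ℝ 2 ν) (v : H) {s : Set Y} (hs : s ∈ W.A) :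
    inner ℝ (W.p s (W.J ν f K)) v = ∫ κ in s, K κ * W.D ν f v κ ∂ν := by
  rw [W.sa s hs, J_inner, ← integral_indicator (W.meas hs)]
  refine integral_congr_ae ?_
  filter_upwards [W.D_p ν hf v hs] with κ h1
  rw [h1]; by_cases hk : κ ∈ s <;> simp [hk]

lemma p_univ_J {f : H} (hf : W.mu f ≤ ν) (K : Lp ℝ 2 ν) : W.p univ (W.J ν f K) = W.J ν f K := by
  refine ext_inner_right ℝ fun v => ?_
  rw [W.J_p ν hf K v W.alg.univ_mem, J_inner, setIntegral_univ]

end PM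
end MM

section PI
lemma spec {ι : Type*} [Fintype ι] [DecidableEq ι] (G : Matrix ι ι ℝ) (hG : G.transpose = G) :
    ∃ (U : Matrix ι ι ℝ) (d : ι → ℝ), U * U.transpose = 1 ∧ U.transpose * U = 1 ∧ G = U * Matrix.diagonal d * U.transpose := by
  have hH : G.IsHermitian := by rw [Matrix.IsHermitian, Matrix.conjTranspose_eq_transpose_of_trivial, hG]
  refine ⟨hH.eigenvectorUnitary, hH.eigenvalues, ?_, ?_, ?_⟩
  · have := Unitary.mul_star_self_of_mem hH.eigenvectorUnitary.2
    rwa [Matrix.star_eq_conjTranspose, Matrix.conjTranspose_eq_transpose_of_trivial] at this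
  · have := Unitary.star_mul_self_of_mem hH.eigenvectorUnitary.2
    rwa [Matrix.star_eq_conjTranspose, Matrix.conjTranspose_eq_transpose_of_trivial] at this
  · have := hH.spectral_theorem
    rw [Unitary.conjStarAlgAut_apply, Matrix.star_eq_conjTranspose, Matrix.conjTranspose_eq_transpose_of_trivial] at this
    exact this

lemma exists_pinv {ι : Type*} [Fintype ι] [DecidableEq ι] (G : Matrix ι ι ℝ) (hG : G.transpose = G) :
    ∃ Gp : Matrix ι ι ℝ, Gp.transpose = Gp ∧ G * Gp = Gp * G ∧ G * (1 - G * Gp) = 0 ∧ Gp * (1 - G * Gp) = 0 ∧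
      Tendsto (fun n : ℕ => (G * G + (1/((n:ℝ)+1)) • (1 : Matrix ι ι ℝ))⁻¹ * G) atTop (𝓝 Gp) := by
  obtain ⟨U, d, h1, h2, rfl⟩ := spec G hG
  have conj : ∀ a b : ι → ℝ, (U * Matrix.diagonal a * U.transpose) * (U * Matrix.diagonal b * U.transpose) =
      U * Matrix.diagonal (fun i => a i * b i) * U.transpose := by
    intro a b
    rw [← Matrix.diagonal_mul_diagonal]
    calc _ = U * Matrix.diagonal a * (U.transpose * U) * Matrix.diagonal b * U.transpose := by
          simp only [Matrix.mul_assoc]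
      _ = _ := by rw [h2]; simp only [Matrix.mul_assoc, Matrix.mul_one, Matrix.one_mul]
  have one : (1 : Matrix ι ι ℝ) = U * Matrix.diagonal (fun _ => 1) * U.transpose := by
    simp [h1]
  have sub : ∀ a b : ι → ℝ, (U * Matrix.diagonal a * U.transpose) - (U * Matrix.diagonal b * U.transpose) =
      U * Matrix.diagonal (fun i => a i - b i) * U.transpose := by
    intro a b
    rw [← Matrix.diagonal_sub, Matrix.mul_sub, Matrix.sub_mul]
  have add : ∀ a b : ι → ℝ, (U * Matrix.diagonal a * U.transpose) + (U * Matrix.diagonal b * U.transpose) =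
      U * Matrix.diagonal (fun i => a i + b i) * U.transpose := by
    intro a b
    rw [← Matrix.diagonal_add, Matrix.mul_add, Matrix.add_mul]
  have smul : ∀ (c : ℝ) (a : ι → ℝ), c • (U * Matrix.diagonal a * U.transpose) =
      U * Matrix.diagonal (fun i => c * a i) * U.transpose := by
    intro c a
    rw [show (fun i => c * a i) = c • a from rfl, Matrix.diagonal_smul, Matrix.mul_smul, Matrix.smul_mul]
  have z : U * Matrix.diagonal (fun _ => (0:ℝ)) * U.transpose = 0 := by simp
  refine ⟨U * Matrix.diagonal (fun i => (d i)⁻¹) * U.transpose, ?_, ?_, ?_, ?_, ?_⟩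
  · simp only [Matrix.transpose_mul, Matrix.transpose_transpose, Matrix.diagonal_transpose, Matrix.mul_assoc]
  · rw [conj, conj]; simp only [mul_comm]
  · rw [conj, one, sub, conj, ← z]
    congr 3; ext i; by_cases h : d i = 0 <;> simp [h]
  · rw [conj, one, sub, conj, ← z]
    congr 3; ext i; by_cases h : d i = 0 <;> simp [h]
  · have key : ∀ n : ℕ, (U * Matrix.diagonal d * U.transpose * (U * Matrix.diagonal d * U.transpose) + (1/((n:ℝ)+1)) • (1 : Matrix ι ι ℝ))⁻¹ *
        (U * Matrix.diagonal d * U.transpose) = U * Matrix.diagonal (fun i => (d i * d i + 1/((n:ℝ)+1))⁻¹ * d i) * U.transpose := by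
      intro n
      have : (U * Matrix.diagonal d * U.transpose * (U * Matrix.diagonal d * U.transpose) + (1/((n:ℝ)+1)) • (1 : Matrix ι ι ℝ))⁻¹ =
          U * Matrix.diagonal (fun i => (d i * d i + 1/((n:ℝ)+1))⁻¹) * U.transpose := by
        apply Matrix.inv_eq_right_inv
        rw [conj, one, smul, add, conj]
        congr 3; ext i
        have : d i * d i + 1/((n:ℝ)+1) ≠ 0 := (add_pos_of_nonneg_of_pos (mul_self_nonneg _) (by positivity)).ne'
        rw [mul_one, mul_inv_cancel₀ this]
      rw [this, conj]
    simp only [key]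
    have hcont : Continuous fun a : ι → ℝ => U * Matrix.diagonal a * U.transpose := by fun_prop
    refine (hcont.tendsto _).comp (tendsto_pi_nhds.2 fun i => ?_)
    by_cases h : d i = 0
    · simp [h]
    · have h0 : Tendsto (fun n : ℕ => d i * d i + 1/((n:ℝ)+1)) atTop (𝓝 (d i * d i + 0)) :=
        tendsto_const_nhds.add tendsto_one_div_add_atTop_nhds_zero_nat
      have := (h0.inv₀ (by simpa using h)).mul_const (d i)
      convert this using 2
      field_simp; simp

lemma pinv_meas {Y ι : Type*} [MeasurableSpace Y] [Fintype ι] [DecidableEq ι] (G : Y → Matrix ι ι ℝ)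
    (hG : ∀ κ, (G κ).transpose = G κ) (hm : ∀ i j, Measurable fun κ => G κ i j) :
    ∃ Gp : Y → Matrix ι ι ℝ, (∀ i j, Measurable fun κ => Gp κ i j) ∧ ∀ κ, (Gp κ).transpose = Gp κ ∧
      G κ * Gp κ = Gp κ * G κ ∧ G κ * (1 - G κ * Gp κ) = 0 ∧ Gp κ * (1 - G κ * Gp κ) = 0 := by
  choose Gp h1 h2 h3 h4 h5 using fun κ => exists_pinv (G κ) (hG κ)
  refine ⟨Gp, fun i j => ?_, fun κ => ⟨h1 κ, h2 κ, h3 κ, h4 κ⟩⟩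
  have hGm : Measurable fun κ => (fun i j => G κ i j : ι → ι → ℝ) :=
    measurable_pi_lambda _ fun i => measurable_pi_lambda _ fun j => hm i j
  refine measurable_of_tendsto_metrizable (f := fun (n : ℕ) κ =>
    ((G κ * G κ + (1/((n:ℝ)+1)) • (1 : Matrix ι ι ℝ))⁻¹ * G κ) i j) (fun n => ?_) ?_
  · have e : ∀ κ, ((G κ * G κ + (1/((n:ℝ)+1)) • (1 : Matrix ι ι ℝ))⁻¹ * G κ) i j =
        (G κ * G κ + (1/((n:ℝ)+1)) • (1 : Matrix ι ι ℝ)).det⁻¹ *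
        ((G κ * G κ + (1/((n:ℝ)+1)) • (1 : Matrix ι ι ℝ)).adjugate * G κ) i j := by
      intro κ
      rw [Matrix.inv_def, Ring.inverse_eq_inv', Matrix.smul_mul, Matrix.smul_apply, smul_eq_mul]
    simp only [e]
    have c1 : Continuous fun A : ι → ι → ℝ => (Matrix.of A * Matrix.of A + (1/((n:ℝ)+1)) • (1 : Matrix ι ι ℝ)) := by
      have : Continuous fun A : ι → ι → ℝ => (Matrix.of A : Matrix ι ι ℝ) := continuous_id
      exact (this.matrix_mul this).add continuous_const
    have c2 : Continuous fun A : ι → ι → ℝ => (Matrix.of A * Matrix.of A + (1/((n:ℝ)+1)) • (1 : Matrix ι ι ℝ)).det :=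
      c1.matrix_det
    have c3 : Continuous fun A : ι → ι → ℝ =>
        ((Matrix.of A * Matrix.of A + (1/((n:ℝ)+1)) • (1 : Matrix ι ι ℝ)).adjugate * Matrix.of A) i j := by
      have : Continuous fun A : ι → ι → ℝ => (Matrix.of A : Matrix ι ι ℝ) := continuous_id
      exact (c1.matrix_adjugate.matrix_mul this).matrix_elem i j
    exact ((c2.measurable.comp hGm).inv).mul (c3.measurable.comp hGm)
  · rw [tendsto_pi_nhds]
    intro κ
    exact ((continuous_id.matrix_elem i j).tendsto _).comp (h5 κ)

lemma proj_entry_le {ι : Type*} [Fintype ι] [DecidableEq ι] (Q : Matrix ι ι ℝ) (hT : Q.transpose = Q) (hi : Q * Q = Q)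
    (i j : ι) : |Q i j| ≤ 1 := by
  have h : ∀ i, Q i i = ∑ j, Q i j ^ 2 := by
    intro i
    conv_lhs => rw [← hi]
    rw [Matrix.mul_apply]
    refine Finset.sum_congr rfl fun j _ => ?_
    have : Q j i = Q i j := by
      conv_lhs => rw [← hT]
      rfl
    rw [this]; ring
  have h2 : ∀ j, Q i j ^ 2 ≤ Q i i := by
    intro j; rw [h i]
    exact Finset.single_le_sum (f := fun j => Q i j ^ 2) (fun _ _ => sq_nonneg _) (Finset.mem_univ j)
  have h3 : Q i i ≤ 1 := by nlinarith [h2 i]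
  exact abs_le_one_iff_mul_self_le_one.2 (by nlinarith [h2 j])

end PI

section GD
variable {Y H ι : Type*} [TopologicalSpace Y] [CompactSpace Y] [MeasurableSpace Y]
    [NormedAddCommGroup H] [InnerProductSpace ℝ H] [CompleteSpace H] [Fintype ι] [DecidableEq ι]

/-- Gram matrix data -/
structure GData (W : PM Y H) (ν : Measure Y) [IsFiniteMeasure ν] (w : ι → H) where
  G : Y → Matrix ι ι ℝ
  Gp : Y → Matrix ι ι ℝ
  Pi : Y → Matrix ι ι ℝ
  mG : ∀ i j, Measurable fun κ => G κ i j
  mGp : ∀ i j, Measurable fun κ => Gp κ i j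
  mPi : ∀ i j, Measurable fun κ => Pi κ i j
  Geq : ∀ i l, (fun κ => G κ i l) =ᵐ[ν] W.D ν (w i) (w l)
  PiDef : ∀ κ, Pi κ = 1 - G κ * Gp κ
  PiT : ∀ κ, (Pi κ).transpose = Pi κ
  GT : ∀ κ, (G κ).transpose = G κ
  GPi : ∀ κ, G κ * Pi κ = 0
  PiGp : ∀ κ, Pi κ * Gp κ = 0
  PiPi : ∀ κ, Pi κ * Pi κ = Pi κ
  ker : ∀ v, ∀ᵐ κ ∂ν, ∀ m, ∑ l, W.D ν (w l) v κ * Pi κ l m = 0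

lemma exists_GData (W : PM Y H) (ν : Measure Y) [IsFiniteMeasure ν] (w : ι → H) (hw : ∀ l, W.mu (w l) ≤ ν) :
    Nonempty (GData W ν w) := by
  set G : Y → Matrix ι ι ℝ := fun κ => Matrix.of fun i l =>
    (W.D ν (w i) (w l) κ + W.D ν (w l) (w i) κ) / 2 with hGdef
  have mD : ∀ i l, Measurable fun κ => W.D ν (w i) (w l) κ := fun i l =>
    (Lp.stronglyMeasurable (W.D ν (w i) (w l))).measurable
  have mG : ∀ i j, Measurable fun κ => G κ i j := fun i j => ((mD i j).add (mD j i)).div_const 2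
  have GT : ∀ κ, (G κ).transpose = G κ := by
    intro κ; ext i j; simp [hGdef, add_comm]
  obtain ⟨Gp, mGp, hGp⟩ := pinv_meas G GT mG
  have Geq : ∀ i l, (fun κ => G κ i l) =ᵐ[ν] W.D ν (w i) (w l) := by
    intro i l
    filter_upwards [W.D_symm ν (hw i) (hw l)] with κ h
    simp only [hGdef, Matrix.of_apply]; rw [h]; ring
  set Pi : Y → Matrix ι ι ℝ := fun κ => 1 - G κ * Gp κ with hPi
  have mPi : ∀ i j, Measurable fun κ => Pi κ i j := by
    intro i j
    simp only [hPi, Matrix.sub_apply, Matrix.mul_apply]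
    exact measurable_const.sub (Finset.measurable_sum _ fun l _ => (mG i l).mul (mGp l j))
  have PiT : ∀ κ, (Pi κ).transpose = Pi κ := by
    intro κ
    obtain ⟨h1, h2, -, -⟩ := hGp κ
    simp only [hPi, Matrix.transpose_sub, Matrix.transpose_one, Matrix.transpose_mul, h1, GT κ, h2]
  have GPi : ∀ κ, G κ * Pi κ = 0 := fun κ => (hGp κ).2.2.1
  have GpPi : ∀ κ, Gp κ * Pi κ = 0 := fun κ => (hGp κ).2.2.2
  have PiGp : ∀ κ, Pi κ * Gp κ = 0 := by
    intro κ
    have := congrArg Matrix.transpose (GpPi κ)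
    rwa [Matrix.transpose_mul, PiT, (hGp κ).1, Matrix.transpose_zero] at this
  have PiPi : ∀ κ, Pi κ * Pi κ = Pi κ := by
    intro κ
    conv_lhs => enter [1]; rw [hPi]
    rw [Matrix.sub_mul, Matrix.mul_assoc, GpPi, Matrix.mul_zero, sub_zero, Matrix.one_mul]
  refine ⟨⟨G, Gp, Pi, mG, mGp, mPi, Geq, fun _ => rfl, PiT, GT, GPi, PiGp, PiPi, fun v => ?_⟩⟩
  rw [ae_all_iff]
  intro m
  have mem : ∀ (s : Set Y), MeasurableSet s → ∀ l, MemLp (s.indicator fun κ => Pi κ l m) 2 ν := by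
    intro s hs l
    refine MemLp.of_bound ((mPi l m).indicator hs).aestronglyMeasurable 1 (ae_of_all _ fun κ => ?_)
    have := proj_entry_le (Pi κ) (PiT κ) (PiPi κ) l m
    by_cases hk : κ ∈ s <;> simp [hk, this]
  have hitg : ∀ l, Integrable (fun κ => W.D ν (w l) v κ * Pi κ l m) ν := by
    intro l
    refine (PM.L2int ν _).mul_bdd (c := 1) (mPi l m).aestronglyMeasurable (ae_of_all _ fun κ => ?_)
    exact proj_entry_le (Pi κ) (PiT κ) (PiPi κ) l m
  refine W.ae_eq_of_A ν (integrable_finset_sum _ fun l _ => hitg l) (integrable_zero _ _ _) fun s hs => ?_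
  set K : ι → Lp ℝ 2 ν := fun l => toL ν (s.indicator fun κ => Pi κ l m) with hK
  have Kae : ∀ l, K l =ᵐ[ν] s.indicator fun κ => Pi κ l m := fun l => toL_ae ν (mem s (W.meas hs) l)
  have hz : ∑ l, W.J ν (w l) (K l) = 0 := by
    rw [← norm_eq_zero, ← sq_eq_zero_iff, ← real_inner_self_eq_norm_sq, sum_inner]
    have e1 : ∀ i, inner ℝ (W.J ν (w i) (K i)) (∑ l, W.J ν (w l) (K l)) = 0 := by
      intro i
      rw [inner_sum]
      have e2 : ∀ l, inner ℝ (W.J ν (w i) (K i)) (W.J ν (w l) (K l)) = ∫ κ, K i κ * (K l κ * G κ i l) ∂ν := by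
        intro l
        rw [W.J_inner]
        refine integral_congr_ae ?_
        filter_upwards [W.D_J ν (hw i) (hw l) (K l), Geq i l] with κ h1 h2
        rw [h1, h2]
      simp only [e2]
      rw [← integral_finset_sum]
      · refine integral_eq_zero_of_ae ?_
        have : ∀ᵐ κ ∂ν, ∀ l, K l κ = s.indicator (fun κ => Pi κ l m) κ := ae_all_iff.2 Kae
        filter_upwards [this] with κ h
        rw [← Finset.mul_sum]
        have h0 : ∑ l, K l κ * G κ i l = 0 := by
          by_cases hk : κ ∈ s
          · have := congrFun (congrFun (GPi κ) i) m
            rw [Matrix.mul_apply] at this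
            simp only [h, indicator_of_mem hk]
            simpa [mul_comm] using this
          · simp [h, hk]
        rw [h0, mul_zero]; rfl
      · intro l _
        refine (PM.L2mul ν (K i) (W.D ν (w i) (W.J ν (w l) (K l)))).congr ?_
        filter_upwards [W.D_J ν (hw i) (hw l) (K l), Geq i l] with κ h1 h2
        rw [h1, h2]
    simp [e1]
  have h1 : inner ℝ (∑ l, W.J ν (w l) (K l)) v = 0 := by rw [hz, inner_zero_left]
  rw [sum_inner] at h1
  simp only [W.J_inner] at h1
  rw [integral_finset_sum _ fun l _ => (hitg l).integrableOn]
  simp only [integral_zero]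
  rw [← h1]
  refine Finset.sum_congr rfl fun l _ => ?_
  rw [← integral_indicator (W.meas hs)]
  refine integral_congr_ae ?_
  filter_upwards [Kae l] with κ h
  rw [h]; by_cases hk : κ ∈ s <;> simp [hk, mul_comm]

end GD

section N0
lemma tendsto_setIntegral_of_symmDiff {Y : Type*} [MeasurableSpace Y] {ν : Measure Y} [IsFiniteMeasure ν] {φ : Y → ℝ}
    (hi : Integrable φ ν) {s B : Set Y} {A : ℕ → Set Y} (hs : MeasurableSet s) (hA : ∀ n, MeasurableSet (A n))
    (hB : MeasurableSet B) (hlim : Tendsto (fun n => ν.real (symmDiff B (A n))) atTop (𝓝 0)) :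
    Tendsto (fun n => ∫ κ in s ∩ A n, φ κ ∂ν) atTop (𝓝 (∫ κ in s ∩ B, φ κ ∂ν)) := by
  have key : ∀ C : ℕ → Set Y, (∀ n, C n ⊆ symmDiff B (A n)) →
      Tendsto (fun n => ∫ κ in C n, φ κ ∂ν) atTop (𝓝 0) := by
    intro C hC
    refine hi.tendsto_setIntegral_nhds_zero ?_
    have h1 : Tendsto (fun n => ν (symmDiff B (A n))) atTop (𝓝 0) := by
      have := ENNReal.tendsto_ofReal hlim
      simpa [ofReal_measureReal] using this
    exact tendsto_of_tendsto_of_tendsto_of_le_of_le tendsto_const_nhds h1 (fun _ => zero_le) fun n => measure_mono (hC n)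
  have h1 := key (fun n => (s ∩ A n) \ (s ∩ B)) (fun n κ hκ => by
    simp only [mem_symmDiff, mem_diff, mem_inter_iff] at *; tauto)
  have h2 := key (fun n => (s ∩ B) \ (s ∩ A n)) (fun n κ hκ => by
    simp only [mem_symmDiff, mem_diff, mem_inter_iff] at *; tauto)
  have h3 := (h1.sub h2).add_const (∫ κ in s ∩ B, φ κ ∂ν)
  simp only [sub_zero, zero_add] at h3
  refine h3.congr fun n => ?_
  have e1 := setIntegral_union (μ := ν) (f := φ) (s := (s ∩ A n) \ (s ∩ B)) (t := (s ∩ A n) ∩ (s ∩ B)) disjoint_sdiff_inter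
    ((hs.inter (hA n)).inter (hs.inter hB)) hi.integrableOn hi.integrableOn
  have e2 := setIntegral_union (μ := ν) (f := φ) (s := (s ∩ B) \ (s ∩ A n)) (t := (s ∩ B) ∩ (s ∩ A n)) disjoint_sdiff_inter
    ((hs.inter hB).inter (hs.inter (hA n))) hi.integrableOn hi.integrableOn
  rw [diff_union_inter] at e1 e2
  rw [e1, e2, inter_comm (s ∩ B) (s ∩ A n)]; ring
end N0

section N1
variable {Y H ι : Type*} [TopologicalSpace Y] [CompactSpace Y] [MeasurableSpace Y]
    [NormedAddCommGroup H] [InnerProductSpace ℝ H] [CompleteSpace H] [Fintype ι] [DecidableEq ι]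

namespace GData
variable {W : PM Y H} {ν : Measure Y} [IsFiniteMeasure ν] {w : ι → H} (g : GData W ν w)

/-- local coefficients of `X` -/
def h (X : H) (κ : Y) : ι → ℝ := (g.Gp κ).mulVec fun l => W.D ν (w l) X κ

lemma h_meas (X : H) (l : ι) : Measurable fun κ => g.h X κ l := by
  simp only [h, Matrix.mulVec, dotProduct]
  exact Finset.measurable_sum _ fun i _ => (g.mGp l i).mul (Lp.stronglyMeasurable _).measurable

lemma Pi_h (X : H) (κ : Y) : (g.Pi κ).mulVec (g.h X κ) = 0 := by
  rw [h, Matrix.mulVec_mulVec, g.PiGp, Matrix.zero_mulVec]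

lemma G_h (X : H) : ∀ᵐ κ ∂ν, (g.G κ).mulVec (g.h X κ) = fun l => W.D ν (w l) X κ := by
  filter_upwards [g.ker X] with κ hk
  have h1 : g.G κ * g.Gp κ = 1 - g.Pi κ := by rw [g.PiDef]; abel
  rw [h, Matrix.mulVec_mulVec, h1, Matrix.sub_mulVec, Matrix.one_mulVec]
  have h2 : (g.Pi κ).mulVec (fun l => W.D ν (w l) X κ) = 0 := by
    ext m
    refine Eq.trans ?_ (hk m)
    simp only [Matrix.mulVec, dotProduct]
    refine Finset.sum_congr rfl fun l _ => ?_
    have : g.Pi κ m l = g.Pi κ l m := by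
      conv_lhs => rw [← g.PiT]
      rfl
    rw [this, mul_comm]
  rw [h2, sub_zero]

/-- truncated coefficients -/
def K (X : H) (B : Set Y) (l : ι) : Lp ℝ 2 ν := toL ν (B.indicator fun κ => g.h X κ l)

lemma K_ae (X : H) {B : Set Y} (hB : MeasurableSet B) {k : ℝ} (hk : ∀ κ ∈ B, ∀ l, |g.h X κ l| ≤ k) (l : ι) :
    g.K X B l =ᵐ[ν] B.indicator fun κ => g.h X κ l := by
  refine toL_ae ν (MemLp.of_bound ((g.h_meas X l).indicator hB).aestronglyMeasurable (max k 0) (ae_of_all _ fun κ => ?_))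
  by_cases hκ : κ ∈ B
  · simp only [indicator_of_mem hκ]; exact (hk κ hκ l).trans (le_max_left _ _)
  · simp [hκ]

/-- projected vector -/
def Yp (X : H) (B : Set Y) : H := ∑ l, W.J ν (w l) (g.K X B l)

lemma Yp_univ (hw : ∀ l, W.mu (w l) ≤ ν) (X : H) (B : Set Y) : W.p univ (g.Yp X B) = g.Yp X B := by
  unfold Yp
  rw [map_sum]
  exact Finset.sum_congr rfl fun l _ => W.p_univ_J ν (hw l) _

lemma Yp_inner (hw : ∀ l, W.mu (w l) ≤ ν) (X v : H) {B : Set Y} (hB : MeasurableSet B) {k : ℝ}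
    (hk : ∀ κ ∈ B, ∀ l, |g.h X κ l| ≤ k) {s : Set Y} (hs : s ∈ W.A) :
    inner ℝ (W.p s (g.Yp X B)) v = ∫ κ in s, (∑ l, B.indicator (fun κ => g.h X κ l) κ * W.D ν (w l) v κ) ∂ν := by
  unfold Yp
  rw [map_sum, sum_inner]
  simp only [W.J_p ν (hw _) _ v hs]
  rw [← integral_finset_sum _ fun l _ => (PM.L2mul ν _ _).integrableOn]
  refine integral_congr_ae (ae_restrict_of_ae ?_)
  have : ∀ᵐ κ ∂ν, ∀ l, g.K X B l κ = B.indicator (fun κ => g.h X κ l) κ := ae_all_iff.2 fun l => g.K_ae X hB hk l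
  filter_upwards [this] with κ h
  simp only [h]

lemma loc (hw : ∀ l, W.mu (w l) ≤ ν) (X : H)
    (hX : ∀ ε > 0, ∃ δ > 0, ∀ s ∈ W.A, ν.real s < δ → ‖W.p s X‖ < ε) {B : Set Y} (hB : MeasurableSet B) {k : ℝ}
    (hk : ∀ κ ∈ B, ∀ l, |g.h X κ l| ≤ k) :
    ∃ X' : H, W.p univ X' = X' ∧
      (∀ δ > 0, ∃ s ∈ W.A, ν.real (symmDiff B s) < δ ∧ ‖W.p s X - X'‖ < δ) ∧
      (∀ s ∈ W.A, ∀ l, inner ℝ (W.p s X') (w l) = inner ℝ (W.p s (g.Yp X B)) (w l)) := by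
  have hch : ∀ n : ℕ, ∃ t ∈ W.A, ν.real (symmDiff B t) < 1/((n:ℝ)+1) := by
    intro n
    obtain ⟨t, ht, h⟩ := (W.dense ν).approx B hB (measure_ne_top _ _) (1/((n:ℝ)+1)) (by positivity)
    exact ⟨t, ht, by rw [Measure.real]; exact ENNReal.toReal_lt_of_lt_ofReal h⟩
  choose A hA hAB using hch
  have hdiff : ∀ s ∈ W.A, ∀ t ∈ W.A, W.p s X - W.p t X = W.p (s \ t) X - W.p (t \ s) X := by
    intro s hs t ht
    have h1 := W.union (s \ t) (W.alg.sdiff_mem hs ht) (s ∩ t) (W.alg.inter_mem hs ht)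
      (disjoint_sdiff_inter)
    have h2 := W.union (t \ s) (W.alg.sdiff_mem ht hs) (t ∩ s) (W.alg.inter_mem ht hs)
      (disjoint_sdiff_inter)
    rw [diff_union_inter] at h1 h2
    rw [h1, h2, inter_comm t s]; simp
  have hcau : CauchySeq fun n => W.p (A n) X := by
    rw [Metric.cauchySeq_iff']
    intro ε hε
    obtain ⟨δ, hδ, h⟩ := hX (ε/2) (by positivity)
    obtain ⟨N, hN⟩ := exists_nat_one_div_lt (K := ℝ) (ε := δ/2) (by positivity)
    refine ⟨N, fun n hn => ?_⟩
    have hle : 1/((n:ℝ)+1) ≤ 1/((N:ℝ)+1) := by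
      apply one_div_le_one_div_of_le (by positivity)
      have : (N:ℝ) ≤ n := by exact_mod_cast hn
      linarith
    have key : ∀ s t : Set Y, ν.real (symmDiff B s) < δ/2 → ν.real (symmDiff B t) < δ/2 → ν.real (s \ t) < δ := by
      intro s t h1 h2
      have : s \ t ⊆ symmDiff B s ∪ symmDiff B t := by
        intro κ hκ
        simp only [mem_union, mem_symmDiff, mem_diff] at *
        by_cases κ ∈ B <;> tauto
      have h3 := measureReal_mono (μ := ν) this
      have h4 := measureReal_union_le (μ := ν) (symmDiff B s) (symmDiff B t)
      linarith
    have a1 : ν.real (symmDiff B (A n)) < δ/2 := (hAB n).trans_le (hle.trans hN.le)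
    have a2 : ν.real (symmDiff B (A N)) < δ/2 := (hAB N).trans_le hN.le
    rw [dist_eq_norm, hdiff _ (hA n) _ (hA N)]
    have e1 := h _ (W.alg.sdiff_mem (hA n) (hA N)) (key _ _ a1 a2)
    have e2 := h _ (W.alg.sdiff_mem (hA N) (hA n)) (key _ _ a2 a1)
    have := norm_sub_le (W.p (A n \ A N) X) (W.p (A N \ A n) X)
    linarith
  obtain ⟨X', hX'⟩ := cauchySeq_tendsto_of_complete hcau
  refine ⟨X', ?_, ?_, ?_⟩
  · have h1 := ((W.p univ).continuous.tendsto X').comp hX'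
    refine tendsto_nhds_unique h1 (hX'.congr fun n => ?_)
    simp only [Function.comp]
    rw [W.inter univ W.alg.univ_mem _ (hA n), univ_inter]
  · intro δ hδ
    obtain ⟨N, hN⟩ := exists_nat_one_div_lt (K := ℝ) hδ
    obtain ⟨N', hN'⟩ := (Metric.tendsto_atTop.1 hX') δ hδ
    refine ⟨A (max N N'), hA _, (hAB _).trans_le ?_, ?_⟩
    · refine le_trans ?_ hN.le
      apply one_div_le_one_div_of_le (by positivity)
      have : (N:ℝ) ≤ (max N N' : ℕ) := by exact_mod_cast le_max_left _ _
      linarith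
    · rw [← dist_eq_norm]; exact hN' _ (le_max_right _ _)
  · intro s hs l
    have hlim : Tendsto (fun n => inner ℝ (W.p s (W.p (A n) X)) (w l)) atTop (𝓝 (inner ℝ (W.p s X') (w l))) :=
      (((W.p s).continuous.tendsto X').comp hX').inner tendsto_const_nhds
    refine tendsto_nhds_unique hlim ?_
    have e1 : ∀ n, inner ℝ (W.p s (W.p (A n) X)) (w l) = ∫ κ in s ∩ A n, W.D ν (w l) X κ ∂ν := by
      intro n
      rw [W.inter s hs _ (hA n), W.D_set ν (hw l) X (W.alg.inter_mem hs (hA n)),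
        W.sa _ (W.alg.inter_mem hs (hA n)), real_inner_comm]
    have e2 : inner ℝ (W.p s (g.Yp X B)) (w l) = ∫ κ in s ∩ B, W.D ν (w l) X κ ∂ν := by
      rw [g.Yp_inner hw X (w l) hB hk hs, ← setIntegral_indicator hB]
      refine integral_congr_ae (ae_restrict_of_ae ?_)
      have : ∀ᵐ κ ∂ν, ∀ i, g.G κ i l = W.D ν (w i) (w l) κ := ae_all_iff.2 fun i => g.Geq i l
      filter_upwards [this, g.G_h X] with κ h1 h2
      by_cases hκ : κ ∈ B
      · simp only [indicator_of_mem hκ, ← h1]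
        rw [← congrFun h2 l]
        simp only [Matrix.mulVec, dotProduct]
        refine Finset.sum_congr rfl fun i _ => ?_
        have : g.G κ i l = g.G κ l i := by
          conv_lhs => rw [← g.GT]
          rfl
        rw [this, mul_comm]
      · simp [hκ]
    simp only [e1]; rw [e2]
    have hi : Integrable (W.D ν (w l) X) ν := PM.L2int ν _
    refine tendsto_setIntegral_of_symmDiff hi (W.meas hs) (fun n => W.meas (hA n)) hB ?_
    refine squeeze_zero (fun n => measureReal_nonneg) (fun n => (hAB n).le) tendsto_one_div_add_atTop_nhds_zero_nat

end GData
end N1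

section AP
variable {Y H ι : Type*} [TopologicalSpace Y] [CompactSpace Y] [MeasurableSpace Y]
    [NormedAddCommGroup H] [InnerProductSpace ℝ H] [CompleteSpace H] [Fintype ι] [DecidableEq ι]

lemma PM.ind_sub_norm (ν : Measure Y) [IsFiniteMeasure ν] {s t : Set Y} (hs : MeasurableSet s) (ht : MeasurableSet t) :
    ‖PM.ind ν s - PM.ind ν t‖^2 = ν.real (symmDiff s t) := by
  rw [← real_inner_self_eq_norm_sq, inner_eq', ← integral_indicator_one (hs.symmDiff ht)]
  refine integral_congr_ae ?_
  filter_upwards [Lp.coeFn_sub (PM.ind ν s) (PM.ind ν t), PM.ind_ae ν hs, PM.ind_ae ν ht] with κ h1 h2 h3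
  rw [h1, Pi.sub_apply, h2, h3]
  by_cases a : κ ∈ s <;> by_cases b : κ ∈ t <;> simp [a, b, mem_symmDiff]

lemma floor_sum (L : ℕ) (v : ℝ) (h1 : v ≤ L) :
    (∑ r ∈ Finset.range L, if ((r:ℝ)+1 ≤ v) then (1:ℝ) else 0) = (⌊v⌋₊ : ℝ) := by
  rw [Finset.sum_ite, Finset.sum_const_zero, add_zero, Finset.sum_const, nsmul_eq_mul, mul_one]
  congr 1
  have : (Finset.range L).filter (fun r : ℕ => (r:ℝ)+1 ≤ v) = Finset.range ⌊v⌋₊ := by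
    ext r
    simp only [Finset.mem_filter, Finset.mem_range]
    have e : ((r:ℝ)+1 ≤ v) ↔ r < ⌊v⌋₊ := by
      rw [← Nat.succ_le_iff, Nat.le_floor_iff' (Nat.succ_ne_zero r)]; push_cast; rfl
    rw [e]
    constructor
    · exact fun h => h.2
    · intro h
      refine ⟨lt_of_lt_of_le h ?_, h⟩
      exact_mod_cast Nat.floor_le_of_le h1
  rw [this, Finset.card_range]

lemma PM.approx_unit (W : PM Y H) (ν : Measure Y) [IsFiniteMeasure ν] (φ : Lp ℝ 2 ν) {k : ℝ} (hk : 0 < k)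
    (hφ : ∀ᵐ κ ∂ν, |φ κ| ≤ k) {δ : ℝ} (hδ : 0 < δ) :
    ∃ (L : ℕ) (B : ℕ → Set Y), 0 < L ∧ (∀ r, B r ∈ W.A) ∧
      ‖φ - k • ((2/(L:ℝ)) • (∑ r ∈ Finset.range L, PM.ind ν (B r)) - PM.ind ν univ)‖ ≤ δ := by
  set c : ℝ := (measureUnivNNReal ν : ℝ) ^ (ENNReal.toReal 2)⁻¹ with hc
  have hc0 : 0 ≤ c := by positivity
  obtain ⟨n, hn⟩ := exists_nat_gt (4 * k * c / δ)
  set L : ℕ := n + 1 with hL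
  have hLpos : (0:ℝ) < L := by rw [hL]; positivity
  set u : Y → ℝ := fun κ => (φ κ / k + 1) / 2 with hu
  have mu : Measurable u := (((Lp.stronglyMeasurable φ).measurable.div_const k).add_const 1).div_const 2
  set C : ℕ → Set Y := fun r => {κ | (r:ℝ)+1 ≤ u κ * L} with hC
  have mC : ∀ r, MeasurableSet (C r) := fun r => measurableSet_le measurable_const (mu.mul_const _)
  set η : ℝ := δ / (4*k) with hη
  have hη0 : 0 < η := by positivity
  have hch : ∀ r, ∃ t ∈ W.A, ν.real (symmDiff (C r) t) ≤ η^2 := by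
    intro r
    obtain ⟨t, ht, h⟩ := (W.dense ν).approx (C r) (mC r) (measure_ne_top _ _) (η^2) (by positivity)
    exact ⟨t, ht, by rw [Measure.real]; exact (ENNReal.toReal_lt_of_lt_ofReal h).le⟩
  choose A hA hAC using hch
  refine ⟨L, A, Nat.succ_pos n, hA, ?_⟩
  have hN : ∀ r, ‖PM.ind ν (C r) - PM.ind ν (A r)‖ ≤ η := by
    intro r
    have := PM.ind_sub_norm ν (mC r) (W.meas (hA r))
    exact le_of_sq_le_sq (by rw [this]; exact hAC r) hη0.le
  set φ1 : Lp ℝ 2 ν := k • ((2/(L:ℝ)) • (∑ r ∈ Finset.range L, PM.ind ν (C r)) - PM.ind ν univ) with hφ1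
  have h2 : ‖φ1 - k • ((2/(L:ℝ)) • (∑ r ∈ Finset.range L, PM.ind ν (A r)) - PM.ind ν univ)‖ ≤ δ/2 := by
    rw [hφ1, ← smul_sub, sub_sub_sub_cancel_right, ← smul_sub, ← Finset.sum_sub_distrib, norm_smul, norm_smul]
    have : ‖∑ r ∈ Finset.range L, (PM.ind ν (C r) - PM.ind ν (A r))‖ ≤ L * η := by
      refine (norm_sum_le _ _).trans ((Finset.sum_le_sum fun r _ => hN r).trans ?_)
      simp
    rw [Real.norm_of_nonneg hk.le, Real.norm_of_nonneg (by positivity)]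
    calc k * (2/(L:ℝ) * ‖∑ r ∈ Finset.range L, (PM.ind ν (C r) - PM.ind ν (A r))‖) ≤ k * (2/(L:ℝ) * (L * η)) := by gcongr
      _ = δ/2 := by rw [hη]; field_simp; norm_num
  have h1 : ‖φ - φ1‖ ≤ c * (2*k/L) := by
    refine Lp.norm_le_of_ae_bound (by positivity) ?_
    have e1 : ∀ᵐ κ ∂ν, ∀ r, PM.ind ν (C r) κ = (C r).indicator (fun _ => 1) κ := ae_all_iff.2 fun r => PM.ind_ae ν (mC r)
    have e0 : φ1 =ᵐ[ν] fun κ => k * ((2/(L:ℝ)) * (∑ r ∈ Finset.range L, PM.ind ν (C r) κ) - PM.ind ν univ κ) := by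
      rw [hφ1]
      filter_upwards [Lp.coeFn_smul k ((2/(L:ℝ)) • (∑ r ∈ Finset.range L, PM.ind ν (C r)) - PM.ind ν univ),
        Lp.coeFn_sub ((2/(L:ℝ)) • (∑ r ∈ Finset.range L, PM.ind ν (C r))) (PM.ind ν univ),
        Lp.coeFn_smul (2/(L:ℝ)) (∑ r ∈ Finset.range L, PM.ind ν (C r)),
        Lp_sum_ae ν (Finset.range L) (fun r => PM.ind ν (C r))] with κ a1 a2 a3 a4
      rw [a1, Pi.smul_apply, a2, Pi.sub_apply, a3, Pi.smul_apply, a4]; rfl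
    filter_upwards [Lp.coeFn_sub φ φ1, e0, e1, PM.ind_ae ν MeasurableSet.univ, hφ] with κ a1 a2 a3 a4 a5
    have hsum : ∑ r ∈ Finset.range L, PM.ind ν (C r) κ = (⌊u κ * L⌋₊ : ℝ) := by
      rw [← floor_sum L (u κ * L)]
      · refine Finset.sum_congr rfl fun r _ => ?_
        rw [a3 r]; simp only [hC, indicator, mem_setOf_eq]
      · have : u κ ≤ 1 := by
          simp only [hu]
          have : φ κ / k ≤ 1 := by rw [div_le_one hk]; exact (abs_le.1 a5).2
          linarith
        nlinarith
    rw [a1, Pi.sub_apply, a2, hsum, a4]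
    simp only [mem_univ, indicator_of_mem]
    have hu0 : 0 ≤ u κ := by
      simp only [hu]
      have : -1 ≤ φ κ / k := by rw [le_div_iff₀ hk]; linarith [(abs_le.1 a5).1]
      linarith
    have f1 := Nat.floor_le (mul_nonneg hu0 hLpos.le)
    have f2 := Nat.lt_floor_add_one (u κ * L)
    have e3 : φ κ = k * (2 * u κ - 1) := by simp only [hu]; field_simp; ring
    have e4 : φ κ - k * (2/(L:ℝ) * (⌊u κ * L⌋₊ : ℝ) - 1) = (2*k/L) * (u κ * L - ⌊u κ * L⌋₊) := by
      rw [e3]; field_simp; ring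
    rw [e4, Real.norm_of_nonneg (by apply mul_nonneg; positivity; linarith)]
    calc (2*k/L) * (u κ * L - ⌊u κ * L⌋₊) ≤ (2*k/L) * 1 := by gcongr; linarith
      _ = _ := mul_one _
  have h3 : c * (2*k/L) ≤ δ/2 := by
    rw [div_lt_iff₀ hδ] at hn
    rw [← mul_div_assoc, div_le_iff₀ hLpos, hL]; push_cast
    nlinarith
  calc _ = ‖(φ - φ1) + (φ1 - k • ((2/(L:ℝ)) • (∑ r ∈ Finset.range L, PM.ind ν (A r)) - PM.ind ν univ))‖ := by congr 1; abel
    _ ≤ _ := norm_add_le _ _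
    _ ≤ δ/2 + δ/2 := add_le_add (h1.trans h3) h2
    _ = δ := by ring

end AP

section N1b
variable {Y H ι : Type*} [TopologicalSpace Y] [CompactSpace Y] [MeasurableSpace Y]
    [NormedAddCommGroup H] [InnerProductSpace ℝ H] [CompleteSpace H] [Fintype ι] [DecidableEq ι]

/-- `X` is absolutely continuous with respect to `ν`. -/
def PM.AC (W : PM Y H) (ν : Measure Y) (X : H) : Prop :=
  ∀ ε > 0, ∃ δ > 0, ∀ s ∈ W.A, ν.real s < δ → ‖W.p s X‖ < ε

lemma PM.AC_of_le (W : PM Y H) (ν : Measure Y) [IsFiniteMeasure ν] {X : H} (h : W.mu X ≤ ν) : W.AC ν X := by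
  intro ε hε
  refine ⟨ε^2, by positivity, fun s hs hlt => ?_⟩
  have h1 : (W.mu X).real s ≤ ν.real s := ENNReal.toReal_mono (measure_ne_top _ _) (h s)
  rw [W.mu_real X hs, ← W.pnorm hs] at h1
  exact lt_of_pow_lt_pow_left₀ 2 hε.le (h1.trans_lt hlt)

lemma PM.D_zero (W : PM Y H) (ν : Measure Y) [IsFiniteMeasure ν] {v f : H} (hv : W.mu v ≤ ν)
    (hf : ∀ s ∈ W.A, inner ℝ (W.p s f) v = 0) : W.D ν v f =ᵐ[ν] 0 := by
  refine W.ae_eq_of_A ν (PM.L2int ν _) (integrable_zero _ _ _) fun t ht => ?_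
  rw [W.D_set ν hv _ ht, W.sa t ht, real_inner_comm, hf t ht]; simp

lemma PM.J_orth (W : PM Y H) (ν : Measure Y) [IsFiniteMeasure ν] {v f : H} (hv : W.mu v ≤ ν)
    (hf : ∀ s ∈ W.A, inner ℝ (W.p s f) v = 0) (K : Lp ℝ 2 ν) : inner ℝ (W.J ν v K) f = 0 := by
  rw [W.J_inner]
  refine integral_eq_zero_of_ae ?_
  filter_upwards [W.D_zero ν hv hf] with κ h
  rw [h]; simp

namespace GData
variable {W : PM Y H} {ν : Measure Y} [IsFiniteMeasure ν] {w : ι → H} (g : GData W ν w)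

/-- truncation sets -/
def Bk (X : H) (k : ℕ) : Set Y := {κ | ∀ l, |g.h X κ l| ≤ k}

lemma Bk_meas (X : H) (k : ℕ) : MeasurableSet (g.Bk X k) := by
  have : g.Bk X k = ⋂ l, {κ | |g.h X κ l| ≤ k} := by ext κ; simp [Bk]
  rw [this]
  exact MeasurableSet.iInter fun l => measurableSet_le (continuous_abs.measurable.comp (g.h_meas X l)) measurable_const

lemma Bk_lim (X : H) : Tendsto (fun k => ν.real (g.Bk X k)ᶜ) atTop (𝓝 0) := by
  have h1 : Tendsto (fun k => ν (g.Bk X k)ᶜ) atTop (𝓝 (ν (⋂ k, (g.Bk X k)ᶜ))) := by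
    refine tendsto_measure_iInter_atTop (fun k => (g.Bk_meas X k).compl.nullMeasurableSet) ?_ ⟨0, measure_ne_top _ _⟩
    intro a b hab
    refine compl_subset_compl.2 fun κ hκ l => (hκ l).trans ?_
    exact_mod_cast hab
  have h2 : ⋂ k, (g.Bk X k)ᶜ = ∅ := by
    rw [← compl_iUnion, compl_empty_iff, eq_univ_iff_forall]
    intro κ
    obtain ⟨n, hn⟩ := exists_nat_ge (∑ l, |g.h X κ l|)
    exact mem_iUnion.2 ⟨n, fun l => (Finset.single_le_sum (f := fun l => |g.h X κ l|) (fun _ _ => abs_nonneg _) (Finset.mem_univ l)).trans hn⟩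
  rw [h2, measure_empty] at h1
  have := (ENNReal.tendsto_toReal ENNReal.zero_ne_top).comp h1
  rw [ENNReal.toReal_zero] at this
  exact this

/-- `X` is approximated by its localisations. -/
lemma loc_near (hw : ∀ l, W.mu (w l) ≤ ν) (X : H) (hX : W.AC ν X) {ε : ℝ} (hε : 0 < ε) :
    ∃ k0 : ℕ, ∀ k ≥ k0, ∃ X' : H, W.p univ X' = X' ∧ ‖W.p univ X - X'‖ ≤ ε ∧
      (∀ δ > 0, ∃ s ∈ W.A, ν.real (symmDiff (g.Bk X k) s) < δ ∧ ‖W.p s X - X'‖ < δ) ∧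
      (∀ s ∈ W.A, ∀ l, inner ℝ (W.p s X') (w l) = inner ℝ (W.p s (g.Yp X (g.Bk X k))) (w l)) := by
  obtain ⟨δ, hδ, h⟩ := hX (ε/2) (by positivity)
  have := (g.Bk_lim X).eventually (gt_mem_nhds (show 0 < δ/2 by positivity))
  obtain ⟨k0, hk0⟩ := eventually_atTop.1 this
  refine ⟨k0, fun k hk => ?_⟩
  obtain ⟨X', h1, h2, h3⟩ := g.loc hw X hX (g.Bk_meas X k) (k := k) (fun κ hκ => hκ)
  refine ⟨X', h1, ?_, h2, h3⟩
  obtain ⟨s, hs, hs1, hs2⟩ := h2 (min (δ/2) (ε/2)) (by positivity)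
  have e1 : ‖W.p sᶜ X‖ < ε/2 := by
    refine h _ (W.alg.compl_mem hs) ?_
    have : sᶜ ⊆ (g.Bk X k)ᶜ ∪ symmDiff (g.Bk X k) s := by
      intro κ hκ
      simp only [mem_union, mem_symmDiff, mem_compl_iff] at *
      by_cases κ ∈ g.Bk X k <;> tauto
    have a3 := measureReal_mono (μ := ν) this
    have a4 := measureReal_union_le (μ := ν) (g.Bk X k)ᶜ (symmDiff (g.Bk X k) s)
    have a5 := hk0 k hk
    have a6 := hs1.trans_le (min_le_left _ _)
    linarith
  have e2 : W.p univ X = W.p s X + W.p sᶜ X := by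
    have := W.union s hs sᶜ (W.alg.compl_mem hs) disjoint_compl_right
    rw [union_compl_self] at this; rw [this]; rfl
  calc ‖W.p univ X - X'‖ = ‖(W.p s X - X') + W.p sᶜ X‖ := by rw [e2]; congr 1; abel
    _ ≤ _ := norm_add_le _ _
    _ ≤ ε/2 + ε/2 := add_le_add (hs2.le.trans (min_le_right _ _)) e1.le
    _ = ε := by ring

end GData

lemma N0 (W : PM Y H) (w : ι → H) (X : H) {ε : ℝ} (hε0 : 0 < ε) :
    ∃ (X' N' : H) (k : ℝ), 0 < k ∧ W.p univ N' = N' ∧ (∀ s ∈ W.A, ∀ l, inner ℝ (W.p s N') (w l) = 0) ∧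
      ‖W.p univ X - X'‖ ≤ ε ∧
      (∀ f, (∀ s ∈ W.A, ∀ l, inner ℝ (W.p s f) (w l) = 0) → inner ℝ (X' - N') f = 0) ∧
      ∀ δ > 0, ∃ s ∈ W.A, ∃ (L : ι → ℕ) (B : ι → ℕ → Set Y), (∀ l, 0 < L l) ∧ (∀ l r, B l r ∈ W.A) ∧
        ‖W.p s X - (∑ l, k • ((2/(L l:ℝ)) • (∑ r ∈ Finset.range (L l), W.p (B l r) (w l)) - W.p univ (w l))) - N'‖ ≤ δ ∧
        ‖W.p s X - X'‖ ≤ δ := by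
  set ν : Measure Y := ∑ l, W.mu (w l) + W.mu X with hν
  haveI : IsFiniteMeasure ν := by rw [hν]; infer_instance
  have hw : ∀ l, W.mu (w l) ≤ ν := by
    intro l
    refine le_trans ?_ (Measure.le_add_right le_rfl)
    exact Finset.single_le_sum (f := fun l => W.mu (w l)) (fun _ _ => Measure.zero_le _) (Finset.mem_univ l)
  have hX : W.AC ν X := W.AC_of_le ν (Measure.le_add_left le_rfl)
  obtain ⟨g⟩ := exists_GData W ν w hw
  obtain ⟨k0, hk0⟩ := g.loc_near hw X hX hε0
  set k : ℕ := k0 + 1 with hk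
  obtain ⟨X', h1, h2, h3, h4⟩ := hk0 k (Nat.le_succ _)
  have hkpos : (0:ℝ) < k := by rw [hk]; positivity
  refine ⟨X', X' - g.Yp X (g.Bk X k), k, hkpos, ?_, ?_, by linarith, ?_, ?_⟩
  · rw [map_sub, h1, g.Yp_univ hw]
  · intro s hs l
    rw [map_sub, inner_sub_left, h4 s hs l, sub_self]
  · intro f hf
    rw [sub_sub_cancel]
    unfold GData.Yp
    rw [sum_inner]
    exact Finset.sum_eq_zero fun l _ => W.J_orth ν (hw l) (fun s hs => hf s hs l) _
  · intro δ hδ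
    obtain ⟨s, hs, hs1, hs2⟩ := h3 (δ/2) (by positivity)
    set c : ℝ := Fintype.card ι + 1 with hc
    have hc0 : 0 < c := by rw [hc]; positivity
    have happ := fun l => W.approx_unit ν (g.K X (g.Bk X k) l) hkpos (δ := δ/2/c) (by
      filter_upwards [g.K_ae X (g.Bk_meas X k) (k := k) (fun κ hκ => hκ) l] with κ hκ
      rw [hκ]
      by_cases hh : κ ∈ g.Bk X k
      · rw [indicator_of_mem hh]; exact hh l
      · simp [hh]) (by positivity)
    choose L B hL hB hLB using happ
    refine ⟨s, hs, L, B, hL, hB, ?_, by linarith⟩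
    set Z : ι → Lp ℝ 2 ν := fun l => (k:ℝ) • ((2/(L l:ℝ)) • (∑ r ∈ Finset.range (L l), PM.ind ν (B l r)) - PM.ind ν univ) with hZ
    have eZ : ∀ l, W.J ν (w l) (Z l) =
        (k:ℝ) • ((2/(L l:ℝ)) • (∑ r ∈ Finset.range (L l), W.p (B l r) (w l)) - W.p univ (w l)) := by
      intro l
      rw [hZ]
      simp only [map_smul, map_sub, map_sum]
      rw [W.J_ind ν (hw l) W.alg.univ_mem]
      congr 4
      exact funext fun r => W.J_ind ν (hw l) (hB l r)
    simp only [← eZ]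
    have e1 : W.p s X - (∑ l, W.J ν (w l) (Z l)) - (X' - g.Yp X (g.Bk X k)) =
        (W.p s X - X') + ∑ l, W.J ν (w l) (g.K X (g.Bk X k) l - Z l) := by
      simp only [GData.Yp, map_sub, Finset.sum_sub_distrib]; abel
    rw [e1]
    have e2 : ‖∑ l, W.J ν (w l) (g.K X (g.Bk X k) l - Z l)‖ ≤ δ/2 := by
      refine (norm_sum_le _ _).trans ?_
      calc _ ≤ ∑ l : ι, δ/2/c := Finset.sum_le_sum fun l _ => (W.J_norm ν (hw l) _).trans (hLB l)
        _ = Fintype.card ι * (δ/2/c) := by simp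
        _ ≤ c * (δ/2/c) := by
          have : (Fintype.card ι : ℝ) ≤ c := by rw [hc]; linarith
          gcongr
        _ = δ/2 := by field_simp
    have := norm_add_le (W.p s X - X') (∑ l, W.J ν (w l) (g.K X (g.Bk X k) l - Z l))
    linarith

lemma N1 (W : PM Y H) (w : ι → H) (X f : H) (hf : ∀ s ∈ W.A, ∀ l, inner ℝ (W.p s f) (w l) = 0)
    (hfX : inner ℝ (W.p univ f) X ≠ 0) :
    ∃ (N' : H) (k : ℝ), 0 < k ∧ W.p univ N' = N' ∧ (∀ s ∈ W.A, ∀ l, inner ℝ (W.p s N') (w l) = 0) ∧ N' ≠ 0 ∧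
      ∀ δ > 0, ∃ s ∈ W.A, ∃ (L : ι → ℕ) (B : ι → ℕ → Set Y), (∀ l, 0 < L l) ∧ (∀ l r, B l r ∈ W.A) ∧
        ‖W.p s X - (∑ l, k • ((2/(L l:ℝ)) • (∑ r ∈ Finset.range (L l), W.p (B l r) (w l)) - W.p univ (w l))) - N'‖ ≤ δ := by
  have hfX' : 0 < |inner ℝ f (W.p univ X)| := by
    rw [← W.sa univ W.alg.univ_mem]; exact abs_pos.2 hfX
  set ε : ℝ := |inner ℝ f (W.p univ X)| / (2 * (‖f‖+1)) with hε
  have hε0 : 0 < ε := by positivity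
  obtain ⟨X', N', k, hk, hu, ho, h2, h5, h6⟩ := N0 W w X hε0
  refine ⟨N', k, hk, hu, ho, ?_, fun δ hδ => ?_⟩
  · intro h0
    have e1 : inner ℝ f X' = 0 := by
      rw [real_inner_comm, ← h5 f hf, h0, sub_zero]
    have e2 : inner ℝ f (W.p univ X) = inner ℝ f (W.p univ X - X') := by rw [inner_sub_right, e1, sub_zero]
    have e3 := abs_real_inner_le_norm f (W.p univ X - X')
    rw [← e2] at e3
    have e4 : ‖f‖ * ‖W.p univ X - X'‖ ≤ (‖f‖+1) * ε := by gcongr; linarith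
    have e5 : (‖f‖+1) * ε = |inner ℝ f (W.p univ X)| / 2 := by rw [hε]; field_simp
    linarith
  · obtain ⟨s, hs, L, B, hL, hB, hn, -⟩ := h6 δ hδ
    exact ⟨s, hs, L, B, hL, hB, hn⟩

end N1b

section LS

lemma local_series {E : Type*} [NormedAddCommGroup E] [NormedSpace ℝ E] {φ : ℝ → E} {y : ℝ} (h : AnalyticAt ℝ φ y) :
    ∃ (ρ : ℝ) (a : ℕ → E), 0 < ρ ∧ (Summable fun n => ‖a n‖ * ρ ^ n) ∧
      ∀ x, |x - y| < ρ → HasSum (fun n => (x - y) ^ n • a n) (φ x) := by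
  obtain ⟨p, r, hp⟩ := h
  obtain ⟨ρ, hρ0, hρ⟩ := ENNReal.lt_iff_exists_nnreal_btwn.1 hp.r_pos
  have hρ0' : (0:ℝ) < ρ := by exact_mod_cast hρ0
  refine ⟨ρ, p.coeff, hρ0', ?_, ?_⟩
  · have := p.summable_norm_mul_pow (hρ.trans_le hp.r_le)
    simpa [FormalMultilinearSeries.norm_apply_eq_norm_coef] using this
  · intro x hx
    have hm : x - y ∈ Metric.eball (0:ℝ) r := by
      rw [Metric.mem_eball, edist_dist, dist_zero_right, Real.norm_eq_abs]
      refine lt_trans ?_ hρ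
      rw [← ENNReal.ofReal_coe_nnreal]
      exact (ENNReal.ofReal_lt_ofReal_iff hρ0').2 hx
    have := hp.hasSum hm
    simpa [FormalMultilinearSeries.apply_eq_pow_smul_coeff] using this

lemma ae_hasSum {Y E : Type*} [MeasurableSpace Y] {ν : Measure Y} [NormedAddCommGroup E] [CompleteSpace E]
    {p : ℝ≥0∞} [Fact (1 ≤ p)] {b : ℕ → Lp E p ν} {s : Lp E p ν} (hb : Summable fun n => ‖b n‖) (hs : HasSum b s) :
    ∀ᵐ κ ∂ν, HasSum (fun n => b n κ) (s κ) := by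
  have h1 : ∑' n, ‖b n‖ₑ ≠ ∞ := by
    have := hb.tsum_ofReal_ne_top
    simpa [ofReal_norm_eq_enorm] using this
  have := Lp.hasSum_coeFn_tsum h1
  rwa [hs.tsum_eq] at this

/-- evaluated power series -/
def serf (y : ℝ) (c : ℕ → ℝ) (x : ℝ) : ℝ := ∑' n, (x - y)^n * c n

lemma serf_anal {y ρ : ℝ} (hρ : 0 < ρ) {c : ℕ → ℝ} (hc : Summable fun n => |c n| * ρ ^ n) :
    AnalyticOnNhd ℝ (serf y c) (Metric.ball y ρ) := by
  set p := FormalMultilinearSeries.ofScalars ℝ c with hp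
  have hr : ENNReal.ofReal ρ ≤ p.radius := by
    have := p.le_radius_of_summable_norm (r := ρ.toNNReal) (by
      simpa [hp, FormalMultilinearSeries.ofScalars_norm, Real.coe_toNNReal _ hρ.le] using hc)
    exact this
  have h1 := p.hasFPowerSeriesOnBall (lt_of_lt_of_le (by simpa using hρ) hr)
  have h2 := h1.comp_sub y
  have e : (fun z => p.sum (z - y)) = serf y c := by
    ext z
    unfold FormalMultilinearSeries.sum serf
    refine tsum_congr fun n => ?_
    rw [hp, FormalMultilinearSeries.ofScalars_apply_eq, smul_eq_mul, mul_comm]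
  rw [e, zero_add] at h2
  have h3 := h2.analyticOnNhd
  refine h3.mono fun z hz => ?_
  rw [Metric.mem_eball, edist_dist]
  refine lt_of_lt_of_le ?_ hr
  exact (ENNReal.ofReal_lt_ofReal_iff hρ).2 hz

lemma pointwise_version {Y : Type*} [MeasurableSpace Y] {ν : Measure Y} [IsFiniteMeasure ν] {U : Set ℝ} (hU : IsOpen U)
    {φ : ℝ → Lp ℝ 2 ν} (hφ : AnalyticOnNhd ℝ φ U) :
    ∃ ψ : Y → ℝ → ℝ, (∀ᵐ κ ∂ν, AnalyticOnNhd ℝ (ψ κ) U) ∧ ∀ x ∈ U, ∀ᵐ κ ∂ν, φ x κ = ψ κ x := by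
  choose! ρ a hρ hsum hs using fun y hy => local_series (hφ y hy)
  obtain ⟨T, hTU, hTc, hT⟩ := TopologicalSpace.countable_cover_nhdsWithin (s := U) (f := fun y => Metric.ball y (ρ y))
    (fun y hy => mem_nhdsWithin_of_mem_nhds (Metric.ball_mem_nhds y (hρ y hy)))
  have hpick : ∀ x, ∃ y, x ∈ U → y ∈ T ∧ x ∈ Metric.ball y (ρ y) := by
    intro x
    by_cases hx : x ∈ U
    · obtain ⟨y, hy, hxy⟩ := mem_iUnion₂.1 (hT hx)
      exact ⟨y, fun _ => ⟨hy, hxy⟩⟩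
    · exact ⟨0, fun h => absurd h hx⟩
  choose j hj using hpick
  -- pointwise series
  have hA : ∀ y ∈ U, ∀ x ∈ Metric.ball y (ρ y), ∀ᵐ κ ∂ν, φ x κ = serf y (fun n => a y n κ) x := by
    intro y hy x hx
    have hx' : |x - y| < ρ y := hx
    have h1 := ae_hasSum (ν := ν) (b := fun n => (x-y)^n • a y n) (s := φ x) ?_ (hs y hy x hx')
    · have h2 : ∀ᵐ κ ∂ν, ∀ n, ((x-y)^n • a y n : Lp ℝ 2 ν) κ = (x-y)^n * a y n κ := by
        rw [ae_all_iff]; intro n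
        filter_upwards [Lp.coeFn_smul ((x-y)^n) (a y n)] with κ h
        rw [h]; rfl
      filter_upwards [h1, h2] with κ k1 k2
      simp only [k2] at k1
      exact k1.tsum_eq.symm
    · refine Summable.of_nonneg_of_le (fun _ => norm_nonneg _) (fun n => ?_) (hsum y hy)
      rw [norm_smul, norm_pow, Real.norm_eq_abs, mul_comm]
      gcongr
  have hB : ∀ y ∈ U, ∀ᵐ κ ∂ν, Summable fun n => |a y n κ| * ρ y ^ n := by
    intro y hy
    have hb : Summable fun n => ‖ρ y ^ n • |a y n|‖ := by
      refine (hsum y hy).congr fun n => ?_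
      rw [norm_smul, norm_abs_eq_norm, Real.norm_of_nonneg (pow_nonneg (hρ y hy).le n), mul_comm]
    have h1 := ae_hasSum (ν := ν) hb hb.of_norm.hasSum
    have h2 : ∀ᵐ κ ∂ν, ∀ n, (ρ y ^ n • |a y n| : Lp ℝ 2 ν) κ = |a y n κ| * ρ y ^ n := by
      rw [ae_all_iff]; intro n
      filter_upwards [Lp.coeFn_smul (ρ y ^ n) |a y n|, Lp.coeFn_abs (a y n)] with κ h h'
      rw [h, Pi.smul_apply, h', smul_eq_mul, mul_comm]
    filter_upwards [h1, h2] with κ k1 k2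
    simp only [k2] at k1
    exact k1.summable
  refine ⟨fun κ x => serf (j x) (fun n => a (j x) n κ) x, ?_, ?_⟩
  · have hB' : ∀ᵐ κ ∂ν, ∀ y ∈ T, Summable fun n => |a y n κ| * ρ y ^ n :=
      (ae_ball_iff hTc).2 fun y hy => hB y (hTU hy)
    have hq : ∀ᵐ κ ∂ν, ∀ y ∈ T, ∀ q : ℚ, (q:ℝ) ∈ Metric.ball y (ρ y) → φ q κ = serf y (fun n => a y n κ) q := by
      refine (ae_ball_iff hTc).2 fun y hy => ?_
      rw [ae_all_iff]; intro q
      by_cases h : (q:ℝ) ∈ Metric.ball y (ρ y)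
      · filter_upwards [hA y (hTU hy) q h] with κ hκ _ using hκ
      · exact ae_of_all _ fun κ h' => absurd h' h
    filter_upwards [hB', hq] with κ k1 k2
    have heq : ∀ y ∈ T, ∀ x ∈ Metric.ball y (ρ y) ∩ U, serf (j x) (fun n => a (j x) n κ) x = serf y (fun n => a y n κ) x := by
      intro y hy x hx
      obtain ⟨hj1, hj2⟩ := hj x hx.2
      set V := Metric.ball y (ρ y) ∩ Metric.ball (j x) (ρ (j x)) with hV
      have hVo : IsOpen V := Metric.isOpen_ball.inter Metric.isOpen_ball
      have c1 : ContinuousOn (serf y (fun n => a y n κ)) V :=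
        (serf_anal (hρ y (hTU hy)) (k1 y hy)).continuousOn.mono inter_subset_left
      have c2 : ContinuousOn (serf (j x) (fun n => a (j x) n κ)) V :=
        (serf_anal (hρ _ (hTU hj1)) (k1 _ hj1)).continuousOn.mono inter_subset_right
      have hxV : x ∈ V := ⟨hx.1, hj2⟩
      by_contra hne
      have hcs := (c2.sub c1).isOpen_inter_preimage hVo (isOpen_compl_singleton (x := (0:ℝ)))
      obtain ⟨q, hq⟩ := Rat.denseRange_cast.exists_mem_open hcs ⟨x, hxV, by
        simp only [mem_preimage, mem_compl_iff, mem_singleton_iff, Pi.sub_apply]; exact sub_ne_zero.2 hne⟩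
      refine hq.2 ?_
      simp only [mem_singleton_iff, Pi.sub_apply]
      rw [← k2 y hy q hq.1.1, ← k2 _ hj1 q hq.1.2, sub_self]
    intro x hx
    obtain ⟨y, hy, hxy⟩ := mem_iUnion₂.1 (hT hx)
    refine (serf_anal (hρ y (hTU hy)) (k1 y hy) x hxy).congr ?_
    filter_upwards [Metric.isOpen_ball.mem_nhds hxy, hU.mem_nhds hx] with z hz hz'
    exact (heq y hy z ⟨hz, hz'⟩).symm
  · intro x hx
    obtain ⟨hj1, hj2⟩ := hj x hx
    exact hA _ (hTU hj1) x hj2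

lemma count_lemma {Y : Type*} [MeasurableSpace Y] {ν : Measure Y} [IsFiniteMeasure ν] {U : Set ℝ}
    (hU' : IsPreconnected U) {ψ : Y → ℝ → ℝ} {g : ℝ → Y → ℝ} (hg : ∀ x, Measurable (g x))
    (hgψ : ∀ x ∈ U, ∀ᵐ κ ∂ν, g x κ = ψ κ x) (h1 : ∀ᵐ κ ∂ν, AnalyticOnNhd ℝ (ψ κ) U ∧ ∃ x ∈ U, ψ κ x ≠ 0) :
    {x ∈ U | ¬ ∀ᵐ κ ∂ν, g x κ ≠ 0}.Countable := by
  set E : ℝ → Set Y := fun x => {κ | g x κ = 0} with hE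
  have mE : ∀ x, MeasurableSet (E x) := fun x => (hg x) (measurableSet_singleton 0)
  have key : ∀ k : ℕ, {x ∈ U | ENNReal.ofReal (1/((k:ℝ)+1)) ≤ ν (E x)}.Countable := by
    intro k
    set c := ENNReal.ofReal (1/((k:ℝ)+1)) with hc
    have hc0 : 0 < c := by rw [hc, ENNReal.ofReal_pos]; positivity
    set Tc := {x ∈ U | c ≤ ν (E x)} with hT
    have hd : DiscreteTopology Tc := by
      rw [discreteTopology_subtype_iff]
      intro x hx
      by_contra hne
      haveI : NeBot (𝓝[≠] x ⊓ 𝓟 Tc) := ⟨hne⟩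
      obtain ⟨u, hu⟩ := exists_seq_tendsto (𝓝[≠] x ⊓ 𝓟 Tc)
      rw [tendsto_inf] at hu
      obtain ⟨hu1, hu2⟩ := hu
      rw [tendsto_principal] at hu2
      obtain ⟨n0, hn0⟩ := eventually_atTop.1 hu2
      set F : ℕ → Set Y := fun n => ⋃ m ∈ {m : ℕ | n ≤ m}, E (u m) with hF
      have mF : ∀ n, MeasurableSet (F n) := fun n => MeasurableSet.biUnion (to_countable _) fun m _ => mE _
      have hFlim : Tendsto (fun n => ν (F n)) atTop (𝓝 (ν (⋂ n, F n))) := by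
        refine tendsto_measure_iInter_atTop (fun n => (mF n).nullMeasurableSet) ?_ ⟨0, measure_ne_top _ _⟩
        intro a b hab
        exact biUnion_subset_biUnion_left fun m hm => le_trans hab hm
      have hge : c ≤ ν (⋂ n, F n) := by
        refine ge_of_tendsto hFlim (eventually_atTop.2 ⟨n0, fun n hn => ?_⟩)
        exact (hn0 n hn).2.trans (measure_mono (subset_biUnion_of_mem (u := fun m => E (u m)) (show n ∈ {m : ℕ | n ≤ m} from (le_refl n : n ≤ n))))
      have hae : ∀ᵐ κ ∂ν, ∀ n, u n ∈ U → g (u n) κ = ψ κ (u n) := by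
        rw [ae_all_iff]; intro n
        by_cases h : u n ∈ U
        · filter_upwards [hgψ _ h] with κ hκ _ using hκ
        · exact ae_of_all _ fun κ h' => absurd h' h
      have hz : ν (⋂ n, F n) = 0 := by
        rw [measure_eq_zero_iff_ae_notMem]
        filter_upwards [hae, h1] with κ k1 k2 hκ
        obtain ⟨han, x1, hx1, hx1'⟩ := k2
        refine hx1' (han.eqOn_zero_of_preconnected_of_frequently_eq_zero hU' hx.1 ?_ hx1)
        have hfr : ∃ᶠ n in atTop, ψ κ (u n) = 0 := by
          rw [frequently_atTop]
          intro n
          have := mem_iInter.1 hκ (max n n0)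
          obtain ⟨m, hm, hm'⟩ := mem_iUnion₂.1 this
          refine ⟨m, (le_max_left _ _).trans hm, ?_⟩
          rw [← k1 m (hn0 m ((le_max_right _ _).trans hm)).1]; exact hm'
        exact hu1.frequently hfr
      rw [hz] at hge
      exact absurd hge (not_le.2 hc0)
    exact countable_coe_iff.1 (TopologicalSpace.separableSpace_iff_countable.1 inferInstance)
  refine (countable_iUnion key).mono ?_
  rintro x ⟨hx, hne⟩
  have hpos : 0 < ν (E x) := by
    rw [pos_iff_ne_zero]
    intro h0
    refine hne ?_
    rw [measure_eq_zero_iff_ae_notMem] at h0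
    exact h0
  have hpos' : 0 < ν.real (E x) := ENNReal.toReal_pos hpos.ne' (measure_ne_top _ _)
  obtain ⟨k, hk⟩ := exists_nat_one_div_lt hpos'
  refine mem_iUnion.2 ⟨k, hx, ?_⟩
  rw [← ofReal_measureReal]
  exact ENNReal.ofReal_le_ofReal hk.le

end LS

section II
variable {Y H ι : Type*} [TopologicalSpace Y] [CompactSpace Y] [MeasurableSpace Y]
    [NormedAddCommGroup H] [InnerProductSpace ℝ H] [CompleteSpace H] [Fintype ι] [DecidableEq ι]

/-- abstract representation property -/
def PM.Good (W : PM Y H) (w : ι → H) : Prop :=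
  ∀ f, (∀ s ∈ W.A, ∀ l, inner ℝ (W.p s f) (w l) = 0) → W.p univ f = 0

lemma gram_det_ne {G Gp Pi : Matrix ι ι ℝ} (hT : G.transpose = G) (hPi : Pi = 1 - G * Gp) (hPT : Pi.transpose = Pi)
    (hPP : Pi * Pi = Pi) : (G.transpose * G + Pi).det ≠ 0 := by
  intro h0
  obtain ⟨v, hv, hv0⟩ := Matrix.exists_mulVec_eq_zero_iff.2 h0
  have e1 : v ⬝ᵥ ((G.transpose * G + Pi).mulVec v) = (G.mulVec v) ⬝ᵥ (G.mulVec v) + (Pi.mulVec v) ⬝ᵥ (Pi.mulVec v) := by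
    rw [Matrix.add_mulVec, dotProduct_add, ← Matrix.mulVec_mulVec]
    congr 1
    · rw [Matrix.dotProduct_mulVec, Matrix.vecMul_transpose]
    · conv_lhs => rw [← hPP, ← Matrix.mulVec_mulVec, Matrix.dotProduct_mulVec]
      conv_lhs => enter [1]; rw [← hPT, Matrix.vecMul_transpose]
  rw [hv0, dotProduct_zero] at e1
  have n1 : 0 ≤ (G.mulVec v) ⬝ᵥ (G.mulVec v) := Finset.sum_nonneg fun i _ => mul_self_nonneg _
  have n2 : 0 ≤ (Pi.mulVec v) ⬝ᵥ (Pi.mulVec v) := Finset.sum_nonneg fun i _ => mul_self_nonneg _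
  have g0 : G.mulVec v = 0 := dotProduct_self_eq_zero.1 (by linarith)
  have p0 : Pi.mulVec v = 0 := dotProduct_self_eq_zero.1 (by linarith)
  apply hv
  have e2 : v = (G * Gp).mulVec v := by
    rw [hPi, Matrix.sub_mulVec, Matrix.one_mulVec, sub_eq_zero] at p0; exact p0
  apply dotProduct_self_eq_zero.1
  conv_lhs => enter [2]; rw [e2]
  rw [← Matrix.mulVec_mulVec, Matrix.dotProduct_mulVec]
  conv_lhs => enter [1]; rw [← hT, Matrix.vecMul_transpose, g0]
  simp

lemma det_meas (C : Y → Matrix ι ι ℝ) (hC : ∀ i j, Measurable fun κ => C κ i j) : Measurable fun κ => (C κ).det := by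
  simp only [Matrix.det_apply]
  exact Finset.measurable_sum _ fun σ _ => (Finset.measurable_prod _ fun i _ => hC _ _).const_smul _

lemma det_anal {U : Set ℝ} (C : ℝ → Matrix ι ι ℝ) (hC : ∀ i j, AnalyticOnNhd ℝ (fun x => C x i j) U) :
    AnalyticOnNhd ℝ (fun x => (C x).det) U := by
  simp only [Matrix.det_apply']
  refine Finset.analyticOnNhd_fun_sum _ fun σ _ => ?_
  exact analyticOnNhd_const.mul (Finset.analyticOnNhd_fun_prod _ fun i _ => hC _ _)

lemma PM.AC_good (W : PM Y H) (w : ι → H) (hG : W.Good w) (ν : Measure Y) [IsFiniteMeasure ν]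
    (hw : ∀ l, W.mu (w l) ≤ ν) (f : H) : W.AC ν f := by
  set V : Submodule ℝ H := Submodule.span ℝ {v | ∃ s ∈ W.A, ∃ l, v = W.p s (w l)} with hV
  have hmem : W.p univ f ∈ V.topologicalClosure := by
    rw [← Submodule.orthogonal_orthogonal_eq_closure, Submodule.mem_orthogonal]
    intro u hu
    rw [Submodule.mem_orthogonal] at hu
    have : W.p univ u = 0 := by
      refine hG u fun s hs l => ?_
      rw [W.sa s hs, real_inner_comm]
      exact hu _ (Submodule.subset_span ⟨s, hs, l, rfl⟩)
    rw [← W.sa univ W.alg.univ_mem, this, inner_zero_left]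
  have hVAC : ∀ v ∈ V, W.AC ν v := by
    intro v hv
    induction hv using Submodule.span_induction with
    | mem x hx =>
      obtain ⟨s, hs, l, rfl⟩ := hx
      intro ε hε
      obtain ⟨δ, hδ, h⟩ := W.AC_of_le ν (hw l) ε hε
      refine ⟨δ, hδ, fun t ht htδ => ?_⟩
      rw [W.inter t ht s hs, inter_comm, ← W.inter s hs t ht]
      exact (W.pnorm_le hs _).trans_lt (h t ht htδ)
    | zero => intro ε hε; exact ⟨1, one_pos, fun s _ _ => by simpa using hε⟩
    | add x y _ _ hx hy =>
      intro ε hε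
      obtain ⟨δ1, h1, h1'⟩ := hx (ε/2) (by positivity)
      obtain ⟨δ2, h2, h2'⟩ := hy (ε/2) (by positivity)
      refine ⟨min δ1 δ2, by positivity, fun s hs hlt => ?_⟩
      rw [map_add]
      have a1 := h1' s hs (hlt.trans_le (min_le_left _ _))
      have a2 := h2' s hs (hlt.trans_le (min_le_right _ _))
      have := norm_add_le (W.p s x) (W.p s y)
      linarith
    | smul a x _ hx =>
      intro ε hε
      obtain ⟨δ1, h1, h1'⟩ := hx (ε/(|a|+1)) (by positivity)
      refine ⟨δ1, h1, fun s hs hlt => ?_⟩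
      rw [map_smul, norm_smul, Real.norm_eq_abs]
      have a1 := h1' s hs hlt
      rw [lt_div_iff₀ (by positivity)] at a1
      nlinarith [abs_nonneg a, norm_nonneg (W.p s x)]
  intro ε hε
  rw [← SetLike.mem_coe, Submodule.topologicalClosure_coe, Metric.mem_closure_iff] at hmem
  obtain ⟨v, hv, hvf⟩ := hmem (ε/2) (by positivity)
  obtain ⟨δ, hδ, h⟩ := hVAC v hv (ε/2) (by positivity)
  refine ⟨δ, hδ, fun s hs hlt => ?_⟩
  have e : W.p s f = W.p s (W.p univ f - v) + W.p s v := by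
    rw [map_sub, W.inter s hs univ W.alg.univ_mem, inter_univ]; abel
  rw [e]
  have a1 := W.pnorm_le hs (W.p univ f - v)
  rw [dist_eq_norm] at hvf
  have a2 := h s hs hlt
  have := norm_add_le (W.p s (W.p univ f - v)) (W.p s v)
  linarith

lemma PM.good_of_det (W : PM Y H) (w0 w : ι → H) (hG : W.Good w0) (ν : Measure Y) [IsFiniteMeasure ν]
    (hw : ∀ l, W.mu (w0 l) ≤ ν) (g : GData W ν w0)
    (hdet : ∀ᵐ κ ∂ν, ((Matrix.of fun j l => W.D ν (w0 l) (w j) κ).transpose * (Matrix.of fun j l => W.D ν (w0 l) (w j) κ) + g.Pi κ).det ≠ 0) :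
    W.Good w := by
  intro f hf
  have hAC := W.AC_good w0 hG ν hw f
  have key : ∀ ε > 0, ‖W.p univ f‖ ≤ ε := by
    intro ε hε
    obtain ⟨k, hk⟩ := g.loc_near hw f hAC hε
    obtain ⟨X', h1, h2, h3, h4⟩ := hk k le_rfl
    set B := g.Bk f k with hB
    have hBm : MeasurableSet B := g.Bk_meas f k
    have hX : X' = g.Yp f B := by
      have := hG (X' - g.Yp f B) (fun s hs l => by rw [map_sub, inner_sub_left, h4 s hs l, sub_self])
      rw [map_sub, h1, g.Yp_univ hw, sub_eq_zero] at this
      exact this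
    have hz : ∀ s ∈ W.A, ∀ j, inner ℝ (W.p s X') (w j) = 0 := by
      intro s hs j
      rw [← abs_eq_zero]
      refine le_antisymm (le_of_forall_pos_le_add fun δ hδ => ?_) (abs_nonneg _)
      rw [zero_add]
      obtain ⟨t, ht, -, ht2⟩ := h3 (δ / (‖w j‖+1)) (by positivity)
      have e : inner ℝ (W.p s X') (w j) = inner ℝ (W.p s (X' - W.p t f)) (w j) := by
        rw [map_sub, inner_sub_left, W.inter s hs t ht, hf _ (W.alg.inter_mem hs ht), sub_zero]
      rw [e]
      calc _ ≤ ‖W.p s (X' - W.p t f)‖ * ‖w j‖ := abs_real_inner_le_norm _ _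
        _ ≤ (δ / (‖w j‖+1)) * (‖w j‖+1) := by
          gcongr
          · refine (W.pnorm_le hs _).trans ?_
            rw [norm_sub_rev]; exact ht2.le
          · linarith
        _ = δ := by field_simp
    have hC : ∀ᵐ κ ∂ν, ∀ j, (∑ l, B.indicator (fun κ => g.h f κ l) κ * W.D ν (w0 l) (w j) κ) = 0 := by
      rw [ae_all_iff]; intro j
      have hitg : Integrable (fun κ => ∑ l, B.indicator (fun κ => g.h f κ l) κ * W.D ν (w0 l) (w j) κ) ν := by
        refine integrable_finset_sum _ fun l _ => ?_
        refine (PM.L2int ν _).bdd_mul (c := k) ((g.h_meas f l).indicator hBm).aestronglyMeasurable (ae_of_all _ fun κ => ?_)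
        by_cases hκ : κ ∈ B
        · rw [indicator_of_mem hκ]; exact hκ l
        · simp [hκ]
      refine W.ae_eq_of_A ν hitg (integrable_zero _ _ _) fun s hs => ?_
      rw [← g.Yp_inner hw f (w j) hBm (k := k) (fun κ hκ => hκ) hs, ← hX, hz s hs j]; simp
    have hK : ∀ l, g.K f B l = 0 := by
      intro l
      rw [Lp.eq_zero_iff_ae_eq_zero]
      filter_upwards [g.K_ae f hBm (k := k) (fun κ hκ => hκ) l, hC, hdet] with κ k1 k2 k3
      rw [k1]
      by_cases hκ : κ ∈ B
      · rw [indicator_of_mem hκ]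
        simp only [indicator_of_mem hκ] at k2
        set M := (Matrix.of fun j l => W.D ν (w0 l) (w j) κ) with hM
        have m1 : M.mulVec (g.h f κ) = 0 := by
          ext j
          refine Eq.trans ?_ (k2 j)
          simp only [Matrix.mulVec, dotProduct, hM, Matrix.of_apply, mul_comm]
        have m2 : (M.transpose * M + g.Pi κ).mulVec (g.h f κ) = 0 := by
          rw [Matrix.add_mulVec, ← Matrix.mulVec_mulVec, m1, Matrix.mulVec_zero, g.Pi_h, add_zero]
        have := Matrix.eq_zero_of_mulVec_eq_zero k3 m2
        rw [this]; rfl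
      · simp [hκ]
    have hY : X' = 0 := by
      rw [hX]; unfold GData.Yp; simp [hK]
    rwa [hY, sub_zero] at h2
  exact norm_le_zero_iff.1 (le_of_forall_pos_le_add fun ε hε => by simpa using key ε hε)

lemma PM.good_countable (W : PM Y H) {U : Set ℝ} (hU : IsOpen U) (hU' : IsPreconnected U) (w : ℝ → ι → H)
    (hw : ∀ l, AnalyticOnNhd ℝ (fun x => w x l) U) (w0 : ι → H) (hG : W.Good w0) (xs : ℕ → ℝ) (hxs : ∀ n, xs n ∈ U)
    (hlim : ∀ l, Tendsto (fun n => w (xs n) l) atTop (𝓝 (w0 l))) : {x ∈ U | ¬ W.Good (w x)}.Countable := by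
  set ν : Measure Y := ∑ l, W.mu (w0 l) with hν
  haveI : IsFiniteMeasure ν := by rw [hν]; infer_instance
  have hw0 : ∀ l, W.mu (w0 l) ≤ ν := fun l =>
    Finset.single_le_sum (f := fun l => W.mu (w0 l)) (fun _ _ => Measure.zero_le _) (Finset.mem_univ l)
  obtain ⟨gd⟩ := exists_GData W ν w0 hw0
  set C : ℝ → ι → ι → Lp ℝ 2 ν := fun x j l => W.D ν (w0 l) (w x j) with hC
  have hCan : ∀ j l, AnalyticOnNhd ℝ (fun x => C x j l) U := fun j l x hx =>
    (W.D ν (w0 l)).analyticAt _ |>.comp (hw j x hx)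
  choose ψ hψ1 hψ2 using fun j l => pointwise_version (ν := ν) hU (hCan j l)
  set M : ℝ → Y → Matrix ι ι ℝ := fun x κ => Matrix.of fun j l => C x j l κ with hM
  set N : Y → ℝ → Matrix ι ι ℝ := fun κ x => Matrix.of fun j l => ψ j l κ x with hN
  set g : ℝ → Y → ℝ := fun x κ => ((M x κ).transpose * M x κ + gd.Pi κ).det with hg
  have mM : ∀ x i j, Measurable fun κ => M x κ i j := fun x i j => (Lp.stronglyMeasurable (C x i j)).measurable
  have mg : ∀ x, Measurable (g x) := by
    intro x
    refine det_meas _ fun i j => ?_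
    simp only [Matrix.add_apply, Matrix.mul_apply, Matrix.transpose_apply]
    exact (Finset.measurable_sum _ fun r _ => (mM x _ _).mul (mM x _ _)).add (gd.mPi i j)
  have hMN : ∀ x ∈ U, ∀ᵐ κ ∂ν, M x κ = N κ x := by
    intro x hx
    have : ∀ᵐ κ ∂ν, ∀ j l, C x j l κ = ψ j l κ x := by
      rw [ae_all_iff]; intro j; rw [ae_all_iff]; intro l; exact hψ2 j l x hx
    filter_upwards [this] with κ hκ
    ext j l; exact hκ j l
  have hgψ : ∀ x ∈ U, ∀ᵐ κ ∂ν, g x κ = ((N κ x).transpose * N κ x + gd.Pi κ).det := by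
    intro x hx
    filter_upwards [hMN x hx] with κ hκ
    simp only [hg, hκ]
  -- subsequence
  obtain ⟨ns, hns⟩ : ∃ ns : ℕ → ℕ, ∀ᵐ κ ∂ν, ∀ j l, Tendsto (fun i => C (xs (ns i)) j l κ) atTop (𝓝 (W.D ν (w0 l) (w0 j) κ)) := by
    set Fn : ℕ → Lp ℝ 2 ν := fun n => ∑ j, ∑ l, |C (xs n) j l - W.D ν (w0 l) (w0 j)| with hFn
    have hF0 : Tendsto Fn atTop (𝓝 0) := by
      have z2 : (0 : Lp ℝ 2 ν) = ∑ j : ι, ∑ l : ι, (0 : Lp ℝ 2 ν) := by simp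
      rw [z2]
      refine tendsto_finset_sum _ fun j _ => tendsto_finset_sum _ fun l _ => ?_
      rw [tendsto_zero_iff_norm_tendsto_zero]
      simp only [norm_abs_eq_norm]
      rw [← tendsto_iff_norm_sub_tendsto_zero]
      exact ((W.D ν (w0 l)).continuous.tendsto _).comp (hlim j)
    obtain ⟨ns, -, hns⟩ := (tendstoInMeasure_of_tendsto_Lp hF0).exists_seq_tendsto_ae
    refine ⟨ns, ?_⟩
    have hFae : ∀ᵐ κ ∂ν, ∀ n, Fn n κ = ∑ j, ∑ l, |C (xs n) j l κ - W.D ν (w0 l) (w0 j) κ| := by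
      rw [ae_all_iff]; intro n
      have a1 : ∀ᵐ κ ∂ν, ∀ j, (∑ l, |C (xs n) j l - W.D ν (w0 l) (w0 j)| : Lp ℝ 2 ν) κ = ∑ l, |C (xs n) j l - W.D ν (w0 l) (w0 j)| κ :=
        ae_all_iff.2 fun j => Lp_sum_ae ν _ _
      have a2 : ∀ᵐ κ ∂ν, ∀ j l, |C (xs n) j l - W.D ν (w0 l) (w0 j)| κ = |C (xs n) j l κ - W.D ν (w0 l) (w0 j) κ| := by
        rw [ae_all_iff]; intro j; rw [ae_all_iff]; intro l
        filter_upwards [Lp.coeFn_abs (C (xs n) j l - W.D ν (w0 l) (w0 j)), Lp.coeFn_sub (C (xs n) j l) (W.D ν (w0 l) (w0 j))] with κ b1 b2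
        rw [b1, b2]; rfl
      filter_upwards [Lp_sum_ae ν Finset.univ (fun j => ∑ l, |C (xs n) j l - W.D ν (w0 l) (w0 j)|), a1, a2] with κ b1 b2 b3
      rw [hFn]; simp only [b1, b2, b3]
    filter_upwards [hns, hFae, Lp.coeFn_zero ℝ 2 ν] with κ k1 k2 k3 j l
    rw [k3] at k1
    rw [tendsto_iff_norm_sub_tendsto_zero]
    refine squeeze_zero (fun _ => norm_nonneg _) (fun i => ?_) k1
    rw [k2, Real.norm_eq_abs]
    refine le_trans ?_ (Finset.single_le_sum (f := fun j => ∑ l, |C (xs (ns i)) j l κ - W.D ν (w0 l) (w0 j) κ|)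
      (fun _ _ => Finset.sum_nonneg fun _ _ => abs_nonneg _) (Finset.mem_univ j))
    exact Finset.single_le_sum (f := fun l => |C (xs (ns i)) j l κ - W.D ν (w0 l) (w0 j) κ|)
      (fun _ _ => abs_nonneg _) (Finset.mem_univ l)
  have hmain : ∀ᵐ κ ∂ν, AnalyticOnNhd ℝ (fun x => ((N κ x).transpose * N κ x + gd.Pi κ).det) U ∧
      ∃ x ∈ U, ((N κ x).transpose * N κ x + gd.Pi κ).det ≠ 0 := by
    have a1 : ∀ᵐ κ ∂ν, ∀ j l, AnalyticOnNhd ℝ (ψ j l κ) U := by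
      rw [ae_all_iff]; intro j; rw [ae_all_iff]; intro l; exact hψ1 j l
    have a2 : ∀ᵐ κ ∂ν, ∀ i, M (xs i) κ = N κ (xs i) := ae_all_iff.2 fun i => hMN _ (hxs i)
    have a3 : ∀ᵐ κ ∂ν, ∀ i l, gd.G κ i l = W.D ν (w0 i) (w0 l) κ := by
      rw [ae_all_iff]; intro j; rw [ae_all_iff]; intro l; exact gd.Geq j l
    filter_upwards [a1, a2, a3, hns] with κ b1 b2 b3 b4
    refine ⟨?_, ?_⟩
    · refine det_anal _ fun i j => ?_
      simp only [Matrix.add_apply, Matrix.mul_apply, Matrix.transpose_apply]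
      exact (Finset.analyticOnNhd_fun_sum _ fun r _ => (b1 _ _).mul (b1 _ _)).add analyticOnNhd_const
    · by_contra! hcon
      have hconv : Tendsto (fun i => M (xs (ns i)) κ) atTop (𝓝 (gd.G κ)) := by
        have hh : ∀ j l, Tendsto (fun i => M (xs (ns i)) κ j l) atTop (𝓝 (gd.G κ j l)) := by
          intro j l
          have : gd.G κ j l = W.D ν (w0 l) (w0 j) κ := by
            rw [← b3]; conv_lhs => rw [← gd.GT]
            rfl
          rw [this]; exact b4 j l
        exact tendsto_pi_nhds.2 fun j => tendsto_pi_nhds.2 fun l => hh j l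
      have hcd : Continuous fun A : Matrix ι ι ℝ => (A.transpose * A + gd.Pi κ).det :=
        (((continuous_id.matrix_transpose).matrix_mul continuous_id).add continuous_const).matrix_det
      have hl := (hcd.tendsto (gd.G κ)).comp hconv
      have hz : ((gd.G κ).transpose * gd.G κ + gd.Pi κ).det = 0 := by
        refine tendsto_nhds_unique hl ?_
        refine tendsto_const_nhds.congr fun i => ?_
        simp only [Function.comp]
        rw [b2, hcon _ (hxs _)]
      exact gram_det_ne (gd.GT κ) (gd.PiDef κ) (gd.PiT κ) (gd.PiPi κ) hz
  refine (count_lemma (ν := ν) hU' mg hgψ hmain).mono ?_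
  rintro x ⟨hx, hxG⟩
  exact ⟨hx, fun h => hxG (W.good_of_det w0 (w x) hG ν hw0 gd h)⟩

end II

section PartTen

variable {Ω : Type*} {m : MeasurableSpace Ω} {P : Measure Ω} [IsProbabilityMeasure P] {Γ : Filtration ℝ m}

variable (P Γ) in
/-- continuous-time limit of `T n (mp M) f` -/
def lim (M : Ω → ℝ) (f : Lp ℝ 2 P) : Lp ℝ 2 P := limUnder atTop (fun n => T P Γ n (mp P Γ M) f)

lemma lim_tendsto {M : Ω → ℝ} (hM : MemLp M ∞ P) (f : Lp ℝ 2 P) :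
    Tendsto (fun n => T P Γ n (mp P Γ M) f) atTop (nhds (lim P Γ M f)) :=
  (T_cauchy hM f).tendsto_limUnder

lemma top_norm_bd (M : Lp ℝ ∞ P) : ∀ᵐ o ∂P, |M o| ≤ ‖M‖ := by
  have := bdd_of_top (Lp.memLp M)
  rwa [← Lp.norm_def] at this

lemma lim_bound {M : Ω → ℝ} (hM : MemLp M ∞ P) {c : ℝ} (hc : 0 ≤ c) (hb : ∀ᵐ o ∂P, |M o| ≤ c) (f : Lp ℝ 2 P) :
    ‖lim P Γ M f‖ ≤ c * ‖f‖ :=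
  le_of_tendsto (lim_tendsto hM f).norm (Eventually.of_forall fun n =>
    T_norm_le (mp_ad hM) n hc (fun i _ => mp_bdd hb _) f)

lemma lim_add_right {M : Ω → ℝ} (hM : MemLp M ∞ P) (f g : Lp ℝ 2 P) :
    lim P Γ M (f + g) = lim P Γ M f + lim P Γ M g := by
  refine tendsto_nhds_unique (lim_tendsto hM _) ?_
  simpa using (lim_tendsto hM f).add (lim_tendsto hM g)

lemma lim_smul_right {M : Ω → ℝ} (hM : MemLp M ∞ P) (c : ℝ) (f : Lp ℝ 2 P) :
    lim P Γ M (c • f) = c • lim P Γ M f := by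
  refine tendsto_nhds_unique (lim_tendsto hM _) ?_
  simpa using (lim_tendsto hM f).const_smul c

lemma mp_congr {M M' : Ω → ℝ} (h : M =ᵐ[P] M') (u : ℝ) : mp P Γ M u =ᵐ[P] mp P Γ M' u :=
  condExp_congr_ae h

lemma mp_add {M M' : Ω → ℝ} (h : Integrable M P) (h' : Integrable M' P) (u : ℝ) :
    mp P Γ (M + M') u =ᵐ[P] mp P Γ M u + mp P Γ M' u := condExp_add h h' _

lemma lim_congr {M M' : Ω → ℝ} (hM : MemLp M ∞ P) (h : M =ᵐ[P] M') (f : Lp ℝ 2 P) :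
    lim P Γ M f = lim P Γ M' f := by
  unfold lim
  congr 2
  ext1 n
  rw [T_congr_ae (mp_ad hM) n fun i _ => mp_congr h _]

lemma lim_add_left {M M' : Ω → ℝ} (hM : MemLp M ∞ P) (hM' : MemLp M' ∞ P) (f : Lp ℝ 2 P) :
    lim P Γ (M + M') f = lim P Γ M f + lim P Γ M' f := by
  refine tendsto_nhds_unique (lim_tendsto (hM.add hM') _) ?_
  refine ((lim_tendsto hM f).add (lim_tendsto hM' f)).congr fun n => ?_
  rw [← T_add (mp_ad hM) (mp_ad hM')]
  rw [T_congr_ae (q' := fun u o => mp P Γ M u o + mp P Γ M' u o) (mp_ad (hM.add hM')) n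
    fun i _ => mp_add (top_int hM) (top_int hM') _]

lemma lim_smul_left {M : Ω → ℝ} (hM : MemLp M ∞ P) (c : ℝ) (f : Lp ℝ 2 P) :
    lim P Γ (c • M) f = c • lim P Γ M f := by
  refine tendsto_nhds_unique (lim_tendsto (hM.const_smul c) _) ?_
  refine ((lim_tendsto hM f).const_smul c).congr fun n => ?_
  rw [← T_smul (mp_ad hM)]
  rw [T_congr_ae (q' := fun u o => c * mp P Γ M u o) (mp_ad (hM.const_smul c)) n
    fun i _ => condExp_smul c M _]

lemma lim_sa {M : Ω → ℝ} (hM : MemLp M ∞ P) (f g : Lp ℝ 2 P) :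
    inner ℝ (lim P Γ M f) g = inner ℝ f (lim P Γ M g) := by
  refine tendsto_nhds_unique ((lim_tendsto hM f).inner tendsto_const_nhds) ?_
  refine (Tendsto.inner (tendsto_const_nhds (x := f)) (lim_tendsto (Γ := Γ) hM g)).congr fun n => ?_
  rw [T_sa (mp_ad hM)]

variable (P Γ) in
/-- bilinear version -/
def LT : Lp ℝ ∞ P →L[ℝ] Lp ℝ 2 P →L[ℝ] Lp ℝ 2 P :=
  LinearMap.mkContinuous₂ (LinearMap.mk₂ ℝ (fun (M : Lp ℝ ∞ P) f => lim P Γ M f)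
    (fun M M' f => by
      rw [← lim_add_left (Lp.memLp M) (Lp.memLp M')]
      exact lim_congr (Lp.memLp _) (Lp.coeFn_add M M') f)
    (fun c M f => by
      rw [← lim_smul_left (Lp.memLp M)]
      exact lim_congr (Lp.memLp _) (Lp.coeFn_smul c M) f)
    (fun M f g => lim_add_right (Lp.memLp M) f g)
    (fun c M f => lim_smul_right (Lp.memLp M) c f)) 1
    (fun M f => by
      rw [one_mul]
      exact lim_bound (Lp.memLp M) (norm_nonneg _) (top_norm_bd M) f)

/-- element of `L²` of a bounded function -/
def tL (P : Measure Ω) (φ : Ω → ℝ) : Lp ℝ 2 P := toL P φ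

lemma top_two {M : Ω → ℝ} (hM : MemLp M ∞ P) : MemLp M 2 P := hM.mono_exponent le_top

lemma tL_ae {M : Ω → ℝ} (hM : MemLp M ∞ P) : tL P M =ᵐ[P] M := toL_ae P (top_two hM)

variable (P) in
/-- inclusion of `L^∞` into `L²` -/
def jL : Lp ℝ ∞ P →L[ℝ] Lp ℝ 2 P :=
  LinearMap.mkContinuous
    { toFun := fun M => tL P M
      map_add' := fun M M' => by
        apply Lp.ext
        filter_upwards [tL_ae (Lp.memLp (M + M')), tL_ae (Lp.memLp M), tL_ae (Lp.memLp M'),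
          Lp.coeFn_add M M', Lp.coeFn_add (tL P M) (tL P M')] with o a b c d e
        rw [a, d, e, Pi.add_apply, Pi.add_apply, b, c]
      map_smul' := fun r M => by
        apply Lp.ext
        filter_upwards [tL_ae (Lp.memLp (r • M)), tL_ae (Lp.memLp M), 
          Lp.coeFn_smul r M, Lp.coeFn_smul r (tL P M)] with o a b d e
        rw [a, d, RingHom.id_apply, e, Pi.smul_apply, Pi.smul_apply, b] } 1
    (fun M => by
      rw [one_mul]
      have := Lp.norm_le_of_ae_bound (f := tL P M) (p := 2) (norm_nonneg M) (by
        filter_upwards [tL_ae (Lp.memLp M), top_norm_bd M] with o a b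
        rw [a]; exact b)
      simpa [measureUnivNNReal] using this)

/-! ### the concrete projection family -/

/-- elementary predictable sets -/
def A0 (Γ : Filtration ℝ m) : Set (Set (ℝ × Ω)) :=
  {B | (∃ n, ∀ u o, (u, o) ∈ B ↔ (fl n u, o) ∈ B) ∧ ∀ u, MeasurableSet[Γ u] {o | (u, o) ∈ B}}

/-- indicator process -/
def iq (B : Set (ℝ × Ω)) : ℝ → Ω → ℝ := fun u => indicator {o | (u, o) ∈ B} (fun _ => 1)

lemma iq_ad {B : Set (ℝ × Ω)} (hB : ∀ u, MeasurableSet[Γ u] {o | (u, o) ∈ B}) : Ad P Γ (iq B) :=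
  ⟨fun u => stronglyMeasurable_const.indicator (hB u),
    fun u => (memLp_const 1).indicator (Γ.le u _ (hB u))⟩

lemma iq_lev {B : Set (ℝ × Ω)} {n : ℕ} (hB : ∀ u o, (u, o) ∈ B ↔ (fl n u, o) ∈ B) : Lev n (iq B) := by
  intro u; unfold iq; congr 1; ext o; exact hB u o

lemma lev_mono {B : Set (ℝ × Ω)} {n k : ℕ} (hB : ∀ u o, (u, o) ∈ B ↔ (fl n u, o) ∈ B) (h : n ≤ k) :
    ∀ u o, (u, o) ∈ B ↔ (fl k u, o) ∈ B := by
  intro u o; rw [hB u o, hB (fl k u) o, fl_fl' h]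

variable (P Γ) in
/-- projection attached to a set -/
def pB (B : Set (ℝ × Ω)) : Lp ℝ 2 P →L[ℝ] Lp ℝ 2 P :=
  open Classical in
  if h : ∃ n, ∀ u o, (u, o) ∈ B ↔ (fl n u, o) ∈ B then T P Γ h.choose (iq B) else 0

lemma pB_eq {B : Set (ℝ × Ω)} {n : ℕ} (hB : ∀ u o, (u, o) ∈ B ↔ (fl n u, o) ∈ B) :
    pB P Γ B = T P Γ n (iq B) := by
  have h : ∃ n, ∀ u o, (u, o) ∈ B ↔ (fl n u, o) ∈ B := ⟨n, hB⟩
  unfold pB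
  rw [dif_pos h]
  rw [← (iq_lev h.choose_spec).T_eq (le_max_left _ n), (iq_lev hB).T_eq (le_max_right _ n)]

lemma A0_alg : IsSetAlgebra (A0 Γ) where
  empty_mem := ⟨⟨0, by simp⟩, by simp⟩
  compl_mem := by
    rintro B ⟨⟨n, hn⟩, h⟩
    exact ⟨⟨n, fun u o => not_congr (hn u o)⟩, fun u => (h u).compl⟩
  union_mem := by
    rintro B C ⟨⟨n, hn⟩, h⟩ ⟨⟨k, hk⟩, h'⟩
    exact ⟨⟨max n k, fun u o => or_congr (lev_mono hn (le_max_left _ _) u o)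
      (lev_mono hk (le_max_right _ _) u o)⟩, fun u => (h u).union (h' u)⟩

/-- the compact space -/
def YY (Γ : Filtration ℝ m) : Type _ := Ultrafilter (ℝ × Ω)

instance : TopologicalSpace (YY Γ) := inferInstanceAs (TopologicalSpace (Ultrafilter (ℝ × Ω)))
instance : CompactSpace (YY Γ) := inferInstanceAs (CompactSpace (Ultrafilter (ℝ × Ω)))

/-- basic clopen sets -/
def bas (Γ : Filtration ℝ m) (B : Set (ℝ × Ω)) : Set (YY Γ) := {u : Ultrafilter (ℝ × Ω) | B ∈ u}
/-- trace -/
def unb (C : Set (YY Γ)) : Set (ℝ × Ω) := {x | (pure x : Ultrafilter (ℝ × Ω)) ∈ C}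

lemma unb_bas (B : Set (ℝ × Ω)) : unb (bas Γ B) = B := by
  ext x
  simp only [unb, bas, mem_setOf_eq]
  exact Ultrafilter.mem_pure

instance : MeasurableSpace (YY Γ) := MeasurableSpace.generateFrom (bas Γ '' A0 Γ)

lemma bas_union (B C : Set (ℝ × Ω)) : bas Γ B ∪ bas Γ C = bas Γ (B ∪ C) := by
  ext u; exact Ultrafilter.union_mem_iff.symm
lemma bas_inter (B C : Set (ℝ × Ω)) : bas Γ B ∩ bas Γ C = bas Γ (B ∩ C) := by
  ext u
  exact (Filter.inter_mem_iff (f := ((show Ultrafilter (ℝ × Ω) from u) : Filter (ℝ × Ω)))).symm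
lemma bas_compl (B : Set (ℝ × Ω)) : (bas Γ B)ᶜ = bas Γ Bᶜ := by
  ext u; exact Ultrafilter.compl_mem_iff_notMem.symm
lemma bas_univ : bas Γ univ = univ := by
  ext u
  exact iff_of_true (Filter.univ_mem (f := ((show Ultrafilter (ℝ × Ω) from u) : Filter (ℝ × Ω)))) trivial

variable (P Γ) in
/-- the concrete projection-valued content -/
def WW : PM (YY Γ) (Lp ℝ 2 P) where
  A := bas Γ '' A0 Γ
  alg := by
    refine ⟨⟨∅, A0_alg.empty_mem, ?_⟩, ?_, ?_⟩
    · ext u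
      exact iff_of_false (Ultrafilter.empty_notMem (f := (show Ultrafilter (ℝ × Ω) from u))) (by simp)
    · rintro _ ⟨B, hB, rfl⟩
      exact ⟨Bᶜ, A0_alg.compl_mem hB, (bas_compl B).symm⟩
    · rintro _ _ ⟨B, hB, rfl⟩ ⟨C, hC, rfl⟩
      exact ⟨B ∪ C, A0_alg.union_mem hB hC, (bas_union B C).symm⟩
  clopen := by
    rintro _ ⟨B, hB, rfl⟩
    exact ⟨ultrafilter_isClosed_basic B, ultrafilter_isOpen_basic B⟩
  gen := rfl
  p := fun C => pB P Γ (unb C)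
  inter := by
    rintro _ ⟨B, ⟨⟨n, hn⟩, h⟩, rfl⟩ _ ⟨C, ⟨⟨k, hk⟩, h'⟩, rfl⟩ f
    rw [bas_inter]
    simp only [unb_bas]
    have hn' := lev_mono hn (le_max_left n k)
    have hk' := lev_mono hk (le_max_right n k)
    rw [pB_eq hn', pB_eq hk', pB_eq (n := max n k) (fun u o => and_congr (hn' u o) (hk' u o)),
      T_mul (iq_ad h) (iq_ad h')]
    congr 2
    ext u o
    by_cases h1 : (u, o) ∈ B <;> by_cases h2 : (u, o) ∈ C <;> simp [iq, h1, h2]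
  union := by
    rintro _ ⟨B, ⟨⟨n, hn⟩, h⟩, rfl⟩ _ ⟨C, ⟨⟨k, hk⟩, h'⟩, rfl⟩ hd
    have hd' : ∀ x, x ∈ B → x ∉ C := fun x hB hC => by
      have h1 : (show YY Γ from (pure x : Ultrafilter (ℝ × Ω))) ∈ bas Γ B := Ultrafilter.mem_pure.2 hB
      have h2 : (show YY Γ from (pure x : Ultrafilter (ℝ × Ω))) ∈ bas Γ C := Ultrafilter.mem_pure.2 hC
      exact Set.disjoint_left.1 hd h1 h2
    rw [bas_union]
    simp only [unb_bas]
    have hn' := lev_mono hn (le_max_left n k)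
    have hk' := lev_mono hk (le_max_right n k)
    rw [pB_eq hn', pB_eq hk', pB_eq (n := max n k) (fun u o => or_congr (hn' u o) (hk' u o))]
    ext1 f
    rw [ContinuousLinearMap.add_apply, ← T_add (iq_ad h) (iq_ad h')]
    congr 2
    ext u o
    by_cases h1 : (u, o) ∈ B <;> by_cases h2 : (u, o) ∈ C
    · exact absurd h2 (hd' _ h1)
    all_goals simp [iq, h1, h2]
  sa := by
    rintro _ ⟨B, ⟨⟨n, hn⟩, h⟩, rfl⟩ f g
    simp only [unb_bas]
    rw [pB_eq hn]
    exact T_sa (iq_ad h) n f g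

lemma WW_p_bas (B : Set (ℝ × Ω)) : (WW P Γ).p (bas Γ B) = pB P Γ B := by
  show pB P Γ (unb (bas Γ B)) = _
  rw [unb_bas]

lemma WW_p_univ (f : Lp ℝ 2 P) : (WW P Γ).p univ f = ceF P Γ 1 f - ceF P Γ 0 f := by
  rw [← bas_univ, WW_p_bas, pB_eq (n := 0) (by simp), ← T_one 0]
  congr 2; ext; simp [iq]

/-- the representation property of `(z, y)` -/
def Gd {ι : Type*} (P : Measure Ω) [IsProbabilityMeasure P] (Γ : Filtration ℝ m) (z : Ω → ℝ) (y : ι → Ω → ℝ) : Prop :=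
  (WW P Γ).Good (fun l => lim P Γ z (tL P (y l)) - lim P Γ (y l) (tL P z))

lemma bil_tendsto {E F G : Type*} [NormedAddCommGroup E] [NormedSpace ℝ E] [NormedAddCommGroup F] [NormedSpace ℝ F]
    [NormedAddCommGroup G] [NormedSpace ℝ G] (B : E →L[ℝ] F →L[ℝ] G) {a : ℕ → E} {b : ℕ → F} {a0 : E} {b0 : F}
    (ha : Tendsto a atTop (nhds a0)) (hb : Tendsto b atTop (nhds b0)) :
    Tendsto (fun n => B (a n) (b n)) atTop (nhds (B a0 b0)) :=
  (B.analyticAt_bilinear (a0, b0)).continuousAt.tendsto.comp (ha.prodMk_nhds hb)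

lemma bil_analytic {E F G : Type*} [NormedAddCommGroup E] [NormedSpace ℝ E] [NormedAddCommGroup F] [NormedSpace ℝ F]
    [NormedAddCommGroup G] [NormedSpace ℝ G] (B : E →L[ℝ] F →L[ℝ] G) {a : ℝ → E} {b : ℝ → F} {x : ℝ}
    (ha : AnalyticAt ℝ a x) (hb : AnalyticAt ℝ b x) :
    AnalyticAt ℝ (fun x => B (a x) (b x)) x :=
  (B.analyticAt_bilinear (a x, b x)).comp (f := fun x => (a x, b x)) (ha.prod hb)

lemma Gd_countable {ι : Type*} [Fintype ι] [DecidableEq ι] {U : Set ℝ} (hU : IsOpen U) (hU' : IsPreconnected U)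
    (z : ℝ → Lp ℝ ∞ P) (y : ι → ℝ → Lp ℝ ∞ P) (hz : AnalyticOnNhd ℝ z U)
    (hy : ∀ l, AnalyticOnNhd ℝ (y l) U) (z0 : Lp ℝ ∞ P) (y0 : ι → Lp ℝ ∞ P)
    (hG : Gd P Γ z0 (fun l => y0 l)) (xs : ℕ → ℝ) (hxs : ∀ n, xs n ∈ U)
    (hlz : Tendsto (fun n => z (xs n)) atTop (nhds z0))
    (hly : ∀ l, Tendsto (fun n => y l (xs n)) atTop (nhds (y0 l))) :
    {x ∈ U | ¬ Gd P Γ (z x) (fun l => y l x)}.Countable := by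
  refine (WW P Γ).good_countable hU hU'
    (fun x l => LT P Γ (z x) (jL P (y l x)) - LT P Γ (y l x) (jL P (z x))) ?_
    (fun l => LT P Γ z0 (jL P (y0 l)) - LT P Γ (y0 l) (jL P z0)) hG xs hxs ?_
  · intro l
    have hb : ∀ a b : ℝ → Lp ℝ ∞ P, AnalyticOnNhd ℝ a U → AnalyticOnNhd ℝ b U →
        AnalyticOnNhd ℝ (fun x => LT P Γ (a x) (jL P (b x))) U := by
      intro a b ha hb x hx
      exact bil_analytic (LT P Γ) (ha x hx) (((jL P).analyticAt _).comp (hb x hx))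
    exact (hb _ _ hz (hy l)).sub (hb _ _ (hy l) hz)
  · intro l
    have hb : ∀ (a b : ℕ → Lp ℝ ∞ P) a0 b0, Tendsto a atTop (nhds a0) → Tendsto b atTop (nhds b0) →
        Tendsto (fun n => LT P Γ (a n) (jL P (b n))) atTop (nhds (LT P Γ a0 (jL P b0))) := by
      intro a b a0 b0 ha hb
      exact bil_tendsto (LT P Γ) ha (((jL P).continuous.tendsto _).comp hb)
    exact (hb _ _ _ _ hlz (hly l)).sub (hb _ _ _ _ (hly l) hlz)

/-- sums of `g`, stopped after leaving `[-K, K]` -/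
def rs (g : ℕ → Ω → ℝ) (K : ℝ) : ℕ → Ω → ℝ
  | 0 => fun _ => 0
  | i+1 => fun o => rs g K i o + if |rs g K i o| ≤ K then g i o else 0

lemma rs_bound (g : ℕ → Ω → ℝ) {K b : ℝ} (hK : 0 ≤ K) (hb : 0 ≤ b) (o : Ω) (N : ℕ)
    (h : ∀ i < N, |g i o| ≤ b) : |rs g K N o| ≤ K + b := by
  induction N with
  | zero => simp [rs]; positivity
  | succ N ih =>
    have := ih fun i hi => h i (hi.trans N.lt_succ_self)
    simp only [rs]
    split_ifs with h1
    · exact (abs_add_le _ _).trans (add_le_add h1 (h N N.lt_succ_self))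
    · simpa using this

lemma rs_halt (g : ℕ → Ω → ℝ) {K : ℝ} (o : Ω) {i N : ℕ} (hi : i ≤ N)
    (h : K < |rs g K i o|) : rs g K N o = rs g K i o := by
  induction hi with
  | refl => rfl
  | @step N hN ih =>
    simp only [rs]
    rw [ih, if_neg (not_le.2 h), add_zero]

lemma rs_sum (g : ℕ → Ω → ℝ) (K : ℝ) (o : Ω) (N : ℕ) :
    rs g K N o = ∑ i ∈ Finset.range N, (if |rs g K i o| ≤ K then g i o else 0) := by
  induction N with
  | zero => simp [rs]
  | succ N ih => rw [Finset.sum_range_succ, ← ih]; rfl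

lemma rs_meas {g : ℕ → Ω → ℝ} {n : ℕ} (hg : ∀ i, StronglyMeasurable[Γ (gp n (i+1))] (g i)) (K : ℝ) (i : ℕ) :
    StronglyMeasurable[Γ (gp n i)] (rs g K i) := by
  induction i with
  | zero => exact stronglyMeasurable_const
  | succ i ih =>
    have h := ih.mono (Γ.mono (gp_mono n i.le_succ))
    have hs : MeasurableSet[Γ (gp n (i+1))] {o | |rs g K i o| ≤ K} := by
      have h1 : Measurable[Γ (gp n (i+1))] (rs g K i) := h.measurable
      exact (continuous_abs.measurable.comp h1) measurableSet_Iic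
    exact h.add (StronglyMeasurable.ite hs (hg i) stronglyMeasurable_const)

/-- increments bounded by `κ` -/
def IB (P : Measure Ω) [IsProbabilityMeasure P] (Γ : Filtration ℝ m) (n : ℕ) (κ : ℝ) (f : Lp ℝ 2 P) : Prop :=
  ∀ i < 2^n, ∀ᵐ o ∂P, |dl P Γ n i f o| ≤ κ

/-- honest version of `dl` -/
def dlf (P : Measure Ω) (Γ : Filtration ℝ m) (n i : ℕ) (f : Ω → ℝ) : Ω → ℝ :=
  fun o => (P[f|Γ (gp n (i+1))]) o - (P[f|Γ (gp n i)]) o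

lemma dlf_sm (n i : ℕ) (f : Ω → ℝ) : StronglyMeasurable[Γ (gp n (i+1))] (dlf P Γ n i f) :=
  stronglyMeasurable_condExp.sub (stronglyMeasurable_condExp.mono (Γ.mono (gp_mono n i.le_succ)))

lemma dl_ae (n i : ℕ) (f : Lp ℝ 2 P) : dl P Γ n i f =ᵐ[P] dlf P Γ n i f := by
  have h : dl P Γ n i f = ceF P Γ (gp n (i+1)) f - ceF P Γ (gp n i) f := by simp [dl]
  rw [h]
  filter_upwards [Lp.coeFn_sub (ceF P Γ (gp n (i+1)) f) (ceF P Γ (gp n i) f),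
    ceL_ae (Γ.le (gp n (i+1))) f, ceL_ae (Γ.le (gp n i)) f] with o a b c
  rw [a, Pi.sub_apply, dlf, ceF, ceF, b, c]

lemma dlf_congr {f g : Ω → ℝ} (h : f =ᵐ[P] g) (n i : ℕ) : dlf P Γ n i f =ᵐ[P] dlf P Γ n i g := by
  filter_upwards [condExp_congr_ae (m := Γ (gp n (i+1))) h, condExp_congr_ae (m := Γ (gp n i)) h] with o a b
  simp [dlf, a, b]

lemma dlf_bdd {f : Ω → ℝ} {c : ℝ} (h : ∀ᵐ o ∂P, |f o| ≤ c) (n i : ℕ) : ∀ᵐ o ∂P, |dlf P Γ n i f o| ≤ 2 * c := by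
  filter_upwards [mp_bdd (Γ := Γ) h (gp n (i+1)), mp_bdd (Γ := Γ) h (gp n i)] with o a b
  have := abs_sub (mp P Γ f (gp n (i+1)) o) (mp P Γ f (gp n i) o)
  simp only [dlf]
  simp only [mp] at *
  linarith

lemma sum_dl_sq (n : ℕ) (f : Lp ℝ 2 P) :
    ∑ i ∈ Finset.range (2^n), ∫ o, dl P Γ n i f o * dl P Γ n i f o ∂P ≤ ‖f‖^2 := by
  have := T_one_normsq (Γ := Γ) n f
  rw [T_inner (Ad.const 1)] at this
  simpa using this

/-- grid index -/
def ix (n : ℕ) (u : ℝ) : ℕ := ⌊u * 2^n⌋.toNat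

lemma ix_gp (n i : ℕ) : ix n (gp n i) = i := by
  unfold ix gp
  rw [div_mul_cancel₀ _ (by positivity)]; simp

lemma ix_fl (n : ℕ) (u : ℝ) : ix n (fl n u) = ix n u := by
  unfold ix fl
  rw [div_mul_cancel₀ _ (by positivity)]; simp

lemma gp_ix {n : ℕ} {u : ℝ} (hu : 0 ≤ u) : gp n (ix n u) = fl n u := by
  unfold ix gp fl
  have : 0 ≤ ⌊u * 2^n⌋ := Int.floor_nonneg.2 (by positivity)
  congr 1
  have h := Int.toNat_of_nonneg this
  exact_mod_cast h

lemma ix_neg {n : ℕ} {u : ℝ} (hu : u < 0) : ix n u = 0 := by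
  unfold ix
  apply Int.toNat_of_nonpos
  have : u * 2^n < 0 := by nlinarith [pow_pos (two_pos (α := ℝ)) n]
  exact Int.floor_nonpos this.le

/-- the elementary set of a discrete adapted family of events -/
lemma A0_of_grid (n : ℕ) (D : ℕ → Set Ω) (hD : ∀ i, MeasurableSet[Γ (gp n i)] (D i))
    (h0 : D 0 = univ) : {x : ℝ × Ω | x.2 ∈ D (ix n x.1)} ∈ A0 Γ := by
  refine ⟨⟨n, fun u o => by simp [ix_fl]⟩, fun u => ?_⟩
  by_cases hu : 0 ≤ u
  · have h := Γ.mono (fl_le n u)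
    rw [← gp_ix hu] at h
    exact h _ (hD (ix n u))
  · simp [ix_neg (not_le.1 hu), h0]

variable (P Γ) in
/-- `u^n(X)` -/
def un (z : Ω → ℝ) (n : ℕ) (X : Ω → ℝ) : Lp ℝ 2 P :=
  T P Γ n (mp P Γ z) (tL P X) - T P Γ n (mp P Γ X) (tL P z)

lemma stepA {z : Ω → ℝ} (hz : MemLp z ∞ P) {c : ℝ} (hc0 : 0 ≤ c) (hc : ∀ᵐ o ∂P, |z o| ≤ c)
    (N : Lp ℝ 2 P) (n : ℕ) {κ : ℝ} (hκ : 0 ≤ κ) (hN : IB P Γ n κ N) {K : ℝ} (hK : 0 < K) :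
    ∃ C ∈ A0 Γ, (∀ u o, (u, o) ∈ C ↔ (fl n u, o) ∈ C) ∧ ∃ G : Ω → ℝ, MemLp G ∞ P ∧
      (∀ᵐ o ∂P, |G o| ≤ K + 3 * c * κ) ∧
      (∀ X, MemLp X ∞ P → ∫ o, G o * X o ∂P = inner ℝ (pB P Γ C N) (un P Γ z n X)) ∧
      ∃ E, MeasurableSet E ∧ P.real E * K ≤ c * ‖N‖ + (‖N‖^2 + ‖tL P z‖^2) / 2 ∧
      ∀ f, ‖T P Γ n (fun _ _ => 1) f - pB P Γ C f‖ ≤ ‖mulL P (E.indicator fun _ => (1:ℝ)) f‖ := by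
  set h : ℕ → Ω → ℝ := fun i o => dlf P Γ n i N o * dlf P Γ n i z o with hh
  set g : ℕ → Ω → ℝ := fun i o => mp P Γ z (gp n i) o * dlf P Γ n i N o - (P[h i|Γ (gp n i)]) o with hg
  have hgm : ∀ i, StronglyMeasurable[Γ (gp n (i+1))] (g i) := fun i =>
    (((stronglyMeasurable_condExp.mono (Γ.mono (gp_mono n i.le_succ))).mul (dlf_sm n i N)).sub
      (stronglyMeasurable_condExp.mono (Γ.mono (gp_mono n i.le_succ))))
  have hνb : ∀ i < 2^n, ∀ᵐ o ∂P, |dlf P Γ n i N o| ≤ κ := fun i hi => by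
    filter_upwards [hN i hi, dl_ae (Γ := Γ) n i N] with o a b; rwa [b] at a
  have hhb : ∀ i < 2^n, ∀ᵐ o ∂P, |h i o| ≤ κ * (2 * c) := fun i hi => by
    filter_upwards [hνb i hi, dlf_bdd (Γ := Γ) hc n i] with o a b
    simp only [hh, abs_mul]; gcongr
  have hhm : ∀ i, StronglyMeasurable (h i) := fun i =>
    (((dlf_sm n i N).mul (dlf_sm n i z)).mono (Γ.le _))
  have hhL : ∀ i < 2^n, MemLp (h i) ∞ P := fun i hi =>
    memLp_top_of_bound (hhm i).aestronglyMeasurable _ (hhb i hi)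
  have hgb : ∀ i < 2^n, ∀ᵐ o ∂P, |g i o| ≤ 3 * c * κ := fun i hi => by
    filter_upwards [hνb i hi, mp_bdd (Γ := Γ) hc (gp n i), mp_bdd (Γ := Γ) (hhb i hi) (gp n i)] with o a b d
    have h1 : |mp P Γ z (gp n i) o * dlf P Γ n i N o| ≤ c * κ := by rw [abs_mul]; gcongr
    have h2 := abs_sub (mp P Γ z (gp n i) o * dlf P Γ n i N o) (mp P Γ (h i) (gp n i) o)
    simp only [hg]
    simp only [mp] at *
    linarith
  have hrm := rs_meas hgm K
  set D : ℕ → Set Ω := fun i => {o | |rs g K i o| ≤ K} with hD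
  have hDm : ∀ i, MeasurableSet[Γ (gp n i)] (D i) := fun i => by
    have h1 : Measurable[Γ (gp n i)] (rs g K i) := (hrm i).measurable
    exact (continuous_abs.measurable.comp h1) measurableSet_Iic
  have hD0 : D 0 = univ := by ext o; simp [hD, rs, hK.le]
  set C : Set (ℝ × Ω) := {x : ℝ × Ω | x.2 ∈ D (ix n x.1)} with hC
  have hCA : C ∈ A0 Γ := A0_of_grid n D hDm hD0
  have hCl : ∀ u o, (u, o) ∈ C ↔ (fl n u, o) ∈ C := fun u o => by simp [hC, ix_fl]
  have hCiq : ∀ i o, iq C (gp n i) o = if |rs g K i o| ≤ K then 1 else 0 := fun i o => by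
    simp only [iq, hC, mem_setOf_eq, ix_gp, indicator, hD]
  have hCad : Ad P Γ (iq C) := iq_ad hCA.2
  set G := rs g K (2^n) with hG
  have hGm : StronglyMeasurable G := (hrm (2^n)).mono (Γ.le _)
  have hGb : ∀ᵐ o ∂P, |G o| ≤ K + 3 * c * κ := by
    have : ∀ᵐ o ∂P, ∀ i < 2^n, |g i o| ≤ 3 * c * κ := by
      rw [ae_all_iff]; intro i
      by_cases hi : i < 2^n
      · filter_upwards [hgb i hi] with o a _ using a
      · exact Eventually.of_forall fun o h => absurd h hi
    filter_upwards [this] with o a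
    exact rs_bound g hK.le (by positivity) o _ a
  have hGL : MemLp G ∞ P := memLp_top_of_bound hGm.aestronglyMeasurable _ hGb
  -- expansion of G
  have hGsum : ∀ o, G o = ∑ i ∈ Finset.range (2^n), iq C (gp n i) o * g i o := fun o => by
    rw [hG, rs_sum]
    refine Finset.sum_congr rfl fun i _ => ?_
    rw [hCiq]; split_ifs <;> simp
  have hT1 : T P Γ n (fun u o => iq C u o * mp P Γ z u o) N =ᵐ[P]
      fun o => ∑ i ∈ Finset.range (2^n), iq C (gp n i) o * (mp P Γ z (gp n i) o * dlf P Γ n i N o) := by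
    rw [T_apply]
    have h1 : ∀ᵐ o ∂P, ∀ i, mulL P (fun o => iq C (gp n i) o * mp P Γ z (gp n i) o) (dl P Γ n i N) o
        = iq C (gp n i) o * (mp P Γ z (gp n i) o * dlf P Γ n i N o) := by
      rw [ae_all_iff]; intro i
      filter_upwards [mulL_ae ((hCad.mul (mp_ad hz)).bd (gp n i)) (dl P Γ n i N), dl_ae (Γ := Γ) n i N] with o a b
      rw [a, b]; ring
    filter_upwards [Lp_sum_ae P (Finset.range (2^n))
      (fun i => mulL P (fun o => iq C (gp n i) o * mp P Γ z (gp n i) o) (dl P Γ n i N)), h1] with o a b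
    rw [a]
    exact Finset.sum_congr rfl fun i _ => b i
  have hGae : G =ᵐ[P] fun o => T P Γ n (fun u o => iq C u o * mp P Γ z u o) N o
      - ∑ i ∈ Finset.range (2^n), iq C (gp n i) o * (P[h i|Γ (gp n i)]) o := by
    filter_upwards [hT1] with o a
    rw [a, hGsum, ← Finset.sum_sub_distrib]
    refine Finset.sum_congr rfl fun i _ => ?_
    simp only [hg]; ring
  have hceL : ∀ i < 2^n, MemLp (fun o => (P[h i|Γ (gp n i)]) o) ∞ P := fun i hi => (mp_ad (hhL i hi)).bd _
  have hCce : ∀ i < 2^n, MemLp (fun o => iq C (gp n i) o * (P[h i|Γ (gp n i)]) o) ∞ P := fun i hi =>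
    (hceL i hi).mul (hCad.bd _)
  refine ⟨C, hCA, hCl, G, hGL, hGb, ?_, {o | K < |G o|}, ?_, ?_, ?_⟩
  · intro X hX
    have hXad := mp_ad (Γ := Γ) hX
    have hXint : ∀ {φ : Ω → ℝ}, MemLp φ ∞ P → Integrable (fun o => φ o * X o) P := fun hφ =>
      top_int (hX.mul hφ)
    have e1 : ∫ o, G o * X o ∂P = inner ℝ (T P Γ n (fun u o => iq C u o * mp P Γ z u o) N) (tL P X)
        - ∑ i ∈ Finset.range (2^n), ∫ o, (iq C (gp n i) o * (P[h i|Γ (gp n i)]) o) * X o ∂P := by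
      rw [inner_eq, ← integral_finsetSum, ← integral_sub]
      · apply integral_congr_ae
        filter_upwards [hGae, tL_ae hX] with o a b
        rw [a, b, sub_mul, Finset.sum_mul]
      · exact int_mul _ _
      · exact integrable_finsetSum _ fun i hi => hXint (hCce i (Finset.mem_range.1 hi))
      · exact fun i hi => hXint (hCce i (Finset.mem_range.1 hi))
    have e2 : inner ℝ (pB P Γ C N) (un P Γ z n X) =
        inner ℝ (T P Γ n (fun u o => iq C u o * mp P Γ z u o) N) (tL P X)
        - inner ℝ (T P Γ n (fun u o => iq C u o * mp P Γ X u o) N) (tL P z) := by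
      rw [pB_eq hCl, un, inner_sub_right, ← T_sa (mp_ad hz), ← T_sa hXad, T_mul (mp_ad hz) hCad,
        T_mul hXad hCad]
      simp only [mul_comm]
    rw [e1, e2, T_inner (hCad.mul hXad)]
    congr 1
    refine Finset.sum_congr rfl fun i hi => ?_
    have hi' := Finset.mem_range.1 hi
    have hCX : MemLp (fun o => iq C (gp n i) o * X o) ∞ P := hX.mul (hCad.bd _)
    have s1 : ∫ o, (iq C (gp n i) o * (P[h i|Γ (gp n i)]) o) * X o ∂P =
        inner ℝ (ceF P Γ (gp n i) (tL P (h i))) (tL P (fun o => iq C (gp n i) o * X o)) := by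
      rw [inner_eq]
      apply integral_congr_ae
      filter_upwards [ceL_ae (Γ.le (gp n i)) (tL P (h i)), tL_ae hCX,
        condExp_congr_ae (m := Γ (gp n i)) (tL_ae (hhL i hi'))] with o a b d
      rw [ceF, a, b, d]; ring
    rw [s1, ceF, ceL_sa, inner_eq]
    apply integral_congr_ae
    have hpull := condExp_mul_of_stronglyMeasurable_left (μ := P) (m := Γ (gp n i)) (f := iq C (gp n i)) (g := X)
      (hCad.sm _) (top_int hCX) (top_int hX)
    filter_upwards [ceL_ae (Γ.le (gp n i)) (tL P (fun o => iq C (gp n i) o * X o)), tL_ae (hhL i hi'),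
      condExp_congr_ae (m := Γ (gp n i)) (tL_ae hCX), hpull, dl_ae (Γ := Γ) n i N,
      dl_ae (Γ := Γ) n i (tL P z), dlf_congr (Γ := Γ) (tL_ae hz) n i] with o a b d e p1 p2 p3
    rw [a, b, d, p1, p2, p3]
    have e' : (P[fun o => iq C (gp n i) o * X o | Γ (gp n i)]) o = iq C (gp n i) o * (P[X|Γ (gp n i)]) o := e
    rw [e']
    simp only [hh, mp]; ring
  · exact measurableSet_lt measurable_const (continuous_abs.measurable.comp hGm.measurable)
  · have m1 := mul_meas_ge_le_integral_of_nonneg (μ := P) (f := fun o => |G o|)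
      (Eventually.of_forall fun o => abs_nonneg _) (top_int hGL).abs K
    have m2 : P.real {o | K < |G o|} ≤ P.real {o | K ≤ |G o|} :=
      measureReal_mono fun o (hω : K < |G o|) => hω.le
    have hTint : Integrable (fun o => |T P Γ n (fun u o => iq C u o * mp P Γ z u o) N o|) P := (int_of_L2 _).abs
    have hAint : ∀ i < 2^n, Integrable (fun o => |(P[h i|Γ (gp n i)]) o|) P := fun i hi => integrable_condExp.abs
    have m3 : ∫ o, |G o| ∂P ≤ ∫ o, |T P Γ n (fun u o => iq C u o * mp P Γ z u o) N o| ∂P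
        + ∑ i ∈ Finset.range (2^n), ∫ o, |(P[h i|Γ (gp n i)]) o| ∂P := by
      rw [← integral_finsetSum _ fun i hi => hAint i (Finset.mem_range.1 hi), ← integral_add hTint
        (integrable_finsetSum _ fun i hi => hAint i (Finset.mem_range.1 hi))]
      refine integral_mono_ae (top_int hGL).abs (hTint.add
        (integrable_finsetSum _ fun i hi => hAint i (Finset.mem_range.1 hi))) ?_
      filter_upwards [hGae] with o a
      simp only [a]
      refine (abs_sub _ _).trans (add_le_add le_rfl ?_)
      refine (Finset.abs_sum_le_sum_abs _ _).trans (Finset.sum_le_sum fun i _ => ?_)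
      rw [abs_mul, hCiq]
      split_ifs <;> simp
    have m4 : ∫ o, |T P Γ n (fun u o => iq C u o * mp P Γ z u o) N o| ∂P ≤ c * ‖N‖ := by
      have hle : ‖T P Γ n (fun u o => iq C u o * mp P Γ z u o) N‖ ≤ c * ‖N‖ := by
        refine T_norm_le (hCad.mul (mp_ad hz)) n hc0 (fun i hi => ?_) N
        filter_upwards [mp_bdd (Γ := Γ) hc (gp n i)] with o a
        rw [abs_mul, hCiq]
        split_ifs <;> simp [a, hc0]
      refine le_trans ?_ hle
      set F := T P Γ n (fun u o => iq C u o * mp P Γ z u o) N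
      have h2 := eLpNorm_le_eLpNorm_of_exponent_le (p := 1) (q := 2) (by norm_num) (Lp.aestronglyMeasurable F)
      rw [Lp.norm_def]
      have h3 : ∫ o, |F o| ∂P = (eLpNorm F 1 P).toReal := by
        rw [eLpNorm_one_eq_lintegral_enorm, ← integral_norm_eq_lintegral_enorm (Lp.aestronglyMeasurable F)]
        rfl
      rw [h3]
      exact ENNReal.toReal_mono (Lp.memLp F).2.ne h2
    have m5 : ∑ i ∈ Finset.range (2^n), ∫ o, |(P[h i|Γ (gp n i)]) o| ∂P ≤ (‖N‖^2 + ‖tL P z‖^2) / 2 := by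
      have h1 := sum_dl_sq (Γ := Γ) n N
      have h2 := sum_dl_sq (Γ := Γ) n (tL P z)
      have h3 : ∀ i ∈ Finset.range (2^n), ∫ o, |(P[h i|Γ (gp n i)]) o| ∂P ≤
          ((∫ o, dl P Γ n i N o * dl P Γ n i N o ∂P) +
          ∫ o, dl P Γ n i (tL P z) o * dl P Γ n i (tL P z) o ∂P) / 2 := by
        intro i hi
        refine (integral_abs_condExp_le (h i)).trans ?_
        rw [← integral_add (int_mul _ _) (int_mul _ _), ← integral_div]
        refine integral_mono_ae (top_int (hhL i (Finset.mem_range.1 hi))).abs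
          (((int_mul _ _).add (int_mul _ _)).div_const 2) ?_
        filter_upwards [dl_ae (Γ := Γ) n i N, dl_ae (Γ := Γ) n i (tL P z), dlf_congr (Γ := Γ) (tL_ae hz) n i] with o p1 p2 p3
        simp only [hh, p1, p2, p3, abs_mul]
        nlinarith [sq_nonneg (|dlf P Γ n i N o| - |dlf P Γ n i z o|), sq_abs (dlf P Γ n i N o),
          sq_abs (dlf P Γ n i z o)]
      refine (Finset.sum_le_sum h3).trans ?_
      rw [← Finset.sum_div, Finset.sum_add_distrib]
      linarith
    have := mul_le_mul_of_nonneg_right m2 hK.le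
    linarith
  · intro f
    rw [pB_eq hCl, ← T_sub (Ad.const 1) hCad]
    refine tail_lemma ((Ad.const 1).sub hCad) n _
      (measurableSet_lt measurable_const (continuous_abs.measurable.comp hGm.measurable)) ?_ ?_ f
    · intro i hi o; rw [hCiq]; split_ifs <;> simp
    · intro i hi o; rw [hCiq]
      split_ifs with h1
      · simp
      · intro _
        show K < |rs g K (2^n) o|
        rw [rs_halt g o hi.le (not_le.1 h1)]; exact not_le.1 h1

lemma weak_cluster {H : Type*} [NormedAddCommGroup H] [InnerProductSpace ℝ H] [CompleteSpace H]
    (g : ℕ → H) {b : ℝ} (hb : ∀ j, ‖g j‖ ≤ b) (𝔘 : Ultrafilter ℕ) :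
    ∃ G : H, ∀ x, Tendsto (fun j => inner ℝ (g j) x) 𝔘 (nhds (inner ℝ G x)) := by
  have hc := WeakDual.isCompact_closedBall (𝕜 := ℝ) (E := H) 0 b
  set φ : ℕ → WeakDual ℝ H := fun j => StrongDual.toWeakDual (InnerProductSpace.toDual ℝ H (g j)) with hφ
  obtain ⟨a, _, ha⟩ := hc.ultrafilter_le_nhds (𝔘.map φ) (by
    rw [Ultrafilter.coe_map, le_principal_iff]
    refine Filter.mem_map.2 (Filter.univ_mem' fun j => ?_)
    simp only [mem_preimage, mem_closedBall_zero_iff]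
    show ‖InnerProductSpace.toDual ℝ H (g j)‖ ≤ b
    simpa using hb j)
  refine ⟨(InnerProductSpace.toDual ℝ H).symm (WeakDual.toStrongDual a), fun x => ?_⟩
  have h1 : Tendsto φ 𝔘 (nhds a) := ha
  have h2 := ((WeakDual.eval_continuous (𝕜 := ℝ) x).tendsto a).comp h1
  rw [InnerProductSpace.toDual_symm_apply]
  exact h2

lemma norm_tL_le {M : Ω → ℝ} (hM : MemLp M ∞ P) {b : ℝ} (hb0 : 0 ≤ b) (hb : ∀ᵐ o ∂P, |M o| ≤ b) : ‖tL P M‖ ≤ b := by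
  have := Lp.norm_le_of_ae_bound (f := tL P M) (p := 2) hb0 (by
    filter_upwards [tL_ae hM, hb] with o a b
    rw [a]; exact b)
  simpa [measureUnivNNReal] using this

lemma weak_bdd (G : ℕ → Ω → ℝ) (hG : ∀ j, MemLp (G j) ∞ P) {b : ℝ} (hb0 : 0 ≤ b) (hb : ∀ j, ∀ᵐ o ∂P, |G j o| ≤ b)
    (𝔘 : Ultrafilter ℕ) : ∃ G' : Ω → ℝ, MemLp G' ∞ P ∧ ∀ X, MemLp X ∞ P →
      Tendsto (fun j => ∫ o, G j o * X o ∂P) 𝔘 (nhds (∫ o, G' o * X o ∂P)) := by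
  obtain ⟨g, hg⟩ := weak_cluster (fun j => tL P (G j)) (fun j => norm_tL_le (hG j) hb0 (hb j)) 𝔘
  have key : ∀ X, MemLp X ∞ P → Tendsto (fun j => ∫ o, G j o * X o ∂P) 𝔘 (nhds (∫ o, g o * X o ∂P)) := by
    intro X hX
    have h1 := hg (tL P X)
    have e : ∫ o, g o * X o ∂P = inner ℝ g (tL P X) := by
      rw [inner_eq]; apply integral_congr_ae
      filter_upwards [tL_ae hX] with o a; rw [a]
    rw [e]
    refine h1.congr fun j => ?_
    rw [inner_eq]; apply integral_congr_ae
    filter_upwards [tL_ae hX, tL_ae (hG j)] with o a b; rw [a, b]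
  have hset : ∀ (f : Ω → ℝ) (A : Set Ω), MeasurableSet A → ∫ o in A, f o ∂P = ∫ o, f o * A.indicator (fun _ => (1:ℝ)) o ∂P := by
    intro f A hA
    rw [← integral_indicator hA]; congr 1; ext o; by_cases h : o ∈ A <;> simp [h]
  have hub : (g : Ω → ℝ) ≤ᵐ[P] fun _ => b := by
    refine ae_le_of_forall_setIntegral_le (int_of_L2 g) (integrable_const b) fun A hA _ => ?_
    have h1 := key (A.indicator fun _ => 1) ((memLp_const 1).indicator hA)
    rw [hset g A hA]
    refine le_of_tendsto h1 (Eventually.of_forall fun j => ?_)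
    rw [← hset _ A hA]
    refine integral_mono_ae (top_int (hG j)).integrableOn (integrable_const b) (ae_restrict_of_ae ?_)
    filter_upwards [hb j] with o a using (le_abs_self _).trans a
  have hlb : (fun _ => -b) ≤ᵐ[P] (g : Ω → ℝ) := by
    refine ae_le_of_forall_setIntegral_le (integrable_const _) (int_of_L2 g) fun A hA _ => ?_
    have h1 := key (A.indicator fun _ => 1) ((memLp_const 1).indicator hA)
    rw [hset g A hA]
    refine ge_of_tendsto h1 (Eventually.of_forall fun j => ?_)
    rw [← hset _ A hA]
    refine integral_mono_ae (integrable_const _) (top_int (hG j)).integrableOn (ae_restrict_of_ae ?_)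
    filter_upwards [hb j] with o a using (abs_le.1 a).1
  refine ⟨g, memLp_top_of_bound (Lp.aestronglyMeasurable g) b ?_, key⟩
  filter_upwards [hub, hlb] with o a b
  exact abs_le.2 ⟨b, a⟩

lemma condExp_pos_of {m' : MeasurableSpace Ω} (hm : m' ≤ m) {z : Ω → ℝ} (hz : Integrable z P) (hpos : ∀ᵐ o ∂P, 0 < z o) :
    ∀ᵐ o ∂P, 0 < (P[z|m']) o := by
  set A := {o | (P[z|m']) o ≤ 0} with hA
  have hAm : MeasurableSet[m'] A := by
    have h1 : Measurable[m'] (P[z|m']) := stronglyMeasurable_condExp.measurable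
    exact h1 measurableSet_Iic
  have h1 := setIntegral_condExp hm hz hAm
  have h2 : ∫ o in A, (P[z|m']) o ∂P ≤ 0 := setIntegral_nonpos (hm _ hAm) fun o h => h
  have h3 : 0 ≤ᵐ[P.restrict A] z := ae_restrict_of_ae (hpos.mono fun o h => h.le)
  have h4 : ∫ o in A, z o ∂P = 0 := le_antisymm (h1 ▸ h2) (integral_nonneg_of_ae h3)
  rw [setIntegral_eq_zero_iff_of_nonneg_ae h3 hz.integrableOn] at h4
  have h5 : ∀ᵐ o ∂P, o ∈ A → z o = 0 := by
    have := (ae_restrict_iff' (hm _ hAm)).1 h4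
    exact this
  filter_upwards [h5, hpos] with o a b
  by_contra! h
  exact b.ne' (a h)

lemma fl_ge_iff (k i : ℕ) (u : ℝ) : gp k i ≤ u ↔ gp k i ≤ fl k u := by
  refine ⟨fun h => ?_, fun h => h.trans (fl_le k u)⟩
  unfold gp fl at *
  rw [div_le_iff₀ (by positivity)] at h
  have : (i : ℤ) ≤ ⌊u * 2^k⌋ := Int.le_floor.2 (by exact_mod_cast h)
  have h2 : (i : ℝ) ≤ (⌊u * 2^k⌋ : ℝ) := by exact_mod_cast this
  gcongr

lemma gp_next {k n i₀ i : ℕ} (hn : k ≤ n) (h : gp n i < gp k i₀) : gp n (i+1) ≤ gp k i₀ := by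
  obtain ⟨d, rfl⟩ := Nat.exists_eq_add_of_le hn
  rw [← gp_add k d i₀] at *
  apply gp_mono
  by_contra! h1
  exact absurd (gp_mono (k+d) (Nat.lt_succ_iff.1 h1)) (not_le.2 h)

variable (P Γ) in
/-- uniqueness hypothesis, in linear form -/
def Uq {ι : Type*} (z : Ω → ℝ) (y : ι → Ω → ℝ) : Prop :=
  ∀ G, MemLp G ∞ P → ∫ o, G o * z o ∂P = 0 →
    (∀ k i, i < 2^k → ∀ A, MeasurableSet[Γ (gp k i)] A → ∀ l,
      (∃ c, ∀ o ∈ A, |mp P Γ (y l) (gp k i) o / mp P Γ z (gp k i) o| ≤ c) →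
      ∫ o, G o * A.indicator (fun o => y l o - mp P Γ (y l) (gp k i) o / mp P Γ z (gp k i) o * z o) o ∂P = 0) →
    G =ᵐ[P] 0

/-- the test variables produce elements of the module -/
lemma un_test {z y : Ω → ℝ} (hz : MemLp z ∞ P) (hpos : ∀ᵐ o ∂P, 0 < z o) (hy : MemLp y ∞ P) {k i₀ n : ℕ} (hn : k ≤ n)
    {A : Set Ω} (hA : MeasurableSet[Γ (gp k i₀)] A) {c : ℝ}
    (hc : ∀ o ∈ A, |mp P Γ y (gp k i₀) o / mp P Γ z (gp k i₀) o| ≤ c) :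
    MemLp (A.indicator (fun o => y o - mp P Γ y (gp k i₀) o / mp P Γ z (gp k i₀) o * z o)) ∞ P ∧
    ∃ B ∈ A0 Γ, (∀ u o, (u, o) ∈ B ↔ (fl n u, o) ∈ B) ∧
    un P Γ z n (A.indicator (fun o => y o - mp P Γ y (gp k i₀) o / mp P Γ z (gp k i₀) o * z o)) =
      T P Γ n (iq B) (un P Γ z n y) := by
  set s := gp k i₀ with hs
  set σ : Ω → ℝ := fun o => mp P Γ y s o / mp P Γ z s o with hσ
  set α : Ω → ℝ := A.indicator (fun _ => 1) with hα
  set β : Ω → ℝ := A.indicator σ with hβ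
  have hσm : StronglyMeasurable[Γ s] σ := by
    have h1 : Measurable[Γ s] (mp P Γ y s) := stronglyMeasurable_condExp.measurable
    have h2 : Measurable[Γ s] (mp P Γ z s) := stronglyMeasurable_condExp.measurable
    exact (h1.div h2).stronglyMeasurable
  have hαm : StronglyMeasurable[Γ s] α := stronglyMeasurable_const.indicator hA
  have hβm : StronglyMeasurable[Γ s] β := hσm.indicator hA
  have hαL : MemLp α ∞ P := (memLp_const 1).indicator (Γ.le _ _ hA)
  have hβL : MemLp β ∞ P := by
    refine memLp_top_of_bound (hβm.mono (Γ.le s)).aestronglyMeasurable |c| (Eventually.of_forall fun o => ?_)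
    by_cases h : o ∈ A
    · simp only [hβ, indicator_of_mem h]; exact (hc o h).trans (le_abs_self c)
    · simp [hβ, h]
  set X : Ω → ℝ := A.indicator (fun o => y o - σ o * z o) with hX
  have hXe : X = (fun o => α o * y o - β o * z o) := by
    ext o; by_cases h : o ∈ A <;> simp [hX, hα, hβ, h]
  have hαy : MemLp (fun o => α o * y o) ∞ P := hy.mul hαL
  have hβz : MemLp (fun o => β o * z o) ∞ P := hz.mul hβL
  have hXL : MemLp X ∞ P := by rw [hXe]; exact hαy.sub hβz
  have hXge : ∀ u, s ≤ u → mp P Γ X u =ᵐ[P] fun o => α o * mp P Γ y u o - β o * mp P Γ z u o := by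
    intro u hu
    have h0 := condExp_sub (m := Γ u) (top_int hαy) (top_int hβz)
    have h1 := condExp_mul_of_stronglyMeasurable_left (μ := P) (m := Γ u) (f := α) (g := y) (hαm.mono (Γ.mono hu))
      (top_int hαy) (top_int hy)
    have h2 := condExp_mul_of_stronglyMeasurable_left (μ := P) (m := Γ u) (f := β) (g := z) (hβm.mono (Γ.mono hu))
      (top_int hβz) (top_int hz)
    filter_upwards [h0, h1, h2] with o a b d
    have e : mp P Γ X u o = (P[(fun o => α o * y o) - fun o => β o * z o|Γ u]) o := by rw [mp, hXe]; rfl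
    rw [e, a, Pi.sub_apply]
    have b' : (P[fun o => α o * y o|Γ u]) o = α o * (P[y|Γ u]) o := b
    have d' : (P[fun o => β o * z o|Γ u]) o = β o * (P[z|Γ u]) o := d
    rw [b', d']; rfl
  have hXs : mp P Γ X s =ᵐ[P] 0 := by
    filter_upwards [hXge s le_rfl, condExp_pos_of (Γ.le s) (top_int hz) hpos] with o a b
    rw [a]
    have b' : mp P Γ z s o ≠ 0 := b.ne'
    by_cases h : o ∈ A
    · simp only [hα, hβ, hσ, indicator_of_mem h]; field_simp; simp
    · simp [hα, hβ, h]
  have hXle : ∀ u, u ≤ s → mp P Γ X u =ᵐ[P] 0 := by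
    intro u hu
    have h1 := condExp_condExp_of_le (μ := P) (f := X) (Γ.mono hu) (Γ.le s)
    have h2 := condExp_congr_ae (m := Γ u) hXs
    have h3 : P[(0 : Ω → ℝ)|Γ u] = 0 := condExp_zero
    rw [h3] at h2
    exact h1.symm.trans h2
  refine ⟨hXL, {x | s ≤ x.1 ∧ x.2 ∈ A}, ⟨⟨k, fun u o => ?_⟩, fun u => ?_⟩, ?_, ?_⟩
  · have := fl_ge_iff k i₀ u
    simp only [mem_setOf_eq]; rw [this]
  · by_cases h : s ≤ u
    · simp only [mem_setOf_eq, h, true_and]; exact Γ.mono h _ hA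
    · simp [h]
  · intro u o
    have h1 := fl_ge_iff k i₀ u
    have h2 := fl_ge_iff k i₀ (fl n u)
    rw [fl_fl' hn] at h2
    simp only [mem_setOf_eq]; rw [hs, h1, h2]
  · have hyad := mp_ad (Γ := Γ) hy
    have hzad := mp_ad (Γ := Γ) hz
    have hXad := mp_ad (Γ := Γ) hXL
    set B : Set (ℝ × Ω) := {x | s ≤ x.1 ∧ x.2 ∈ A} with hB
    have hBad : Ad P Γ (iq B) := iq_ad fun u => by
      by_cases h : s ≤ u
      · simp only [hB, mem_setOf_eq, h, true_and]; exact Γ.mono h _ hA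
      · simp [hB, h]
    rw [un, un, T_apply Γ n (iq B), T_apply, T_apply, ← Finset.sum_sub_distrib]
    refine Finset.sum_congr rfl fun i hi => ?_
    have hi' := Finset.mem_range.1 hi
    rw [map_sub (dl P Γ n i), dl_T hzad n hi', dl_T hyad n hi']
    apply Lp.ext
    filter_upwards [Lp.coeFn_sub (mulL P (mp P Γ z (gp n i)) (dl P Γ n i (tL P X)))
        (mulL P (mp P Γ X (gp n i)) (dl P Γ n i (tL P z))),
      mulL_ae (hzad.bd (gp n i)) (dl P Γ n i (tL P X)), mulL_ae (hXad.bd (gp n i)) (dl P Γ n i (tL P z)),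
      mulL_ae (hBad.bd (gp n i)) (mulL P (mp P Γ z (gp n i)) (dl P Γ n i (tL P y)) -
        mulL P (mp P Γ y (gp n i)) (dl P Γ n i (tL P z))),
      Lp.coeFn_sub (mulL P (mp P Γ z (gp n i)) (dl P Γ n i (tL P y)))
        (mulL P (mp P Γ y (gp n i)) (dl P Γ n i (tL P z))),
      mulL_ae (hzad.bd (gp n i)) (dl P Γ n i (tL P y)), mulL_ae (hyad.bd (gp n i)) (dl P Γ n i (tL P z)),
      dl_ae (Γ := Γ) n i (tL P X), dlf_congr (Γ := Γ) (tL_ae hXL) n i,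
      dl_ae (Γ := Γ) n i (tL P y), dlf_congr (Γ := Γ) (tL_ae hy) n i,
      dl_ae (Γ := Γ) n i (tL P z), dlf_congr (Γ := Γ) (tL_ae hz) n i,
      (show ∀ᵐ o ∂P, s ≤ gp n i → mp P Γ X (gp n i) o = α o * mp P Γ y (gp n i) o - β o * mp P Γ z (gp n i) o from by
        by_cases h : s ≤ gp n i
        · filter_upwards [hXge _ h] with o a _ using a
        · exact Eventually.of_forall fun o h' => absurd h' h),
      (show ∀ᵐ o ∂P, s ≤ gp n i → mp P Γ X (gp n (i+1)) o = α o * mp P Γ y (gp n (i+1)) o - β o * mp P Γ z (gp n (i+1)) o from by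
        by_cases h : s ≤ gp n i
        · filter_upwards [hXge _ (h.trans (gp_mono n i.le_succ))] with o a _ using a
        · exact Eventually.of_forall fun o h' => absurd h' h),
      (show ∀ᵐ o ∂P, ¬ s ≤ gp n i → mp P Γ X (gp n i) o = 0 from by
        by_cases h : s ≤ gp n i
        · exact Eventually.of_forall fun o h' => absurd h h'
        · filter_upwards [hXle _ (not_le.1 h).le] with o a _ using a),
      (show ∀ᵐ o ∂P, ¬ s ≤ gp n i → mp P Γ X (gp n (i+1)) o = 0 from by
        by_cases h : s ≤ gp n i
        · exact Eventually.of_forall fun o h' => absurd h h'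
        · filter_upwards [hXle _ (gp_next hn (not_le.1 h))] with o a _ using a)]
      with o a1 a2 a3 a4 a5 a6 a7 x1 x2 y1 y2 z1 z2 q1 q2 q3 q4
    rw [a1, Pi.sub_apply, a2, a3, a4, a5, Pi.sub_apply, a6, a7, x1, x2, y1, y2, z1, z2]
    have dX : dlf P Γ n i X o = mp P Γ X (gp n (i+1)) o - mp P Γ X (gp n i) o := rfl
    have dy : dlf P Γ n i y o = mp P Γ y (gp n (i+1)) o - mp P Γ y (gp n i) o := rfl
    have dz : dlf P Γ n i z o = mp P Γ z (gp n (i+1)) o - mp P Γ z (gp n i) o := rfl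
    rw [dX, dy, dz]
    by_cases h : s ≤ gp n i
    · have hm : (gp n i, o) ∈ B ↔ o ∈ A := ⟨fun x => x.2, fun x => ⟨h, x⟩⟩
      have : iq B (gp n i) o = α o := by
        by_cases hω : o ∈ A
        · simp only [iq, hα]
          rw [indicator_of_mem (show o ∈ {o | (gp n i, o) ∈ B} from hm.2 hω), indicator_of_mem hω]
        · simp only [iq, hα]
          rw [indicator_of_notMem (show o ∉ {o | (gp n i, o) ∈ B} from fun h' => hω (hm.1 h')),
            indicator_of_notMem hω]
      rw [this, q1 h, q2 h]; ring
    · have hm : (gp n i, o) ∉ B := fun x => h x.1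
      have : iq B (gp n i) o = 0 := by simp only [iq, indicator, mem_setOf_eq, hm, if_false]
      rw [this, q3 h, q4 h]; ring

lemma pB_norm {B : Set (ℝ × Ω)} (hB : B ∈ A0 Γ) (f : Lp ℝ 2 P) : ‖pB P Γ B f‖ ≤ ‖f‖ := by
  have := (WW P Γ).pnorm_le (s := bas Γ B) ⟨B, hB, rfl⟩ f
  rwa [WW_p_bas] at this

lemma pB_sa {B : Set (ℝ × Ω)} (hB : B ∈ A0 Γ) (f g : Lp ℝ 2 P) :
    inner ℝ (pB P Γ B f) g = inner ℝ f (pB P Γ B g) := by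
  have := (WW P Γ).sa (bas Γ B) ⟨B, hB, rfl⟩ f g
  rwa [WW_p_bas] at this

lemma pB_inter {B C : Set (ℝ × Ω)} (hB : B ∈ A0 Γ) (hC : C ∈ A0 Γ) (f : Lp ℝ 2 P) :
    pB P Γ B (pB P Γ C f) = pB P Γ (B ∩ C) f := by
  have := (WW P Γ).inter (bas Γ B) ⟨B, hB, rfl⟩ (bas Γ C) ⟨C, hC, rfl⟩ f
  rwa [bas_inter, WW_p_bas, WW_p_bas, WW_p_bas] at this

lemma A0_inter {B C : Set (ℝ × Ω)} (hB : B ∈ A0 Γ) (hC : C ∈ A0 Γ) : B ∩ C ∈ A0 Γ :=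
  A0_alg.inter_mem hB hC

variable (P Γ) in
/-- limit of `un` -/
def uL (z X : Ω → ℝ) : Lp ℝ 2 P := lim P Γ z (tL P X) - lim P Γ X (tL P z)

lemma un_tendsto {z X : Ω → ℝ} (hz : MemLp z ∞ P) (hX : MemLp X ∞ P) :
    Tendsto (fun n => un P Γ z n X) atTop (nhds (uL P Γ z X)) :=
  (lim_tendsto hz _).sub (lim_tendsto hX _)

lemma T_one_un {z X : Ω → ℝ} (hz : MemLp z ∞ P) (hX : MemLp X ∞ P) (n : ℕ) :
    T P Γ n (fun _ _ => 1) (un P Γ z n X) = un P Γ z n X := by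
  rw [un, map_sub, T_mul (Ad.const 1) (mp_ad hz), T_mul (Ad.const 1) (mp_ad hX)]
  simp

lemma A1 {ι : Type*} {z : Ω → ℝ} (hz : MemLp z ∞ P) (hpos : ∀ᵐ o ∂P, 0 < z o) {y : ι → Ω → ℝ}
    (hy : ∀ l, MemLp (y l) ∞ P) (hU : Uq P Γ z y) (N : ℕ → Lp ℝ 2 P) (lv : ℕ → ℕ) (hlv : Tendsto lv atTop atTop)
    {κ : ℝ} (hκ : 0 ≤ κ) (hIB : ∀ j, IB P Γ (lv j) κ (N j)) (N' : Lp ℝ 2 P) (hN : Tendsto N atTop (nhds N'))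
    (hperp : ∀ B ∈ A0 Γ, ∀ l, inner ℝ (pB P Γ B N') (uL P Γ z (y l)) = 0)
    {X : Ω → ℝ} (hX : MemLp X ∞ P) : inner ℝ N' (uL P Γ z X) = 0 := by
  obtain ⟨c, hc0, hc⟩ : ∃ c : ℝ, 0 ≤ c ∧ ∀ᵐ o ∂P, |z o| ≤ c := ⟨_, ENNReal.toReal_nonneg, bdd_of_top hz⟩
  obtain ⟨b, hb0, hb⟩ : ∃ b : ℝ, 0 ≤ b ∧ ∀ j, ‖N j‖ ≤ b := by
    obtain ⟨b, hb⟩ := hN.norm.bddAbove_range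
    have h : ∀ j, ‖N j‖ ≤ b := fun j => hb ⟨j, rfl⟩
    exact ⟨b, (norm_nonneg _).trans (h 0), h⟩
  set 𝔘 : Ultrafilter ℕ := Filter.hyperfilter ℕ with h𝔘
  have hle : (𝔘 : Filter ℕ) ≤ atTop := by
    rw [← Nat.cofinite_eq_atTop]; exact Filter.hyperfilter_le_cofinite
  have hu : Tendsto (fun j => un P Γ z (lv j) X) 𝔘 (nhds (uL P Γ z X)) :=
    ((un_tendsto hz hX).comp hlv).mono_left hle
  have hNU : Tendsto N 𝔘 (nhds N') := hN.mono_left hle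
  have main : ∀ η > 0, |inner ℝ N' (uL P Γ z X)| ≤ b * η := by
    intro η hη
    obtain ⟨δ, hδ, hδ'⟩ := ui_lemma (uL P Γ z X) hη
    set b1 := c * b + (b^2 + ‖tL P z‖^2) / 2 with hb1
    have hb1n : 0 ≤ b1 := by positivity
    set K := (b1 + 1) / δ with hK
    have hKp : 0 < K := by positivity
    choose C hCA hCl G hGL hGb hGX E hE hPE hEf using fun j =>
      stepA hz hc0 hc (N j) (lv j) hκ (hIB j) hKp
    have hEs : ∀ j, P.real (E j) ≤ δ := fun j => by
      have h1 : P.real (E j) * K ≤ b1 := by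
        refine (hPE j).trans ?_
        rw [hb1]
        have := hb j
        gcongr
      have h2 : P.real (E j) * (b1 + 1) ≤ b1 * δ := by
        rw [hK, mul_div_assoc', div_le_iff₀ hδ] at h1; exact h1
      have h3 : P.real (E j) ≥ 0 := measureReal_nonneg
      nlinarith
    obtain ⟨G', hG'L, hG'⟩ := weak_bdd G hGL (b := K + 3 * c * κ) (by positivity) hGb 𝔘
    have hG0 : G' =ᵐ[P] 0 := by
      refine hU G' hG'L ?_ ?_
      · refine tendsto_nhds_unique (hG' z hz) ?_
        refine tendsto_const_nhds.congr fun j => ?_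
        rw [hGX j z hz, un, sub_self, inner_zero_right]
      · rintro k i hi A hA l ⟨cc, hcc⟩
        have hXl := (un_test hz hpos (hy l) (le_refl k) hA hcc).1
        refine tendsto_nhds_unique (hG' _ hXl) ?_
        have hw : Tendsto (fun j => un P Γ z (lv j) (y l)) 𝔘 (nhds (uL P Γ z (y l))) :=
          ((un_tendsto hz (hy l)).comp hlv).mono_left hle
        have hlarge : ∀ᶠ j in (𝔘 : Filter ℕ), k ≤ lv j := (hlv.eventually_ge_atTop k).filter_mono hle
        have hbd : Tendsto (fun j => ‖N j - N'‖ * ‖un P Γ z (lv j) (y l)‖ + ‖N'‖ * ‖un P Γ z (lv j) (y l) - uL P Γ z (y l)‖)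
            𝔘 (nhds (‖N' - N'‖ * ‖uL P Γ z (y l)‖ + ‖N'‖ * ‖uL P Γ z (y l) - uL P Γ z (y l)‖)) :=
          ((hNU.sub_const N').norm.mul hw.norm).add ((hw.sub_const _).norm.const_mul _)
        simp only [sub_self, norm_zero, zero_mul, mul_zero, add_zero] at hbd
        refine squeeze_zero_norm' ?_ hbd
        filter_upwards [hlarge] with j hj
        obtain ⟨-, B, hBA, hBl, hBe⟩ := un_test hz hpos (hy l) hj hA hcc
        rw [hGX j _ hXl, hBe, ← pB_eq hBl, ← pB_sa hBA, pB_inter hBA (hCA j)]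
        have hBC := A0_inter hBA (hCA j)
        have h0 := hperp _ hBC l
        have e : inner ℝ (pB P Γ (B ∩ C j) (N j)) (un P Γ z (lv j) (y l)) =
            inner ℝ (pB P Γ (B ∩ C j) (N j - N')) (un P Γ z (lv j) (y l)) +
            inner ℝ (pB P Γ (B ∩ C j) N') (un P Γ z (lv j) (y l) - uL P Γ z (y l)) := by
          rw [map_sub, inner_sub_left, inner_sub_right, h0]; ring
        rw [e]
        refine (norm_add_le _ _).trans (add_le_add ?_ ?_)
        · exact (norm_inner_le_norm _ _).trans (mul_le_mul_of_nonneg_right (pB_norm hBC _) (norm_nonneg _))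
        · exact (norm_inner_le_norm _ _).trans (mul_le_mul_of_nonneg_right (pB_norm hBC _) (norm_nonneg _))
    have hlim0 : Tendsto (fun j => inner ℝ (pB P Γ (C j) (N j)) (un P Γ z (lv j) X)) 𝔘 (nhds 0) := by
      have h1 := hG' X hX
      have h2 : ∫ o, G' o * X o ∂P = 0 := by
        rw [integral_eq_zero_of_ae]
        filter_upwards [hG0] with o a; simp [a]
      rw [h2] at h1
      exact h1.congr fun j => hGX j X hX
    have hd : Tendsto (fun j => |inner ℝ (N j) (un P Γ z (lv j) X) -
        inner ℝ (pB P Γ (C j) (N j)) (un P Γ z (lv j) X)|) 𝔘 (nhds |inner ℝ N' (uL P Γ z X) - 0|) :=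
      ((hNU.inner hu).sub hlim0).abs
    rw [sub_zero] at hd
    have hr : Tendsto (fun j => b * (‖un P Γ z (lv j) X - uL P Γ z X‖ + η)) 𝔘
        (nhds (b * (‖uL P Γ z X - uL P Γ z X‖ + η))) :=
      (((hu.sub_const _).norm.add_const η)).const_mul b
    rw [sub_self, norm_zero, zero_add] at hr
    refine le_of_tendsto_of_tendsto' hd hr fun j => ?_
    rw [pB_sa (hCA j), ← inner_sub_right]
    refine (abs_real_inner_le_norm _ _).trans (mul_le_mul (hb j) ?_ (norm_nonneg _) hb0)
    have h1 := hEf j (un P Γ z (lv j) X)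
    rw [T_one_un hz hX] at h1
    refine h1.trans ?_
    have h2 := hδ' (E j) (hE j) (hEs j)
    have hI : MemLp ((E j).indicator fun _ => (1:ℝ)) ∞ P := (memLp_const (1:ℝ)).indicator (hE j)
    have e : mulL P ((E j).indicator fun _ => (1:ℝ)) (un P Γ z (lv j) X) =
        mulL P ((E j).indicator fun _ => (1:ℝ)) (un P Γ z (lv j) X - uL P Γ z X) +
        mulL P ((E j).indicator fun _ => (1:ℝ)) (uL P Γ z X) := by rw [map_sub]; abel
    rw [e]
    refine (norm_add_le _ _).trans (add_le_add ?_ h2)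
    refine Lp.norm_le_norm_of_ae_le ?_
    filter_upwards [mulL_ae hI (un P Γ z (lv j) X - uL P Γ z X)] with o a
    rw [a]
    by_cases h : o ∈ E j <;> simp [h]
  have : |inner ℝ N' (uL P Γ z X)| ≤ 0 := by
    refine le_of_forall_pos_le_add fun ε hε => ?_
    have := main (ε / (b + 1)) (by positivity)
    refine this.trans ?_
    rw [mul_div_assoc', div_le_iff₀ (by positivity)]
    nlinarith
  exact abs_eq_zero.1 (le_antisymm this (abs_nonneg _))

lemma small_of_int {z : Ω → ℝ} (hz : Integrable z P) (hpos : ∀ᵐ o ∂P, 0 < z o) {δ : ℝ} (hδ : 0 < δ) :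
    ∃ κ > 0, ∀ E : Set Ω, MeasurableSet E → ∫ o in E, z o ∂P ≤ κ → P.real E ≤ δ := by
  set s : ℕ → Set Ω := fun n => {o | z o < 1 / ((n:ℝ) + 1)} with hs
  have hm : ∀ n, NullMeasurableSet (s n) P := fun n => nullMeasurableSet_lt hz.aemeasurable aemeasurable_const
  have ht := tendsto_measure_iInter_atTop (μ := P) hm (fun a b hab o hω => by
    have h1 : z o < 1 / ((b:ℝ) + 1) := hω
    have h2 : 1 / ((b:ℝ) + 1) ≤ 1 / ((a:ℝ) + 1) := by gcongr
    exact lt_of_lt_of_le h1 h2) ⟨0, measure_ne_top P _⟩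
  have h0 : P (⋂ n, s n) = 0 := by
    refine measure_mono_null (t := {o | ¬ 0 < z o}) (fun o hω hlt => ?_) hpos
    obtain ⟨n, hn⟩ := exists_nat_one_div_lt hlt
    exact absurd (mem_iInter.1 hω n) (not_lt.2 hn.le)
  rw [h0] at ht
  have hd : (0:ℝ≥0∞) < ENNReal.ofReal (δ/2) := by simpa using hδ
  obtain ⟨n, hn⟩ := (ht.eventually (gt_mem_nhds hd)).exists
  set a : ℝ := 1 / ((n:ℝ) + 1) with ha
  have hap : 0 < a := by positivity
  refine ⟨a * (δ/2), by positivity, fun E hE hi => ?_⟩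
  have h1 : P.real (s n) ≤ δ/2 := ENNReal.toReal_le_of_le_ofReal (by positivity) hn.le
  have h2 : P.real (E \ s n) * a ≤ a * (δ/2) := by
    refine le_trans ?_ hi
    have hnm : NullMeasurableSet (E \ s n) P := hE.nullMeasurableSet.diff (hm n)
    have e : P.real (E \ s n) * a = ∫ o in E \ s n, a ∂P := by simp
    rw [e]
    refine le_trans (setIntegral_mono_on₀ (integrable_const _).integrableOn hz.integrableOn hnm (fun o hω => ?_))
      (setIntegral_mono_set hz.integrableOn (ae_restrict_of_ae (hpos.mono fun o h => h.le))
        (Filter.Eventually.of_forall fun o hω => hω.1))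
    exact not_lt.1 hω.2
  have h3 : P.real (E \ s n) ≤ δ/2 := by
    rw [mul_comm] at h2; exact le_of_mul_le_mul_left h2 hap
  have h4 : P.real E ≤ P.real (E \ s n) + P.real (s n) :=
    (measureReal_mono (μ := P) (fun o hω => by
      by_cases h : o ∈ s n
      · exact Or.inr h
      · exact Or.inl ⟨hω, h⟩)).trans (measureReal_union_le _ _)
  linarith

lemma IB.mono {n : ℕ} {κ κ' : ℝ} {f : Lp ℝ 2 P} (h : IB P Γ n κ f) (hk : κ ≤ κ') : IB P Γ n κ' f :=
  fun i hi => (h i hi).mono fun o a => a.trans hk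

lemma IB.add {n : ℕ} {κ κ' : ℝ} {f g : Lp ℝ 2 P} (h : IB P Γ n κ f) (h' : IB P Γ n κ' g) : IB P Γ n (κ + κ') (f + g) := by
  intro i hi
  rw [map_add]
  filter_upwards [h i hi, h' i hi, Lp.coeFn_add (dl P Γ n i f) (dl P Γ n i g)] with o a b c
  rw [c, Pi.add_apply]
  exact (abs_add_le _ _).trans (add_le_add a b)

lemma IB.smul {n : ℕ} {κ : ℝ} {f : Lp ℝ 2 P} (h : IB P Γ n κ f) (c : ℝ) : IB P Γ n (|c| * κ) (c • f) := by
  intro i hi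
  rw [map_smul]
  filter_upwards [h i hi, Lp.coeFn_smul c (dl P Γ n i f)] with o a d
  rw [d, Pi.smul_apply, smul_eq_mul, abs_mul]
  exact mul_le_mul_of_nonneg_left a (abs_nonneg _)

lemma IB.sub {n : ℕ} {κ κ' : ℝ} {f g : Lp ℝ 2 P} (h : IB P Γ n κ f) (h' : IB P Γ n κ' g) : IB P Γ n (κ + κ') (f - g) := by
  have := h.add (h'.smul (-1))
  simpa [sub_eq_add_neg] using this

lemma IB.sum {α : Type*} {n : ℕ} (s : Finset α) {κ : α → ℝ} {f : α → Lp ℝ 2 P} (h : ∀ a ∈ s, IB P Γ n (κ a) (f a)) :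
    IB P Γ n (∑ a ∈ s, κ a) (∑ a ∈ s, f a) := by
  classical
  induction s using Finset.induction_on with
  | empty =>
    intro i hi
    simp only [Finset.sum_empty, map_zero]
    filter_upwards [Lp.coeFn_zero ℝ 2 P] with o a
    simp [a]
  | insert a s ha ih =>
    rw [Finset.sum_insert ha, Finset.sum_insert ha]
    exact (h a (Finset.mem_insert_self a s)).add (ih fun b hb => h b (Finset.mem_insert_of_mem hb))

lemma IB.T {n : ℕ} {κ : ℝ} {f : Lp ℝ 2 P} (h : IB P Γ n κ f) {q : ℝ → Ω → ℝ} (hq : Ad P Γ q) {c : ℝ}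
    (hc : ∀ i < 2^n, ∀ᵐ o ∂P, |q (gp n i) o| ≤ c) : IB P Γ n (c * κ) (T P Γ n q f) := by
  intro i hi
  rw [dl_T hq n hi]
  filter_upwards [h i hi, hc i hi, mulL_ae (hq.bd (gp n i)) (dl P Γ n i f)] with o a b d
  rw [d, abs_mul]
  exact mul_le_mul b a (abs_nonneg _) ((abs_nonneg _).trans b)

lemma IB.pB {n : ℕ} {κ : ℝ} {f : Lp ℝ 2 P} (h : IB P Γ n κ f) {B : Set (ℝ × Ω)} (hB : B ∈ A0 Γ)
    (hl : ∀ u o, (u, o) ∈ B ↔ (fl n u, o) ∈ B) : IB P Γ n κ (pB P Γ B f) := by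
  rw [pB_eq hl, ← one_mul κ]
  refine h.T (iq_ad hB.2) fun i hi => Eventually.of_forall fun o => ?_
  unfold iq
  by_cases hω : o ∈ {o | (gp n i, o) ∈ B} <;> simp [hω, indicator]

lemma IB_tL {X : Ω → ℝ} (hX : MemLp X ∞ P) {c : ℝ} (hc : ∀ᵐ o ∂P, |X o| ≤ c) (n : ℕ) : IB P Γ n (2 * c) (tL P X) := by
  intro i hi
  filter_upwards [dl_ae (Γ := Γ) n i (tL P X), dlf_congr (Γ := Γ) (tL_ae hX) n i, dlf_bdd (Γ := Γ) hc n i] with o a b d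
  rw [a, b]; exact d

lemma IB_un {z X : Ω → ℝ} (hz : MemLp z ∞ P) (hX : MemLp X ∞ P) {c c' : ℝ} (hc : ∀ᵐ o ∂P, |z o| ≤ c)
    (hc' : ∀ᵐ o ∂P, |X o| ≤ c') (n : ℕ) : IB P Γ n (c * (2 * c') + c' * (2 * c)) (un P Γ z n X) := by
  refine IB.sub ?_ ?_
  · exact (IB_tL hX hc' n).T (mp_ad hz) fun i _ => mp_bdd hc _
  · exact (IB_tL hz hc n).T (mp_ad hX) fun i _ => mp_bdd hc' _

lemma A2 {ι : Type*} [Fintype ι] [DecidableEq ι] {z : Ω → ℝ} (hz : MemLp z ∞ P) (hpos : ∀ᵐ o ∂P, 0 < z o) {y : ι → Ω → ℝ}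
    (hy : ∀ l, MemLp (y l) ∞ P) (hU : Uq P Γ z y) {X₀ : Ω → ℝ} (hX₀ : MemLp X₀ ∞ P) (N' : Lp ℝ 2 P) {k : ℝ} (hk : 0 < k)
    (hperp : ∀ B ∈ A0 Γ, ∀ l, inner ℝ (pB P Γ B N') (uL P Γ z (y l)) = 0)
    (happ : ∀ δ > 0, ∃ s ∈ A0 Γ, ∃ (L : ι → ℕ) (B : ι → ℕ → Set (ℝ × Ω)), (∀ l, 0 < L l) ∧ (∀ l r, B l r ∈ A0 Γ) ∧
      ‖pB P Γ s (tL P X₀) - (∑ l, k • ((2/(L l:ℝ)) • (∑ r ∈ Finset.range (L l), pB P Γ (B l r) (uL P Γ z (y l)))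
        - pB P Γ univ (uL P Γ z (y l)))) - N'‖ ≤ δ) :
    ∀ B ∈ A0 Γ, ∀ X, MemLp X ∞ P → inner ℝ (pB P Γ B N') (uL P Γ z X) = 0 := by
  obtain ⟨c, hc0, hc⟩ : ∃ c : ℝ, 0 ≤ c ∧ ∀ᵐ o ∂P, |z o| ≤ c := ⟨_, ENNReal.toReal_nonneg, bdd_of_top hz⟩
  obtain ⟨cX, hcX0, hcX⟩ : ∃ c : ℝ, 0 ≤ c ∧ ∀ᵐ o ∂P, |X₀ o| ≤ c := ⟨_, ENNReal.toReal_nonneg, bdd_of_top hX₀⟩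
  have hyb : ∀ l, ∃ c : ℝ, 0 ≤ c ∧ ∀ᵐ o ∂P, |y l o| ≤ c := fun l => ⟨_, ENNReal.toReal_nonneg, bdd_of_top (hy l)⟩
  choose cy hcy0 hcy using hyb
  set kl : ι → ℝ := fun l => c * (2 * cy l) + cy l * (2 * c) with hkl
  have hkl0 : ∀ l, 0 ≤ kl l := fun l => by have := hcy0 l; simp only [hkl]; positivity
  set κ : ℝ := 2 * cX + ∑ l, k * (3 * kl l) with hκ
  have hκ0 : 0 ≤ κ := by
    have : 0 ≤ ∑ l, k * (3 * kl l) := Finset.sum_nonneg fun l _ => by have := hkl0 l; positivity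
    positivity
  have huniv : (univ : Set (ℝ × Ω)) ∈ A0 Γ := by simpa using A0_alg.compl_mem (A0_alg (Γ := Γ)).empty_mem
  have step : ∀ j : ℕ, ∃ n, j ≤ n ∧ ∃ N, IB P Γ n κ N ∧ ‖N - N'‖ ≤ 2 * (1 / ((j:ℝ) + 1)) := by
    intro j
    have hd : (0:ℝ) < 1 / ((j:ℝ) + 1) := by positivity
    obtain ⟨s, hs, L, B, hL, hB, hle⟩ := happ _ hd
    set Fn : (ι → Lp ℝ 2 P) → Lp ℝ 2 P := fun u => pB P Γ s (tL P X₀) -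
      (∑ l, k • ((2/(L l:ℝ)) • (∑ r ∈ Finset.range (L l), pB P Γ (B l r) (u l)) - pB P Γ univ (u l))) with hFn
    have hFc : Continuous Fn := by
      simp only [hFn]; fun_prop
    have ht : Tendsto (fun n => Fn (fun l => un P Γ z n (y l))) atTop (nhds (Fn fun l => uL P Γ z (y l))) :=
      (hFc.tendsto _).comp (tendsto_pi_nhds.2 fun l => un_tendsto hz (hy l))
    obtain ⟨ns, hns⟩ := hs.1
    have hBl : ∀ l r, ∃ n, ∀ u o, (u, o) ∈ B l r ↔ (fl n u, o) ∈ B l r := fun l r => (hB l r).1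
    choose nb hnb using hBl
    have e1 : ∀ᶠ n in atTop, ∀ l, ∀ r ∈ Finset.range (L l), nb l r ≤ n :=
      eventually_all.2 fun l => (Filter.eventually_all_finset _).2 fun r _ => eventually_ge_atTop _
    have e2 := (tendsto_iff_norm_sub_tendsto_zero.1 ht).eventually (gt_mem_nhds hd)
    obtain ⟨n, h1, h2, h3, h4⟩ := (e1.and (e2.and ((eventually_ge_atTop ns).and (eventually_ge_atTop j)))).exists
    refine ⟨n, h4, Fn (fun l => un P Γ z n (y l)), ?_, ?_⟩
    · simp only [hFn, hκ]
      refine IB.sub ((IB_tL hX₀ hcX n).pB hs (lev_mono hns h3)) (IB.sum _ fun l _ => ?_)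
      have hI := IB_un (Γ := Γ) hz (hy l) hc (hcy l) n
      have hLl : (0:ℝ) < L l := by exact_mod_cast hL l
      have h5 := ((IB.sum (Finset.range (L l)) (κ := fun _ => kl l) fun r hr =>
        hI.pB (hB l r) (lev_mono (hnb l r) (h1 l r hr))).smul (2 / (L l:ℝ))).sub (hI.pB huniv (by simp))
      have h6 := h5.smul k
      refine h6.mono (le_of_eq ?_)
      rw [abs_of_pos hk, abs_of_pos (by positivity), Finset.sum_const, Finset.card_range, nsmul_eq_mul]
      have : 2 / (L l : ℝ) * (L l * kl l) = 2 * kl l := by field_simp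
      rw [this]; simp only [hkl]; ring
    · have := norm_add_le (Fn (fun l => un P Γ z n (y l)) - Fn (fun l => uL P Γ z (y l))) (Fn (fun l => uL P Γ z (y l)) - N')
      rw [sub_add_sub_cancel] at this
      refine this.trans ?_
      linarith
  choose lv hlv N hIB hN using step
  have hlt : Tendsto lv atTop atTop := tendsto_atTop_mono hlv tendsto_id
  have hNt : Tendsto N atTop (nhds N') := by
    rw [tendsto_iff_norm_sub_tendsto_zero]
    refine squeeze_zero (fun _ => norm_nonneg _) hN ?_
    simpa using (tendsto_one_div_add_atTop_nhds_zero_nat (𝕜 := ℝ)).const_mul 2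
  intro B hB X hX
  obtain ⟨nB, hnB⟩ := hB.1
  refine A1 hz hpos hy hU (fun j => pB P Γ B (N (j + nB))) (fun j => lv (j + nB)) (hlt.comp (tendsto_add_atTop_nat nB))
    hκ0 (fun j => (hIB _).pB hB (lev_mono hnB (le_trans (by omega) (hlv (j + nB))))) _
    (((pB P Γ B).continuous.tendsto _).comp (hNt.comp (tendsto_add_atTop_nat nB))) (fun C hC l => ?_) hX
  rw [pB_inter hC hB]
  exact hperp _ (A0_inter hC hB) l

lemma zero_of_perp (f : Lp ℝ 2 P) (h : ∀ X, MemLp X ∞ P → inner ℝ f (tL P X) = 0) : f = 0 := by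
  rw [Lp.eq_zero_iff_ae_eq_zero]
  refine Integrable.ae_eq_zero_of_forall_setIntegral_eq_zero (int_of_L2 f) fun s hs _ => ?_
  have hX : MemLp (s.indicator fun _ => (1:ℝ)) ∞ P := (memLp_const (1:ℝ)).indicator hs
  rw [← h _ hX, inner_eq, ← integral_indicator hs]
  apply integral_congr_ae
  filter_upwards [tL_ae hX] with o a
  rw [a]
  by_cases hω : o ∈ s <;> simp [hω]

lemma A0_univ : (univ : Set (ℝ × Ω)) ∈ A0 Γ := by simpa using A0_alg.compl_mem (A0_alg (Γ := Γ)).empty_mem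

lemma pB_univ (f : Lp ℝ 2 P) : pB P Γ univ f = ceF P Γ 1 f - ceF P Γ 0 f := by
  rw [← WW_p_univ, ← bas_univ, WW_p_bas]

lemma pB_univ_T (n : ℕ) (f : Lp ℝ 2 P) : pB P Γ univ f = T P Γ n (fun _ _ => 1) f := by
  rw [pB_univ, T_one]

/-- orthogonality of `N'` to `z` in the strong sense -/
lemma perp_T {N' Z : Lp ℝ 2 P} (h : ∀ B ∈ A0 Γ, inner ℝ (pB P Γ B N') Z = 0) {q : ℝ → Ω → ℝ} (hq : Ad P Γ q) (n : ℕ) :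
    inner ℝ (T P Γ n q N') Z = 0 := by
  rw [T_inner hq]
  refine Finset.sum_eq_zero fun i hi => ?_
  set g : Ω → ℝ := fun o => dl P Γ n i N' o * dl P Γ n i Z o with hg
  have hgi : Integrable g P := int_mul _ _
  have hce : P[g|Γ (gp n i)] =ᵐ[P] 0 := by
    refine (ae_eq_condExp_of_forall_setIntegral_eq (Γ.le _) hgi (fun s _ _ => integrableOn_zero) (fun s hs _ => ?_)
      aestronglyMeasurable_zero).symm
    set B : Set (ℝ × Ω) := {x | fl n x.1 = gp n i ∧ x.2 ∈ s} with hB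
    have hBA : B ∈ A0 Γ := by
      refine ⟨⟨n, fun u o => by simp [hB, fl_fl le_rfl]⟩, fun u => ?_⟩
      by_cases hu : fl n u = gp n i
      · have : {o | (u, o) ∈ B} = s := by ext o; simp [hB, hu]
        rw [this]
        exact Γ.mono (hu ▸ fl_le n u) _ hs
      · have : {o | (u, o) ∈ B} = ∅ := by ext o; simp [hB, hu]
        rw [this]; exact @MeasurableSet.empty _ (Γ u)
    have hl : ∀ u o, (u, o) ∈ B ↔ (fl n u, o) ∈ B := fun u o => by simp [hB, fl_fl le_rfl]
    have h1 := h B hBA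
    rw [pB_eq hl, T_inner (iq_ad hBA.2), Finset.sum_eq_single_of_mem i hi] at h1
    · rw [integral_congr_ae (g := fun _ => (0:ℝ)) (ae_restrict_of_ae (Eventually.of_forall fun _ => rfl)), integral_zero, ← h1,
        ← integral_indicator (Γ.le _ _ hs)]
      congr 1
      ext o
      by_cases hω : o ∈ s
      · have : o ∈ {o | (gp n i, o) ∈ B} := ⟨fl_gp n i, hω⟩
        simp only [iq]
        rw [indicator_of_mem this, indicator_of_mem hω, one_mul]
      · have : o ∉ {o | (gp n i, o) ∈ B} := fun h' => hω h'.2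
        simp only [iq]
        rw [indicator_of_notMem this, indicator_of_notMem hω, zero_mul]
    · intro j _ hj
      rw [integral_eq_zero_of_ae]
      refine Eventually.of_forall fun o => ?_
      have : o ∉ {o | (gp n j, o) ∈ B} := fun h' => by
        apply hj
        have h2 := h'.1
        simp only [fl_gp] at h2
        have h3 := congrArg (ix n) h2
        rwa [ix_gp, ix_gp] at h3
      simp only [iq]
      rw [indicator_of_notMem this, zero_mul]; rfl
  have h2 := integral_mul_condExp' (Γ.le (gp n i)) (hq.sm (gp n i)) (M := g) (int_qff (hq.bd _) _ _) hgi
  rw [show (∫ o, q (gp n i) o * (dl P Γ n i N' o * dl P Γ n i Z o) ∂P) = ∫ o, q (gp n i) o * g o ∂P from rfl, ← h2]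
  rw [integral_eq_zero_of_ae]
  filter_upwards [hce] with o a
  rw [a]; simp

lemma uL_one {z : Ω → ℝ} (hz : MemLp z ∞ P) : uL P Γ z (fun _ => 1) = - pB P Γ univ (tL P z) := by
  have h1 : MemLp (fun _ : Ω => (1:ℝ)) ∞ P := memLp_const 1
  have hce : ∀ u, ceF P Γ u (tL P fun _ => (1:ℝ)) = tL P fun _ => (1:ℝ) := fun u => by
    refine ceL_fix _ _ ?_
    exact (aestronglyMeasurable_const (b := (1:ℝ))).congr (tL_ae h1).symm
  refine tendsto_nhds_unique (un_tendsto hz h1) ?_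
  refine tendsto_const_nhds.congr fun n => ?_
  have e1 : T P Γ n (mp P Γ z) (tL P fun _ => (1:ℝ)) = 0 := by
    rw [T_apply]
    refine Finset.sum_eq_zero fun i _ => ?_
    simp [dl, hce]
  have e2 : T P Γ n (mp P Γ fun _ => (1:ℝ)) = T P Γ n fun _ _ => 1 :=
    T_congr n fun i _ => by simp only [mp]; rw [condExp_const (Γ.le _)]
  rw [un, e1, e2, pB_univ_T n, zero_sub]

lemma A4 {z : Ω → ℝ} (hz : MemLp z ∞ P) (hpos : ∀ᵐ o ∂P, 0 < z o) {N' : Lp ℝ 2 P} (h0 : lim P Γ z N' = 0)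
    (h1 : pB P Γ univ N' = N') : N' = 0 := by
  have main : ∀ η > 0, ‖N'‖ ≤ η := by
    intro η hη
    obtain ⟨δ, hδ, hδ'⟩ := ui_lemma N' hη
    obtain ⟨κ, hκ, hκ'⟩ := small_of_int (top_int hz) hpos hδ
    have ht : Tendsto (fun n => κ⁻¹ * ‖T P Γ n (mp P Γ z) N'‖ + η) atTop (nhds (κ⁻¹ * ‖(0 : Lp ℝ 2 P)‖ + η)) := by
      have := lim_tendsto (Γ := Γ) hz N'
      rw [h0] at this
      exact (this.norm.const_mul _).add_const _
    rw [norm_zero, mul_zero, zero_add] at ht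
    refine ge_of_tendsto' ht fun n => ?_
    have hZm : ∀ i, Measurable[Γ (gp n i)] (mp P Γ z (gp n i)) := fun i => stronglyMeasurable_condExp.measurable
    have hlt : ∀ i, MeasurableSet[Γ (gp n i)] {o | mp P Γ z (gp n i) o < κ} := fun i => hZm i measurableSet_Iio
    -- the bad sets
    set E : ℕ → Set Ω := fun N => {o | ∃ i < N, mp P Γ z (gp n i) o < κ} with hE
    have hEs : ∀ N, E (N+1) = E N ∪ {o | mp P Γ z (gp n N) o < κ} := fun N => by
      ext o; simp only [hE, mem_setOf_eq, mem_union]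
      constructor
      · rintro ⟨i, hi, h⟩
        rcases Nat.lt_succ_iff_lt_or_eq.1 hi with h' | h'
        · exact Or.inl ⟨i, h', h⟩
        · exact Or.inr (h' ▸ h)
      · rintro (⟨i, hi, h⟩ | h)
        · exact ⟨i, hi.trans N.lt_succ_self, h⟩
        · exact ⟨N, N.lt_succ_self, h⟩
    have hEm : ∀ N i, N ≤ i + 1 → MeasurableSet[Γ (gp n i)] (E N) := by
      intro N
      induction N with
      | zero => intro i _; simp only [hE]; simp
      | succ N ih =>
        intro i hi
        rw [hEs]
        exact MeasurableSet.union (ih i (by omega)) (Γ.mono (gp_mono n (by omega)) _ (hlt N))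
    have hEm' : ∀ N, MeasurableSet (E N) := fun N => Γ.le _ _ (hEm N N (by omega))
    have hEi : ∀ N, ∫ o in E N, z o ∂P ≤ κ * P.real (E N) := by
      intro N
      induction N with
      | zero => simp [hE]
      | succ N ih =>
        have e : E (N+1) = E N ∪ ({o | mp P Γ z (gp n N) o < κ} \ E N) := by rw [hEs, union_diff_self]
        have hd : Disjoint (E N) ({o | mp P Γ z (gp n N) o < κ} \ E N) := disjoint_sdiff_right
        have hm1 : MeasurableSet[Γ (gp n N)] ({o | mp P Γ z (gp n N) o < κ} \ E N) := (hlt N).diff (hEm N N (by omega))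
        have hm2 := Γ.le _ _ hm1
        rw [e, setIntegral_union hd hm2 (top_int hz).integrableOn (top_int hz).integrableOn,
          measureReal_union hd hm2, mul_add]
        refine add_le_add ih ?_
        rw [← setIntegral_condExp (Γ.le (gp n N)) (top_int hz) hm1]
        have e2 : κ * P.real ({o | mp P Γ z (gp n N) o < κ} \ E N) = ∫ o in ({o | mp P Γ z (gp n N) o < κ} \ E N), κ ∂P := by
          simp [mul_comm]
        rw [e2]
        exact setIntegral_mono_on integrable_condExp.integrableOn (integrable_const _).integrableOn hm2 fun o hω => hω.1.le
    set q : ℝ → Ω → ℝ := fun u => if 0 ≤ u then ((E (ix n u + 1))ᶜ).indicator (fun _ => 1) else fun _ => 1 with hq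
    have hqA : Ad P Γ q := by
      refine ⟨fun u => ?_, fun u => ?_⟩
      · by_cases hu : 0 ≤ u
        · simp only [hq, hu, if_true]
          refine stronglyMeasurable_const.indicator ?_
          have h3 := (hEm (ix n u + 1) (ix n u) le_rfl).compl
          rw [gp_ix hu] at h3
          exact Γ.mono (fl_le n u) _ h3
        · simp only [hq, hu, if_false]; exact stronglyMeasurable_const
      · by_cases hu : 0 ≤ u
        · simp only [hq, hu, if_true]
          exact (memLp_const 1).indicator (hEm' _).compl
        · simp only [hq, hu, if_false]; exact memLp_const 1
    have hqg : ∀ i, q (gp n i) = ((E (i+1))ᶜ).indicator (fun _ => 1) := fun i => by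
      have : 0 ≤ gp n i := by unfold gp; positivity
      simp only [hq, this, if_true, ix_gp]
    have hsp : N' = T P Γ n q N' + T P Γ n (fun u o => 1 - q u o) N' := by
      rw [T_sub (Ad.const 1) hqA, ← pB_univ_T, h1]; abel
    have b1 : ‖T P Γ n q N'‖ ≤ κ⁻¹ * ‖T P Γ n (mp P Γ z) N'‖ := by
      have hA := (mp_ad (Γ := Γ) hz).cmul κ⁻¹
      have h3 := T_mono (hqA.mul hqA) (hA.mul hA) n (f := N') (fun i hi => Eventually.of_forall fun o => by
        simp only [hqg]
        by_cases hω : o ∈ (E (i+1))ᶜ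
        · rw [indicator_of_mem hω]
          have : κ ≤ mp P Γ z (gp n i) o := not_lt.1 fun h => hω ⟨i, i.lt_succ_self, h⟩
          have h4 : 1 ≤ κ⁻¹ * mp P Γ z (gp n i) o := by
            rw [← inv_mul_cancel₀ hκ.ne']; gcongr
          nlinarith
        · rw [indicator_of_notMem hω, zero_mul]; exact mul_self_nonneg _)
      rw [← T_normsq hqA, ← T_normsq hA, T_smul (mp_ad hz)] at h3
      have := abs_le_of_sq_le_sq' h3 (norm_nonneg _)
      refine this.2.trans ?_
      rw [norm_smul, Real.norm_of_nonneg (by positivity)]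
    have b2 : ‖T P Γ n (fun u o => 1 - q u o) N'‖ ≤ η := by
      refine (tail_lemma ((Ad.const 1).sub hqA) n (E (2^n)) (hEm' _) (fun i hi o => ?_) (fun i hi o h => ?_) N').trans
        (hδ' _ (hEm' _) (hκ' _ (hEm' _) ((hEi _).trans ?_)))
      · simp only [hqg]
        by_cases hω : o ∈ (E (i+1))ᶜ
        · left; rw [indicator_of_mem hω]; simp
        · right; rw [indicator_of_notMem hω]; simp
      · simp only [hqg] at h
        by_contra hω
        have : o ∈ (E (i+1))ᶜ := fun ⟨j, hj, h'⟩ => hω ⟨j, by omega, h'⟩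
        rw [indicator_of_mem this] at h
        norm_num at h
      · have : P.real (E (2^n)) ≤ 1 := measureReal_le_one
        nlinarith
    conv_lhs => rw [hsp]
    exact (norm_add_le _ _).trans (add_le_add b1 b2)
  have : ‖N'‖ ≤ 0 := le_of_forall_pos_le_add fun ε hε => by simpa using main ε hε
  exact norm_le_zero_iff.1 this

lemma A3 {z : Ω → ℝ} (hz : MemLp z ∞ P) (hpos : ∀ᵐ o ∂P, 0 < z o) {N' : Lp ℝ 2 P} (h1 : pB P Γ univ N' = N')
    (h : ∀ B ∈ A0 Γ, ∀ X, MemLp X ∞ P → inner ℝ (pB P Γ B N') (uL P Γ z X) = 0) : N' = 0 := by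
  have hz0 : ∀ B ∈ A0 Γ, inner ℝ (pB P Γ B N') (tL P z) = 0 := by
    intro B hB
    have h2 := h B hB _ (memLp_const 1)
    rw [uL_one hz, inner_neg_right, neg_eq_zero, ← pB_sa A0_univ, pB_inter A0_univ hB, univ_inter] at h2
    exact h2
  refine A4 hz hpos (zero_of_perp _ fun X hX => ?_) h1
  rw [lim_sa hz]
  have h2 := h univ A0_univ X hX
  rw [h1, uL, inner_sub_right] at h2
  have h3 : inner ℝ N' (lim P Γ X (tL P z)) = 0 := by
    refine tendsto_nhds_unique (Tendsto.inner tendsto_const_nhds (lim_tendsto (Γ := Γ) hX (tL P z))) ?_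
    refine tendsto_const_nhds.congr fun n => ?_
    rw [← T_sa (mp_ad hX), perp_T hz0 (mp_ad hX)]
  linarith

/-- uniqueness implies the representation property -/
lemma Gd_of_Uq {ι : Type*} [Fintype ι] [DecidableEq ι] {z : Ω → ℝ} (hz : MemLp z ∞ P) (hpos : ∀ᵐ o ∂P, 0 < z o)
    {y : ι → Ω → ℝ} (hy : ∀ l, MemLp (y l) ∞ P) (hU : Uq P Γ z y) : Gd P Γ z y := by
  intro f hf
  by_contra hne
  obtain ⟨X, hX, hX0⟩ : ∃ X, MemLp X ∞ P ∧ inner ℝ ((WW P Γ).p univ f) (tL P X) ≠ 0 := by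
    by_contra! hcon
    exact hne (zero_of_perp _ hcon)
  obtain ⟨N', k, hk, h1, h2, h3, h4⟩ := N1 (WW P Γ) _ (tL P X) f hf hX0
  apply h3
  rw [← bas_univ, WW_p_bas] at h1
  have h2' : ∀ B ∈ A0 Γ, ∀ l, inner ℝ (pB P Γ B N') (uL P Γ z (y l)) = 0 := fun B hB l => by
    rw [← WW_p_bas]; exact h2 _ ⟨B, hB, rfl⟩ l
  refine A3 hz hpos h1 (A2 hz hpos hy hU hX N' hk h2' fun δ hδ => ?_)
  obtain ⟨s, ⟨s', hs', rfl⟩, L, B, hL, hB, hle⟩ := h4 δ hδ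
  choose B' hB' hB'' using hB
  refine ⟨s', hs', L, B', hL, hB', ?_⟩
  simp only [← hB'', ← bas_univ, WW_p_bas] at hle
  exact hle

end PartTen

section PartSixteenA
variable {Y H ι : Type*} [TopologicalSpace Y] [CompactSpace Y] [MeasurableSpace Y]
    [NormedAddCommGroup H] [InnerProductSpace ℝ H] [CompleteSpace H] [Fintype ι] [DecidableEq ι]

lemma N2 (W : PM Y H) (w : ι → H) (hG : W.Good w) (X : H) {ε : ℝ} (hε0 : 0 < ε) :
    ∃ k : ℝ, 0 < k ∧
      ∀ δ > 0, ∃ s ∈ W.A, ∃ (L : ι → ℕ) (B : ι → ℕ → Set Y), (∀ l, 0 < L l) ∧ (∀ l r, B l r ∈ W.A) ∧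
        ‖W.p s X - (∑ l, k • ((2/(L l:ℝ)) • (∑ r ∈ Finset.range (L l), W.p (B l r) (w l)) - W.p univ (w l)))‖ ≤ δ ∧
        ‖W.p univ X - W.p s X‖ ≤ ε + δ := by
  obtain ⟨X', N', k, hk, hu, ho, h2, -, h6⟩ := N0 W w X hε0
  have hN : N' = 0 := by rw [← hu]; exact hG _ ho
  refine ⟨k, hk, fun δ hδ => ?_⟩
  obtain ⟨s, hs, L, B, hL, hB, hn, hx⟩ := h6 δ hδ
  rw [hN, sub_zero] at hn
  refine ⟨s, hs, L, B, hL, hB, hn, ?_⟩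
  calc ‖W.p univ X - W.p s X‖ = ‖(W.p univ X - X') - (W.p s X - X')‖ := by congr 1; abel
    _ ≤ _ := norm_sub_le _ _
    _ ≤ ε + δ := by linarith

end PartSixteenA

section PartSeventeen
variable {Ω : Type*} {m : MeasurableSpace Ω} {P : Measure Ω} [IsProbabilityMeasure P] {Γ : Filtration ℝ m}

variable (P Γ) in
/-- grid increments of the numerator process -/
def uf (z X : Ω → ℝ) (n i : ℕ) : Ω → ℝ := fun o =>
  mp P Γ z (gp n i) o * dlf P Γ n i X o - mp P Γ X (gp n i) o * dlf P Γ n i z o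

lemma dl_tL_ae {X : Ω → ℝ} (hX : MemLp X ∞ P) (n i : ℕ) : dl P Γ n i (tL P X) =ᵐ[P] dlf P Γ n i X :=
  (dl_ae n i _).trans (by
    filter_upwards [condExp_congr_ae (m := Γ (gp n (i+1))) (tL_ae hX), condExp_congr_ae (m := Γ (gp n i)) (tL_ae hX)] with o a b
    rw [dlf, dlf, a, b])

lemma dl_un {z X : Ω → ℝ} (hz : MemLp z ∞ P) (hX : MemLp X ∞ P) (n : ℕ) {i : ℕ} (hi : i < 2^n) :
    dl P Γ n i (un P Γ z n X) =ᵐ[P] uf P Γ z X n i := by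
  rw [un, map_sub, dl_T (mp_ad hz) n hi, dl_T (mp_ad hX) n hi]
  filter_upwards [Lp.coeFn_sub (mulL P (mp P Γ z (gp n i)) (dl P Γ n i (tL P X))) (mulL P (mp P Γ X (gp n i)) (dl P Γ n i (tL P z))),
    mulL_ae ((mp_ad (Γ := Γ) hz).bd (gp n i)) (dl P Γ n i (tL P X)), mulL_ae ((mp_ad (Γ := Γ) hX).bd (gp n i)) (dl P Γ n i (tL P z)),
    dl_tL_ae (Γ := Γ) hX n i, dl_tL_ae (Γ := Γ) hz n i] with o a b c d e
  rw [a, Pi.sub_apply, b, c, d, e, uf]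

lemma dl_T_un {z X : Ω → ℝ} (hz : MemLp z ∞ P) (hX : MemLp X ∞ P) {q : ℝ → Ω → ℝ} (hq : Ad P Γ q) (n : ℕ) {i : ℕ} (hi : i < 2^n) :
    dl P Γ n i (T P Γ n q (un P Γ z n X)) =ᵐ[P] fun o => q (gp n i) o * uf P Γ z X n i o := by
  rw [dl_T hq n hi]
  filter_upwards [mulL_ae (hq.bd (gp n i)) (dl P Γ n i (un P Γ z n X)), dl_un (Γ := Γ) hz hX n hi] with o a b
  rw [a, b]

lemma iq_01 (B : Set (ℝ × Ω)) (u : ℝ) (o : Ω) : 0 ≤ iq B u o ∧ iq B u o ≤ 1 := by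
  unfold iq
  by_cases h : o ∈ {o | (u, o) ∈ B} <;> simp [indicator, h]

lemma T_fsum {q : ℕ → ℝ → Ω → ℝ} (hq : ∀ r, Ad P Γ (q r)) (s : Finset ℕ) (n : ℕ) (f : Lp ℝ 2 P) :
    T P Γ n (fun u o => ∑ r ∈ s, q r u o) f = ∑ r ∈ s, T P Γ n (q r) f := by
  induction s using Finset.induction with
  | empty =>
    have := T_smul (P := P) (Γ := Γ) (Ad.const 0) 0 n f
    simpa using this
  | insert a s ha ih =>
    simp only [Finset.sum_insert ha]
    rw [T_add (hq a) (Ad.sum _ _ fun r _ => hq r), ih]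

lemma rep_approx {ι : Type*} [Fintype ι] [DecidableEq ι] {z : Ω → ℝ} {y : ι → Ω → ℝ} (hz : MemLp z ∞ P)
    (hy : ∀ l, MemLp (y l) ∞ P) (hG : Gd P Γ z y) {X : Ω → ℝ} (hX : MemLp X ∞ P) {ε : ℝ} (hε : 0 < ε) :
    ∃ k : ℝ, 0 < k ∧ ∀ δ > 0, ∀ n1 : ℕ, ∃ n ≥ n1, ∃ (b : ℝ → Ω → ℝ) (K : ι → ℝ → Ω → ℝ), Ad P Γ b ∧ (∀ l, Ad P Γ (K l)) ∧
      (∀ u o, 0 ≤ b u o ∧ b u o ≤ 1) ∧ (∀ l u o, |K l u o| ≤ k) ∧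
      ∑ i ∈ Finset.range (2^n), ∫ o, (b (gp n i) o * uf P Γ z X n i o - ∑ l, K l (gp n i) o * uf P Γ z (y l) n i o)^2 ∂P ≤ δ ∧
      ∑ i ∈ Finset.range (2^n), ∫ o, ((1 - b (gp n i) o) * uf P Γ z X n i o)^2 ∂P ≤ ε := by
  have hse : 0 < √ε := Real.sqrt_pos.2 hε
  obtain ⟨k, hk, hN⟩ := N2 (WW P Γ) _ hG (uL P Γ z X) (ε := √ε/4) (by positivity)
  refine ⟨k, hk, fun δ hδ n1 => ?_⟩
  set δ' : ℝ := min (√δ/2) (√ε/4) with hδ'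
  have hsd : 0 < √δ := Real.sqrt_pos.2 hδ
  have hδ'0 : 0 < δ' := by positivity
  obtain ⟨s, ⟨B0, hB0, rfl⟩, L, B, hL, hB, h1, h2⟩ := hN δ' hδ'0
  choose B' hB' hBB using hB
  simp only [← hBB, WW_p_bas, ← bas_univ (Γ := Γ)] at h1 h2
  set V : ℕ → Lp ℝ 2 P := fun n => pB P Γ B0 (un P Γ z n X) -
    ∑ l, k • ((2/(L l:ℝ)) • (∑ r ∈ Finset.range (L l), pB P Γ (B' l r) (un P Γ z n (y l))) - pB P Γ univ (un P Γ z n (y l))) with hV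
  have hVl : Tendsto V atTop (𝓝 (pB P Γ B0 (uL P Γ z X) -
    ∑ l, k • ((2/(L l:ℝ)) • (∑ r ∈ Finset.range (L l), pB P Γ (B' l r) (uL P Γ z (y l))) - pB P Γ univ (uL P Γ z (y l))))) := by
    have hc : ∀ (A : Set (ℝ × Ω)) (X : Ω → ℝ), MemLp X ∞ P → Tendsto (fun n => pB P Γ A (un P Γ z n X)) atTop (𝓝 (pB P Γ A (uL P Γ z X))) :=
      fun A X hX => ((pB P Γ A).continuous.tendsto _).comp (un_tendsto hz hX)
    refine (hc _ _ hX).sub (tendsto_finsetSum _ fun l _ => ((Tendsto.const_smul (tendsto_finsetSum _ fun r _ => hc _ _ (hy l)) _).sub (hc _ _ (hy l))).const_smul k)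
  have hWl : Tendsto (fun n => pB P Γ univ (un P Γ z n X) - pB P Γ B0 (un P Γ z n X)) atTop
      (𝓝 (pB P Γ univ (uL P Γ z X) - pB P Γ B0 (uL P Γ z X))) :=
    (((pB P Γ univ).continuous.tendsto _).comp (un_tendsto hz hX)).sub (((pB P Γ B0).continuous.tendsto _).comp (un_tendsto hz hX))
  have ev1 : ∀ᶠ n in atTop, ‖V n‖ < √δ := hVl.norm.eventually (gt_mem_nhds (h1.trans_lt (by
    have := min_le_left (√δ/2) (√ε/4); linarith)))
  have ev2 : ∀ᶠ n in atTop, ‖pB P Γ univ (un P Γ z n X) - pB P Γ B0 (un P Γ z n X)‖ < √ε := hWl.norm.eventually (gt_mem_nhds (h2.trans_lt (by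
    have := min_le_right (√δ/2) (√ε/4); linarith)))
  obtain ⟨c0, hc0⟩ := hB0.1
  have hlv := fun l r => (hB' l r).1
  choose c hc using hlv
  have ev3 : ∀ᶠ n in atTop, ∀ l, ∀ r ∈ Finset.range (L l), c l r ≤ n := by
    refine eventually_all.2 fun l => (Finset.eventually_all _).2 fun r _ => eventually_ge_atTop _
  obtain ⟨n, hn1, hn2, hn3, hn4, hn5⟩ := (ev1.and (ev2.and (ev3.and ((eventually_ge_atTop c0).and (eventually_ge_atTop n1))))).exists
  set K : ι → ℝ → Ω → ℝ := fun l u o => k * ((2/(L l:ℝ)) * (∑ r ∈ Finset.range (L l), iq (B' l r) u o) - 1) with hKd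
  have hKs : ∀ l, Ad P Γ (fun u o => ∑ r ∈ Finset.range (L l), iq (B' l r) u o) := fun l =>
    Ad.sum _ _ (fun r _ => iq_ad (hB' l r).2)
  have hK : ∀ l, Ad P Γ (K l) := fun l => (((hKs l).cmul (2/(L l:ℝ))).sub (Ad.const 1)).cmul k
  have hb : Ad P Γ (iq B0) := iq_ad hB0.2
  refine ⟨n, hn5, iq B0, K, hb, hK, iq_01 B0, ?_, ?_, ?_⟩
  · intro l u o
    have a1 : (0:ℝ) ≤ ∑ r ∈ Finset.range (L l), iq (B' l r) u o := Finset.sum_nonneg fun r _ => (iq_01 _ _ _).1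
    have a2 : ∑ r ∈ Finset.range (L l), iq (B' l r) u o ≤ L l := by
      calc _ ≤ ∑ r ∈ Finset.range (L l), (1:ℝ) := Finset.sum_le_sum fun r _ => (iq_01 _ _ _).2
        _ = _ := by simp
    have a3 : (0:ℝ) < L l := by exact_mod_cast hL l
    rw [hKd]
    simp only
    rw [abs_mul, abs_of_pos hk]
    refine mul_le_of_le_one_right hk.le (abs_le.2 ⟨?_, ?_⟩)
    · have : 0 ≤ 2/(L l:ℝ) * ∑ r ∈ Finset.range (L l), iq (B' l r) u o := by positivity
      linarith
    · have : 2/(L l:ℝ) * ∑ r ∈ Finset.range (L l), iq (B' l r) u o ≤ 2/(L l:ℝ) * L l := by gcongr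
      rw [div_mul_cancel₀ _ a3.ne'] at this
      linarith
  · have e1 : V n = T P Γ n (iq B0) (un P Γ z n X) - ∑ l, T P Γ n (K l) (un P Γ z n (y l)) := by
      rw [hV]
      simp only
      rw [pB_eq (lev_mono hc0 hn4)]
      congr 1
      refine Finset.sum_congr rfl fun l _ => ?_
      rw [hKd]
      simp only
      rw [T_smul (((hKs l).cmul (2/(L l:ℝ))).sub (Ad.const 1)), T_sub ((hKs l).cmul (2/(L l:ℝ))) (Ad.const 1), T_smul (hKs l), pB_univ_T n]
      congr 3
      rw [T_fsum (fun r => iq_ad (hB' l r).2)]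
      exact Finset.sum_congr rfl fun r hr => by rw [pB_eq (lev_mono (hc l r) (hn3 l r hr))]
    have e2 := sum_dl_sq (Γ := Γ) n (V n)
    have e3 : ‖V n‖^2 ≤ δ := by
      rw [← Real.sq_sqrt hδ.le]; gcongr
    refine le_trans (le_of_eq (Finset.sum_congr rfl fun i hi => integral_congr_ae ?_)) (e2.trans e3)
    have hi' := Finset.mem_range.1 hi
    rw [e1, map_sub, map_sum]
    filter_upwards [Lp.coeFn_sub (dl P Γ n i (T P Γ n (iq B0) (un P Γ z n X))) (∑ l, dl P Γ n i (T P Γ n (K l) (un P Γ z n (y l)))),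
      dl_T_un hz hX hb n hi', ae_all_iff.2 fun l => dl_T_un hz (hy l) (hK l) n hi', Lp_sum_ae P Finset.univ (fun l => dl P Γ n i (T P Γ n (K l) (un P Γ z n (y l))))] with o a b c d
    rw [a, Pi.sub_apply, b, d, pow_two]
    simp only [c]
  · have e1 : pB P Γ univ (un P Γ z n X) - pB P Γ B0 (un P Γ z n X) = T P Γ n (fun u o => 1 - iq B0 u o) (un P Γ z n X) := by
      rw [pB_eq (lev_mono hc0 hn4), pB_univ_T n, T_sub (Ad.const 1) hb]
    rw [e1] at hn2
    have e2 := sum_dl_sq (Γ := Γ) n (T P Γ n (fun u o => 1 - iq B0 u o) (un P Γ z n X))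
    have e3 : ‖T P Γ n (fun u o => 1 - iq B0 u o) (un P Γ z n X)‖^2 ≤ ε := by
      rw [← Real.sq_sqrt hε.le]; gcongr
    refine le_trans (le_of_eq (Finset.sum_congr rfl fun i hi => integral_congr_ae ?_)) (e2.trans e3)
    have hi' := Finset.mem_range.1 hi
    filter_upwards [dl_T_un hz hX ((Ad.const 1).sub hb) n hi'] with o a
    rw [a, pow_two]

end PartSeventeen

section PartEighteen
variable {Ω : Type*} {m : MeasurableSpace Ω} {P : Measure Ω} [IsProbabilityMeasure P]

lemma ac_int {ψ : Ω → ℝ} (hψ : Integrable ψ P) {ε : ℝ} (hε : 0 < ε) :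
    ∃ δ > 0, ∀ E : Set Ω, P.real E ≤ δ → ∫ o in E, ψ o ∂P ≤ ε := by
  have h1 : Tendsto (fun E : Set Ω => ∫ o in E, ψ o ∂P) (comap (fun E => P E) (𝓝 0)) (𝓝 0) :=
    hψ.tendsto_setIntegral_nhds_zero (s := id) tendsto_comap
  have h2 := h1.eventually (gt_mem_nhds hε)
  rw [eventually_comap] at h2
  obtain ⟨δ, hδ, h⟩ := (ENNReal.nhds_zero_basis_Iic).mem_iff.1 h2
  refine ⟨(min δ 1).toReal, ENNReal.toReal_pos (by simp [hδ.ne']) (by simp), fun E hE => ?_⟩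
  refine (h (a := P E) ?_ E rfl).le
  have := (ENNReal.toReal_le_toReal (measure_ne_top P E) (by simp)).1 hE
  exact this.trans (min_le_left _ _)

/-- conditional expectations can be inserted in set integrals -/
lemma pull {m' : MeasurableSpace Ω} (h : m' ≤ m) {z q : Ω → ℝ} (hz : Integrable z P)
    (hq : StronglyMeasurable[m'] q) {C : Set Ω} (hC : MeasurableSet[m'] C) (hi : IntegrableOn (fun o => z o * q o) C P) :
    ∫ o in C, z o * q o ∂P = ∫ o in C, (P[z|m']) o * q o ∂P ∧ IntegrableOn (fun o => (P[z|m']) o * q o) C P := by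
  have hC' := h _ hC
  have e1 : (C.indicator q) * z = C.indicator (fun o => z o * q o) := by
    ext o; by_cases hω : o ∈ C <;> simp [hω, mul_comm]
  have e2 : (C.indicator q) * (P[z|m']) = C.indicator (fun o => (P[z|m']) o * q o) := by
    ext o; by_cases hω : o ∈ C <;> simp [hω, mul_comm]
  have hi' : Integrable ((C.indicator q) * z) P := by rw [e1]; exact hi.integrable_indicator hC'
  have h1 := condExp_mul_of_stronglyMeasurable_left (μ := P) (hq.indicator hC) hi' hz
  constructor
  · rw [← integral_indicator hC', ← integral_indicator hC', ← e1, ← e2]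
    exact (integral_mul_condExp' h (hq.indicator hC) hi' hz).symm
  · rw [← integrable_indicator_iff hC', ← e2]
    exact integrable_condExp.congr h1

lemma intOn_bdd {z q : Ω → ℝ} (hz : Integrable z P) (hq : AEStronglyMeasurable q P) {C : Set Ω} (hC : MeasurableSet C)
    {c : ℝ} (hb : ∀ o ∈ C, |q o| ≤ c) : IntegrableOn (fun o => z o * q o) C P :=
  hz.integrableOn.mul_bdd (c := c) hq.restrict ((ae_restrict_iff' hC).2 (ae_of_all _ hb))

lemma pull_bdd {m' : MeasurableSpace Ω} (h : m' ≤ m) {z q : Ω → ℝ} (hz : Integrable z P)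
    (hq : StronglyMeasurable[m'] q) {C : Set Ω} (hC : MeasurableSet[m'] C) {c : ℝ} (hb : ∀ o ∈ C, |q o| ≤ c) :
    ∫ o in C, z o * q o ∂P = ∫ o in C, (P[z|m']) o * q o ∂P ∧ IntegrableOn (fun o => z o * q o) C P ∧
      IntegrableOn (fun o => (P[z|m']) o * q o) C P := by
  have hi := intOn_bdd hz (hq.mono h).aestronglyMeasurable (h _ hC) hb
  have := pull h hz hq hC hi
  exact ⟨this.1, hi, this.2⟩

/-- a maximal inequality -/
lemma maxl (H : Filtration ℕ m) {φ ψ : Ω → ℝ} (hφ : Integrable φ P) (hψ : Integrable ψ P) (hψ0 : ∀ᵐ o ∂P, 0 ≤ ψ o)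
    {c : ℝ} (hc : 0 ≤ c) (C : ℕ → Set Ω) (hC : ∀ j, MeasurableSet[H j] (C j)) (M : ℕ)
    (h : ∀ j ≤ M, ∀ B, MeasurableSet[H j] B → B ⊆ C j → ∫ o in B, φ o ∂P ≤ c * ∫ o in B, ψ o ∂P) :
    ∫ o in ⋃ j ∈ Finset.range (M+1), C j, φ o ∂P ≤ c * ∫ o, ψ o ∂P := by
  set B : ℕ → Set Ω := disjointed C with hB
  have hBm : ∀ j, MeasurableSet[H j] (B j) := fun j => by
    rw [hB, disjointed_apply]
    refine (hC j).diff ?_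
    rw [Finset.sup_eq_iSup]
    refine @MeasurableSet.iUnion _ _ (H j) _ _ fun i => @MeasurableSet.iUnion _ _ (H j) _ _ fun hi => H.mono (Finset.mem_Iio.1 hi).le _ (hC i)
  have hBm' := fun j => H.le j _ (hBm j)
  have hU : ⋃ j ∈ Finset.range (M+1), C j = ⋃ j ∈ Finset.range (M+1), B j := by
    have := partialSups_disjointed C
    have h2 := congrArg (fun f => f M) this
    rw [partialSups_eq_biSup, partialSups_eq_biSup] at h2
    simp only [Finset.mem_range, Nat.lt_succ_iff]
    exact h2.symm
  have hd : (↑(Finset.range (M+1)) : Set ℕ).PairwiseDisjoint B := fun i _ j _ hij => disjoint_disjointed C hij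
  rw [hU, integral_biUnion_finset _ (fun i _ => hBm' i) hd (fun i _ => hφ.integrableOn)]
  calc _ ≤ ∑ j ∈ Finset.range (M+1), c * ∫ o in B j, ψ o ∂P :=
        Finset.sum_le_sum fun j hj => h j (Nat.lt_succ_iff.1 (Finset.mem_range.1 hj)) _ (hBm j) (disjointed_subset C j)
    _ = c * ∫ o in ⋃ j ∈ Finset.range (M+1), B j, ψ o ∂P := by
        rw [integral_biUnion_finset _ (fun i _ => hBm' i) hd (fun i _ => hψ.integrableOn), Finset.mul_sum]
    _ ≤ c * ∫ o, ψ o ∂P := by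
        exact mul_le_mul_of_nonneg_left (setIntegral_le_integral hψ hψ0) hc

end PartEighteen

section PartNineteen
variable {Ω : Type*} {m : MeasurableSpace Ω} {P : Measure Ω} [IsProbabilityMeasure P]

lemma ms_le {α : Type*} {m' : MeasurableSpace α} {f : α → ℝ} (hf : StronglyMeasurable f) (c : ℝ) : MeasurableSet {o | f o ≤ c} :=
  measurableSet_le hf.measurable measurable_const
lemma ms_lt {α : Type*} {m' : MeasurableSpace α} {f : α → ℝ} (hf : StronglyMeasurable f) (c : ℝ) : MeasurableSet {o | f o < c} :=
  measurableSet_lt hf.measurable measurable_const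
lemma ms_ge {α : Type*} {m' : MeasurableSpace α} {f : α → ℝ} (hf : StronglyMeasurable f) (c : ℝ) : MeasurableSet {o | c ≤ f o} :=
  measurableSet_le measurable_const hf.measurable
lemma ms_gt {α : Type*} {m' : MeasurableSpace α} {f : α → ℝ} (hf : StronglyMeasurable f) (c : ℝ) : MeasurableSet {o | c < f o} :=
  measurableSet_lt measurable_const hf.measurable
lemma sm_abs {α : Type*} {m' : MeasurableSpace α} {f : α → ℝ} (hf : StronglyMeasurable f) : StronglyMeasurable (fun o => |f o|) :=
  continuous_abs.comp_stronglyMeasurable hf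

/-- densities and a dominating variable -/
structure Dens (P : Measure Ω) (z r v : Ω → ℝ) : Prop where
  zi : Integrable z P
  zp : ∀ᵐ o ∂P, 0 < z o
  z1 : ∫ o, z o ∂P = 1
  ri : Integrable r P
  rp : ∀ᵐ o ∂P, 0 < r o
  r1 : ∫ o, r o ∂P = 1
  v0 : ∀ o, 0 ≤ v o
  zv : Integrable (fun o => z o * v o) P
  rv : Integrable (fun o => r o * v o) P

/-- a nonnegative process dominated by `v` -/
structure Dom (P : Measure Ω) (H : Filtration ℕ m) (M : ℕ) (z r v : Ω → ℝ) (A : ℕ → Ω → ℝ) : Prop where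
  sm : ∀ i, StronglyMeasurable[H i] (A i)
  nn : ∀ i o, 0 ≤ A i o
  zi : ∀ i ≤ M, Integrable (fun o => z o * A i o) P
  ri : ∀ i ≤ M, Integrable (fun o => r o * A i o) P
  zd : ∀ i ≤ M, ∀ E, MeasurableSet[H i] E → ∫ o in E, z o * A i o ∂P ≤ ∫ o in E, z o * v o ∂P
  rd : ∀ i ≤ M, ∀ E, MeasurableSet[H i] E → ∫ o in E, r o * A i o ∂P ≤ ∫ o in E, r o * v o ∂P

/-- density ratio -/
def Dq (P : Measure Ω) (H : Filtration ℕ m) (z r : Ω → ℝ) (i : ℕ) : Ω → ℝ := fun o => (P[r|H i]) o / (P[z|H i]) o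

/-- good sets -/
def Gs (P : Measure Ω) (H : Filtration ℕ m) (z r : Ω → ℝ) (A : ℕ → Ω → ℝ) (n : ℝ) (i : ℕ) : Set Ω :=
  {o | ∀ j ≤ i, |Dq P H z r j o| ≤ n ∧ 1/n ≤ (P[z|H j]) o ∧ A j o ≤ n}

variable {H : Filtration ℕ m} {z r v : Ω → ℝ} {A : ℕ → Ω → ℝ} {M : ℕ}

lemma Dq_sm (i : ℕ) : StronglyMeasurable[H i] (Dq P H z r i) :=
  (stronglyMeasurable_condExp.measurable.div stronglyMeasurable_condExp.measurable).stronglyMeasurable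

lemma Gs_meas (hA : ∀ i, StronglyMeasurable[H i] (A i)) (n : ℝ) (i : ℕ) : MeasurableSet[H i] (Gs P H z r A n i) := by
  have : Gs P H z r A n i = ⋂ j, ⋂ (_ : j ≤ i), ({o | |Dq P H z r j o| ≤ n} ∩ ({o | 1/n ≤ (P[z|H j]) o} ∩ {o | A j o ≤ n})) := by
    ext o; simp [Gs]
  rw [this]
  refine @MeasurableSet.iInter _ _ (H i) _ _ fun j => @MeasurableSet.iInter _ _ (H i) _ _ fun hj => H.mono hj _ ?_
  refine @MeasurableSet.inter _ (H j) _ _ ?_ (@MeasurableSet.inter _ (H j) _ _ ?_ ?_)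
  · exact ms_le (sm_abs (Dq_sm j)) _
  · exact ms_ge stronglyMeasurable_condExp _
  · exact ms_le (hA j) _

lemma Gs_anti (n : ℝ) : Antitone (Gs P H z r A n) := fun i j hij o hω k hk => hω k (hk.trans hij)

lemma Z_small (hD : Dens P z r v) {δ : ℝ} (hδ : 0 < δ) :
    ∃ n' : ℝ, 0 < n' ∧ ∀ (H : Filtration ℕ m) (M : ℕ), P.real (⋃ j ∈ Finset.range (M+1), {o | (P[z|H j]) o < 1/n'}) ≤ δ := by
  obtain ⟨κ, hκ, h⟩ := small_of_int hD.zi hD.zp hδ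
  refine ⟨1/κ, by positivity, fun H M => ?_⟩
  have hCm : ∀ j, MeasurableSet[H j] {o | (P[z|H j]) o < 1/(1/κ)} := fun j =>
    ms_lt stronglyMeasurable_condExp _
  refine h _ (Finset.measurableSet_biUnion _ fun j _ => H.le j _ (hCm j)) ?_
  have := maxl (P := P) H hD.zi (integrable_const (1:ℝ)) (ae_of_all _ fun _ => zero_le_one) hκ.le _ hCm M (by
    intro j hj B hB hBC
    rw [← setIntegral_condExp (H.le j) hD.zi hB, ← integral_const_mul]
    refine setIntegral_mono_on integrable_condExp.integrableOn ((integrable_const _).integrableOn) (H.le j _ hB) fun o hω => ?_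
    have := hBC hω
    simp only [mem_setOf_eq, one_div_one_div] at this
    linarith)
  simpa using this

lemma D_max (hD : Dens P z r v) (H : Filtration ℕ m) (M : ℕ) {n : ℝ} (hn : 0 < n) :
    ∫ o in ⋃ j ∈ Finset.range (M+1), {o | n < |Dq P H z r j o|}, z o ∂P ≤ 1/n := by
  have hCm : ∀ j, MeasurableSet[H j] {o | n < |Dq P H z r j o|} := fun j =>
    ms_gt (sm_abs (Dq_sm j)) _
  have := maxl (P := P) H hD.zi hD.ri (hD.rp.mono fun _ h => h.le) (c := 1/n) (by positivity) _ hCm M (by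
    intro j hj B hB hBC
    rw [← setIntegral_condExp (H.le j) hD.zi hB, ← setIntegral_condExp (H.le j) hD.ri hB, ← integral_const_mul]
    refine setIntegral_mono_on_ae integrable_condExp.integrableOn ((integrable_condExp.const_mul _).integrableOn) (H.le j _ hB) ?_
    filter_upwards [condExp_pos_of (H.le j) hD.zi hD.zp, condExp_pos_of (H.le j) hD.ri hD.rp] with o a b hω
    have := hBC hω
    simp only [mem_setOf_eq, Dq] at this
    rw [abs_of_pos (by positivity), lt_div_iff₀ a] at this
    rw [one_div, ← div_eq_inv_mul, le_div_iff₀ hn]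
    linarith)
  rwa [hD.r1, mul_one] at this

lemma A_max (hD : Dens P z r v) (hA : Dom P H M z r v A) {n : ℝ} (hn : 0 < n) :
    ∫ o in ⋃ j ∈ Finset.range (M+1), {o | n < A j o}, z o ∂P ≤ 1/n * ∫ o, z o * v o ∂P := by
  have hCm : ∀ j, MeasurableSet[H j] {o | n < A j o} := fun j =>
    ms_gt (hA.sm j) _
  refine maxl (P := P) H hD.zi hD.zv (hD.zp.mono fun o h => mul_nonneg h.le (hD.v0 o)) (c := 1/n) (by positivity) _ hCm M ?_
  intro j hj B hB hBC
  refine le_trans ?_ (mul_le_mul_of_nonneg_left (hA.zd j hj B hB) (by positivity))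
  rw [← integral_const_mul]
  refine setIntegral_mono_on_ae hD.zi.integrableOn (((hA.zi j hj).const_mul _).integrableOn) (H.le j _ hB) ?_
  filter_upwards [hD.zp] with o a hω
  have := hBC hω
  simp only [mem_setOf_eq] at this
  rw [one_div, ← div_eq_inv_mul, le_div_iff₀ hn]
  gcongr

lemma Gs_compl (hD : Dens P z r v) {ε : ℝ} (hε : 0 < ε) :
    ∃ n : ℝ, 1 ≤ n ∧ ∀ (H : Filtration ℕ m) (M : ℕ) (A : ℕ → Ω → ℝ), Dom P H M z r v A → ∫ o in (Gs P H z r A n M)ᶜ, r o ∂P ≤ ε := by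
  obtain ⟨δ, hδ, h1⟩ := ac_int hD.ri hε
  obtain ⟨n', hn', h2⟩ := Z_small hD (half_pos hδ)
  obtain ⟨κ, hκ, h3⟩ := small_of_int hD.zi hD.zp (half_pos hδ)
  have hV : 0 ≤ ∫ o, z o * v o ∂P := integral_nonneg_of_ae (hD.zp.mono fun o h => mul_nonneg h.le (hD.v0 o))
  set V := ∫ o, z o * v o ∂P
  set n := max 1 (max n' ((1 + V)/κ)) with hn
  have hn1 : 1 ≤ n := le_max_left _ _
  have hn0 : 0 < n := by linarith
  have hnn : n' ≤ n := (le_max_left _ _).trans (le_max_right _ _)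
  have hnV : (1 + V)/κ ≤ n := (le_max_right _ _).trans (le_max_right _ _)
  refine ⟨n, hn1, fun H M A hA => h1 _ ?_⟩
  set E1 := ⋃ j ∈ Finset.range (M+1), {o | (P[z|H j]) o < 1/n'}
  set E2 := ⋃ j ∈ Finset.range (M+1), {o | n < |Dq P H z r j o|}
  set E3 := ⋃ j ∈ Finset.range (M+1), {o | n < A j o}
  have hsub : (Gs P H z r A n M)ᶜ ⊆ E1 ∪ (E2 ∪ E3) := by
    intro o hω
    simp only [Gs, mem_compl_iff, mem_setOf_eq, not_forall] at hω
    obtain ⟨j, hj, hω⟩ := hω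
    simp only [E1, E2, E3, mem_union, mem_iUnion, Finset.mem_range, mem_setOf_eq, exists_prop]
    by_contra hc
    push Not at hc
    apply hω
    obtain ⟨a, b, c⟩ := hc
    refine ⟨b j (by omega), le_trans ?_ (a j (by omega)), c j (by omega)⟩
    gcongr
  have hE2 : MeasurableSet E2 := Finset.measurableSet_biUnion _ fun j _ => H.le j _
    (ms_gt (sm_abs (Dq_sm j)) _)
  have hE3 : MeasurableSet E3 := Finset.measurableSet_biUnion _ fun j _ => H.le j _
    (ms_gt (hA.sm j) _)
  have b1 := h2 H M
  have b2 : P.real (E2 ∪ E3) ≤ δ/2 := by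
    refine h3 _ (hE2.union hE3) ?_
    have c1 : ∫ o in E2 ∪ E3, z o ∂P ≤ ∫ o in E2, z o ∂P + ∫ o in E3, z o ∂P := by
      rw [← union_diff_self, setIntegral_union disjoint_sdiff_self_right (hE3.diff hE2) hD.zi.integrableOn hD.zi.integrableOn]
      refine add_le_add le_rfl ?_
      refine setIntegral_mono_set hD.zi.integrableOn (ae_restrict_of_ae (hD.zp.mono fun o h => h.le)) ?_
      exact diff_subset.eventuallyLE
    have c2 := D_max hD H M hn0
    have c3 := A_max hD hA hn0
    have c4 : 1/n + 1/n * V ≤ κ := by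
      rw [div_le_iff₀ hκ] at hnV
      have : 1/n + 1/n*V = (1+V)/n := by ring
      rw [this, div_le_iff₀ hn0]
      linarith
    linarith
  calc P.real (Gs P H z r A n M)ᶜ ≤ P.real (E1 ∪ (E2 ∪ E3)) := measureReal_mono hsub
    _ ≤ P.real E1 + P.real (E2 ∪ E3) := measureReal_union_le _ _
    _ ≤ δ := by linarith

lemma swapD (hD : Dens P z r v) {n : ℝ} (hn : 0 < n) {j : ℕ} {q : Ω → ℝ} (hq : StronglyMeasurable[H j] q) {C : Set Ω}
    (hC : MeasurableSet[H j] C) (hCG : C ⊆ Gs P H z r A n j) {c : ℝ} (hb : ∀ o ∈ C, |q o| ≤ c) :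
    ∫ o in C, r o * q o ∂P = ∫ o in C, z o * (Dq P H z r j o * q o) ∂P := by
  have e2 : ∫ o in C, z o * (Dq P H z r j o * q o) ∂P = ∫ o in C, (P[z|H j]) o * (Dq P H z r j o * q o) ∂P :=
    (pull_bdd (H.le j) hD.zi (q := fun o => Dq P H z r j o * q o) ((Dq_sm (P := P) (z := z) (r := r) j).mul hq) hC (c := n * c) (fun o hω => by
    rw [abs_mul]
    exact mul_le_mul (hCG hω j le_rfl).1 (hb o hω) (abs_nonneg _) hn.le)).1
  rw [(pull_bdd (H.le j) hD.ri hq hC hb).1, e2]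
  refine setIntegral_congr_fun (H.le j _ hC) fun o hω => ?_
  have h1 := (hCG hω j le_rfl).2.1
  have h2 : 0 < (P[z|H j]) o := lt_of_lt_of_le (by positivity) h1
  simp only [Pi.mul_apply, Dq]
  field_simp

lemma dsq_step (hD : Dens P z r v) (hA : ∀ i, StronglyMeasurable[H i] (A i)) {n : ℝ} (hn : 0 < n) (i : ℕ) :
    ∫ o in Gs P H z r A n (i+1), z o * (Dq P H z r (i+1) o - Dq P H z r i o)^2 ∂P ≤
      (∫ o in Gs P H z r A n (i+1), z o * (Dq P H z r (i+1) o)^2 ∂P + 2 * n * ∫ o in (Gs P H z r A n (i+1))ᶜ, r o ∂P) -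
      (∫ o in Gs P H z r A n i, z o * (Dq P H z r i o)^2 ∂P + 2 * n * ∫ o in (Gs P H z r A n i)ᶜ, r o ∂P) := by
  set G := Gs P H z r A n i with hG
  set G' := Gs P H z r A n (i+1) with hG'
  set q := Dq P H z r i with hq
  set q' := Dq P H z r (i+1) with hq'
  have hsub : G' ⊆ G := Gs_anti n i.le_succ
  have hGm : MeasurableSet[H i] G := Gs_meas hA n i
  have hGm' : MeasurableSet[H (i+1)] G' := Gs_meas hA n (i+1)
  have gm := H.le _ _ hGm
  have gm' := H.le _ _ hGm'
  have sq : StronglyMeasurable[H i] q := Dq_sm i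
  have sq' : StronglyMeasurable[H (i+1)] q' := Dq_sm (i+1)
  have sq1 : StronglyMeasurable[H (i+1)] q := sq.mono (H.mono i.le_succ)
  have aq := (sq.mono (H.le _)).aestronglyMeasurable (μ := P)
  have aq' := (sq'.mono (H.le _)).aestronglyMeasurable (μ := P)
  have bq : ∀ o ∈ G, |q o| ≤ n := fun o hω => (hω i le_rfl).1
  have bq' : ∀ o ∈ G', |q' o| ≤ n := fun o hω => (hω (i+1) le_rfl).1
  have bm : ∀ a b : ℝ, |a| ≤ n → |b| ≤ n → |a * b| ≤ n * n := fun a b ha hb => by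
    rw [abs_mul]; exact mul_le_mul ha hb (abs_nonneg _) hn.le
  have i1 : IntegrableOn (fun o => z o * (q' o * q' o)) G' P :=
    intOn_bdd hD.zi (aq'.mul aq') gm' (c := n*n) fun o hω => bm _ _ (bq' o hω) (bq' o hω)
  have i2 : IntegrableOn (fun o => z o * (q' o * q o)) G' P :=
    intOn_bdd hD.zi (aq'.mul aq) gm' (c := n*n) fun o hω => bm _ _ (bq' o hω) (bq o (hsub hω))
  have i3 : IntegrableOn (fun o => z o * (q o * q o)) G P :=
    intOn_bdd hD.zi (aq.mul aq) gm (c := n*n) fun o hω => bm _ _ (bq o hω) (bq o hω)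
  have i4 : IntegrableOn (fun o => r o * q o) G P := intOn_bdd hD.ri aq gm bq
  have e1 : ∫ o in G', z o * (q' o - q o)^2 ∂P = ∫ o in G', z o * (q' o * q' o) ∂P - 2 * ∫ o in G', z o * (q' o * q o) ∂P
      + ∫ o in G', z o * (q o * q o) ∂P := by
    have i5 : IntegrableOn (fun o => z o * (q' o * q' o) - 2 * (z o * (q' o * q o))) G' P := i1.sub (i2.const_mul 2)
    rw [← integral_const_mul, ← integral_sub i1 (i2.const_mul 2), ← integral_add i5 (i3.mono_set hsub)]
    refine integral_congr_ae (ae_of_all _ fun o => ?_)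
    dsimp only; ring
  have e2 : ∫ o in G', r o * q o ∂P = ∫ o in G', z o * (q' o * q o) ∂P :=
    swapD hD hn sq1 hGm' subset_rfl (c := n) fun o hω => bq o (hsub hω)
  have e3 : ∫ o in G, r o * q o ∂P = ∫ o in G, z o * (q o * q o) ∂P := swapD hD hn sq hGm subset_rfl bq
  have e4 : ∫ o in G, r o * q o ∂P = ∫ o in G', r o * q o ∂P + ∫ o in G \ G', r o * q o ∂P := by
    rw [← setIntegral_union disjoint_sdiff_self_right (gm.diff gm') (i4.mono_set hsub) (i4.mono_set diff_subset), union_diff_cancel hsub]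
  have e5 : ∫ o in G \ G', r o * q o ∂P ≤ n * ∫ o in G \ G', r o ∂P := by
    rw [← integral_const_mul]
    refine setIntegral_mono_on_ae (i4.mono_set diff_subset) (hD.ri.integrableOn.const_mul _) (gm.diff gm') ?_
    filter_upwards [hD.rp] with o h hω
    rw [mul_comm]
    exact mul_le_mul_of_nonneg_right ((le_abs_self _).trans (bq o hω.1)) h.le
  have e6 : ∫ o in G'ᶜ, r o ∂P = ∫ o in Gᶜ, r o ∂P + ∫ o in G \ G', r o ∂P := by
    rw [← setIntegral_union (show Disjoint Gᶜ (G \ G') from disjoint_left.2 fun o h1 h2 => h1 h2.1) (gm.diff gm') hD.ri.integrableOn hD.ri.integrableOn]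
    congr 2
    ext o; simp only [mem_compl_iff, mem_union, mem_diff]
    by_cases h1 : o ∈ G' <;> by_cases h2 : o ∈ G <;> simp [h1, h2]
    exact h2 (hsub h1)
  have e7 : ∫ o in G', z o * (q o * q o) ∂P ≤ ∫ o in G, z o * (q o * q o) ∂P := by
    refine setIntegral_mono_set i3 (ae_restrict_of_ae ?_) hsub.eventuallyLE
    filter_upwards [hD.zp] with o h
    exact mul_nonneg h.le (mul_self_nonneg _)
  rw [e1]
  simp only [pow_two]
  rw [e6]
  nlinarith

lemma dsq (hD : Dens P z r v) (hA : ∀ i, StronglyMeasurable[H i] (A i)) {n : ℝ} (hn : 0 < n) (M : ℕ) :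
    ∑ i ∈ Finset.range M, ∫ o in Gs P H z r A n (i+1), z o * (Dq P H z r (i+1) o - Dq P H z r i o)^2 ∂P ≤ 2 * n := by
  refine (Finset.sum_le_sum fun i _ => dsq_step hD hA hn i).trans ?_
  rw [Finset.sum_range_sub (fun i => ∫ o in Gs P H z r A n i, z o * (Dq P H z r i o)^2 ∂P + 2 * n * ∫ o in (Gs P H z r A n i)ᶜ, r o ∂P)]
  have h0 : 0 ≤ ∫ o in Gs P H z r A n 0, z o * (Dq P H z r 0 o)^2 ∂P :=
    integral_nonneg_of_ae (ae_restrict_of_ae (hD.zp.mono fun o h => mul_nonneg h.le (sq_nonneg _)))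
  have h1 : 0 ≤ ∫ o in (Gs P H z r A n 0)ᶜ, r o ∂P :=
    integral_nonneg_of_ae (ae_restrict_of_ae (hD.rp.mono fun o h => h.le))
  set G := Gs P H z r A n M with hG
  have hGm : MeasurableSet[H M] G := Gs_meas hA n M
  have bq : ∀ o ∈ G, |Dq P H z r M o| ≤ n := fun o hω => (hω M le_rfl).1
  have h2 := swapD (A := A) hD hn (Dq_sm (P := P) (z := z) (r := r) M) hGm subset_rfl bq
  have h3 : ∫ o in G, r o * Dq P H z r M o ∂P ≤ n * ∫ o in G, r o ∂P := by
    rw [← integral_const_mul]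
    refine setIntegral_mono_on_ae (intOn_bdd hD.ri ((Dq_sm M).mono (H.le _)).aestronglyMeasurable (H.le _ _ hGm) bq) (hD.ri.integrableOn.const_mul _) (H.le _ _ hGm) ?_
    filter_upwards [hD.rp] with o h hω
    rw [mul_comm]
    exact mul_le_mul_of_nonneg_right ((le_abs_self _).trans (bq o hω)) h.le
  have h4 := integral_add_compl (H.le _ _ hGm) hD.ri
  rw [hD.r1] at h4
  have h5 : 0 ≤ ∫ o in G, r o ∂P :=
    integral_nonneg_of_ae (ae_restrict_of_ae (hD.rp.mono fun o h => h.le))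
  simp only [pow_two] at *
  nlinarith

lemma int_of_dom {w : Ω → ℝ} (hw : AEStronglyMeasurable w P) (hA : Dom P H M z r v A) {κ : ℝ} {i : ℕ} {a : Ω → ℝ}
    (h1 : Integrable (fun o => w o * A i o) P) (h2 : Integrable (fun o => w o * A (i+1) o) P)
    (ha : StronglyMeasurable[H (i+1)] a) (hb : ∀ o, |a o| ≤ κ * (A i o + A (i+1) o)) :
    Integrable (fun o => w o * a o) P := by
  refine Integrable.mono' ((h1.norm.add h2.norm).const_mul κ) (hw.mul (ha.mono (H.le _)).aestronglyMeasurable) (ae_of_all _ fun o => ?_)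
  simp only [Pi.add_apply, norm_mul, Real.norm_eq_abs]
  rw [abs_of_nonneg (hA.nn i o), abs_of_nonneg (hA.nn (i+1) o)]
  calc |w o| * |a o| ≤ |w o| * (κ * (A i o + A (i+1) o)) := mul_le_mul_of_nonneg_left (hb o) (abs_nonneg _)
    _ = _ := by ring

lemma core_main (hD : Dens P z r v) (hA : Dom P H M z r v A) {n κ lam : ℝ} (hn : 1 ≤ n) (hκ : 0 ≤ κ) (hlam : 0 < lam) {i : ℕ} (hi : i < M) {a : Ω → ℝ}
    (ha : StronglyMeasurable[H (i+1)] a) (hb : ∀ o, |a o| ≤ κ * (A i o + A (i+1) o))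
    (hc : P[fun o => z o * a o|H i] =ᵐ[P] 0) (hI : Integrable (fun o => ((P[z|H i]) o * (P[z|H (i+1)]) o * a o)^2) P) :
    |∫ o in Gs P H z r A n i, r o * a o ∂P| ≤
      lam / 2 * ∫ o in Gs P H z r A n (i+1), z o * (Dq P H z r (i+1) o - Dq P H z r i o)^2 ∂P
      + n^3/(2*lam) * ∫ o, ((P[z|H i]) o * (P[z|H (i+1)]) o * a o)^2 ∂P
      + ∫ o in Gs P H z r A n i \ Gs P H z r A n (i+1), (r o + n * z o) * |a o| ∂P := by
  have hn0 : 0 < n := by linarith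
  set G := Gs P H z r A n i with hG
  set G' := Gs P H z r A n (i+1) with hG'
  set q := Dq P H z r i with hq
  set q' := Dq P H z r (i+1) with hq'
  have hsub : G' ⊆ G := Gs_anti n i.le_succ
  have hGm : MeasurableSet[H i] G := Gs_meas hA.sm n i
  have hGm' : MeasurableSet[H (i+1)] G' := Gs_meas hA.sm n (i+1)
  have gm := H.le _ _ hGm
  have gm' := H.le _ _ hGm'
  have sq : StronglyMeasurable[H i] q := Dq_sm i
  have sq' : StronglyMeasurable[H (i+1)] q' := Dq_sm (i+1)
  have sq1 : StronglyMeasurable[H (i+1)] q := sq.mono (H.mono i.le_succ)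
  have aq := (sq.mono (H.le _)).aestronglyMeasurable (μ := P)
  have aq' := (sq'.mono (H.le _)).aestronglyMeasurable (μ := P)
  have bq : ∀ o ∈ G, |q o| ≤ n := fun o hω => (hω i le_rfl).1
  have bq' : ∀ o ∈ G', |q' o| ≤ n := fun o hω => (hω (i+1) le_rfl).1
  have ba : ∀ o ∈ G', |a o| ≤ 2*κ*n := fun o hω => (hb o).trans (by
    have h1 := (hω i (by omega)).2.2
    have h2 := (hω (i+1) le_rfl).2.2
    nlinarith)
  have ira : Integrable (fun o => r o * a o) P := int_of_dom hD.ri.1 hA (hA.ri i hi.le) (hA.ri (i+1) hi) ha hb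
  have iza : Integrable (fun o => z o * a o) P := int_of_dom hD.zi.1 hA (hA.zi i hi.le) (hA.zi (i+1) hi) ha hb
  have izaq : IntegrableOn (fun o => z o * a o * q o) G P := intOn_bdd iza aq gm bq
  have c1 : ∫ o in G, z o * a o * q o ∂P = 0 := by
    rw [(pull (H.le i) iza sq hGm izaq).1, integral_eq_zero_of_ae]
    refine ae_restrict_of_ae ?_
    filter_upwards [hc] with o h
    rw [h]; simp
  have ip : IntegrableOn (fun o => r o * a o - z o * a o * q o) G P := ira.integrableOn.sub izaq
  have c2 : ∫ o in G, r o * a o ∂P = ∫ o in G', (r o * a o - z o * a o * q o) ∂P + ∫ o in G \ G', (r o * a o - z o * a o * q o) ∂P := by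
    rw [← setIntegral_union disjoint_sdiff_self_right (gm.diff gm') (ip.mono_set hsub) (ip.mono_set diff_subset), union_diff_cancel hsub,
      integral_sub ira.integrableOn izaq, c1, sub_zero]
  have c3 : ∫ o in G', r o * a o ∂P = ∫ o in G', z o * (q' o * a o) ∂P := swapD hD hn0 ha hGm' subset_rfl ba
  have bm : ∀ x y c d : ℝ, |x| ≤ c → |y| ≤ d → 0 ≤ c → |x * y| ≤ c * d := fun a b c d ha hb hc => by
    rw [abs_mul]; exact mul_le_mul ha hb (abs_nonneg _) hc
  have aa := (ha.mono (H.le _)).aestronglyMeasurable (μ := P)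
  have j1 : IntegrableOn (fun o => z o * (q' o * a o)) G' P :=
    intOn_bdd hD.zi (aq'.mul aa) gm' (c := n*(2*κ*n)) fun o hω => bm _ _ _ _ (bq' o hω) (ba o hω) hn0.le
  have j2 : IntegrableOn (fun o => z o * (q o * a o)) G' P :=
    intOn_bdd hD.zi (aq.mul aa) gm' (c := n*(2*κ*n)) fun o hω => bm _ _ _ _ (bq o (hsub hω)) (ba o hω) hn0.le
  have c4 : ∫ o in G', (r o * a o - z o * a o * q o) ∂P = ∫ o in G', z o * ((q' o - q o) * a o) ∂P := by
    rw [integral_sub ira.integrableOn (izaq.mono_set hsub), c3]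
    have e : ∫ o in G', z o * a o * q o ∂P = ∫ o in G', z o * (q o * a o) ∂P := by
      congr 1; ext o; ring
    rw [e, ← integral_sub j1 j2]
    congr 1; ext o; ring
  have bd : ∀ o ∈ G', |q' o - q o| ≤ n + n := fun o hω => (abs_sub _ _).trans (add_le_add (bq' o hω) (bq o (hsub hω)))
  have k1 : IntegrableOn (fun o => z o * (q' o - q o)^2) G' P :=
    intOn_bdd hD.zi ((aq'.sub aq).pow 2) gm' (c := (n+n)*(n+n)) fun o hω => by
      simp only [Pi.pow_apply, Pi.sub_apply]
      rw [pow_two]; exact bm _ _ _ _ (bd o hω) (bd o hω) (by positivity)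
  have c5' := pull_bdd (H.le (i+1)) hD.zi (q := fun o => (a o)^2) (by exact ha.pow 2) hGm' (c := (2*κ*n)*(2*κ*n)) fun o hω => by
      rw [pow_two]; exact bm _ _ _ _ (ba o hω) (ba o hω) (by positivity)
  have c6 : ∫ o in G', z o * (a o)^2 ∂P ≤ n^3 * ∫ o, ((P[z|H i]) o * (P[z|H (i+1)]) o * a o)^2 ∂P := by
    rw [c5'.1]
    calc _ ≤ ∫ o in G', n^3 * ((P[z|H i]) o * (P[z|H (i+1)]) o * a o)^2 ∂P := by
          refine setIntegral_mono_on c5'.2.2 (hI.integrableOn.const_mul _) gm' fun o hω => ?_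
          have h1 := (hω i (by omega)).2.1
          have h2 := (hω (i+1) le_rfl).2.1
          set Z := (P[z|H i]) o
          set Z' := (P[z|H (i+1)]) o
          rw [div_le_iff₀ hn0] at h1 h2
          have e1 : 0 < Z' := by by_contra hh; push Not at hh; nlinarith
          have e2 : n^3 * (Z * Z' * a o)^2 = (Z' * a o^2) * ((Z*n)^2 * (Z' * n)) := by ring
          rw [e2]
          refine le_mul_of_one_le_right (by positivity) ?_
          exact one_le_mul_of_one_le_of_one_le (one_le_pow₀ h1) h2
      _ ≤ _ := by
          rw [integral_const_mul]
          refine mul_le_mul_of_nonneg_left (setIntegral_le_integral hI (ae_of_all _ fun o => sq_nonneg _)) (by positivity)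
  have c7 : |∫ o in G', z o * ((q' o - q o) * a o) ∂P| ≤ lam/2 * ∫ o in G', z o * (q' o - q o)^2 ∂P + 1/(2*lam) * ∫ o in G', z o * (a o)^2 ∂P := by
    rw [← integral_const_mul, ← integral_const_mul, ← integral_add (k1.const_mul _) (c5'.2.1.const_mul _)]
    rw [← Real.norm_eq_abs]
    refine norm_integral_le_of_norm_le (by exact (k1.const_mul (lam/2)).add (c5'.2.1.const_mul (1/(2*lam)))) (ae_restrict_of_ae ?_)
    filter_upwards [hD.zp] with o h
    rw [Real.norm_eq_abs, abs_mul, abs_of_pos h]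
    have : |(q' o - q o) * a o| ≤ lam/2 * (q' o - q o)^2 + 1/(2*lam) * (a o)^2 := by
      rw [abs_mul]
      have h1 : 0 ≤ (lam * |q' o - q o| - |a o|)^2 / (2*lam) := by positivity
      have h2 : (lam * |q' o - q o| - |a o|)^2 / (2*lam) = lam/2 * |q' o - q o|^2 + 1/(2*lam) * |a o|^2 - |q' o - q o| * |a o| := by
        field_simp; ring
      rw [sq_abs, sq_abs] at h2
      linarith
    have := mul_le_mul_of_nonneg_left this h.le
    linarith
  have c8 : |∫ o in G \ G', (r o * a o - z o * a o * q o) ∂P| ≤ ∫ o in G \ G', (r o + n * z o) * |a o| ∂P := by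
    rw [← Real.norm_eq_abs]
    refine norm_integral_le_of_norm_le (g := fun o => (r o + n * z o) * |a o|) ?_ ?_
    · have : Integrable (fun o => |r o * a o| + n * |z o * a o|) P := ira.abs.add (iza.abs.const_mul n)
      refine (this.congr ?_).integrableOn
      filter_upwards [hD.rp, hD.zp] with o h1 h2
      rw [abs_mul, abs_mul, abs_of_pos h1, abs_of_pos h2]; ring
    · refine (ae_restrict_iff' (gm.diff gm')).2 ?_
      filter_upwards [hD.rp, hD.zp] with o h1 h2 hω
      have h3 := bq o hω.1
      rw [Real.norm_eq_abs]
      refine (abs_sub _ _).trans ?_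
      rw [abs_mul, abs_mul, abs_mul, abs_of_pos h1, abs_of_pos h2]
      have := mul_le_mul_of_nonneg_left h3 (mul_nonneg h2.le (abs_nonneg (a o)))
      linarith
  rw [c2, c4]
  refine (abs_add_le _ _).trans (add_le_add (c7.trans (add_le_add le_rfl ?_)) c8)
  have := mul_le_mul_of_nonneg_left c6 (show 0 ≤ 1/(2*lam) by positivity)
  refine this.trans (le_of_eq ?_)
  ring

lemma p_int (hD : Dens P z r v) (n : ℝ) : Integrable (fun o => r o + n * z o) P := hD.ri.add (hD.zi.const_mul n)

lemma p_int1 (hD : Dens P z r v) (n : ℝ) : ∫ o, (r o + n * z o) ∂P = 1 + n := by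
  rw [integral_add hD.ri (hD.zi.const_mul n), integral_const_mul, hD.z1, hD.r1, mul_one]

lemma pv_int (hD : Dens P z r v) (n : ℝ) : Integrable (fun o => (r o + n * z o) * (n + v o)) P := by
  have := ((hD.ri.mul_const n).add hD.rv).add (((hD.zi.mul_const n).add hD.zv).const_mul n)
  refine this.congr (ae_of_all _ fun o => ?_)
  simp only [Pi.add_apply]; ring

lemma core_E (hD : Dens P z r v) (hA : Dom P H M z r v A) {n κ η : ℝ} (hn : 1 ≤ n) (hκ : 0 ≤ κ) (hη : 0 < η) {i : ℕ} (hi : i < M) {a : Ω → ℝ}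
    (ha : StronglyMeasurable[H (i+1)] a) (hb : ∀ o, |a o| ≤ κ * (A i o + A (i+1) o)) :
    ∫ o in Gs P H z r A n i \ Gs P H z r A n (i+1), (r o + n * z o) * |a o| ∂P ≤
      η * ∫ o in Gs P H z r A n i \ Gs P H z r A n (i+1), (r o + n * z o) ∂P +
      κ * ∫ o in (Gs P H z r A n i \ Gs P H z r A n (i+1)) ∩ {o | η < |a o|}, (r o + n * z o) * (n + v o) ∂P := by
  have hn0 : 0 < n := by linarith
  set G := Gs P H z r A n i with hG
  set G' := Gs P H z r A n (i+1) with hG'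
  have hGm : MeasurableSet[H (i+1)] G := H.mono i.le_succ _ (Gs_meas hA.sm n i)
  have hGm' : MeasurableSet[H (i+1)] G' := Gs_meas hA.sm n (i+1)
  have hE1 : MeasurableSet[H (i+1)] (G \ G') := @MeasurableSet.diff _ (H (i+1)) _ _ hGm hGm'
  have hE2 : MeasurableSet[H (i+1)] {o | η < |a o|} := ms_gt (sm_abs ha) _
  have hE : MeasurableSet[H (i+1)] ((G \ G') ∩ {o | η < |a o|}) := @MeasurableSet.inter _ (H (i+1)) _ _ hE1 hE2
  set E' := G \ G'
  set E := E' ∩ {o | η < |a o|} with hEd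
  have me := H.le _ _ hE
  have me' := H.le _ _ hE1
  have me2 := H.le _ _ hE2
  have ira : Integrable (fun o => r o * a o) P := int_of_dom hD.ri.1 hA (hA.ri i hi.le) (hA.ri (i+1) hi) ha hb
  have iza : Integrable (fun o => z o * a o) P := int_of_dom hD.zi.1 hA (hA.zi i hi.le) (hA.zi (i+1) hi) ha hb
  have ipa : Integrable (fun o => (r o + n * z o) * |a o|) P := by
    have : Integrable (fun o => |r o * a o| + n * |z o * a o|) P := ira.abs.add (iza.abs.const_mul n)
    refine this.congr ?_
    filter_upwards [hD.rp, hD.zp] with o h1 h2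
    rw [abs_mul, abs_mul, abs_of_pos h1, abs_of_pos h2]; ring
  have e1 : ∫ o in E', (r o + n * z o) * |a o| ∂P = ∫ o in E' \ {o | η < |a o|}, (r o + n * z o) * |a o| ∂P + ∫ o in E, (r o + n * z o) * |a o| ∂P := by
    rw [← setIntegral_union (disjoint_left.2 fun o h1 h2 => h1.2 h2.2) me ipa.integrableOn ipa.integrableOn, diff_union_inter]
  have e2 : ∫ o in E' \ {o | η < |a o|}, (r o + n * z o) * |a o| ∂P ≤ η * ∫ o in E', (r o + n * z o) ∂P := by
    calc _ ≤ ∫ o in E' \ {o | η < |a o|}, η * (r o + n * z o) ∂P := by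
          refine setIntegral_mono_on_ae ipa.integrableOn ((p_int hD n).const_mul η).integrableOn (me'.diff me2) ?_
          filter_upwards [hD.rp, hD.zp] with o h1 h2 hω
          have h3 : |a o| ≤ η := by simpa using hω.2
          rw [mul_comm η]
          exact mul_le_mul_of_nonneg_left h3 (by positivity)
      _ ≤ ∫ o in E', η * (r o + n * z o) ∂P := by
          refine setIntegral_mono_set ((p_int hD n).const_mul η).integrableOn (ae_restrict_of_ae ?_) diff_subset.eventuallyLE
          filter_upwards [hD.rp, hD.zp] with o h1 h2
          simp only [Pi.zero_apply]; positivity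
      _ = _ := by rw [integral_const_mul]
  have iA : Integrable (fun o => (r o + n * z o) * (n + A (i+1) o)) P := by
    have := ((hD.ri.mul_const n).add (hA.ri (i+1) hi)).add (((hD.zi.mul_const n).add (hA.zi (i+1) hi)).const_mul n)
    refine this.congr (ae_of_all _ fun o => ?_)
    simp only [Pi.add_apply]; ring
  have e3 : ∫ o in E, (r o + n * z o) * |a o| ∂P ≤ κ * ∫ o in E, (r o + n * z o) * (n + A (i+1) o) ∂P := by
    rw [← integral_const_mul]
    refine setIntegral_mono_on_ae ipa.integrableOn (iA.const_mul κ).integrableOn me ?_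
    filter_upwards [hD.rp, hD.zp] with o h1 h2 hω
    have h3 := (hω.1.1 i le_rfl).2.2
    have h4 : |a o| ≤ κ * (n + A (i+1) o) := (hb o).trans (mul_le_mul_of_nonneg_left (by linarith) hκ)
    have := mul_le_mul_of_nonneg_left h4 (show 0 ≤ r o + n * z o by positivity)
    linarith
  have e4 : ∫ o in E, (r o + n * z o) * (n + A (i+1) o) ∂P ≤ ∫ o in E, (r o + n * z o) * (n + v o) ∂P := by
    have t1 := hA.rd (i+1) hi E hE
    have t2 := hA.zd (i+1) hi E hE
    have i1 := (hA.ri (i+1) hi).integrableOn (s := E)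
    have i2 := (hA.zi (i+1) hi).integrableOn (s := E)
    have i3 := hD.rv.integrableOn (s := E)
    have i4 := hD.zv.integrableOn (s := E)
    have i0 := ((p_int hD n).mul_const n).integrableOn (s := E)
    have f1 : ∫ o in E, (r o + n * z o) * (n + A (i+1) o) ∂P = ∫ o in E, (r o + n * z o) * n ∂P + (∫ o in E, r o * A (i+1) o ∂P + n * ∫ o in E, z o * A (i+1) o ∂P) := by
      rw [← integral_const_mul, ← integral_add i1 (i2.const_mul n), ← integral_add i0 (by exact i1.add (i2.const_mul n))]
      congr 1; ext o; ring
    have f2 : ∫ o in E, (r o + n * z o) * (n + v o) ∂P = ∫ o in E, (r o + n * z o) * n ∂P + (∫ o in E, r o * v o ∂P + n * ∫ o in E, z o * v o ∂P) := by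
      rw [← integral_const_mul, ← integral_add i3 (i4.const_mul n), ← integral_add i0 (by exact i3.add (i4.const_mul n))]
      congr 1; ext o; ring
    rw [f1, f2]
    have := mul_le_mul_of_nonneg_left t2 hn0.le
    linarith
  rw [e1]
  exact add_le_add e2 (e3.trans (mul_le_mul_of_nonneg_left e4 hκ))

lemma core (hD : Dens P z r v) {n κ ε0 : ℝ} (hn : 1 ≤ n) (hκ : 0 ≤ κ) (hε0 : 0 < ε0) :
    ∃ ε > 0, ∀ (H : Filtration ℕ m) (M : ℕ) (A : ℕ → Ω → ℝ), Dom P H M z r v A → ∀ a : ℕ → Ω → ℝ,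
      (∀ i < M, StronglyMeasurable[H (i+1)] (a i)) → (∀ i < M, ∀ o, |a i o| ≤ κ * (A i o + A (i+1) o)) →
      (∀ i < M, P[fun o => z o * a i o|H i] =ᵐ[P] 0) →
      (∀ i < M, Integrable (fun o => ((P[z|H i]) o * (P[z|H (i+1)]) o * a i o)^2) P) →
      ∑ i ∈ Finset.range M, ∫ o, ((P[z|H i]) o * (P[z|H (i+1)]) o * a i o)^2 ∂P ≤ ε →
      |∑ i ∈ Finset.range M, ∫ o in Gs P H z r A n i, r o * a i o ∂P| ≤ ε0 := by
  have hn0 : 0 < n := by linarith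
  set η := ε0 / (4 * (1+n)) with hη'
  have hη : 0 < η := by positivity
  obtain ⟨δ, hδ, h1⟩ := ac_int ((pv_int hD n).const_mul κ) (show 0 < ε0/4 by positivity)
  obtain ⟨n', hn', h2⟩ := Z_small hD (half_pos hδ)
  set ε := min (ε0^2/(8*n^4)) (δ/2 * (η/(n*n'))^2) with hεd
  have hε : 0 < ε := by
    rw [hεd]; exact lt_min (by positivity) (by positivity)
  have hεa : ε ≤ ε0^2/(8*n^4) := min_le_left _ _
  have hεb : ε ≤ δ/2 * (η/(n*n'))^2 := min_le_right _ _
  refine ⟨ε, hε, fun H M A hA a ha hb hc hI hs => ?_⟩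
  set G := Gs P H z r A n with hG
  set lam := ε0/(4*n) with hlam'
  have hlam : 0 < lam := by positivity
  have gm : ∀ i, MeasurableSet (G i) := fun i => H.le _ _ (Gs_meas hA.sm n i)
  set E : ℕ → Set Ω := fun i => (G i \ G (i+1)) ∩ {o | η < |a i o|} with hE
  have me' : ∀ i, MeasurableSet (G i \ G (i+1)) := fun i => (gm i).diff (gm (i+1))
  have me : ∀ i < M, MeasurableSet (E i) := fun i hi => (me' i).inter (ms_gt (sm_abs ((ha i hi).mono (H.le _))) _)
  have hdis : Pairwise (fun i j => Disjoint (G i \ G (i+1)) (G j \ G (j+1))) := by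
    have key : ∀ i j, i < j → Disjoint (G i \ G (i+1)) (G j \ G (j+1)) := fun i j hij =>
      disjoint_left.2 fun o h1 h2 => h1.2 (Gs_anti n (Nat.succ_le_of_lt hij) h2.1)
    intro i j hij
    rcases lt_or_gt_of_ne hij with h | h
    · exact key _ _ h
    · exact (key _ _ h).symm
  have hdisE : Pairwise (fun i j => Disjoint (E i) (E j)) := fun i j hij =>
    (hdis hij).mono inter_subset_left inter_subset_left
  have s1 : ∑ i ∈ Finset.range M, ∫ o in G i \ G (i+1), (r o + n * z o) ∂P ≤ 1 + n := by
    rw [← integral_biUnion_finset _ (fun i _ => me' i) (fun i _ j _ hij => hdis hij) (fun i _ => (p_int hD n).integrableOn), ← p_int1 hD n]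
    refine setIntegral_le_integral (p_int hD n) ?_
    filter_upwards [hD.rp, hD.zp] with o h1 h2
    simp only [Pi.zero_apply]; positivity
  have s2 : κ * ∑ i ∈ Finset.range M, ∫ o in E i, (r o + n * z o) * (n + v o) ∂P ≤ ε0/4 := by
    rw [← integral_biUnion_finset _ (fun i hi => me i (Finset.mem_range.1 hi)) (fun i _ j _ hij => hdisE hij) (fun i _ => (pv_int hD n).integrableOn), ← integral_const_mul]
    refine h1 _ ?_
    set B := ⋃ j ∈ Finset.range (M+1), {o | (P[z|H j]) o < 1/n'}
    set C : ℕ → Set Ω := fun i => {o | (η/(n*n'))^2 ≤ ((P[z|H i]) o * (P[z|H (i+1)]) o * a i o)^2}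
    have hsub : (⋃ i ∈ Finset.range M, E i) ⊆ B ∪ ⋃ i ∈ Finset.range M, C i := by
      intro o hω
      simp only [mem_iUnion, Finset.mem_range, exists_prop] at hω
      obtain ⟨i, hi, hω⟩ := hω
      by_cases hZ : (P[z|H (i+1)]) o < 1/n'
      · left
        simp only [B, mem_iUnion, Finset.mem_range, exists_prop, mem_setOf_eq]
        exact ⟨i+1, by omega, hZ⟩
      · right
        push Not at hZ
        simp only [mem_iUnion, Finset.mem_range, exists_prop]
        refine ⟨i, hi, ?_⟩
        simp only [C, mem_setOf_eq]
        have h5 := (hω.1.1 i le_rfl).2.1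
        have h6 : η < |a i o| := hω.2
        rw [← sq_abs ((P[z|H i]) o * (P[z|H (i+1)]) o * a i o)]
        refine pow_le_pow_left₀ (by positivity) ?_ 2
        have z1 : 0 < (P[z|H i]) o := lt_of_lt_of_le (by positivity) h5
        have z2 : 0 < (P[z|H (i+1)]) o := lt_of_lt_of_le (by positivity) hZ
        rw [abs_mul, abs_of_pos (mul_pos z1 z2)]
        calc η/(n*n') = 1/n * (1/n') * η := by field_simp
          _ ≤ _ := mul_le_mul (mul_le_mul h5 hZ (by positivity) z1.le) h6.le hη.le (by positivity)
    refine (measureReal_mono hsub).trans ((measureReal_union_le _ _).trans ?_)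
    have t1 : P.real (⋃ i ∈ Finset.range M, C i) ≤ δ/2 := by
      refine (measureReal_biUnion_finset_le _ _).trans ?_
      have : ∀ i ∈ Finset.range M, P.real (C i) ≤ ((η/(n*n'))^2)⁻¹ * ∫ o, ((P[z|H i]) o * (P[z|H (i+1)]) o * a i o)^2 ∂P := fun i hi => by
        have := mul_meas_ge_le_integral_of_nonneg (ae_of_all _ fun o => sq_nonneg _) (hI i (Finset.mem_range.1 hi)) ((η/(n*n'))^2)
        rw [inv_mul_eq_div, le_div_iff₀ (by positivity), mul_comm]
        exact this
      refine (Finset.sum_le_sum this).trans ?_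
      rw [← Finset.mul_sum, inv_mul_eq_div, div_le_iff₀ (by positivity)]
      exact hs.trans hεb
    have := h2 H M
    linarith
  have main : ∀ i ∈ Finset.range M, |∫ o in G i, r o * a i o ∂P| ≤
      lam / 2 * ∫ o in G (i+1), z o * (Dq P H z r (i+1) o - Dq P H z r i o)^2 ∂P
      + n^3/(2*lam) * ∫ o, ((P[z|H i]) o * (P[z|H (i+1)]) o * a i o)^2 ∂P
      + (η * ∫ o in G i \ G (i+1), (r o + n * z o) ∂P + κ * ∫ o in E i, (r o + n * z o) * (n + v o) ∂P) := fun i hi => by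
    have hi' := Finset.mem_range.1 hi
    exact (core_main hD hA hn hκ hlam hi' (ha i hi') (hb i hi') (hc i hi') (hI i hi')).trans
      (add_le_add le_rfl (core_E hD hA hn hκ hη hi' (ha i hi') (hb i hi')))
  refine (Finset.abs_sum_le_sum_abs _ _).trans ((Finset.sum_le_sum main).trans ?_)
  simp only [Finset.sum_add_distrib, ← Finset.mul_sum]
  have t1 := mul_le_mul_of_nonneg_left (dsq (H := H) hD hA.sm hn0 M) (show 0 ≤ lam/2 by positivity)
  have t2 := mul_le_mul_of_nonneg_left (hs.trans hεa) (show 0 ≤ n^3/(2*lam) by positivity)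
  have t3 := mul_le_mul_of_nonneg_left s1 hη.le
  have e1 : lam/2 * (2*n) = ε0/4 := by rw [hlam']; field_simp
  have e2 : n^3/(2*lam) * (ε0^2/(8*n^4)) = ε0/4 := by rw [hlam']; field_simp; norm_num
  have e3 : η * (1+n) = ε0/4 := by rw [hη']; field_simp
  rw [e1] at t1
  rw [e2] at t2
  rw [e3] at t3
  linarith

end PartNineteen

section PartTwentyThree
variable {Ω : Type*} {m : MeasurableSpace Ω} {P : Measure Ω} [IsProbabilityMeasure P]
variable {H : Filtration ℕ m} {z y : Ω → ℝ} {x : ℕ → Ω → ℝ} {M : ℕ}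

/-- `x` is the martingale closed by `y / z` under the density `z` -/
structure Mg (P : Measure Ω) (H : Filtration ℕ m) (M : ℕ) (z y : Ω → ℝ) (x : ℕ → Ω → ℝ) : Prop where
  sm : ∀ i, StronglyMeasurable[H i] (x i)
  zi : ∀ i ≤ M, Integrable (fun o => z o * x i o) P
  ze : ∀ i ≤ M, ∀ C, MeasurableSet[H i] C → ∫ o in C, z o * x i o ∂P = ∫ o in C, y o ∂P

lemma ce_zero {m' : MeasurableSpace Ω} (h : m' ≤ m) {f : Ω → ℝ} (hf : Integrable f P)
    (h0 : ∀ C, MeasurableSet[m'] C → ∫ o in C, f o ∂P = 0) : P[f|m'] =ᵐ[P] 0 := by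
  refine (ae_eq_condExp_of_forall_setIntegral_eq h hf (fun _ _ _ => (integrable_zero _ _ _).integrableOn) (fun C hC _ => ?_) ?_).symm
  · rw [h0 C hC]; simp
  · exact (stronglyMeasurable_zero (α := Ω)).aestronglyMeasurable

lemma Mg.eq (hx : Mg P H M z y x) (hz : Integrable z P) (hy : Integrable y P) {i : ℕ} (hi : i ≤ M) :
    ∀ᵐ o ∂P, (P[z|H i]) o * x i o = (P[y|H i]) o := by
  have h1 : P[fun o => z o * x i o - y o|H i] =ᵐ[P] 0 := ce_zero (H.le i) ((hx.zi i hi).sub hy) fun C hC => by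
    rw [integral_sub (hx.zi i hi).integrableOn hy.integrableOn, hx.ze i hi C hC, sub_self]
  have h2 := condExp_sub (hx.zi i hi) hy (H i)
  have h3 := condExp_mul_of_stronglyMeasurable_right (hx.sm i) (by exact hx.zi i hi) hz (μ := P)
  filter_upwards [h1, h2, h3] with o a b c
  have e : (fun o => z o * x i o) - y = (fun o => z o * x i o - y o) := rfl
  have e' : z * x i = (fun o => z o * x i o) := rfl
  rw [e, a, Pi.sub_apply] at b
  rw [e', Pi.mul_apply] at c
  simp only [Pi.zero_apply] at b
  linarith

lemma Mg.cent (hx : Mg P H M z y x) (hy : Integrable y P) {i : ℕ} (hi : i < M) {q : Ω → ℝ} {c : ℝ}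
    (hq : StronglyMeasurable[H i] q) (hb : ∀ o, |q o| ≤ c) :
    Integrable (fun o => z o * (q o * (x (i+1) o - x i o))) P ∧ P[fun o => z o * (q o * (x (i+1) o - x i o))|H i] =ᵐ[P] 0 := by
  have i1 : Integrable (fun o => z o * x (i+1) o - z o * x i o) P := (hx.zi (i+1) hi).sub (hx.zi i hi.le)
  have h1 : P[fun o => z o * x (i+1) o - z o * x i o|H i] =ᵐ[P] 0 := ce_zero (H.le i) i1 fun C hC => by
    rw [integral_sub (hx.zi (i+1) hi).integrableOn (hx.zi i hi.le).integrableOn, hx.ze i hi.le C hC,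
      hx.ze (i+1) hi C (H.mono i.le_succ _ hC), sub_self]
  have i2 : Integrable (fun o => q o * (z o * x (i+1) o - z o * x i o)) P :=
    i1.bdd_mul (c := c) (hq.mono (H.le i)).aestronglyMeasurable (ae_of_all _ hb)
  have e : (fun o => z o * (q o * (x (i+1) o - x i o))) = q * (fun o => z o * x (i+1) o - z o * x i o) := by
    ext o; simp only [Pi.mul_apply]; ring
  rw [e]
  refine ⟨i2, (condExp_mul_of_stronglyMeasurable_left hq i2 i1).trans ?_⟩
  filter_upwards [h1] with o a
  rw [Pi.mul_apply, a]; simp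

lemma Mg.incr (hx : Mg P H M z y x) (hz : Integrable z P) (hy : Integrable y P) {i : ℕ} (hi : i < M) :
    ∀ᵐ o ∂P, (P[z|H i]) o * (P[z|H (i+1)]) o * (x (i+1) o - x i o) =
      (P[z|H i]) o * ((P[y|H (i+1)]) o - (P[y|H i]) o) - (P[y|H i]) o * ((P[z|H (i+1)]) o - (P[z|H i]) o) := by
  filter_upwards [hx.eq hz hy hi.le, hx.eq hz hy (Nat.succ_le_of_lt hi)] with o a b
  rw [← a, ← b]; ring

lemma abs_dom {r s t : Ω → ℝ} {m' : MeasurableSpace Ω} (h : m' ≤ m) (hr : ∀ᵐ o ∂P, 0 < r o) (hs : StronglyMeasurable[m'] s)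
    (hi : Integrable (fun o => r o * s o) P) (hi' : Integrable (fun o => r o * t o) P)
    (he : ∀ C, MeasurableSet[m'] C → ∫ o in C, r o * s o ∂P = ∫ o in C, r o * t o ∂P) {E : Set Ω} (hE : MeasurableSet[m'] E) :
    ∫ o in E, r o * |s o| ∂P ≤ ∫ o in E, r o * |t o| ∂P := by
  have hN : MeasurableSet[m'] {o | 0 ≤ s o} := ms_ge hs 0
  have j : ∀ {t : Ω → ℝ}, Integrable (fun o => r o * t o) P → Integrable (fun o => r o * |t o|) P := fun {t} hi => by
    refine hi.abs.congr ?_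
    filter_upwards [hr] with o h
    rw [abs_mul, abs_of_pos h]
  have e : ∀ {t : Ω → ℝ}, Integrable (fun o => r o * t o) P → ∫ o in E, r o * |t o| ∂P = ∫ o in E ∩ {o | 0 ≤ s o}, r o * |t o| ∂P + ∫ o in E \ {o | 0 ≤ s o}, r o * |t o| ∂P :=
    fun {t} hi => (integral_inter_add_diff (h _ hN) (j hi).integrableOn).symm
  have mA : MeasurableSet[m'] (E ∩ {o | 0 ≤ s o}) := @MeasurableSet.inter _ m' _ _ hE hN
  have mB : MeasurableSet[m'] (E \ {o | 0 ≤ s o}) := @MeasurableSet.diff _ m' _ _ hE hN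
  rw [e hi, e hi']
  refine add_le_add ?_ ?_
  · calc _ = ∫ o in E ∩ {o | 0 ≤ s o}, r o * s o ∂P := setIntegral_congr_fun (h _ mA) fun o hω => by
          rw [abs_of_nonneg hω.2]
      _ = ∫ o in E ∩ {o | 0 ≤ s o}, r o * t o ∂P := he _ mA
      _ ≤ _ := by
          refine setIntegral_mono_on_ae hi'.integrableOn (j hi').integrableOn (h _ mA) ?_
          filter_upwards [hr] with o h _
          exact mul_le_mul_of_nonneg_left (le_abs_self _) h.le
  · calc _ = -∫ o in E \ {o | 0 ≤ s o}, r o * s o ∂P := by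
          rw [← integral_neg]
          refine setIntegral_congr_fun (h _ mB) fun o hω => ?_
          have : s o < 0 := by simpa using hω.2
          rw [abs_of_neg this]; ring
      _ = ∫ o in E \ {o | 0 ≤ s o}, -(r o * t o) ∂P := by rw [he _ mB, integral_neg]
      _ ≤ _ := by
          refine setIntegral_mono_on_ae hi'.neg.integrableOn (j hi').integrableOn (h _ mB) ?_
          filter_upwards [hr] with o h _
          have := mul_le_mul_of_nonneg_left (neg_le_abs (t o)) h.le
          linarith

lemma ce_triv {m' : MeasurableSpace Ω} (h : m' ≤ m) (ht : ∀ C, MeasurableSet[m'] C → P C = 0 ∨ P C = 1) {X : Ω → ℝ} (hX : Integrable X P) :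
    P[X|m'] =ᵐ[P] fun _ => ∫ o, X o ∂P := by
  refine (ae_eq_condExp_of_forall_setIntegral_eq h hX (fun _ _ _ => (integrable_const _).integrableOn) (fun C hC _ => ?_) ?_).symm
  · rcases ht C hC with h0 | h1
    · rw [Measure.restrict_eq_zero.2 h0]; simp
    · have : P.restrict C = P := Measure.restrict_eq_self_of_ae_mem (by
        rw [← mem_ae_iff_prob_eq_one (h _ hC)] at h1; exact h1)
      rw [this]; simp
  · exact (stronglyMeasurable_const (α := Ω)).aestronglyMeasurable

/-- the clipped conditional probability -/
def rho (P : Measure Ω) (H : Filtration ℕ m) (z X : Ω → ℝ) (i : ℕ) : Ω → ℝ := fun o => max 0 (min 1 ((P[X|H i]) o / (P[z|H i]) o))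

lemma rho_01 (X : Ω → ℝ) (i : ℕ) (o : Ω) : 0 ≤ rho P H z X i o ∧ rho P H z X i o ≤ 1 :=
  ⟨le_max_left _ _, max_le zero_le_one (min_le_left _ _)⟩

lemma rho_sm (X : Ω → ℝ) (i : ℕ) : StronglyMeasurable[H i] (rho P H z X i) :=
  (measurable_const.max (measurable_const.min (stronglyMeasurable_condExp.measurable.div stronglyMeasurable_condExp.measurable))).stronglyMeasurable

lemma rho_eq {X : Ω → ℝ} (hz : Integrable z P) (hp : ∀ᵐ o ∂P, 0 < z o) (hX : Integrable X P) (h0 : ∀ᵐ o ∂P, 0 ≤ X o) (h1 : ∀ᵐ o ∂P, X o ≤ z o) (i : ℕ) :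
    ∀ᵐ o ∂P, rho P H z X i o = (P[X|H i]) o / (P[z|H i]) o := by
  filter_upwards [condExp_pos_of (H.le i) hz hp, condExp_mono (m := H i) hX hz h1, condExp_nonneg (m := H i) h0] with o a b c
  rw [rho, min_eq_right ((div_le_one a).2 b), max_eq_right (div_nonneg c a.le)]

lemma rho_Mg {X : Ω → ℝ} (hz : Integrable z P) (hp : ∀ᵐ o ∂P, 0 < z o) (hX : Integrable X P) (h0 : ∀ᵐ o ∂P, 0 ≤ X o) (h1 : ∀ᵐ o ∂P, X o ≤ z o) (M : ℕ) :
    Mg P H M z X (rho P H z X) := by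
  refine ⟨rho_sm X, fun i _ => ?_, fun i _ C hC => ?_⟩
  · exact hz.mul_bdd (c := 1) ((rho_sm X i).mono (H.le i)).aestronglyMeasurable (ae_of_all _ fun o => by
      rw [Real.norm_eq_abs, abs_of_nonneg (rho_01 X i o).1]; exact (rho_01 X i o).2)
  · rw [(pull_bdd (H.le i) hz (rho_sm X i) hC (c := 1) (fun o _ => by
      rw [abs_of_nonneg (rho_01 X i o).1]; exact (rho_01 X i o).2)).1, ← setIntegral_condExp (H.le i) hX hC]
    refine integral_congr_ae (ae_restrict_of_ae ?_)
    filter_upwards [rho_eq (H := H) hz hp hX h0 h1 i, condExp_pos_of (H.le i) hz hp] with o a b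
    rw [a]; field_simp

/-- telescoping along decreasing sets -/
lemma tele (G : ℕ → Set Ω) (hG : Antitone G) (x : ℕ → Ω → ℝ) (h01 : ∀ i o, 0 ≤ x i o ∧ x i o ≤ 1) (M : ℕ) (o : Ω) :
    ∃ k ≤ M, (o ∈ G M → k = M) ∧ ∑ i ∈ Finset.range M, (G i).indicator (fun o => x (i+1) o - x i o) o = x k o - x 0 o := by
  induction M with
  | zero => exact ⟨0, le_rfl, fun _ => rfl, by simp⟩
  | succ M ih =>
    obtain ⟨k, hk, h1, h2⟩ := ih
    rw [Finset.sum_range_succ, h2]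
    by_cases h : o ∈ G M
    · refine ⟨M+1, le_rfl, fun _ => rfl, ?_⟩
      rw [indicator_of_mem h, h1 h]; ring
    · refine ⟨k, hk.trans M.le_succ, fun h' => absurd (hG M.le_succ h') h, ?_⟩
      rw [indicator_of_notMem h]; ring

end PartTwentyThree

section PartTwentyFour
variable {Ω : Type*} {m : MeasurableSpace Ω} {P : Measure Ω} [IsProbabilityMeasure P] {Γ : Filtration ℝ m}
variable {ι : Type*} [Fintype ι] [DecidableEq ι]

lemma top_mul {f g : Ω → ℝ} (hf : MemLp f ∞ P) (hg : MemLp g ∞ P) : MemLp (fun o => f o * g o) ∞ P := hg.mul hf (r := ∞)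

lemma uf_top {z X : Ω → ℝ} (hz : MemLp z ∞ P) (hX : MemLp X ∞ P) (n i : ℕ) : MemLp (uf P Γ z X n i) ∞ P :=
  (top_mul ((mp_ad (Γ := Γ) hz).bd _) (((mp_ad (Γ := Γ) hX).bd _).sub ((mp_ad (Γ := Γ) hX).bd _))).sub
    (top_mul ((mp_ad (Γ := Γ) hX).bd _) (((mp_ad (Γ := Γ) hz).bd _).sub ((mp_ad (Γ := Γ) hz).bd _)))

/-- the hypotheses on the process `s` up to the horizon `w` -/
structure SH (P : Measure Ω) (Γ : Filtration ℝ m) (z r : Ω → ℝ) (y : ι → Ω → ℝ) (s : ι → ℝ → Ω → ℝ) (w : ℝ) : Prop where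
  sm : ∀ l u, StronglyMeasurable[Γ u] (s l u)
  zi : ∀ l u, 0 ≤ u → u ≤ w → Integrable (fun o => z o * s l u o) P
  ze : ∀ l u, 0 ≤ u → u ≤ w → ∀ C, MeasurableSet[Γ u] C → ∫ o in C, z o * s l u o ∂P = ∫ o in C, y l o ∂P
  ri : ∀ l u, 0 ≤ u → u ≤ w → Integrable (fun o => r o * s l u o) P
  re : ∀ l u, 0 ≤ u → u ≤ w → ∀ C, MeasurableSet[Γ u] C → ∫ o in C, r o * s l u o ∂P = ∫ o in C, r o * s l w o ∂P

/-- the grid filtration -/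
def gH (Γ : Filtration ℝ m) (n : ℕ) : Filtration ℕ m := ⟨fun i => Γ (gp n i), fun _ _ h => Γ.mono (gp_mono n h), fun i => Γ.le _⟩

lemma gp_nonneg (n i : ℕ) : 0 ≤ gp n i := by unfold gp; positivity

/-- the dominating process -/
def AA (s : ι → ℝ → Ω → ℝ) (u : ℝ) : Ω → ℝ := fun o => 1 + ∑ l, |s l u o|

lemma AA_int {s : ι → ℝ → Ω → ℝ} {r : Ω → ℝ} (hr : Integrable r P) (hp : ∀ᵐ o ∂P, 0 < r o) {u : ℝ} (hs : ∀ l, Integrable (fun o => r o * s l u o) P) :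
    Integrable (fun o => r o * AA s u o) P := by
  have : Integrable (fun o => r o + ∑ l, |r o * s l u o|) P := hr.add (integrable_finsetSum _ fun l _ => (hs l).abs)
  refine this.congr ?_
  filter_upwards [hp] with o h
  simp only [AA, abs_mul, abs_of_pos h, ← Finset.mul_sum]; ring

lemma AA_dom {s : ι → ℝ → Ω → ℝ} {r : Ω → ℝ} (hr : Integrable r P) (hp : ∀ᵐ o ∂P, 0 < r o) {u w : ℝ} (hu : ∀ l, Integrable (fun o => r o * s l u o) P)
    (hw : ∀ l, Integrable (fun o => r o * s l w o) P) (hsm : ∀ l, StronglyMeasurable[Γ u] (s l u))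
    (he : ∀ l C, MeasurableSet[Γ u] C → ∫ o in C, r o * s l u o ∂P = ∫ o in C, r o * s l w o ∂P) {E : Set Ω} (hE : MeasurableSet[Γ u] E) :
    ∫ o in E, r o * AA s u o ∂P ≤ ∫ o in E, r o * AA s w o ∂P := by
  have j : ∀ {t : Ω → ℝ}, Integrable (fun o => r o * t o) P → Integrable (fun o => r o * |t o|) P := fun {t} hi => by
    refine hi.abs.congr ?_
    filter_upwards [hp] with o h
    rw [abs_mul, abs_of_pos h]
  have e : ∀ {u : ℝ}, (∀ l, Integrable (fun o => r o * s l u o) P) → ∫ o in E, r o * AA s u o ∂P = ∫ o in E, r o ∂P + ∑ l, ∫ o in E, r o * |s l u o| ∂P := fun {u} hu => by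
    rw [← integral_finsetSum _ (fun l _ => (j (hu l)).integrableOn), ← integral_add hr.integrableOn (integrable_finsetSum _ fun l _ => (j (hu l)).integrableOn)]
    congr 1; ext o; simp only [AA, ← Finset.mul_sum]; ring
  rw [e hu, e hw]
  exact add_le_add le_rfl (Finset.sum_le_sum fun l _ => abs_dom (Γ.le u) hp (hsm l) (hu l) (hw l) (he l) hE)

lemma SH.dens {z r : Ω → ℝ} {y : ι → Ω → ℝ} {s : ι → ℝ → Ω → ℝ} {w : ℝ} (hS : SH P Γ z r y s w) (hw : 0 ≤ w)
    (zi : Integrable z P) (zp : ∀ᵐ o ∂P, 0 < z o) (z1 : ∫ o, z o ∂P = 1) (ri : Integrable r P) (rp : ∀ᵐ o ∂P, 0 < r o) (r1 : ∫ o, r o ∂P = 1) :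
    Dens P z r (AA s w) :=
  ⟨zi, zp, z1, ri, rp, r1, fun o => by unfold AA; positivity, AA_int zi zp fun l => hS.zi l w hw le_rfl, AA_int ri rp fun l => hS.ri l w hw le_rfl⟩

lemma SH.dom {z r : Ω → ℝ} {y : ι → Ω → ℝ} {s : ι → ℝ → Ω → ℝ} {w : ℝ} (hS : SH P Γ z r y s w)
    (zi : Integrable z P) (zp : ∀ᵐ o ∂P, 0 < z o) (ri : Integrable r P) (rp : ∀ᵐ o ∂P, 0 < r o) (n M : ℕ) (hM : gp n M = w) :
    Dom P (gH Γ n) M z r (AA s w) (fun i => AA s (gp n i)) := by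
  have hle : ∀ i ≤ M, gp n i ≤ w := fun i hi => hM ▸ gp_mono n hi
  have hw : 0 ≤ w := hM ▸ gp_nonneg n M
  refine ⟨fun i => ?_, fun i o => by unfold AA; positivity, fun i hi => AA_int zi zp fun l => hS.zi l _ (gp_nonneg _ _) (hle i hi),
    fun i hi => AA_int ri rp fun l => hS.ri l _ (gp_nonneg _ _) (hle i hi), fun i hi E hE => ?_, fun i hi E hE => ?_⟩
  · exact stronglyMeasurable_const.add (Finset.stronglyMeasurable_fun_sum _ fun l _ => sm_abs (hS.sm l _))
  · refine AA_dom (Γ := Γ) zi zp (fun l => hS.zi l _ (gp_nonneg _ _) (hle i hi)) (fun l => hS.zi l w hw le_rfl) (fun l => hS.sm l _) (fun l C hC => ?_) hE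
    rw [hS.ze l _ (gp_nonneg _ _) (hle i hi) C hC, hS.ze l w hw le_rfl C (Γ.mono (hle i hi) _ hC)]
  · exact AA_dom (Γ := Γ) ri rp (fun l => hS.ri l _ (gp_nonneg _ _) (hle i hi)) (fun l => hS.ri l w hw le_rfl) (fun l => hS.sm l _)
      (fun l C hC => hS.re l _ (gp_nonneg _ _) (hle i hi) C hC) hE

lemma SH.mgz {z r : Ω → ℝ} {y : ι → Ω → ℝ} {s : ι → ℝ → Ω → ℝ} {w : ℝ} (hS : SH P Γ z r y s w) (n M : ℕ) (hM : gp n M = w) (l : ι) :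
    Mg P (gH Γ n) M z (y l) (fun i => s l (gp n i)) :=
  ⟨fun i => hS.sm l _, fun i hi => hS.zi l _ (gp_nonneg _ _) (hM ▸ gp_mono n hi), fun i hi => hS.ze l _ (gp_nonneg _ _) (hM ▸ gp_mono n hi)⟩

lemma SH.mgr {z r : Ω → ℝ} {y : ι → Ω → ℝ} {s : ι → ℝ → Ω → ℝ} {w : ℝ} (hS : SH P Γ z r y s w) (n M : ℕ) (hM : gp n M = w) (l : ι) :
    Mg P (gH Γ n) M r (fun o => r o * s l w o) (fun i => s l (gp n i)) :=
  ⟨fun i => hS.sm l _, fun i hi => hS.ri l _ (gp_nonneg _ _) (hM ▸ gp_mono n hi), fun i hi => hS.re l _ (gp_nonneg _ _) (hM ▸ gp_mono n hi)⟩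

lemma tele_int {H : Filtration ℕ m} {r : Ω → ℝ} (ri : Integrable r P) (rp : ∀ᵐ o ∂P, 0 < r o) (G : ℕ → Set Ω) (hGm : ∀ i, MeasurableSet (G i))
    (hG : Antitone G) (x : ℕ → Ω → ℝ) (hx : ∀ i, StronglyMeasurable (x i)) (h01 : ∀ i o, 0 ≤ x i o ∧ x i o ≤ 1) (M : ℕ) :
    |∑ i ∈ Finset.range M, ∫ o in G i, r o * (x (i+1) o - x i o) ∂P - ∫ o, r o * (x M o - x 0 o) ∂P| ≤ ∫ o in (G M)ᶜ, r o ∂P := by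
  have hb : ∀ i j o, |x i o - x j o| ≤ 1 := fun i j o => by
    have := h01 i o; have := h01 j o
    rw [abs_le]; constructor <;> linarith
  have i1 : ∀ i j, Integrable (fun o => r o * (x i o - x j o)) P := fun i j =>
    ri.mul_bdd (c := 1) ((hx i).sub (hx j)).aestronglyMeasurable (ae_of_all _ (hb i j))
  have e1 : ∑ i ∈ Finset.range M, ∫ o in G i, r o * (x (i+1) o - x i o) ∂P = ∫ o, ∑ i ∈ Finset.range M, (G i).indicator (fun o => r o * (x (i+1) o - x i o)) o ∂P := by
    rw [integral_finsetSum _ fun i _ => (i1 _ _).indicator (hGm i)]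
    exact Finset.sum_congr rfl fun i _ => (integral_indicator (hGm i)).symm
  rw [e1, ← integral_sub (integrable_finsetSum _ fun i _ => (i1 _ _).indicator (hGm i)) (i1 _ _), ← integral_indicator (hGm M).compl, ← Real.norm_eq_abs]
  refine norm_integral_le_of_norm_le (ri.indicator (hGm M).compl) ?_
  filter_upwards [rp] with o h
  have e2 : ∑ i ∈ Finset.range M, (G i).indicator (fun o => r o * (x (i+1) o - x i o)) o = r o * ∑ i ∈ Finset.range M, (G i).indicator (fun o => (x (i+1) o - x i o)) o := by
    rw [Finset.mul_sum]
    refine Finset.sum_congr rfl fun i _ => ?_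
    by_cases hω : o ∈ G i <;> simp [hω]
  obtain ⟨k, hk, h1, h2⟩ := tele G hG x h01 M o
  rw [e2, h2]
  by_cases hω : o ∈ G M
  · rw [h1 hω, sub_self, norm_zero, indicator_of_notMem (by simpa using hω)]
  · rw [indicator_of_mem (by simpa using hω), ← mul_sub, Real.norm_eq_abs, abs_mul, abs_of_pos h]
    have : x k o - x 0 o - (x M o - x 0 o) = x k o - x M o := by ring
    rw [this]
    exact mul_le_of_le_one_right h.le (hb _ _ _)

/-- a filtration stopped outside the decreasing sets `N u` -/
structure Stp (Γ 𝓗 : Filtration ℝ m) (N : ℝ → Set Ω) (w : ℝ) : Prop where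
  le : ∀ u, (𝓗 u : MeasurableSpace Ω) ≤ Γ u
  Nm : ∀ u, u ≤ w → MeasurableSet[Γ u] (N u)
  sub : ∀ u, u ≤ w → ∀ C, MeasurableSet[Γ u] C → C ⊆ N u → MeasurableSet[𝓗 u] C
  out : ∀ u u', u ≤ u' → u' ≤ w → ∀ C, MeasurableSet[𝓗 u'] C → MeasurableSet[𝓗 u] (C ∩ (N u)ᶜ)

lemma Stp.indSM {𝓗 : Filtration ℝ m} {N : ℝ → Set Ω} {w u : ℝ} (h : Stp Γ 𝓗 N w) (hu : u ≤ w) {q : Ω → ℝ} (hq : StronglyMeasurable[Γ u] q) :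
    StronglyMeasurable[𝓗 u] ((N u).indicator q) :=
  (hq.indicator (h.Nm u hu)).stronglyMeasurable_of_measurableSpace_le_on (h.Nm u hu) (fun t ht => h.sub u hu _ ht inter_subset_left)
    fun x hx => indicator_of_notMem hx _

lemma Stp.agree {𝓗 : Filtration ℝ m} {N : ℝ → Set Ω} {w u : ℝ} (h : Stp Γ 𝓗 N w) (hu : u ≤ w) (f : Ω → ℝ) :
    ∀ᵐ o ∂P, o ∈ N u → (P[f|Γ u]) o = (P[f|𝓗 u]) o := by
  have := condExp_ae_eq_restrict_of_measurableSpace_eq_on (μ := P) (f := f) (Γ.le u) (𝓗.le u) (h.Nm u hu)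
    (fun t => ⟨fun ht => h.sub u hu _ ht inter_subset_left, fun ht => h.le u _ ht⟩)
  exact (ae_restrict_iff' (Γ.le u _ (h.Nm u hu))).1 this

lemma Stp.agree' {𝓗 : Filtration ℝ m} {N : ℝ → Set Ω} {w u u' : ℝ} (h : Stp Γ 𝓗 N w) (huu : u ≤ u') (hu : u' ≤ w) (f : Ω → ℝ) :
    ∀ᵐ o ∂P, o ∉ N u → (P[f|𝓗 u]) o = (P[f|𝓗 u']) o := by
  have hN : MeasurableSet[𝓗 u] (N u)ᶜ := (h.sub u (huu.trans hu) _ (h.Nm u (huu.trans hu)) subset_rfl).compl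
  have := condExp_ae_eq_restrict_of_measurableSpace_eq_on (μ := P) (f := f) (𝓗.le u) (𝓗.le u') hN
    (fun t => ⟨fun ht => 𝓗.mono huu _ ht, fun ht => by
      have := h.out u u' huu hu _ ht
      rwa [inter_right_comm, inter_self] at this⟩)
  exact (ae_restrict_iff' (𝓗.le u _ hN)).1 this

lemma sq_contr {m' : MeasurableSpace Ω} (h : m' ≤ m) {f : Ω → ℝ} (hf : MemLp f ∞ P) :
    MemLp (P[f|m']) ∞ P ∧ ∫ o, (P[f|m']) o ^ 2 ∂P ≤ ∫ o, f o ^ 2 ∂P := by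
  have hg : MemLp (P[f|m']) ∞ P := hf.condExp (by simp)
  refine ⟨hg, ?_⟩
  have fi := top_int hf
  have i1 := top_int (top_mul hf hf)
  have i2 := top_int (top_mul hf hg)
  have i3 := top_int (top_mul hg hg)
  have e : ∫ o, f o * (P[f|m']) o ∂P = ∫ o, (P[f|m']) o * (P[f|m']) o ∂P := by
    rw [← integral_condExp h]
    exact integral_congr_ae (condExp_mul_of_stronglyMeasurable_right stronglyMeasurable_condExp i2 fi)
  have p : 0 ≤ ∫ o, (f o - (P[f|m']) o) ^ 2 ∂P := integral_nonneg fun o => sq_nonneg _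
  have e2 : ∫ o, (f o - (P[f|m']) o) ^ 2 ∂P = ∫ o, f o * f o ∂P - 2 * ∫ o, f o * (P[f|m']) o ∂P + ∫ o, (P[f|m']) o * (P[f|m']) o ∂P := by
    rw [← integral_const_mul, ← integral_sub i1 (i2.const_mul 2), ← integral_add (show Integrable (fun o => f o * f o - 2 * (f o * (P[f|m']) o)) P from i1.sub (i2.const_mul 2)) i3]
    congr 1; ext o; ring
  simp only [pow_two] at *
  rw [e2, e] at p
  linarith

lemma Stp.proj {𝓗 : Filtration ℝ m} {N : ℝ → Set Ω} {w : ℝ} (h : Stp Γ 𝓗 N w) {z f : Ω → ℝ} (hz : MemLp z ∞ P) (hf : MemLp f ∞ P)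
    {n M i : ℕ} (hM : gp n M = w) (hi : i < M) {x : ℕ → Ω → ℝ} (hx : Mg P (gH 𝓗 n) M z f x) {q : Ω → ℝ} (hq : StronglyMeasurable[Γ (gp n i)] q) (hqb : MemLp q ∞ P) :
    P[fun o => (N (gp n i)).indicator q o * uf P Γ z f n i o | gH 𝓗 n (i+1)] =ᵐ[P]
      fun o => (P[z|gH 𝓗 n i]) o * (P[z|gH 𝓗 n (i+1)]) o * ((N (gp n i)).indicator q o * (x (i+1) o - x i o)) := by
  have hiw : gp n i ≤ w := hM ▸ gp_mono n hi.le
  have zi := top_int hz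
  have fi := top_int hf
  set u := gp n i with hu
  set u' := gp n (i+1) with hu'
  have huu : u ≤ u' := gp_mono n i.le_succ
  have hNm : MeasurableSet (N u) := Γ.le _ _ (h.Nm u hiw)
  have sα : StronglyMeasurable[𝓗 u'] ((N u).indicator fun o => q o * mp P Γ z u o) := (h.indSM hiw (hq.mul ((mp_ad hz).sm u))).mono (𝓗.mono huu)
  have sβ : StronglyMeasurable[𝓗 u'] ((N u).indicator fun o => q o * mp P Γ f u o) := (h.indSM hiw (hq.mul ((mp_ad hf).sm u))).mono (𝓗.mono huu)
  have bα : MemLp ((N u).indicator fun o => q o * mp P Γ z u o) ∞ P := (top_mul hqb ((mp_ad (Γ := Γ) hz).bd u)).indicator hNm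
  have bβ : MemLp ((N u).indicator fun o => q o * mp P Γ f u o) ∞ P := (top_mul hqb ((mp_ad (Γ := Γ) hf).bd u)).indicator hNm
  set α := (N u).indicator fun o => q o * mp P Γ z u o with hα
  set β := (N u).indicator fun o => q o * mp P Γ f u o with hβ
  have iα := top_int (top_mul bα ((mp_ad (Γ := Γ) hf).bd u'))
  have iβ := top_int (top_mul bβ ((mp_ad (Γ := Γ) hz).bd u'))
  have e : (fun o => (N u).indicator q o * uf P Γ z f n i o) = (fun o => α o * mp P Γ f u' o) - (fun o => β o * mp P Γ z u' o) := by
    ext o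
    by_cases hω : o ∈ N u
    · simp only [Pi.sub_apply, hα, hβ, indicator_of_mem hω, uf, dlf, mp, ← hu]
      ring
    · simp [hα, hβ, hω]
  have t1 : P[fun o => α o * mp P Γ f u' o | 𝓗 u'] =ᵐ[P] fun o => α o * (P[f|𝓗 u']) o := by
    refine (condExp_mul_of_stronglyMeasurable_left sα iα integrable_condExp).trans ?_
    filter_upwards [condExp_condExp_of_le (μ := P) (f := f) (h.le u') (Γ.le u')] with o h1
    rw [Pi.mul_apply, mp, h1]
  have t2 : P[fun o => β o * mp P Γ z u' o | 𝓗 u'] =ᵐ[P] fun o => β o * (P[z|𝓗 u']) o := by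
    refine (condExp_mul_of_stronglyMeasurable_left sβ iβ integrable_condExp).trans ?_
    filter_upwards [condExp_condExp_of_le (μ := P) (f := z) (h.le u') (Γ.le u')] with o h1
    rw [Pi.mul_apply, mp, h1]
  have : (gH 𝓗 n (i+1) : MeasurableSpace Ω) = 𝓗 u' := rfl
  have g0 : (gH 𝓗 n i : MeasurableSpace Ω) = 𝓗 u := rfl
  rw [e]
  refine (condExp_sub iα iβ _).trans ?_
  filter_upwards [t1, t2, hx.incr zi fi hi, h.agree hiw z, h.agree hiw f] with o a1 a2 a3 a4 a5
  rw [this, g0] at *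
  rw [Pi.sub_apply, a1, a2]
  by_cases hω : o ∈ N u
  · simp only [hα, hβ, indicator_of_mem hω, mp, a4 hω, a5 hω]
    rw [mul_left_comm, a3]; ring
  · simp [hα, hβ, hω]

theorem main_est {z r : Ω → ℝ} {y : ι → Ω → ℝ} {s : ι → ℝ → Ω → ℝ} (hz : MemLp z ∞ P) (hy : ∀ l, MemLp (y l) ∞ P) (hG : Gd P Γ z y)
    (zp : ∀ᵐ o ∂P, 0 < z o) (z1 : ∫ o, z o ∂P = 1) (ri : Integrable r P) (rp : ∀ᵐ o ∂P, 0 < r o) (r1 : ∫ o, r o ∂P = 1)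
    {𝓗 : Filtration ℝ m} {D : ℝ → Set Ω} (ht : ∀ C, MeasurableSet[𝓗 0] C → P C = 0 ∨ P C = 1) (j J : ℕ) (hJ : J ≤ 2^j) (hT : Stp Γ 𝓗 D (gp j J)) (hS : SH P 𝓗 z r y s (gp j J))
    {B : Set Ω} (hB : MeasurableSet[𝓗 (gp j J)] B) : ∫ o in B, r o ∂P = ∫ o in B, z o ∂P := by
  set w := gp j J with hw
  have zi := top_int hz
  have hB' := 𝓗.le _ _ hB
  set X : Ω → ℝ := B.indicator z with hX
  have hXt : MemLp X ∞ P := hz.indicator hB'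
  have hXi := top_int hXt
  have hX0 : ∀ᵐ o ∂P, 0 ≤ X o := zp.mono fun o h => by
    by_cases hω : o ∈ B <;> simp [hX, hω, h.le]
  have hX1 : ∀ᵐ o ∂P, X o ≤ z o := zp.mono fun o h => indicator_le_self' (fun _ _ => h.le) o
  have hD : Dens P z r (AA s w) := hS.dens (gp_nonneg _ _) zi zp z1 ri rp r1
  refine eq_of_forall_dist_le fun ε0 hε0 => ?_
  rw [Real.dist_eq]
  have hε : 0 < ε0/3 := by positivity
  obtain ⟨n, hn, hn2⟩ := Gs_compl hD hε
  obtain ⟨ε, hεp, hc1⟩ := core hD hn zero_le_one hε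
  obtain ⟨k, hk, hrep⟩ := rep_approx (Γ := Γ) hz hy hG hXt hεp
  obtain ⟨δ, hδp, hc2⟩ := core hD hn (show (0:ℝ) ≤ max 1 k by positivity) hε
  obtain ⟨q, hq, b, K, hb, hK, hb01, hKk, hr1, hr2⟩ := hrep δ hδp j
  obtain ⟨p, rfl⟩ := Nat.exists_eq_add_of_le hq
  set N := j + p with hN
  set M := 2^p * J with hM
  have hMw : gp N M = w := gp_add j p J
  have hM2 : M ≤ 2^N := by rw [hN, pow_add, mul_comm (2^j)]; exact Nat.mul_le_mul_left _ hJ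
  set H := gH 𝓗 N with hH
  set A : ℕ → Ω → ℝ := fun i => AA s (gp N i) with hA
  have hdom : Dom P H M z r (AA s w) A := hS.dom zi zp ri rp N M hMw
  set ρ := rho P H z X with hρ
  have hρM : Mg P H M z X ρ := rho_Mg zi zp hXi hX0 hX1 M
  have hsM : ∀ l, Mg P H M z (y l) (fun i => s l (gp N i)) := hS.mgz N M hMw
  have hsR : ∀ l, Mg P H M r (fun o => r o * s l w o) (fun i => s l (gp N i)) := hS.mgr N M hMw
  set G := Gs P H z r A n with hGd
  have hGa : Antitone G := Gs_anti n
  have hGm : ∀ i, MeasurableSet[H i] (G i) := Gs_meas hdom.sm n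
  have yi : ∀ l, Integrable (y l) P := fun l => top_int (hy l)
  have hρ01 : ∀ i o, 0 ≤ ρ i o ∧ ρ i o ≤ 1 := rho_01 X
  have hρd : ∀ i o, |ρ (i+1) o - ρ i o| ≤ 1 := fun i o => by
    have := hρ01 i o; have := hρ01 (i+1) o
    rw [abs_le]; constructor <;> linarith
  have hwi : ∀ i, i < M → gp N i ≤ w := fun i hi => hMw ▸ gp_mono N hi.le
  set β : ℕ → Ω → ℝ := fun i => (D (gp N i)).indicator (b (gp N i)) with hβ
  set c : ℕ → Ω → ℝ := fun i => (D (gp N i)).indicator (fun o => 1 - b (gp N i) o) with hc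
  set κ : ι → ℕ → Ω → ℝ := fun l i => (D (gp N i)).indicator (K l (gp N i)) with hκ
  set a1 : ℕ → Ω → ℝ := fun i o => β i o * (ρ (i+1) o - ρ i o) - ∑ l, κ l i o * (s l (gp N (i+1)) o - s l (gp N i) o) with ha1
  set a2 : ℕ → Ω → ℝ := fun i o => c i o * (ρ (i+1) o - ρ i o) with ha2
  have mono1 : ∀ i, (H i : MeasurableSpace Ω) ≤ H (i+1) := fun i => H.mono i.le_succ
  have sb : ∀ i < M, StronglyMeasurable[H i] (β i) := fun i hi => hT.indSM (hwi i hi) (hb.sm _)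
  have s1b : ∀ i < M, StronglyMeasurable[H i] (c i) := fun i hi => hT.indSM (hwi i hi) (stronglyMeasurable_const.sub (hb.sm _))
  have sK : ∀ l, ∀ i < M, StronglyMeasurable[H i] (κ l i) := fun l i hi => hT.indSM (hwi i hi) ((hK l).sm _)
  have sρ : ∀ i, StronglyMeasurable[H (i+1)] (fun o => ρ (i+1) o - ρ i o) := fun i => (hρM.sm (i+1)).sub ((hρM.sm i).mono (mono1 i))
  have ss : ∀ l i, StronglyMeasurable[H (i+1)] (fun o => s l (gp N (i+1)) o - s l (gp N i) o) := fun l i =>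
    ((hsM l).sm (i+1)).sub (((hsM l).sm i).mono (mono1 i))
  have ind1 : ∀ {f : Ω → ℝ} {e : ℝ} {E : Set Ω} (o : Ω), |f o| ≤ e → |E.indicator f o| ≤ e := fun {f e E} o h => by
    by_cases hω : o ∈ E
    · rwa [indicator_of_mem hω]
    · rw [indicator_of_notMem hω, abs_zero]; exact (abs_nonneg _).trans h
  have bb : ∀ i o, |β i o| ≤ 1 := fun i o => ind1 o (by rw [abs_of_nonneg (hb01 _ _).1]; exact (hb01 _ _).2)
  have bb' : ∀ i o, |c i o| ≤ 1 := fun i o => ind1 o (by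
    have := hb01 (gp N i) o
    rw [abs_of_nonneg (by linarith)]; linarith)
  have bK : ∀ l i o, |κ l i o| ≤ k := fun l i o => ind1 o (hKk l _ _)
  have AA1 : ∀ i o, 1 ≤ A i o := fun i o => by
    simp only [hA, AA, le_add_iff_nonneg_right]; positivity
  -- centering
  have cρ : ∀ i < M, ∀ q : Ω → ℝ, StronglyMeasurable[H i] q → (∀ o, |q o| ≤ 1) → _ := fun i hi q h1 h2 => hρM.cent hXi hi h1 h2
  have cs : ∀ l, ∀ i < M, _ := fun l i hi => (hsM l).cent (yi l) hi (sK l i hi) (bK l i)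
  have csR : ∀ l, ∀ i < M, _ := fun l i hi => (hsR l).cent (hS.ri l w (gp_nonneg _ _) le_rfl) hi (sK l i hi) (bK l i)
  -- squares
  have t2 : ∀ i, MemLp (fun o => (1 - b (gp N i) o) * uf P Γ z X N i o) ∞ P := fun i =>
    top_mul ((memLp_const (1:ℝ)).sub (hb.bd _)) (uf_top hz hXt N i)
  have t1 : ∀ i, MemLp (fun o => b (gp N i) o * uf P Γ z X N i o - ∑ l, K l (gp N i) o * uf P Γ z (y l) N i o) ∞ P := fun i =>
    (top_mul (hb.bd _) (uf_top hz hXt N i)).sub (memLp_finsetSum _ fun l _ => top_mul ((hK l).bd _) (uf_top hz (hy l) N i))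
  have hDm : ∀ i < M, MeasurableSet (D (gp N i)) := fun i hi => Γ.le _ _ (hT.Nm _ (hwi i hi))
  have pβ : ∀ i, i < M → _ := fun i hi => hT.proj hz hXt hMw hi hρM (hb.sm _) (hb.bd _)
  have pc : ∀ i, i < M → _ := fun i hi => hT.proj hz hXt hMw hi hρM (stronglyMeasurable_const.sub (hb.sm _)) ((memLp_const (1:ℝ)).sub (hb.bd _))
  have pκ : ∀ l, ∀ i, i < M → _ := fun l i hi => hT.proj hz (hy l) hMw hi (hsM l) ((hK l).sm _) ((hK l).bd _)
  have f2 : ∀ i < M, (fun o => (P[z|H i]) o * (P[z|H (i+1)]) o * a2 i o) =ᵐ[P] P[fun o => (D (gp N i)).indicator (fun o => (1 - b (gp N i) o) * uf P Γ z X N i o) o|H (i+1)] := fun i hi => by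
    refine (pc i hi).symm.trans (condExp_congr_ae (ae_of_all _ fun o => ?_))
    by_cases hω : o ∈ D (gp N i) <;> simp [hω]
  have f1 : ∀ i < M, (fun o => (P[z|H i]) o * (P[z|H (i+1)]) o * a1 i o) =ᵐ[P] P[fun o => (D (gp N i)).indicator (fun o => b (gp N i) o * uf P Γ z X N i o - ∑ l, K l (gp N i) o * uf P Γ z (y l) N i o) o|H (i+1)] := fun i hi => by
    have tb : MemLp (β i) ∞ P := (hb.bd _).indicator (hDm i hi)
    have tK : ∀ l, MemLp (κ l i) ∞ P := fun l => ((hK l).bd _).indicator (hDm i hi)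
    have e : (fun o => (D (gp N i)).indicator (fun o => b (gp N i) o * uf P Γ z X N i o - ∑ l, K l (gp N i) o * uf P Γ z (y l) N i o) o)
        = (fun o => β i o * uf P Γ z X N i o) - ∑ l, (fun o => κ l i o * uf P Γ z (y l) N i o) := by
      ext o
      by_cases hω : o ∈ D (gp N i) <;> simp [hω, hβ, hκ]
    rw [e]
    refine EventuallyEq.symm ?_
    have iκ : ∀ l, Integrable (fun o => κ l i o * uf P Γ z (y l) N i o) P := fun l => top_int (top_mul (tK l) (uf_top hz (hy l) N i))
    refine (condExp_sub (top_int (top_mul tb (uf_top hz hXt N i))) (integrable_finsetSum' _ fun l _ => iκ l) (H (i+1))).trans ?_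
    filter_upwards [pβ i hi, ae_all_iff.2 fun l => pκ l i hi, condExp_finsetSum (s := Finset.univ) (fun l _ => iκ l) (H (i+1))] with o h1 h2 h3
    have e2 : ∀ l, (P[fun o => κ l i o * uf P Γ z (y l) N i o|H (i+1)]) o = (P[z|H i]) o * (P[z|H (i+1)]) o * (κ l i o * (s l (gp N (i+1)) o - s l (gp N i) o)) := h2
    have e1 : (P[fun o => β i o * uf P Γ z X N i o|H (i+1)]) o = (P[z|H i]) o * (P[z|H (i+1)]) o * (β i o * (ρ (i+1) o - ρ i o)) := h1
    rw [Pi.sub_apply, h3, Finset.sum_apply, e1]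
    simp only [e2, ha1]
    rw [← Finset.mul_sum, ← mul_sub]
  have sqD : ∀ {f : Ω → ℝ} {i : ℕ}, i < M → MemLp f ∞ P → ∫ o, (P[fun o => (D (gp N i)).indicator f o|H (i+1)]) o ^ 2 ∂P ≤ ∫ o, f o ^ 2 ∂P := fun {f i} hi hf => by
    refine (sq_contr (H.le _) (hf.indicator (hDm i hi))).2.trans ?_
    refine integral_mono ?_ ?_ fun o => ?_
    · have := hf.indicator (hDm i hi)
      simp only [pow_two]; exact top_int (top_mul this this)
    · simp only [pow_two]; exact top_int (top_mul hf hf)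
    · by_cases hω : o ∈ D (gp N i) <;> simp [hω, sq_nonneg]
  have sqI : ∀ {f : Ω → ℝ}, MemLp f ∞ P → Integrable (fun o => f o ^ 2) P := fun {f} hf => by
    simp only [pow_two]; exact top_int (top_mul hf hf)
  have hrng : Finset.range M ⊆ Finset.range (2^N) := Finset.range_mono hM2
  have B1 : |∑ i ∈ Finset.range M, ∫ o in G i, r o * a1 i o ∂P| ≤ ε0/3 := by
    refine hc2 H M A hdom a1 (fun i hi => ?_) (fun i hi o => ?_) (fun i hi => ?_) (fun i hi => ?_) ?_
    · exact (((sb i hi).mono (mono1 i)).mul (sρ i)).sub (Finset.stronglyMeasurable_fun_sum _ fun l _ => ((sK l i hi).mono (mono1 i)).mul (ss l i))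
    · have u1 : |β i o * (ρ (i+1) o - ρ i o)| ≤ 1 := by
        rw [abs_mul]; exact mul_le_one₀ (bb i o) (abs_nonneg _) (hρd i o)
      have u2 : |∑ l, κ l i o * (s l (gp N (i+1)) o - s l (gp N i) o)| ≤ max 1 k * ∑ l, (|s l (gp N i) o| + |s l (gp N (i+1)) o|) := by
        refine (Finset.abs_sum_le_sum_abs _ _).trans ?_
        rw [Finset.mul_sum]
        refine Finset.sum_le_sum fun l _ => ?_
        rw [abs_mul]
        refine mul_le_mul ((bK l _ _).trans (le_max_right _ _)) ?_ (abs_nonneg _) (by positivity)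
        exact (abs_sub _ _).trans (le_of_eq (add_comm _ _))
      refine (abs_sub _ _).trans ((add_le_add u1 u2).trans ?_)
      simp only [hA, AA, Finset.sum_add_distrib]
      have : 1 ≤ max 1 k := le_max_left _ _
      nlinarith
    · have e : (fun o => z o * a1 i o) = (fun o => z o * (β i o * (ρ (i+1) o - ρ i o))) - ∑ l, (fun o => z o * (κ l i o * (s l (gp N (i+1)) o - s l (gp N i) o))) := by
        ext o; simp only [ha1, Pi.sub_apply, Finset.sum_apply, mul_sub, Finset.mul_sum]
      rw [e]
      refine (condExp_sub (cρ i hi _ (sb i hi) (bb i)).1 (integrable_finsetSum' _ fun l _ => (cs l i hi).1) (H i)).trans ?_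
      filter_upwards [(cρ i hi _ (sb i hi) (bb i)).2, condExp_finsetSum (s := Finset.univ) (fun l _ => (cs l i hi).1) (H i), ae_all_iff.2 fun l => (cs l i hi).2] with o v1 v2 v3
      rw [Pi.sub_apply, v1, v2, Finset.sum_apply]
      simp [v3]
    · refine (sqI (sq_contr (H.le (i+1)) ((t1 i).indicator (hDm i hi))).1).congr ?_
      filter_upwards [f1 i hi] with o h
      rw [h]
    · refine le_trans ?_ ((Finset.sum_le_sum_of_subset_of_nonneg hrng fun i _ _ => integral_nonneg fun o => sq_nonneg _).trans hr1)
      refine Finset.sum_le_sum fun i hi => le_trans (le_of_eq (integral_congr_ae ?_)) (sqD (Finset.mem_range.1 hi) (t1 i))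
      filter_upwards [f1 i (Finset.mem_range.1 hi)] with o h
      rw [h]
  have B2 : |∑ i ∈ Finset.range M, ∫ o in G i, r o * a2 i o ∂P| ≤ ε0/3 := by
    refine hc1 H M A hdom a2 (fun i hi => ?_) (fun i hi o => ?_) (fun i hi => ?_) (fun i hi => ?_) ?_
    · exact ((s1b i hi).mono (mono1 i)).mul (sρ i)
    · have u1 : |c i o * (ρ (i+1) o - ρ i o)| ≤ 1 := by
        rw [abs_mul]; exact mul_le_one₀ (bb' i o) (abs_nonneg _) (hρd i o)
      have := AA1 i o; have := AA1 (i+1) o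
      refine u1.trans ?_
      linarith
    · exact (cρ i hi _ (s1b i hi) (bb' i)).2
    · refine (sqI (sq_contr (H.le (i+1)) ((t2 i).indicator (hDm i hi))).1).congr ?_
      filter_upwards [f2 i hi] with o h
      rw [h]
    · refine le_trans ?_ ((Finset.sum_le_sum_of_subset_of_nonneg hrng fun i _ _ => integral_nonneg fun o => sq_nonneg _).trans hr2)
      refine Finset.sum_le_sum fun i hi => le_trans (le_of_eq (integral_congr_ae ?_)) (sqD (Finset.mem_range.1 hi) (t2 i))
      filter_upwards [f2 i (Finset.mem_range.1 hi)] with o h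
      rw [h]
  have ib : ∀ {f : Ω → ℝ}, StronglyMeasurable f → (∀ o, |f o| ≤ 1) → Integrable (fun o => r o * f o) P := fun {f} h1 h2 =>
    ri.mul_bdd (c := 1) h1.aestronglyMeasurable (ae_of_all _ h2)
  have B3 : ∑ i ∈ Finset.range M, ∫ o in G i, r o * (ρ (i+1) o - ρ i o) ∂P = ∑ i ∈ Finset.range M, ∫ o in G i, r o * a1 i o ∂P + ∑ i ∈ Finset.range M, ∫ o in G i, r o * a2 i o ∂P := by
    rw [← Finset.sum_add_distrib]
    refine Finset.sum_congr rfl fun i hi => ?_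
    have hi' := Finset.mem_range.1 hi
    have g0 : ∑ l, ∫ o in G i, r o * (κ l i o * (s l (gp N (i+1)) o - s l (gp N i) o)) ∂P = 0 := Finset.sum_eq_zero fun l _ => by
      rw [← setIntegral_condExp (H.le i) (csR l i hi').1 (hGm i), integral_eq_zero_of_ae (ae_restrict_of_ae (csR l i hi').2)]
    rw [← integral_finsetSum _ fun l _ => (csR l i hi').1.integrableOn] at g0
    have j1 : Integrable (fun o => r o * (β i o * (ρ (i+1) o - ρ i o))) P := ib (((sb i hi').mono (H.le _)).mul ((sρ i).mono (H.le _))) fun o => by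
      rw [abs_mul]; exact mul_le_one₀ (bb i o) (abs_nonneg _) (hρd i o)
    have j2 : Integrable (fun o => r o * (c i o * (ρ (i+1) o - ρ i o))) P := ib (((s1b i hi').mono (H.le _)).mul ((sρ i).mono (H.le _))) fun o => by
      rw [abs_mul]; exact mul_le_one₀ (bb' i o) (abs_nonneg _) (hρd i o)
    have e1 : ∫ o in G i, r o * a1 i o ∂P = ∫ o in G i, r o * (β i o * (ρ (i+1) o - ρ i o)) ∂P := by
      rw [← sub_zero (∫ o in G i, r o * (β i o * (ρ (i+1) o - ρ i o)) ∂P), ← g0, ← integral_sub j1.integrableOn (integrable_finsetSum _ fun l _ => (csR l i hi').1.integrableOn)]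
      congr 1; ext o; simp only [ha1, mul_sub, Finset.mul_sum]
    rw [e1, ← integral_add j1.integrableOn j2.integrableOn]
    refine integral_congr_ae (ae_restrict_of_ae ?_)
    filter_upwards [hT.agree' (P := P) (gp_mono N i.le_succ) (hMw ▸ gp_mono N hi') X, hT.agree' (P := P) (gp_mono N i.le_succ) (hMw ▸ gp_mono N hi') z] with o v1 v2
    by_cases hω : o ∈ D (gp N i)
    · simp only [hβ, hc, indicator_of_mem hω]; ring
    · have : ρ (i+1) o = ρ i o := by
        have v1' : (P[X|H i]) o = (P[X|H (i+1)]) o := v1 hω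
        have v2' : (P[z|H i]) o = (P[z|H (i+1)]) o := v2 hω
        simp only [hρ, rho, v1', v2']
      rw [this]; ring
  have B4 := tele_int (H := H) ri rp G (fun i => H.le _ _ (hGm i)) hGa ρ (fun i => (hρM.sm i).mono (H.le i)) hρ01 M
  have B5 := hn2 H M A hdom
  have hρe := fun i => rho_eq (H := H) zi zp hXi hX0 hX1 i
  have B6 : ∫ o, r o * (ρ M o - ρ 0 o) ∂P = ∫ o in B, r o ∂P - ∫ o in B, z o ∂P := by
    have hBM : MeasurableSet[H M] B := by
      have : (H M : MeasurableSpace Ω) = 𝓗 w := by rw [← hMw]; rfl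
      rw [this]; exact hB
    have q1 : P[X|H M] =ᵐ[P] B.indicator (P[z|H M]) := condExp_indicator zi hBM
    have q0 : P[X|H 0] =ᵐ[P] fun _ => ∫ o, X o ∂P := by
      refine ce_triv (H.le 0) ?_ hXi
      have : (H 0 : MeasurableSpace Ω) = 𝓗 0 := by rw [← gp_zero N]; rfl
      rw [this]; exact ht
    have q0' : P[z|H 0] =ᵐ[P] fun _ => ∫ o, z o ∂P := by
      refine ce_triv (H.le 0) ?_ zi
      have : (H 0 : MeasurableSpace Ω) = 𝓗 0 := by rw [← gp_zero N]; rfl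
      rw [this]; exact ht
    have iX : ∫ o, X o ∂P = ∫ o in B, z o ∂P := integral_indicator hB'
    have e : (fun o => r o * (ρ M o - ρ 0 o)) =ᵐ[P] fun o => B.indicator r o - r o * ∫ o in B, z o ∂P := by
      filter_upwards [hρe M, hρe 0, q1, q0, q0', condExp_pos_of (H.le M) zi zp] with o x1 x2 x3 x4 x5 x6
      have y1 : ρ M o = B.indicator (fun _ => (1:ℝ)) o := by
        rw [hρ, x1, x3]
        by_cases h : o ∈ B
        · simp only [indicator_of_mem h]; exact div_self x6.ne'
        · simp [indicator_of_notMem h]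
      have y0 : ρ 0 o = ∫ o in B, z o ∂P := by rw [hρ, x2, x4, x5, z1, iX, div_one]
      rw [y1, y0]
      by_cases h : o ∈ B
      · simp [h]; ring
      · simp [h]
    rw [integral_congr_ae e, integral_sub (ri.indicator hB') (ri.mul_const _), integral_indicator hB', integral_mul_const, r1, one_mul]
  rw [← B6]
  rw [B3] at B4
  rw [abs_le] at *
  constructor <;> linarith [B1.1, B1.2, B2.1, B2.2, B4.1, B4.2]

end PartTwentyFour

section PartTwentySix
variable {Ω : Type*} {m : MeasurableSpace Ω}

lemma ui_lim {μ : Measure Ω} [IsFiniteMeasure μ] {η : Ω → ℝ} (hη : Integrable η μ) {mk : ℕ → MeasurableSpace Ω} (hmk : ∀ k, mk k ≤ m)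
    {h : ℕ → Ω → ℝ} {g : Ω → ℝ} (hh : ∀ k, h k =ᵐ[μ] μ[η|mk k]) (hl : ∀ᵐ o ∂μ, Tendsto (fun k => h k o) atTop (𝓝 (g o))) :
    Integrable g μ ∧ ∀ C, Tendsto (fun k => ∫ o in C, h k o ∂μ) atTop (𝓝 (∫ o in C, g o ∂μ)) := by
  have hu : UniformIntegrable h 1 μ := (uniformIntegrable_congr_ae hh).2 (hη.uniformIntegrable_condExp hmk)
  have hg : MemLp g 1 μ := hu.memLp_of_ae_tendsto hl
  refine ⟨memLp_one_iff_integrable.1 hg, fun C => ?_⟩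
  refine tendsto_setIntegral_of_L1' g hg.1 (Eventually.of_forall fun k => integrable_condExp.congr (hh k).symm) ?_ C
  exact tendsto_Lp_finite_of_tendsto_ae le_rfl ENNReal.one_ne_top (fun k => hu.1 k) hg hu.2.1 hl

lemma mart_comp {F : Filtration ℝ≥0 m} {d : ℕ} {S : ℝ≥0 → Ω → EuclideanSpace ℝ (Fin d)} {μ : Measure Ω} (h : Martingale S F μ) (l : Fin d) :
    Martingale (fun t o => S t o l) F μ := by
  set T : EuclideanSpace ℝ (Fin d) →L[ℝ] ℝ := EuclideanSpace.proj l
  refine ⟨fun t => T.continuous.comp_stronglyMeasurable (h.1 t), fun s t hst => ?_⟩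
  refine (T.comp_condExp_comm (m := F s) (h.integrable t)).symm.trans ?_
  filter_upwards [h.2 s t hst] with o hω
  simp only [Function.comp, hω]; rfl

lemma mart_of_comp {F : Filtration ℝ≥0 m} {d : ℕ} {S : ℝ≥0 → Ω → EuclideanSpace ℝ (Fin d)} {μ : Measure Ω} (hs : StronglyAdapted F S) (hi : ∀ t, Integrable (S t) μ)
    (h : ∀ l, Martingale (fun t o => S t o l) F μ) : Martingale S F μ := by
  refine ⟨hs, fun s t hst => ?_⟩
  have : ∀ l, ∀ᵐ o ∂μ, (μ[S t|F s]) o l = S s o l := fun l => by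
    filter_upwards [(EuclideanSpace.proj l : EuclideanSpace ℝ (Fin d) →L[ℝ] ℝ).comp_condExp_comm (m := F s) (hi t), (h l).2 s t hst] with o h1 h2
    exact h1.trans h2
  filter_upwards [ae_all_iff.2 this] with o hω
  ext l; exact hω l

/-- the stopped filtration -/
def sF (F : Filtration ℝ≥0 m) (τ : Ω → ℝ≥0∞) (hτ : IsStoppingTimeENN F τ) : Filtration ℝ≥0 m where
  seq t :=
    { MeasurableSet' := fun A => MeasurableSet[F t] A ∧ ∀ r ≤ t, MeasurableSet[F r] (A ∩ {o | τ o ≤ (r : ℝ≥0∞)})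
      measurableSet_empty := ⟨@MeasurableSet.empty _ (F t), fun r _ => by rw [empty_inter]; exact @MeasurableSet.empty _ (F r)⟩
      measurableSet_compl := fun A hA => ⟨hA.1.compl, fun r hr => by
        have : Aᶜ ∩ {o | τ o ≤ (r : ℝ≥0∞)} = {o | τ o ≤ (r : ℝ≥0∞)} \ (A ∩ {o | τ o ≤ (r : ℝ≥0∞)}) := by ext o; simp; tauto
        rw [this]; exact (hτ r).diff (hA.2 r hr)⟩
      measurableSet_iUnion := fun A hA => ⟨MeasurableSet.iUnion fun i => (hA i).1, fun r hr => by
        rw [iUnion_inter]; exact MeasurableSet.iUnion fun i => (hA i).2 r hr⟩ }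
  mono' s t hst A hA := ⟨F.mono hst _ hA.1, fun r hr => by
    rcases le_total r s with h | h
    · exact hA.2 r h
    · exact (F.mono h _ hA.1).inter (hτ r)⟩
  le' t A hA := F.le t _ hA.1

/-- the time change -/
def th (u : ℝ) : ℝ≥0 := Real.toNNReal (u / (1 - u))

lemma th_mono {u u' : ℝ} (h : u ≤ u') (h' : u' < 1) : th u ≤ th u' := by
  refine Real.toNNReal_le_toNNReal ?_
  rw [div_le_div_iff₀ (by linarith) (by linarith)]
  nlinarith

lemma th_zero : th 0 = 0 := by simp [th]

lemma gp_lt {j i : ℕ} (h : i < 2^j) : gp j i < 1 := by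
  unfold gp
  rw [div_lt_one (by positivity)]
  exact_mod_cast h

lemma th_last (j : ℕ) : (th (gp j (2^j-1)) : ℝ) = 2^j - 1 := by
  have h1 : (1:ℝ) ≤ 2^j := one_le_pow₀ one_le_two
  have e : gp j (2^j-1) / (1 - gp j (2^j-1)) = 2^j - 1 := by
    have h2 : ((2^j-1 : ℕ) : ℝ) = 2^j - 1 := by
      rw [Nat.cast_sub Nat.one_le_two_pow]; simp
    unfold gp
    rw [h2]
    have : (1:ℝ) - (2^j-1)/2^j = 1/2^j := by field_simp; ring
    rw [this]; field_simp
  rw [th, e, Real.coe_toNNReal _ (by linarith)]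

/-- the time-changed filtration -/
def tc (F : Filtration ℝ≥0 m) : Filtration ℝ m where
  seq u := if u < 1 then F (th u) else m
  mono' u u' h := by
    dsimp only
    split_ifs with h1 h2 h2
    · exact F.mono (th_mono h h2)
    · exact F.le _
    · linarith
    · exact le_rfl
  le' u := by
    split_ifs with h1
    · exact F.le _
    · exact le_rfl

lemma tc_lt (F : Filtration ℝ≥0 m) {u : ℝ} (h : u < 1) : (tc F u : MeasurableSpace Ω) = F (th u) := if_pos h
lemma tc_ge (F : Filtration ℝ≥0 m) {u : ℝ} (h : ¬ u < 1) : (tc F u : MeasurableSpace Ω) = m := if_neg h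

lemma stp_sF (F : Filtration ℝ≥0 m) (τ : Ω → ℝ≥0∞) (hτ : IsStoppingTimeENN F τ) {w : ℝ} (hw : w < 1) :
    Stp (tc F) (tc (sF F τ hτ)) (fun u => {o | τ o ≤ (th u : ℝ≥0∞)}ᶜ) w := by
  refine ⟨fun u => ?_, fun u hu => ?_, fun u hu C hC hCN => ?_, fun u u' huu hu C hC => ?_⟩
  · by_cases h : u < 1
    · rw [tc_lt F h, tc_lt _ h]; exact fun A hA => hA.1
    · rw [tc_ge F h, tc_ge _ h]
  · rw [tc_lt F (hu.trans_lt hw)]; exact (hτ _).compl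
  · rw [tc_lt _ (hu.trans_lt hw)] at *
    refine ⟨hC, fun r hr => ?_⟩
    have : C ∩ {o | τ o ≤ (r : ℝ≥0∞)} = ∅ := by
      ext o
      simp only [mem_inter_iff, mem_empty_iff_false, iff_false, not_and]
      intro h1 h2
      exact hCN h1 (le_trans (show τ o ≤ (r : ℝ≥0∞) from h2) (ENNReal.coe_le_coe.2 hr))
    rw [this]; exact @MeasurableSet.empty _ (F r)
  · rw [tc_lt _ (hu.trans_lt hw)] at hC
    rw [tc_lt _ ((huu.trans hu).trans_lt hw), compl_compl]
    have h1 := th_mono huu (hu.trans_lt hw)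
    refine ⟨hC.2 _ h1, fun r hr => ?_⟩
    have : C ∩ {o | τ o ≤ (th u : ℝ≥0∞)} ∩ {o | τ o ≤ (r : ℝ≥0∞)} = C ∩ {o | τ o ≤ (r : ℝ≥0∞)} := by
      ext o
      simp only [mem_inter_iff, Set.mem_ofPred_eq]
      exact ⟨fun h => ⟨h.1.1, h.2⟩, fun h => ⟨⟨h.1, h.2.trans (by exact_mod_cast hr)⟩, h.2⟩⟩
    rw [this]; exact hC.2 r (hr.trans h1)

/-- dyadic upper approximation, capped at `t` -/
def dk (k : ℕ) (t a : ℝ≥0) : ℝ≥0 := min t (⌈2^k * a⌉₊ / 2^k)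

lemma dk_ge {k : ℕ} {t a : ℝ≥0} (h : a ≤ t) : a ≤ dk k t a := by
  refine le_min h ?_
  rw [le_div_iff₀ (by positivity), mul_comm]; exact Nat.le_ceil _

lemma dk_le_iff {k : ℕ} {t a r : ℝ≥0} (h : r < t) : dk k t a ≤ r ↔ a ≤ ⌊2^k * r⌋₊ / 2^k := by
  rw [dk, min_le_iff, or_iff_right (not_le.2 h), div_le_iff₀ (by positivity), le_div_iff₀ (by positivity), mul_comm r, mul_comm a, ← Nat.ceil_le]
  exact ⟨fun h => Nat.le_floor h, fun h => (Nat.le_floor_iff (by positivity)).1 h⟩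

lemma dk_tendsto {t a : ℝ≥0} (h : a ≤ t) : Tendsto (fun k => dk k t a) atTop (𝓝 a) := by
  have h1 : ∀ k, dk k t a ≤ a + (1/2)^k := fun k => by
    refine (min_le_right _ _).trans ?_
    rw [div_le_iff₀ (by positivity), add_mul, one_div, inv_pow, inv_mul_cancel₀ (by positivity), mul_comm a]
    exact (Nat.ceil_lt_add_one (by positivity)).le
  have h2 : Tendsto (fun k : ℕ => a + (1/2 : ℝ≥0)^k) atTop (𝓝 a) := by
    have := (NNReal.tendsto_pow_atTop_nhds_zero_of_lt_one (r := (1/2 : ℝ≥0)) (by rw [div_lt_one (by norm_num)]; norm_num)).const_add a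
    simpa using this
  exact tendsto_of_tendsto_of_tendsto_of_le_of_le tendsto_const_nhds h2 (fun k => dk_ge h) h1

lemma opt_samp {F : Filtration ℝ≥0 m} {Q : Measure Ω} [IsProbabilityMeasure Q] {x : ℝ≥0 → Ω → ℝ} (hx : Martingale x F Q)
    (hrc : ∀ o t, ContinuousWithinAt (fun s => x s o) (Ici t) t) {τ : Ω → ℝ≥0∞} (hτ : IsStoppingTimeENN F τ) (t : ℝ≥0) :
    Integrable (stoppedAtENN x τ t) Q ∧ ∀ C, MeasurableSet[sF F τ hτ t] C → ∫ o in C, stoppedAtENN x τ t o ∂Q = ∫ o in C, x t o ∂Q := by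
  set a : Ω → ℝ≥0 := fun o => (min (τ o) t).toNNReal with ha
  have hac : ∀ o, (a o : ℝ≥0∞) = min (τ o) t := fun o => ENNReal.coe_toNNReal (ne_top_of_le_ne_top ENNReal.coe_ne_top (min_le_right _ _))
  have hat : ∀ o, a o ≤ t := fun o => by
    have := (hac o).trans_le (min_le_right _ _)
    exact_mod_cast this
  have hv : stoppedAtENN x τ t = fun o => x (a o) o := by
    ext o
    simp only [stoppedAtENN, ha]
    split_ifs with h
    · rw [min_eq_left h]
    · rw [min_eq_right (not_le.1 h).le]; simp
  set σ : ℕ → Ω → WithTop ℝ≥0 := fun k o => (dk k t (a o) : ℝ≥0) with hσ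
  have key : ∀ k (r : ℝ≥0), r < t → {o | σ k o ≤ (r : WithTop ℝ≥0)} = {o | τ o ≤ ((⌊2^k * r⌋₊ / 2^k : ℝ≥0) : ℝ≥0∞)} := fun k r hr => by
    ext o
    simp only [Set.mem_ofPred_eq, hσ, WithTop.coe_le_coe]
    rw [dk_le_iff hr, ← ENNReal.coe_le_coe, hac, min_le_iff]
    refine or_iff_left ?_
    rw [not_le, ENNReal.coe_lt_coe]
    refine lt_of_le_of_lt ?_ hr
    rw [div_le_iff₀ (by positivity), mul_comm]; exact Nat.floor_le (by positivity)
  have key2 : ∀ k (r : ℝ≥0), (⌊2^k * r⌋₊ / 2^k : ℝ≥0) ≤ r := fun k r => by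
    rw [div_le_iff₀ (by positivity), mul_comm]; exact Nat.floor_le (by positivity)
  have hσl : ∀ k o, σ k o ≤ (t : WithTop ℝ≥0) := fun k o => WithTop.coe_le_coe.2 (min_le_left _ _)
  have key3 : ∀ k (r : ℝ≥0), t ≤ r → {o | σ k o ≤ (r : WithTop ℝ≥0)} = univ := fun k r hr => eq_univ_of_forall fun o =>
    (hσl k o).trans (WithTop.coe_le_coe.2 hr)
  have hst : ∀ k, IsStoppingTime F (σ k) := fun k r => by
    rcases lt_or_ge r t with hr | hr
    · rw [key k r hr]; exact F.mono (key2 k r) _ (hτ _)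
    · rw [key3 k r hr]; exact @MeasurableSet.univ _ (F r)
  have hcr : ∀ k, (Set.range (σ k)).Countable := fun k => by
    refine Set.Countable.mono ?_ (Set.countable_range (fun n : ℕ => ((min t (n / 2^k) : ℝ≥0) : WithTop ℝ≥0)))
    rintro _ ⟨o, rfl⟩
    exact ⟨⌈2^k * a o⌉₊, rfl⟩
  have hm : ∀ k, (hst k).measurableSpace ≤ m := fun k => (hst k).measurableSpace_le_of_le (hσl k)
  have hce : ∀ k, (fun o => x (dk k t (a o)) o) =ᵐ[Q] Q[x t|(hst k).measurableSpace] := fun k =>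
    hx.stoppedValue_ae_eq_condExp_of_le_const_of_countable_range (hst k) (hσl k) (hcr k)
  have hlim : ∀ o, Tendsto (fun k => x (dk k t (a o)) o) atTop (𝓝 (x (a o) o)) := fun o => by
    refine (hrc o (a o)).tendsto.comp ?_
    exact tendsto_nhdsWithin_iff.2 ⟨dk_tendsto (hat o), Eventually.of_forall fun k => dk_ge (hat o)⟩
  obtain ⟨h1, h2⟩ := ui_lim (hx.integrable t) hm hce (ae_of_all _ hlim)
  rw [hv]
  refine ⟨h1, fun C hC => tendsto_nhds_unique (h2 C) ?_⟩
  have : ∀ k, ∫ o in C, x (dk k t (a o)) o ∂Q = ∫ o in C, x t o ∂Q := fun k => by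
    rw [integral_congr_ae (ae_restrict_of_ae (hce k))]
    refine setIntegral_condExp (hm k) (hx.integrable t) ?_
    refine ⟨le_iSup (fun t => (F t : MeasurableSpace Ω)) t _ hC.1, fun r => ?_⟩
    rcases lt_or_ge r t with hr | hr
    · rw [key k r hr]; exact F.mono (key2 k r) _ (hC.2 _ ((key2 k r).trans hr.le))
    · rw [key3 k r hr, inter_univ]; exact F.mono hr _ hC.1
  simp only [this]
  exact tendsto_const_nhds

lemma stop_sm {F : Filtration ℝ≥0 m} {x : ℝ≥0 → Ω → ℝ} {τ : Ω → ℝ≥0∞} (hτ : IsStoppingTimeENN F τ) (hs : ∀ t, StronglyMeasurable[F t] (stoppedAtENN x τ t)) (t : ℝ≥0) :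
    StronglyMeasurable[sF F τ hτ t] (stoppedAtENN x τ t) := by
  have h0 : Measurable[sF F τ hτ t] (stoppedAtENN x τ t) := fun B hB => ?_
  · exact h0.stronglyMeasurable
  refine ⟨(hs t).measurable hB, fun r hr => ?_⟩
  have : stoppedAtENN x τ t ⁻¹' B ∩ {o | τ o ≤ (r : ℝ≥0∞)} = stoppedAtENN x τ r ⁻¹' B ∩ {o | τ o ≤ (r : ℝ≥0∞)} := by
    ext o
    simp only [mem_inter_iff, mem_preimage, Set.mem_ofPred_eq, and_congr_left_iff]
    intro h
    rw [stoppedAtENN, stoppedAtENN, if_pos h, if_pos (h.trans (by exact_mod_cast hr))]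
  rw [this]; exact ((hs r).measurable hB).inter (hτ r)

end PartTwentySix

section PartTwentySeven
variable {Ω : Type*} {m : MeasurableSpace Ω} {P : Measure Ω} [IsProbabilityMeasure P]

/-- measure with real density `z` -/
abbrev wd (P : Measure Ω) (z : Ω → ℝ) : Measure Ω := P.withDensity fun o => ENNReal.ofReal (z o)

lemma wd_int {z : Ω → ℝ} (zi : Integrable z P) (zp : ∀ᵐ o ∂P, 0 ≤ z o) (f : Ω → ℝ) (C : Set Ω) : ∫ o in C, f o ∂(wd P z) = ∫ o in C, z o * f o ∂P := by
  rw [wd, setIntegral_withDensity_eq_setIntegral_toReal_smul₀' C zi.1.aemeasurable.ennreal_ofReal.restrict (ae_of_all _ fun o => ENNReal.ofReal_lt_top)]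
  refine integral_congr_ae (ae_restrict_of_ae ?_)
  filter_upwards [zp] with o h
  rw [ENNReal.toReal_ofReal h, smul_eq_mul]

lemma wd_int' {z : Ω → ℝ} (zi : Integrable z P) (zp : ∀ᵐ o ∂P, 0 ≤ z o) (f : Ω → ℝ) : ∫ o, f o ∂(wd P z) = ∫ o, z o * f o ∂P := by
  have := wd_int zi zp f univ
  simpa using this

lemma wd_integrable {z : Ω → ℝ} (zi : Integrable z P) (zp : ∀ᵐ o ∂P, 0 ≤ z o) (f : Ω → ℝ) : Integrable f (wd P z) ↔ Integrable (fun o => z o * f o) P := by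
  rw [wd, integrable_withDensity_iff_integrable_smul₀' zi.1.aemeasurable.ennreal_ofReal (ae_of_all _ fun o => ENNReal.ofReal_lt_top)]
  refine integrable_congr ?_
  filter_upwards [zp] with o h
  rw [ENNReal.toReal_ofReal h, smul_eq_mul]

lemma wd_prob {z : Ω → ℝ} (zi : Integrable z P) (zp : ∀ᵐ o ∂P, 0 ≤ z o) (z1 : ∫ o, z o ∂P = 1) : IsProbabilityMeasure (wd P z) := by
  refine ⟨?_⟩
  rw [wd, withDensity_apply _ MeasurableSet.univ, Measure.restrict_univ, ← ofReal_integral_eq_lintegral_ofReal zi zp, z1, ENNReal.ofReal_one]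

lemma wd_ac (P : Measure Ω) (z : Ω → ℝ) : wd P z ≪ P := withDensity_absolutelyContinuous _ _

lemma wd_ac' {z : Ω → ℝ} (zi : Integrable z P) (zp : ∀ᵐ o ∂P, 0 < z o) : P ≪ wd P z :=
  withDensity_absolutelyContinuous' zi.1.aemeasurable.ennreal_ofReal (zp.mono fun o h => (ENNReal.ofReal_pos.2 h).ne')

lemma wd_real {z : Ω → ℝ} (zi : Integrable z P) (zp : ∀ᵐ o ∂P, 0 ≤ z o) (C : Set Ω) : (wd P z).real C = ∫ o in C, z o ∂P := by
  have := wd_int zi zp (fun _ => 1) C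
  simpa using this

lemma rn_wd {R : Measure Ω} [IsProbabilityMeasure R] (h : R ≪ P) (h' : P ≪ R) :
    ∃ r : Ω → ℝ, Integrable r P ∧ (∀ᵐ o ∂P, 0 < r o) ∧ ∫ o, r o ∂P = 1 ∧ R = wd P r := by
  have hi : Integrable (fun o => (R.rnDeriv P o).toReal) P := Measure.integrable_toReal_rnDeriv
  have hw : R = wd P fun o => (R.rnDeriv P o).toReal := by
    conv_lhs => rw [← Measure.withDensity_rnDeriv_eq R P h]
    refine withDensity_congr_ae ?_
    filter_upwards [Measure.rnDeriv_lt_top R P] with o hω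
    rw [ENNReal.ofReal_toReal hω.ne]
  refine ⟨fun o => (R.rnDeriv P o).toReal, hi, ?_, ?_, hw⟩
  · filter_upwards [Measure.rnDeriv_lt_top R P, Measure.rnDeriv_pos' h'] with o h1 h2
    exact ENNReal.toReal_pos h2.ne' h1.ne
  · have := wd_real hi (ae_of_all _ fun o => ENNReal.toReal_nonneg) univ
    rw [← hw] at this
    simpa using this.symm

variable {F : Filtration ℝ≥0 m} {d : ℕ}

/-- the standing model -/
structure Mdl (P : Measure Ω) (F : Filtration ℝ≥0 m) (z : Ω → ℝ) (y : Fin d → Ω → ℝ) (S : ℝ≥0 → Ω → EuclideanSpace ℝ (Fin d)) : Prop where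
  hz : MemLp z ∞ P
  hy : ∀ l, MemLp (y l) ∞ P
  zp : ∀ᵐ o ∂P, 0 < z o
  z1 : ∫ o, z o ∂P = 1
  mart : Martingale S F (wd P z)
  rc : ∀ o t, ContinuousWithinAt (fun s => S s o) (Ici t) t
  ver : ∀ l t C, MeasurableSet[F t] C → ∫ o in C, z o * S t o l ∂P = ∫ o in C, y l o ∂P
  triv : ∀ C, MeasurableSet[F 0] C → P C = 0 ∨ P C = 1
  gen : (⨆ t : ℝ≥0, (F t : MeasurableSpace Ω)) = m

lemma stop_comp {S : ℝ≥0 → Ω → EuclideanSpace ℝ (Fin d)} (τ : Ω → ℝ≥0∞) (l : Fin d) (t : ℝ≥0) :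
    stoppedAtENN (fun t o => S t o l) τ t = fun o => stoppedAtENN S τ t o l := by
  ext o; simp only [stoppedAtENN]; split_ifs <;> rfl

lemma Mdl.rcl {z : Ω → ℝ} {y : Fin d → Ω → ℝ} {S : ℝ≥0 → Ω → EuclideanSpace ℝ (Fin d)} (h : Mdl P F z y S) (l : Fin d) (o : Ω) (t : ℝ≥0) :
    ContinuousWithinAt (fun s => S s o l) (Ici t) t :=
  (EuclideanSpace.proj l : EuclideanSpace ℝ (Fin d) →L[ℝ] ℝ).continuous.continuousAt.comp_continuousWithinAt (h.rc o t)

theorem Mdl.stopped_eq {z : Ω → ℝ} {y : Fin d → Ω → ℝ} {S : ℝ≥0 → Ω → EuclideanSpace ℝ (Fin d)} (h : Mdl P F z y S) (hG : Gd P (tc F) z y)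
    {r : Ω → ℝ} (ri : Integrable r P) (rp : ∀ᵐ o ∂P, 0 < r o) (r1 : ∫ o, r o ∂P = 1) {τ : Ω → ℝ≥0∞} (hτ : IsStoppingTimeENN F τ)
    (hM : Martingale (stoppedAtENN S τ) F (wd P r)) (j : ℕ) {B : Set Ω} (hB : MeasurableSet[F (th (gp j (2^j-1)))] B) :
    ∫ o in B ∩ {o | τ o ≤ (th (gp j (2^j-1)) : ℝ≥0∞)}ᶜ, r o ∂P = ∫ o in B ∩ {o | τ o ≤ (th (gp j (2^j-1)) : ℝ≥0∞)}ᶜ, z o ∂P := by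
  have zi := top_int h.hz
  have zn := h.zp.mono fun o h => h.le
  have rn := rp.mono fun o h => h.le
  haveI := wd_prob zi zn h.z1
  haveI := wd_prob ri rn r1
  have hpos : 0 < 2^j := by positivity
  have hw : gp j (2^j-1) < 1 := gp_lt (by omega)
  have hMl := fun l => mart_comp hM l
  have hsm : ∀ l t, StronglyMeasurable[F t] (stoppedAtENN (fun t o => S t o l) τ t) := fun l t => by
    rw [stop_comp]; exact (hMl l).1 t
  have ho := fun l t => opt_samp (mart_comp h.mart l) (h.rcl l) hτ t
  have hT := stp_sF F τ hτ hw
  have hset : MeasurableSet[tc (sF F τ hτ) (gp j (2^j-1))] (B ∩ {o | τ o ≤ (th (gp j (2^j-1)) : ℝ≥0∞)}ᶜ) := by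
    refine hT.sub _ le_rfl _ ?_ inter_subset_right
    rw [tc_lt _ hw]; exact hB.inter (hτ _).compl
  refine main_est (Γ := tc F) (𝓗 := tc (sF F τ hτ)) (s := fun l u => stoppedAtENN (fun t o => S t o l) τ (th u)) h.hz h.hy hG h.zp h.z1 ri rp r1 (fun C hC => ?_) j (2^j-1) (by omega) hT ?_ hset
  · rw [tc_lt _ zero_lt_one, th_zero] at hC
    exact h.triv C hC.1
  · refine ⟨fun l u => ?_, fun l u _ hu => ?_, fun l u _ hu C hC => ?_, fun l u _ hu => ?_, fun l u _ hu C hC => ?_⟩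
    · by_cases h1 : u < 1
      · rw [tc_lt _ h1]; exact stop_sm hτ (hsm l) _
      · rw [tc_ge _ h1]; exact (hsm l _).mono (F.le _)
    · exact (wd_integrable zi zn _).1 (ho l _).1
    · rw [tc_lt _ (hu.trans_lt hw)] at hC
      rw [← wd_int zi zn, (ho l _).2 C hC, wd_int zi zn]
      exact h.ver l _ C hC.1
    · rw [stop_comp]; exact (wd_integrable ri rn _).1 ((hMl l).integrable _)
    · rw [tc_lt _ (hu.trans_lt hw)] at hC
      rw [← wd_int ri rn, ← wd_int ri rn, stop_comp, stop_comp]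
      have := (hMl l).2 _ _ (th_mono hu hw)
      rw [← integral_congr_ae (ae_restrict_of_ae this), setIntegral_condExp (F.le _) ((hMl l).integrable _) hC.1]

theorem Mdl.uniq {z : Ω → ℝ} {y : Fin d → Ω → ℝ} {S : ℝ≥0 → Ω → EuclideanSpace ℝ (Fin d)} (h : Mdl P F z y S) (hG : Gd P (tc F) z y)
    {R : Measure Ω} [IsProbabilityMeasure R] (h1 : R ≪ P) (h2 : P ≪ R) (hR : IsLocalMartingale F S R) : R = wd P z := by
  obtain ⟨r, ri, rp, r1, rfl⟩ := rn_wd h1 h2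
  obtain ⟨τ, hτ, hmono, hsup, hM⟩ := hR
  have zi := top_int h.hz
  have zn := h.zp.mono fun o h => h.le
  have rn := rp.mono fun o h => h.le
  haveI := wd_prob zi zn h.z1
  have key : ∀ j (B : Set Ω), MeasurableSet[F (th (gp j (2^j-1)))] B → wd P r B = wd P z B := fun j B hB => by
    set t := th (gp j (2^j-1)) with ht
    set D : ℕ → Set Ω := fun n => B ∩ {o | τ n o ≤ (t : ℝ≥0∞)}ᶜ with hD
    have hDm : Monotone D := fun a b hab => inter_subset_inter_right _ (compl_subset_compl.2 fun o hω => le_trans (hmono o hab) hω)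
    have hDu : ⋃ n, D n = B := by
      rw [hD, ← inter_iUnion]
      refine inter_eq_left.2 fun o _ => ?_
      have : (t : ℝ≥0∞) < ⨆ n, τ n o := by rw [hsup]; exact ENNReal.coe_lt_top
      obtain ⟨n, hn⟩ := lt_iSup_iff.1 this
      exact mem_iUnion.2 ⟨n, not_le.2 hn⟩
    have e : ∀ n, wd P r (D n) = wd P z (D n) := fun n => by
      have := h.stopped_eq hG ri rp r1 (hτ n) (hM n) j hB
      rw [← wd_real ri rn, ← wd_real zi zn] at this
      exact (measureReal_eq_measureReal_iff (measure_ne_top _ _) (measure_ne_top _ _)).1 this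
    have l1 := tendsto_measure_iUnion_atTop (μ := wd P r) hDm
    have l2 := tendsto_measure_iUnion_atTop (μ := wd P z) hDm
    rw [hDu] at l1 l2
    have : (wd P r ∘ D) = (wd P z ∘ D) := funext e
    rw [this] at l1
    exact tendsto_nhds_unique l1 l2
  refine ext_of_generate_finite {B : Set Ω | ∃ t, MeasurableSet[F t] B} ?_ ?_ ?_ (by simp)
  · exact h.gen.symm.trans (MeasurableSpace.measurableSpace_iSup_eq fun t => (F t : MeasurableSpace Ω))
  · rintro A ⟨t, hA⟩ B ⟨t', hB⟩ _
    exact ⟨max t t', (F.mono (le_max_left t t') _ hA).inter (F.mono (le_max_right t t') _ hB)⟩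
  · rintro B ⟨t, hB⟩
    obtain ⟨j, hj⟩ := pow_unbounded_of_one_lt ((t : ℝ) + 1) one_lt_two
    refine key j B (F.mono ?_ _ hB)
    rw [← NNReal.coe_le_coe, th_last]; linarith

lemma dy_seq (s : ℝ≥0) : ∃ (k i : ℕ → ℕ), (∀ n, i n < 2^(k n)) ∧ (∀ n, s ≤ th (gp (k n) (i n))) ∧
    Tendsto (fun n => th (gp (k n) (i n))) atTop (𝓝 s) := by
  set v : ℝ := s / (1 + s) with hv
  have hs : (0:ℝ) ≤ s := s.2
  have hv0 : 0 ≤ v := by positivity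
  have hv1 : v < 1 := by rw [hv, div_lt_one (by linarith)]; linarith
  have hvs : th v = s := by
    have : v / (1 - v) = s := by rw [hv]; field_simp; ring
    rw [th, this, Real.toNNReal_coe]
  have h1 : ∀ k : ℕ, v ≤ gp k ⌈2^k * v⌉₊ := fun k => by
    rw [gp, le_div_iff₀ (by positivity), mul_comm]; exact Nat.le_ceil _
  have h2 : ∀ k : ℕ, gp k ⌈2^k * v⌉₊ ≤ v + (1/2)^k := fun k => by
    rw [gp, div_le_iff₀ (by positivity), add_mul, one_div, inv_pow, inv_mul_cancel₀ (by positivity), mul_comm v]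
    exact (Nat.ceil_lt_add_one (by positivity)).le
  have h3 : Tendsto (fun k : ℕ => gp k ⌈2^k * v⌉₊) atTop (𝓝 v) := by
    have : Tendsto (fun k : ℕ => v + (1/2 : ℝ)^k) atTop (𝓝 v) := by
      simpa using (tendsto_pow_atTop_nhds_zero_of_lt_one (by norm_num) (by norm_num : (1/2:ℝ) < 1)).const_add v
    exact tendsto_of_tendsto_of_tendsto_of_le_of_le tendsto_const_nhds this h1 h2
  obtain ⟨N, hN⟩ := eventually_atTop.1 (h3.eventually_lt_const hv1)
  refine ⟨fun n => n + N, fun n => ⌈2^(n+N) * v⌉₊, fun n => ?_, fun n => ?_, ?_⟩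
  · have := hN (n+N) (by omega)
    rw [gp, div_lt_one (by positivity)] at this
    exact_mod_cast this
  · conv_lhs => rw [← hvs]
    exact th_mono (h1 _) (hN (n+N) (by omega))
  · have hc : ContinuousAt th v := by
      refine continuous_real_toNNReal.continuousAt.comp ?_
      exact continuousAt_id.div (continuousAt_const.sub continuousAt_id) (by linarith)
    have := (hc.tendsto.comp h3).comp (tendsto_add_atTop_nat N)
    rw [hvs] at this
    exact this

variable {z : Ω → ℝ} {y : Fin d → Ω → ℝ} {S : ℝ≥0 → Ω → EuclideanSpace ℝ (Fin d)}

lemma Mdl.zS (h : Mdl P F z y S) (l : Fin d) (t : ℝ≥0) : Integrable (fun o => z o * S t o l) P :=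
  (wd_integrable (top_int h.hz) (h.zp.mono fun o h => h.le) _).1 ((mart_comp h.mart l).integrable t)

lemma Mdl.ratio (h : Mdl P F z y S) (l : Fin d) (t : ℝ≥0) : ∀ᵐ o ∂P, (P[y l|F t]) o / (P[z|F t]) o = S t o l := by
  have h1 : (P[fun o => z o * S t o l|F t]) =ᵐ[P] P[y l|F t] := by
    refine ae_eq_condExp_of_forall_setIntegral_eq (F.le t) (top_int (h.hy l)) (fun _ _ _ => integrable_condExp.integrableOn) (fun C hC _ => ?_) stronglyMeasurable_condExp.aestronglyMeasurable
    rw [setIntegral_condExp (F.le t) (h.zS l t) hC, h.ver l t C hC]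
  have h2 : (P[fun o => z o * S t o l|F t]) =ᵐ[P] fun o => (P[z|F t]) o * S t o l :=
    condExp_mul_of_stronglyMeasurable_right ((mart_comp h.mart l).1 t) (h.zS l t) (top_int h.hz)
  filter_upwards [h1, h2, condExp_pos_of (F.le t) (top_int h.hz) h.zp] with o a b c
  rw [← a, b, mul_div_cancel_left₀ _ c.ne']

lemma Mdl.test (h : Mdl P F z y S) {G : Ω → ℝ} (hG : MemLp G ∞ P) (l : Fin d) {t : ℝ≥0}
    (ht : ∀ A, MeasurableSet[F t] A → (∃ c, ∀ o ∈ A, |(P[y l|F t]) o / (P[z|F t]) o| ≤ c) →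
      ∫ o, G o * A.indicator (fun o => y l o - (P[y l|F t]) o / (P[z|F t]) o * z o) o ∂P = 0)
    {A : Set Ω} (hA : MeasurableSet[F t] A) : ∫ o in A, G o * (z o * S t o l) ∂P = ∫ o in A, G o * y l o ∂P := by
  have hb := bdd_of_top hG
  have i1 : Integrable (fun o => G o * (z o * S t o l)) P := (h.zS l t).bdd_mul hG.1 (by simpa using hb)
  have i2 : Integrable (fun o => G o * y l o) P := (top_int (h.hy l)).bdd_mul hG.1 (by simpa using hb)
  set q : Ω → ℝ := fun o => (P[y l|F t]) o / (P[z|F t]) o with hq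
  have hqm : StronglyMeasurable[F t] q := stronglyMeasurable_condExp.div stronglyMeasurable_condExp
  have hqa : ∀ᵐ o ∂P, q o = S t o l := h.ratio l t
  set f : Ω → ℝ := fun o => y l o - q o * z o with hf
  have fe : ∀ᵐ o ∂P, G o * f o = G o * y l o - G o * (z o * S t o l) := hqa.mono fun o h => by
    simp only [hf, h]; ring
  have fi : Integrable (fun o => G o * f o) P := (i2.sub i1).congr (fe.mono fun o h => h.symm)
  set A' : ℕ → Set Ω := fun n => A ∩ {o | |q o| ≤ n} with hA'
  have hAm : ∀ n, MeasurableSet[F t] (A' n) := fun n => hA.inter (hqm.norm.measurable measurableSet_Iic)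
  have h0 : ∀ n, ∫ o in A' n, G o * f o ∂P = 0 := fun n => by
    rw [← integral_indicator (F.le t _ (hAm n)), ← ht (A' n) (hAm n) ⟨n, fun o hω => hω.2⟩]
    refine integral_congr_ae (ae_of_all _ fun o => ?_)
    by_cases hω : o ∈ A' n <;> simp [hω, hf]
  have hmono : Monotone A' := fun a b hab => inter_subset_inter_right _ fun o (hω : |q o| ≤ a) => show |q o| ≤ b from hω.trans (by exact_mod_cast hab)
  have hun : ⋃ n, A' n = A := by
    rw [hA', ← inter_iUnion]
    refine inter_eq_left.2 fun o _ => ?_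
    obtain ⟨n, hn⟩ := exists_nat_ge |q o|
    exact mem_iUnion.2 ⟨n, hn⟩
  have lim := tendsto_setIntegral_of_monotone (fun n => F.le t _ (hAm n)) hmono (f := fun o => G o * f o) (μ := P) fi.integrableOn
  rw [hun] at lim
  simp only [h0] at lim
  have e := tendsto_nhds_unique lim tendsto_const_nhds
  rw [integral_congr_ae (ae_restrict_of_ae fe), integral_sub i2.integrableOn i1.integrableOn] at e
  linarith

theorem loc_of_mart (h : Martingale S F P) : IsLocalMartingale F S P := by
  refine ⟨fun _ _ => ∞, fun _ t => by simp, fun _ => monotone_const, fun _ => by simp, fun _ => ?_⟩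
  have : stoppedAtENN S (fun _ => ∞) = S := by
    ext1 t; ext1 o
    simp [stoppedAtENN]
  rw [this]; exact h

set_option maxHeartbeats 400000 in
theorem Mdl.toUq (h : Mdl P F z y S) (hun : ∀ R : Measure Ω, IsProbabilityMeasure R → (R ≪ P ∧ P ≪ R) → IsLocalMartingale F S R → R = wd P z) :
    Uq P (tc F) z y := by
  intro G0 hG0 hGz0 ht0
  have zi := top_int h.hz
  have zn := h.zp.mono fun o h => h.le
  haveI := wd_prob zi zn h.z1
  have hb0 := bdd_of_top hG0
  obtain ⟨ε, hεp, hεb⟩ : ∃ ε : ℝ, 0 < ε ∧ ε * (eLpNorm G0 ∞ P).toReal ≤ 1/2 := by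
    generalize hbe : (eLpNorm G0 ∞ P).toReal = b
    have hbn : 0 ≤ b := by rw [← hbe]; exact ENNReal.toReal_nonneg
    refine ⟨1 / (2 * (b + 1)), by positivity, ?_⟩
    field_simp; linarith
  set G : Ω → ℝ := fun o => 1 + ε * G0 o with hGd
  have hG : MemLp G ∞ P := by
    have h1 : MemLp (fun _ : Ω => (1:ℝ)) ∞ P := memLp_const 1
    have h2 : MemLp (fun o => ε * G0 o) ∞ P := hG0.const_mul ε
    exact h1.add h2
  have hGb : ∀ᵐ o ∂P, 0 < G o := hb0.mono fun o hω => by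
    have := mul_le_mul_of_nonneg_left (neg_le_of_abs_le hω) hεp.le
    simp only [hGd]; linarith
  set r : Ω → ℝ := fun o => G o * z o with hr
  have rt : MemLp r ∞ P := top_mul hG h.hz
  have ri := top_int rt
  have rp : ∀ᵐ o ∂P, 0 < r o := by filter_upwards [hGb, h.zp] with o a b using mul_pos a b
  have rn := rp.mono fun o h => h.le
  have G0z := top_int (top_mul hG0 h.hz)
  have r1 : ∫ o, r o ∂P = 1 := by
    have : r = fun o => z o + ε * (G0 o * z o) := by ext o; simp only [hr, hGd]; ring
    rw [this, integral_add zi (G0z.const_mul ε), h.z1, integral_const_mul, hGz0, mul_zero, add_zero]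
  haveI := wd_prob ri rn r1
  have tG : ∀ k i, i < 2^k → ∀ l A, MeasurableSet[F (th (gp k i))] A → ∫ o in A, r o * S (th (gp k i)) o l ∂P = ∫ o in A, G o * y l o ∂P := fun k i hi l A hA => by
    have e1 : ∫ o in A, G0 o * (z o * S (th (gp k i)) o l) ∂P = ∫ o in A, G0 o * y l o ∂P := by
      refine h.test hG0 l (fun A hA hc => ?_) hA
      have := ht0 k i hi A (by rw [tc_lt _ (gp_lt hi)]; exact hA) l
      simp only [mp, tc_lt F (gp_lt hi)] at this
      exact this hc
    have i1 : Integrable (fun o => G0 o * (z o * S (th (gp k i)) o l)) P := (h.zS l _).bdd_mul hG0.1 (by simpa using hb0)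
    have i2 : Integrable (fun o => G0 o * y l o) P := top_int (top_mul hG0 (h.hy l))
    have e2 : ∀ o, r o * S (th (gp k i)) o l = z o * S (th (gp k i)) o l + ε * (G0 o * (z o * S (th (gp k i)) o l)) := fun o => by
      simp only [hr, hGd]; ring
    have e3 : ∀ o, G o * y l o = y l o + ε * (G0 o * y l o) := fun o => by simp only [hGd]; ring
    simp only [e2, e3]
    rw [integral_add (h.zS l _).integrableOn (i1.const_mul ε).integrableOn, integral_add (top_int (h.hy l)).integrableOn (i2.const_mul ε).integrableOn,
      integral_const_mul, integral_const_mul, e1, h.ver l _ A hA]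
  have rη : ∀ l, (fun o => r o * (y l o / z o)) =ᵐ[P] fun o => G o * y l o := fun l => h.zp.mono fun o hω => by
    simp only [hr]; field_simp
  have ηi : ∀ l, Integrable (fun o => y l o / z o) (wd P r) := fun l => by
    rw [wd_integrable ri rn]
    exact (top_int (top_mul hG (h.hy l))).congr (rη l).symm
  have Si : ∀ l t, Integrable (fun o => S t o l) (wd P r) := fun l t => by
    rw [wd_integrable ri rn]
    have : Integrable (fun o => G o * (z o * S t o l)) P := (h.zS l _).bdd_mul hG.1 (by simpa using bdd_of_top hG)
    exact this.congr (ae_of_all _ fun o => by simp only [hr]; ring)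
  have cond : ∀ l t, (∀ A, MeasurableSet[F t] A → ∫ o in A, S t o l ∂(wd P r) = ∫ o in A, y l o / z o ∂(wd P r)) →
      (fun o => S t o l) =ᵐ[wd P r] (wd P r)[fun o => y l o / z o|F t] := fun l t hA =>
    ae_eq_condExp_of_forall_setIntegral_eq (F.le t) (ηi l) (fun _ _ _ => (Si l t).integrableOn) (fun A hA' _ => hA A hA') ((mart_comp h.mart l).1 t).aestronglyMeasurable
  have dy : ∀ k i, i < 2^k → ∀ l A, MeasurableSet[F (th (gp k i))] A →
      ∫ o in A, S (th (gp k i)) o l ∂(wd P r) = ∫ o in A, y l o / z o ∂(wd P r) := fun k i hi l A hA => by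
    rw [wd_int ri rn, wd_int ri rn, tG k i hi l A hA, integral_congr_ae (ae_restrict_of_ae (rη l))]
  have gen : ∀ l t, (fun o => S t o l) =ᵐ[wd P r] (wd P r)[fun o => y l o / z o|F t] := fun l t => by
    refine cond l t fun A hA => ?_
    obtain ⟨k, i, hi, hle, hlim⟩ := dy_seq t
    have u := (ui_lim (ηi l) (fun n => F.le (th (gp (k n) (i n)))) (fun n => cond l _ (dy _ _ (hi n) l)) (g := fun o => S t o l)
      (ae_of_all _ fun o => (h.rcl l o t).tendsto.comp (tendsto_nhdsWithin_iff.2 ⟨hlim, Eventually.of_forall hle⟩))).2 A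
    refine tendsto_nhds_unique u ?_
    have : ∀ n, ∫ o in A, S (th (gp (k n) (i n))) o l ∂(wd P r) = ∫ o in A, y l o / z o ∂(wd P r) := fun n =>
      dy _ _ (hi n) l A (F.mono (hle n) _ hA)
    simp only [this]; exact tendsto_const_nhds
  have mart : Martingale S F (wd P r) := by
    refine mart_of_comp h.mart.1 (fun t => ?_) fun l => ?_
    · exact Integrable.of_eval_piLp fun l => Si l t
    · refine ⟨(mart_comp h.mart l).1, fun s t hst => ?_⟩
      refine (condExp_congr_ae (gen l t)).trans ?_
      refine (condExp_condExp_of_le (F.mono hst) (F.le t)).trans (gen l s).symm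
  have eqm := hun (wd P r) inferInstance ⟨wd_ac P r, wd_ac' ri rp⟩ (loc_of_mart mart)
  have rz : r =ᵐ[P] z := by
    refine ri.ae_eq_of_forall_setIntegral_eq _ _ zi fun C _ _ => ?_
    rw [← wd_real ri rn, ← wd_real zi zn, eqm]
  filter_upwards [rz, h.zp] with o a b
  have : ε * G0 o * z o = 0 := by
    simp only [hr, hGd] at a; linarith
  simpa [hεp.ne', b.ne'] using this

end PartTwentySeven

section PartTwentyNine
variable {Ω : Type*} {m : MeasurableSpace Ω} {P : Measure Ω} [IsProbabilityMeasure P]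

lemma dom1 {b : ℕ → Lp ℝ 1 P} (hb : Summable fun n => ‖b n‖) : ∃ H : Lp ℝ 1 P, ∀ n, |b n| ≤ H := by
  have hs : Summable fun n => |b n| := Summable.of_norm (by simpa [norm_abs_eq_norm] using hb)
  exact ⟨∑' n, |b n|, fun n => hs.le_tsum n fun _ _ => abs_nonneg _⟩

lemma abs_ae {a H : Lp ℝ 1 P} (h : |a| ≤ H) : ∀ᵐ o ∂P, |a o| ≤ H o := by
  filter_upwards [Lp.coeFn_abs a, (Lp.coeFn_le _ _).2 h] with o h1 h2
  rw [← h1]; exact h2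

lemma dom2 {ι : Type*} [Countable ι] (H : ι → Lp ℝ 1 P) : ∃ g : Lp ℝ 1 P, ∀ i, ∃ C, 0 ≤ C ∧ ∀ᵐ o ∂P, |H i o| ≤ C * |g o| := by
  rcases isEmpty_or_nonempty ι with h | h
  · exact ⟨0, fun i => h.elim i⟩
  obtain ⟨e, he⟩ := exists_surjective_nat ι
  set k : ℕ → ℝ := fun n => (1/2)^n * (1 + ‖H (e n)‖)⁻¹ with hk
  have kp : ∀ n, 0 < k n := fun n => by positivity
  obtain ⟨g, hg⟩ := dom1 (b := fun n => k n • H (e n)) (P := P) (by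
    refine Summable.of_nonneg_of_le (fun n => norm_nonneg _) (fun n => ?_) (summable_geometric_of_lt_one (by norm_num) (by norm_num : (1/2:ℝ) < 1))
    rw [norm_smul, Real.norm_of_nonneg (kp n).le, hk, mul_assoc]
    refine mul_le_of_le_one_right (by positivity) ?_
    rw [inv_mul_le_iff₀ (by positivity)]; linarith)
  refine ⟨g, fun i => ?_⟩
  obtain ⟨n, rfl⟩ := he i
  refine ⟨(k n)⁻¹, (inv_pos.2 (kp n)).le, ?_⟩
  filter_upwards [abs_ae (hg n), Lp.coeFn_smul (k n) (H (e n))] with o h1 h2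
  rw [h2, Pi.smul_apply, smul_eq_mul, abs_mul, abs_of_pos (kp n)] at h1
  rw [le_inv_mul_iff₀ (kp n)]; exact h1.trans (le_abs_self _)

/-- division by the dominating density, as an essentially bounded class -/
def Td (P : Measure Ω) (w : Ω → ℝ) (f : Lp ℝ 1 P) : Lp ℝ ∞ (wd P w) :=
  open Classical in if h : MemLp (fun o => f o / w o) ∞ (wd P w) then h.toLp else 0

lemma Td_ae {w : Ω → ℝ} (hw : Measurable w) (wi : Integrable w P) (wp : ∀ o, 0 < w o) {f : Lp ℝ 1 P} {C : ℝ} (hf : ∀ᵐ o ∂P, |f o| ≤ C * w o) :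
    ∀ᵐ o ∂P, Td P w f o = f o / w o := by
  have h : MemLp (fun o => f o / w o) ∞ (wd P w) := by
    refine memLp_top_of_bound (((Lp.stronglyMeasurable f).measurable.div hw).aestronglyMeasurable) C ?_
    refine (wd_ac P w).ae_le ?_
    filter_upwards [hf] with o h
    rw [Real.norm_eq_abs, abs_div, abs_of_pos (wp o), div_le_iff₀ (wp o)]; exact h
  refine (wd_ac' wi (ae_of_all _ wp)).ae_le ?_
  rw [Td, dif_pos h]; exact h.coeFn_toLp

lemma Td_norm {w : Ω → ℝ} (hw : Measurable w) (wi : Integrable w P) (wp : ∀ o, 0 < w o) (w1 : ∫ o, w o ∂P = 1) {f : Lp ℝ 1 P} {C : ℝ} (hC : 0 ≤ C) (hf : ∀ᵐ o ∂P, |f o| ≤ C * w o) :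
    ‖Td P w f‖ ≤ C := by
  haveI := wd_prob wi (ae_of_all _ fun o => (wp o).le) w1
  have := Lp.norm_le_of_ae_bound (f := Td P w f) hC ((wd_ac P w).ae_le (by
    filter_upwards [Td_ae hw wi wp hf, hf] with o h1 h2
    rw [h1, Real.norm_eq_abs, abs_div, abs_of_pos (wp o), div_le_iff₀ (wp o)]; exact h2))
  simpa using this

lemma Td_series {w : Ω → ℝ} (hw : Measurable w) (wi : Integrable w P) (wp : ∀ o, 0 < w o) (w1 : ∫ o, w o ∂P = 1)
    {φ : ℝ → Lp ℝ 1 P} {y ρ : ℝ} (hρ : 0 < ρ) {a : ℕ → Lp ℝ 1 P} (ha : Summable fun n => ‖a n‖ * ρ^n)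
    (hs : ∀ x, |x - y| < ρ → HasSum (fun n => (x - y)^n • a n) (φ x)) {C : ℝ} (hC : 0 ≤ C) (hd : ∀ n, ∀ᵐ o ∂P, |a n o| ≤ C / ρ^n * w o) {x : ℝ} (hx : |x - y| < ρ) :
    (HasSum (fun n => (x - y)^n • Td P w (a n)) (Td P w (φ x))) ∧ ∀ᵐ o ∂P, Td P w (φ x) o = φ x o / w o := by
  haveI := wd_prob wi (ae_of_all _ fun o => (wp o).le) w1
  have ac := wd_ac P w
  have ac' := wd_ac' wi (ae_of_all _ wp)
  have s1 : Summable fun n => ‖(x - y)^n • a n‖ := by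
    refine Summable.of_nonneg_of_le (fun n => norm_nonneg _) (fun n => ?_) ha
    rw [norm_smul, norm_pow, Real.norm_eq_abs, mul_comm]
    exact mul_le_mul_of_nonneg_left (pow_le_pow_left₀ (abs_nonneg _) hx.le n) (norm_nonneg _)
  have s2 : Summable fun n => ‖(x - y)^n • Td P w (a n)‖ := by
    refine Summable.of_nonneg_of_le (fun n => norm_nonneg _) (fun n => ?_) ((summable_geometric_of_lt_one (r := |x-y|/ρ) (by positivity) ((div_lt_one hρ).2 hx)).mul_left C)
    rw [norm_smul, norm_pow, Real.norm_eq_abs, div_pow]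
    calc _ ≤ |x-y|^n * (C / ρ^n) := mul_le_mul_of_nonneg_left (Td_norm hw wi wp w1 (by positivity) (hd n)) (by positivity)
      _ = _ := by ring
  obtain ⟨s, hss⟩ : Summable fun n => (x - y)^n • Td P w (a n) := Summable.of_norm s2
  have e : ∀ᵐ o ∂P, s o = φ x o / w o := by
    have c1 : ∀ᵐ o ∂P, ∀ n, ((x - y)^n • Td P w (a n) : Lp ℝ ∞ (wd P w)) o = (x-y)^n * Td P w (a n) o := ae_all_iff.2 fun n => by
      refine ac'.ae_le ?_
      filter_upwards [Lp.coeFn_smul ((x-y)^n) (Td P w (a n))] with o h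
      rw [h]; rfl
    have c2 : ∀ᵐ o ∂P, ∀ n, ((x - y)^n • (a n) : Lp ℝ 1 P) o = (x-y)^n * (a n) o := ae_all_iff.2 fun n => by
      filter_upwards [Lp.coeFn_smul ((x-y)^n) (a n)] with o h
      rw [h]; rfl
    filter_upwards [ae_hasSum s1 (hs x hx), ac'.ae_le (ae_hasSum s2 hss), c1, c2, ae_all_iff.2 fun n => Td_ae hw wi wp (hd n)] with o h1 h2 h3 h4 h5
    simp only [h3, h5] at h2
    simp only [h4] at h1
    have h6 := h1.div_const (w o)
    simp only [mul_div_assoc] at h6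
    exact h2.unique h6
  have e' : s = Td P w (φ x) := by
    have h : MemLp (fun o => φ x o / w o) ∞ (wd P w) := (memLp_congr_ae (ac.ae_le e)).1 (Lp.memLp s)
    rw [Td, dif_pos h]
    refine Lp.ext ?_
    filter_upwards [ac.ae_le e, h.coeFn_toLp] with o h1 h2
    rw [h1, h2]
  rw [← e']
  exact ⟨hss, e⟩

lemma an_ball {E : Type*} [NormedAddCommGroup E] [NormedSpace ℝ E] [CompleteSpace E] {f : ℝ → E} {b : ℕ → E} {y ρ C : ℝ} (hρ : 0 < ρ)
    (hb : ∀ n, ‖b n‖ ≤ C / ρ^n) (hs : ∀ x, |x - y| < ρ → HasSum (fun n => (x - y)^n • b n) (f x)) {x : ℝ} (hx : |x - y| < ρ) : AnalyticAt ℝ f x := by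
  set p : FormalMultilinearSeries ℝ ℝ E := fun n => ContinuousMultilinearMap.mkPiRing ℝ (Fin n) (b n) with hp
  have : HasFPowerSeriesOnBall f p y (ENNReal.ofReal ρ) := by
    refine ⟨?_, by simpa using hρ, fun {v} hv => ?_⟩
    · have := p.le_radius_of_bound (r := ⟨ρ, hρ.le⟩) C fun n => by
        rw [hp, ContinuousMultilinearMap.norm_mkPiRing]
        exact (le_div_iff₀ (by positivity)).1 (hb n)
      rw [ENNReal.ofReal, Real.toNNReal_of_nonneg hρ.le]; exact this
    · have hv' : |v| < ρ := by
        rw [Metric.mem_eball, edist_zero_right, ← ofReal_norm_eq_enorm, ENNReal.ofReal_lt_ofReal_iff hρ] at hv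
        exact hv
      have := hs (y + v) (by simpa using hv')
      simpa [hp] using this
  refine this.analyticAt_of_mem ?_
  rw [Metric.mem_eball, edist_dist, ENNReal.ofReal_lt_ofReal_iff hρ]; exact hx

theorem normalize {κ : Type*} [Fintype κ] (φ : κ → ℝ → Lp ℝ 1 P) {U : Set ℝ} (hU : IsOpen U) {x₀ : ℝ} (hx₀ : x₀ ∈ closure U)
    (hc : ∀ i, ContinuousOn (φ i) (U ∪ {x₀})) (ha : ∀ i, AnalyticOnNhd ℝ (φ i) U) :
    ∃ w : Ω → ℝ, Integrable w P ∧ (∀ o, 0 < w o) ∧ ∫ o, w o ∂P = 1 ∧ ∃ xs : ℕ → ℝ, (∀ n, xs n ∈ U) ∧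
      (∀ i, Tendsto (fun n => φ i (xs n)) atTop (𝓝 (φ i x₀))) ∧
      (∀ i, ∀ x ∈ U ∪ {x₀}, ∀ᵐ o ∂P, Td P w (φ i x) o = φ i x o / w o) ∧
      (∀ i, AnalyticOnNhd ℝ (fun x => Td P w (φ i x)) U) ∧
      ∀ i, Tendsto (fun n => Td P w (φ i (xs n))) atTop (𝓝 (Td P w (φ i x₀))) := by
  haveI : (𝓝[U] x₀).NeBot := mem_closure_iff_nhdsWithin_neBot.1 hx₀
  have hxs : ∀ n : ℕ, ∃ x ∈ U, ∀ i, ‖φ i x - φ i x₀‖ < (1/4)^n := fun n => by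
    have h1 : ∀ᶠ x in 𝓝[U] x₀, ∀ i, ‖φ i x - φ i x₀‖ < (1/4)^n := eventually_all.2 fun i => by
      have h2 : Tendsto (φ i) (𝓝[U] x₀) (𝓝 (φ i x₀)) := ((hc i) x₀ (by simp)).mono_left (nhdsWithin_mono _ subset_union_left)
      have := (Metric.tendsto_nhds.1 h2) ((1/4)^n) (by positivity)
      simpa [dist_eq_norm] using this
    obtain ⟨x, hx⟩ := (h1.and self_mem_nhdsWithin).exists
    exact ⟨x, hx.2, hx.1⟩
  choose xs hxU hxn using hxs
  have hlim : ∀ i, Tendsto (fun n => φ i (xs n)) atTop (𝓝 (φ i x₀)) := fun i => by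
    rw [tendsto_iff_norm_sub_tendsto_zero]
    exact squeeze_zero (fun n => norm_nonneg _) (fun n => (hxn n i).le) (tendsto_pow_atTop_nhds_zero_of_lt_one (by norm_num) (by norm_num))
  have hloc : ∀ (i : κ) (y : U), ∃ (ρ : ℝ) (a : ℕ → Lp ℝ 1 P), 0 < ρ ∧ (Summable fun n => ‖a n‖ * ρ ^ n) ∧
      ∀ x : ℝ, |x - (y:ℝ)| < ρ → HasSum (fun n => (x - (y:ℝ)) ^ n • a n) (φ i x) := fun i y => local_series (ha i y y.2)
  choose ρ a hρ hsm hsum using hloc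
  have hH : ∀ (i : κ) (y : U), ∃ H : Lp ℝ 1 P, ∀ n, |(ρ i y)^n • a i y n| ≤ H := fun i y => dom1 (by
    refine (hsm i y).congr fun n => ?_
    rw [norm_smul, norm_pow, Real.norm_of_nonneg (hρ i y).le, mul_comm])
  choose H hH using hH
  have hK : ∀ i : κ, ∃ K : Lp ℝ 1 P, ∀ n, |(2:ℝ)^n • (φ i (xs n) - φ i x₀)| ≤ K := fun i => dom1 (by
    refine Summable.of_nonneg_of_le (fun n => norm_nonneg _) (fun n => ?_) (summable_geometric_of_lt_one (by norm_num) (by norm_num : (1/2:ℝ) < 1))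
    rw [norm_smul, norm_pow, Real.norm_of_nonneg zero_le_two]
    calc (2:ℝ)^n * _ ≤ 2^n * (1/4)^n := mul_le_mul_of_nonneg_left (hxn n i).le (by positivity)
      _ = _ := by rw [← mul_pow]; norm_num)
  choose K hK using hK
  have hcov : ∀ i : κ, ∃ t : Set U, t.Countable ∧ ∀ x : U, ∃ y ∈ t, |(x:ℝ) - y| < ρ i y := fun i => by
    obtain ⟨t, ht, hun⟩ := TopologicalSpace.countable_cover_nhds (f := fun y : U => {x : U | |(x:ℝ) - y| < ρ i y}) fun y => by
      refine IsOpen.mem_nhds ?_ (by simpa using hρ i y)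
      exact isOpen_lt (by fun_prop) continuous_const
    refine ⟨t, ht, fun x => ?_⟩
    have := hun.symm ▸ mem_univ x
    simpa using this
  choose t ht hcov using hcov
  haveI : ∀ i, Countable (t i) := fun i => (ht i).to_subtype
  obtain ⟨g, hg⟩ := dom2 (P := P) (ι := (Σ i, t i) ⊕ κ ⊕ κ) (fun j => match j with
    | .inl j => H j.1 j.2.1
    | .inr (.inl i) => K i
    | .inr (.inr i) => φ i x₀)
  set g1 : Ω → ℝ := fun o => 1 + |g o| with hg1
  have g1i : Integrable g1 P := (integrable_const 1).add (L1.integrable_coeFn g).abs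
  have g1p : ∀ o, 0 < g1 o := fun o => by have := abs_nonneg (g o); simp only [hg1]; linarith
  set c := ∫ o, g1 o ∂P with hcd
  have cp : 0 < c := by
    have : ∫ o, (1:ℝ) ∂P ≤ c := integral_mono (integrable_const 1) g1i fun o => by have := abs_nonneg (g o); simp only [hg1]; linarith
    simp at this; linarith
  set w : Ω → ℝ := fun o => g1 o / c with hw
  have wm : Measurable w := ((measurable_const.add (Lp.stronglyMeasurable g).measurable.norm)).div_const c
  have wi : Integrable w P := g1i.div_const c
  have wp : ∀ o, 0 < w o := fun o => div_pos (g1p o) cp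
  have w1 : ∫ o, w o ∂P = 1 := by rw [hw, integral_div, ← hcd, div_self cp.ne']
  have hgw : ∀ o, |g o| ≤ c * w o := fun o => by
    simp only [hw, hg1]; rw [mul_div_cancel₀ _ cp.ne']; linarith
  have hdom : ∀ {f : Lp ℝ 1 P}, (∃ C, 0 ≤ C ∧ ∀ᵐ o ∂P, |f o| ≤ C * |g o|) → ∃ C, 0 ≤ C ∧ ∀ᵐ o ∂P, |f o| ≤ C * w o := by
    rintro f ⟨C, hC, h⟩
    refine ⟨C * c, by positivity, h.mono fun o hω => hω.trans ?_⟩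
    rw [mul_assoc]; exact mul_le_mul_of_nonneg_left (hgw o) hC
  have d1 : ∀ i (y : t i), ∃ C, 0 ≤ C ∧ ∀ n, ∀ᵐ o ∂P, |a i y n o| ≤ C / (ρ i y)^n * w o := fun i y => by
    obtain ⟨C, hC, h⟩ := hdom (hg (.inl ⟨i, y⟩))
    refine ⟨C, hC, fun n => ?_⟩
    have := hρ i y
    filter_upwards [h, abs_ae (hH i y n), Lp.coeFn_smul ((ρ i y)^n) (a i y n)] with o h1 h2 h3
    rw [h3, Pi.smul_apply, smul_eq_mul, abs_mul, abs_of_pos (by positivity)] at h2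
    rw [div_mul_eq_mul_div, le_div_iff₀ (by positivity), mul_comm]
    exact h2.trans ((le_abs_self _).trans h1)
  have ser : ∀ i (x : ℝ), x ∈ U → AnalyticAt ℝ (fun x => Td P w (φ i x)) x ∧ ∀ᵐ o ∂P, Td P w (φ i x) o = φ i x o / w o := fun i x hx => by
    obtain ⟨y, hy, hxy⟩ := hcov i ⟨x, hx⟩
    obtain ⟨C, hC, hd⟩ := d1 i ⟨y, hy⟩
    have hT := fun (x' : ℝ) (hx' : |x' - (y:ℝ)| < ρ i y) => Td_series wm wi wp w1 (hρ i y) (hsm i y) (hsum i y) hC hd hx'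
    refine ⟨an_ball (hρ i y) (fun n => Td_norm wm wi wp w1 (div_nonneg hC (pow_nonneg (hρ i y).le n)) (hd n)) (fun x' hx' => (hT x' hx').1) hxy, (hT x hxy).2⟩
  have t0 : ∀ i, ∀ᵐ o ∂P, Td P w (φ i x₀) o = φ i x₀ o / w o := fun i => by
    obtain ⟨C, hC, h⟩ := hdom (hg (.inr (.inr i)))
    exact Td_ae wm wi wp h
  refine ⟨w, wi, wp, w1, xs, hxU, hlim, fun i x hx => ?_, fun i x hx => (ser i x hx).1, fun i => ?_⟩
  · rcases hx with hx | rfl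
    · exact (ser i x hx).2
    · exact t0 i
  · obtain ⟨C, hC, h⟩ := hdom (hg (.inr (.inl i)))
    haveI := wd_prob wi (ae_of_all _ fun o => (wp o).le) w1
    rw [tendsto_iff_norm_sub_tendsto_zero]
    refine squeeze_zero (fun n => norm_nonneg _) (g := fun n => C * (1/2)^n) (fun n => ?_) ?_
    · have := Lp.norm_le_of_ae_bound (f := Td P w (φ i (xs n)) - Td P w (φ i x₀)) (C := C * (1/2)^n) (by positivity) ((wd_ac P w).ae_le (by
        filter_upwards [(ser i _ (hxU n)).2, t0 i, (wd_ac' wi (ae_of_all _ wp)).ae_le (Lp.coeFn_sub (Td P w (φ i (xs n))) (Td P w (φ i x₀))),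
          h, abs_ae (hK i n), Lp.coeFn_smul ((2:ℝ)^n) (φ i (xs n) - φ i x₀), Lp.coeFn_sub (φ i (xs n)) (φ i x₀)] with o h1 h2 h3 h4 h5 h6 h7
        rw [h6, Pi.smul_apply, h7, Pi.sub_apply, smul_eq_mul, abs_mul, abs_of_pos (by positivity)] at h5
        rw [h3, Pi.sub_apply, h1, h2, ← sub_div, Real.norm_eq_abs, abs_div, abs_of_pos (wp o), div_le_iff₀ (wp o)]
        have h8 := h5.trans ((le_abs_self _).trans h4)
        rw [one_div, inv_pow, mul_right_comm, ← div_eq_mul_inv, le_div_iff₀ (by positivity), mul_comm]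
        exact h8))
      simpa using this
    · simpa using (tendsto_pow_atTop_nhds_zero_of_lt_one (by norm_num) (by norm_num : (1/2:ℝ) < 1)).const_mul C

end PartTwentyNine

section PartThirty
variable {Ω : Type*} {m : MeasurableSpace Ω} {P : Measure Ω} [IsProbabilityMeasure P]
variable {F : Filtration ℝ≥0 m} {d : ℕ}

lemma wd_wd {w z v : Ω → ℝ} (wi : Integrable w P) (wp : ∀ o, 0 < w o) (hz : AEMeasurable z P) (hv : ∀ᵐ o ∂P, w o * z o = v o) : wd (wd P w) z = wd P v := by
  rw [wd, wd, ← withDensity_mul₀ wi.1.aemeasurable.ennreal_ofReal hz.ennreal_ofReal]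
  refine withDensity_congr_ae ?_
  filter_upwards [hv] with o h
  rw [Pi.mul_apply, ← ENNReal.ofReal_mul (wp o).le, h]

theorem mk_mdl {w : Ω → ℝ} (wi : Integrable w P) (wp : ∀ o, 0 < w o) (w1 : ∫ o, w o ∂P = 1)
    {f : Lp ℝ 1 P} {v : Lp (EuclideanSpace ℝ (Fin d)) 1 P} (fp : ∀ᵐ o ∂P, 0 < f o)
    {Z : Lp ℝ ∞ (wd P w)} {Y : Fin d → Lp ℝ ∞ (wd P w)}
    (hZ : ∀ᵐ o ∂P, Z o = (∫ ω', f ω' ∂P)⁻¹ * (f o / w o)) (hY : ∀ l, ∀ᵐ o ∂P, Y l o = (∫ ω', f ω' ∂P)⁻¹ * (v o l / w o))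
    {Q : Measure Ω} (hQ : Q = P.withDensity (fun o => ENNReal.ofReal (f o / ∫ ω', f ω' ∂P)))
    {S : ℝ≥0 → Ω → EuclideanSpace ℝ (Fin d)} (hrc : ∀ o, ∀ t : ℝ≥0, ContinuousWithinAt (fun s => S s o) (Ici t) t)
    (hver : ∀ t : ℝ≥0, S t =ᵐ[Q] Q[fun o => (f o)⁻¹ • v o | F t]) (hmart : Martingale S F Q)
    (htriv : ∀ s : Set Ω, MeasurableSet[F 0] s → P s = 0 ∨ P s = 1)
    (hgen : (⨆ t : ℝ≥0, (F t : MeasurableSpace Ω)) = m) :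
    Q = wd (wd P w) Z ∧ IsProbabilityMeasure Q ∧ Mdl (wd P w) F Z (fun l => Y l) S := by
  have wn : ∀ᵐ o ∂P, 0 ≤ w o := ae_of_all _ fun o => (wp o).le
  haveI := wd_prob wi wn w1
  have ac := wd_ac P w
  have ac' := wd_ac' wi (ae_of_all _ wp)
  have fi := L1.integrable_coeFn f
  have vi := L1.integrable_coeFn v
  have ep : 0 < ∫ o, f o ∂P := by
    rw [integral_pos_iff_support_of_nonneg_ae (fp.mono fun o h => h.le) fi]
    have : Function.support f =ᵐ[P] (univ : Set Ω) := by
      filter_upwards [fp] with o h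
      exact eq_true (show o ∈ Function.support f from h.ne')
    rw [measure_congr this]; simp
  set e := ∫ o, f o ∂P with he
  set z : Ω → ℝ := fun o => f o / e with hz
  have zi : Integrable z P := fi.div_const e
  have zp : ∀ᵐ o ∂P, 0 < z o := fp.mono fun o h => div_pos h ep
  have zn := zp.mono fun o h => h.le
  have z1 : ∫ o, z o ∂P = 1 := by rw [hz, integral_div, ← he, div_self ep.ne']
  have wZ : ∀ᵐ o ∂P, w o * Z o = z o := hZ.mono fun o h => by
    rw [h]; have := (wp o).ne'; simp only [hz]; field_simp
  have hQ' : Q = wd P z := hQ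
  haveI := wd_prob zi zn z1
  have ZP : AEMeasurable Z P := (Lp.stronglyMeasurable Z).measurable.aemeasurable
  have hQZ : wd (wd P w) Z = wd P z := wd_wd wi wp ZP wZ
  have Zp : ∀ᵐ o ∂(wd P w), 0 < Z o := ac.ae_le (by
    filter_upwards [wZ, zp] with o h1 h2
    rw [← h1] at h2; exact pos_of_mul_pos_right h2 (wp o).le)
  have ηi : Integrable (fun o => (f o)⁻¹ • v o) (wd P z) := by
    refine Integrable.of_eval_piLp fun l => ?_
    rw [wd_integrable zi zn]
    have : Integrable (fun o => v o l / e) P := (((EuclideanSpace.proj l : EuclideanSpace ℝ (Fin d) →L[ℝ] ℝ).integrable_comp vi)).div_const e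
    refine this.congr (fp.mono fun o h => ?_)
    simp only [hz, PiLp.smul_apply, smul_eq_mul]; field_simp
  refine ⟨hQ'.trans hQZ.symm, hQ' ▸ inferInstance, ⟨Lp.memLp Z, fun l => Lp.memLp (Y l), Zp, ?_, ?_, hrc, fun l t C hC => ?_, fun C hC => ?_, hgen⟩⟩
  · rw [wd_int' wi wn, integral_congr_ae wZ, z1]
  · rw [hQZ, ← hQ']; exact hmart
  · have hCm := F.le t C hC
    have s1 : ∫ o in C, S t o ∂(wd P z) = ∫ o in C, (f o)⁻¹ • v o ∂(wd P z) := by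
      have := hver t
      rw [hQ'] at this
      rw [integral_congr_ae (ae_restrict_of_ae this), setIntegral_condExp (F.le t) ηi hC]
    have Si : Integrable (S t) (wd P z) := hQ' ▸ hmart.integrable t
    have s2 : ∫ o in C, S t o l ∂(wd P z) = ∫ o in C, ((f o)⁻¹ • v o) l ∂(wd P z) := by
      have a1 := (EuclideanSpace.proj l : EuclideanSpace ℝ (Fin d) →L[ℝ] ℝ).integral_comp_comm (Si.integrableOn (s := C))
      have a2 := (EuclideanSpace.proj l : EuclideanSpace ℝ (Fin d) →L[ℝ] ℝ).integral_comp_comm (ηi.integrableOn (s := C))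
      simp only [PiLp.proj_apply] at a1 a2
      rw [a1, a2, s1]
    rw [← wd_int (top_int (Lp.memLp Z)) (Zp.mono fun o h => h.le), hQZ, s2, wd_int zi zn, wd_int wi wn]
    refine integral_congr_ae (ae_restrict_of_ae ?_)
    filter_upwards [fp, hY l] with o h1 h2
    rw [h2]
    have := (wp o).ne'
    simp only [hz, PiLp.smul_apply, smul_eq_mul]; field_simp
  · rcases htriv C hC with h | h
    · exact Or.inl (ac h)
    · have h' : P Cᶜ = 0 := (prob_compl_eq_zero_iff (F.le 0 C hC)).2 h
      exact Or.inr ((prob_compl_eq_zero_iff (F.le 0 C hC)).1 (ac h'))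

end PartThirty

end AF

theorem analytic_field_MRP_countable
    {Ω : Type*} {m : MeasurableSpace Ω} {P : Measure Ω} [IsProbabilityMeasure P]
    (F : Filtration ℝ≥0 m)
    -- usual conditions: right-continuity and completeness of the filtration
    (hright : ∀ t : ℝ≥0, (F t : MeasurableSpace Ω) = ⨅ (s : ℝ≥0) (_ : t < s), F s)
    (hcomplete : ∀ s : Set Ω, MeasurableSet[m] s → P s = 0 → MeasurableSet[F 0] s)
    -- `F 0` is `P`-trivial and `F = ⋁ t, F t`
    (htrivial : ∀ s : Set Ω, MeasurableSet[F 0] s → P s = 0 ∨ P s = 1)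
    (hgen : (⨆ t : ℝ≥0, (F t : MeasurableSpace Ω)) = m)
    {d : ℕ}
    -- `U` is an open interval in `ℝ`
    (U : Set ℝ) (hUopen : IsOpen U) (hUinterval : U.OrdConnected) (hUne : U.Nonempty)
    (x₀ : ℝ) (hx₀ : x₀ ∈ closure U)
    -- the fields `x ↦ ζ(x)` and `x ↦ ξ(x)`, continuous on `U ∪ {x₀}` and analytic on `U`
    (ζ : ℝ → Lp ℝ 1 P)
    (ξ : ℝ → Lp (EuclideanSpace ℝ (Fin d)) 1 P)
    (hζcont : ContinuousOn ζ (U ∪ {x₀})) (hξcont : ContinuousOn ξ (U ∪ {x₀}))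
    (hζanal : AnalyticOnNhd ℝ ζ U) (hξanal : AnalyticOnNhd ℝ ξ U)
    (hζpos : ∀ x ∈ U ∪ {x₀}, ∀ᵐ ω ∂P, 0 < (ζ x : Ω → ℝ) ω)
    -- the probability measures `Q(x)` with `dQ(x)/dP = ζ(x) / E_P[ζ(x)]`
    (Q : ℝ → Measure Ω)
    (hQ : ∀ x ∈ U ∪ {x₀}, Q x =
      P.withDensity (fun ω => ENNReal.ofReal ((ζ x : Ω → ℝ) ω / ∫ ω', (ζ x : Ω → ℝ) ω' ∂P)))
    -- `S(x)`: a right-continuous adapted version of the `Q(x)`-martingale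
    -- `t ↦ E_{Q(x)}[ξ(x)/ζ(x) | F t]`
    (S : ℝ → ℝ≥0 → Ω → EuclideanSpace ℝ (Fin d))
    (hSadapted : ∀ x ∈ U ∪ {x₀}, Adapted F (S x))
    (hSrc : ∀ x ∈ U ∪ {x₀}, ∀ ω, ∀ t : ℝ≥0,
      ContinuousWithinAt (fun s => S x s ω) (Ici t) t)
    (hSver : ∀ x ∈ U ∪ {x₀}, ∀ t : ℝ≥0, S x t =ᵐ[Q x]
      (Q x)[fun ω => ((ζ x : Ω → ℝ) ω)⁻¹ • (ξ x : Ω → EuclideanSpace ℝ (Fin d)) ω | F t])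
    (hSmart : ∀ x ∈ U ∪ {x₀}, Martingale (S x) F (Q x))
    -- `S(x₀)` has the MRP
    (hx₀MRP : HasMRP F (S x₀) P (Q x₀)) :
    {x ∈ U | ¬ HasMRP F (S x) P (Q x)}.Countable := by
  classical
  have hmem : ∀ x ∈ U, x ∈ U ∪ {x₀} := fun x hx => Or.inl hx
  set L : Fin d → (Lp (EuclideanSpace ℝ (Fin d)) 1 P →L[ℝ] Lp ℝ 1 P) := fun l =>
    (EuclideanSpace.proj l : EuclideanSpace ℝ (Fin d) →L[ℝ] ℝ).compLpL 1 P with hL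
  have hLae : ∀ l v, ∀ᵐ ω ∂P, L l v ω = (v : Ω → EuclideanSpace ℝ (Fin d)) ω l := fun l v =>
    (EuclideanSpace.proj l : EuclideanSpace ℝ (Fin d) →L[ℝ] ℝ).coeFn_compLpL v
  set φ : Option (Fin d) → ℝ → Lp ℝ 1 P := fun i x => match i with
    | none => ζ x
    | some l => L l (ξ x) with hφ
  obtain ⟨w, wi, wp, w1, xs, hxs, hlim, hae, han, hT⟩ := AF.normalize φ hUopen hx₀
    (fun i => match i with
      | none => hζcont
      | some l => (L l).continuous.comp_continuousOn hξcont)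
    (fun i => match i with
      | none => hζanal
      | some l => fun x hx => ((L l).analyticAt (ξ x)).comp (hξanal x hx))
  haveI := AF.wd_prob wi (ae_of_all _ fun ω => (wp ω).le) w1
  have ac := AF.wd_ac P w
  have ac' := AF.wd_ac' wi (ae_of_all _ wp)
  set e : ℝ → ℝ := fun x => ∫ ω, (ζ x : Ω → ℝ) ω ∂P with he
  have he' : ∀ x, e x = (L1.integralCLM (ζ x) : ℝ) := fun x => by
    rw [he]; dsimp only; rw [← L1.integral_eq_integral, L1.integral_eq]
  have ep : ∀ x ∈ U ∪ {x₀}, e x ≠ 0 := fun x hx => by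
    have fp := hζpos x hx
    refine ne_of_gt ?_
    rw [he]; dsimp only
    rw [integral_pos_iff_support_of_nonneg_ae (fp.mono fun ω h => h.le) (L1.integrable_coeFn _)]
    have : Function.support (ζ x : Ω → ℝ) =ᵐ[P] (univ : Set Ω) := by
      filter_upwards [fp] with ω h
      exact eq_true (show ω ∈ Function.support (ζ x : Ω → ℝ) from h.ne')
    rw [measure_congr this]; simp
  have ea : AnalyticOnNhd ℝ e U := fun x hx => by
    have : e = fun x => (L1.integralCLM (ζ x) : ℝ) := funext he'
    rw [this]
    exact ((L1.integralCLM (α := Ω) (E := ℝ) (μ := P)).analyticAt (ζ x)).comp (hζanal x hx)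
  have el : Tendsto (fun n => e (xs n)) atTop (nhds (e x₀)) := by
    simp only [he']
    exact ((L1.integralCLM (α := Ω) (E := ℝ) (μ := P)).continuous.tendsto _).comp (hlim none)
  set T : Option (Fin d) → ℝ → Lp ℝ ∞ (AF.wd P w) := fun i x => (e x)⁻¹ • AF.Td P w (φ i x) with hTd
  have Ta : ∀ i, AnalyticOnNhd ℝ (T i) U := fun i x hx => ((ea x hx).inv (ep x (hmem x hx))).smul (han i x hx)
  have Tl : ∀ i, Tendsto (fun n => T i (xs n)) atTop (nhds (T i x₀)) := fun i =>
    (el.inv₀ (ep x₀ (by simp))).smul (hT i)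
  have Tae : ∀ i, ∀ x ∈ U ∪ {x₀}, ∀ᵐ ω ∂P, T i x ω = (e x)⁻¹ * (φ i x ω / w ω) := fun i x hx => by
    filter_upwards [hae i x hx, ac'.ae_le (Lp.coeFn_smul (e x)⁻¹ (AF.Td P w (φ i x)))] with ω h1 h2
    rw [hTd]; dsimp only
    rw [h2, Pi.smul_apply, h1, smul_eq_mul]
  have mdl := fun x (hx : x ∈ U ∪ {x₀}) => AF.mk_mdl (F := F) wi wp w1 (hζpos x hx) (Z := T none x) (Y := fun l => T (some l) x)
    (Tae none x hx) (fun l => by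
      filter_upwards [Tae (some l) x hx, hLae l (ξ x)] with ω h1 h2
      rw [h1, ← h2]) (hQ x hx) (hSrc x hx) (hSver x hx) (hSmart x hx) htrivial hgen
  have hx₀' : x₀ ∈ U ∪ {x₀} := by simp
  have G0 : AF.Gd (AF.wd P w) (AF.tc F) (T none x₀) (fun l => T (some l) x₀) := by
    obtain ⟨hq, _, M⟩ := mdl x₀ hx₀'
    refine AF.Gd_of_Uq M.hz M.zp M.hy (M.toUq fun R hR hRP hloc => ?_)
    rw [← hq]
    exact hx₀MRP.2 R hR ⟨hRP.1.trans ac, ac'.trans hRP.2⟩ hloc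
  refine (AF.Gd_countable hUopen hUinterval.isPreconnected (T none) (fun l => T (some l)) (Ta none) (fun l => Ta (some l)) (T none x₀)
    (fun l => T (some l) x₀) G0 xs hxs (Tl none) (fun l => Tl (some l))).mono ?_
  rintro x ⟨hx, hn⟩
  refine ⟨hx, fun hG => hn ?_⟩
  obtain ⟨hq, hp, M⟩ := mdl x (hmem x hx)
  refine ⟨AF.loc_of_mart (hSmart x (hmem x hx)), fun R hR hRP hloc => ?_⟩
  rw [hq]
  exact M.uniq hG (hRP.1.trans ac') (ac.trans hRP.2) hloc
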